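/- Let G be an n-vertex 2-connected planar graph with no Theta graph on 6 vertices as a subgraph. Then e(G) ≤ (18n - 38)/7 if n = 6, e(G) ≤ (18n - 42)/7 if n = 7, e(G) ≤ (18n - 46)/7 if n = 8, and e(G) ≤ (18n - 48)/7 for all n ≥ 9. -/

import Mathlib

open SimpleGraph

/-- `H` is a minor of `G`: there is an assignment of disjoint connected branch sets
of `G` to the vertices of `H` realizing all edges of `H`. -/
def HasMinor {V : Type*} {W : Type*} (G : SimpleGraph V) (H : SimpleGraph W) : Prop :=
  ∃ f : V → Option W,
    (∀ w : W, ∃ v, f v = some w) ∧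
    (∀ w : W, (G.induce {v | f v = some w}).Preconnected) ∧
    (∀ w₁ w₂ : W, H.Adj w₁ w₂ →
      ∃ v₁ v₂, f v₁ = some w₁ ∧ f v₂ = some w₂ ∧ G.Adj v₁ v₂)

/-- Planarity, via Wagner's theorem: no `K₅` minor and no `K₃,₃` minor. -/
def IsPlanar {V : Type*} (G : SimpleGraph V) : Prop :=
  ¬ HasMinor G (completeGraph (Fin 5)) ∧
    ¬ HasMinor G (completeBipartiteGraph (Fin 3) (Fin 3))

/-- `G` contains a Theta graph on 6 vertices: a 6-cycle together with a chord
joining two non-consecutive vertices of the cycle. -/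
def HasTheta6 {V : Type*} (G : SimpleGraph V) : Prop :=
  ∃ v : Fin 6 → V, Function.Injective v ∧
    (∀ i : Fin 6, G.Adj (v i) (v (i + 1))) ∧
    ∃ i j : Fin 6, i ≠ j ∧ j ≠ i + 1 ∧ i ≠ j + 1 ∧ G.Adj (v i) (v j)

/-- A graph is 2-connected: at least 3 vertices, and removing any single
vertex leaves a connected graph. -/
def IsTwoConnected {V : Type*} [Fintype V] (G : SimpleGraph V) : Prop :=
  3 ≤ Fintype.card V ∧ G.Connected ∧
    ∀ v : V, (G.induce {u : V | u ≠ v}).Connected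

/-- Shorthand for a side condition closed by linear arithmetic. -/
local notation "Ω" => (by omega)

/-- Shorthand for a side condition closed by simplification. -/
local notation "Ψ" => (by simp)

/-! ## Cut-connected sets -/

section Foundations

variable {V : Type*} {G : SimpleGraph V}

/-- `S` is connected in `G`, phrased by cuts. -/
def Cn (G : SimpleGraph V) (S : Set V) : Prop :=
  ∀ X : Set V, X ⊆ S → X.Nonempty → (S \ X).Nonempty → ∃ x ∈ X, ∃ y ∈ S \ X, G.Adj x y

/-- Two sets touch. -/
def Tch (G : SimpleGraph V) (A B : Set V) : Prop := ∃ a ∈ A, ∃ b ∈ B, G.Adj a b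

theorem Tch.symm {A B : Set V} (h : Tch G A B) : Tch G B A := by
  obtain ⟨a, ha, b, hb, h⟩ := h
  exact ⟨b, hb, a, ha, h.symm⟩

theorem Tch.mono {A B A' B' : Set V} (h : Tch G A B) (hA : A ⊆ A') (hB : B ⊆ B') :
    Tch G A' B' := by
  obtain ⟨a, ha, b, hb, h⟩ := h
  exact ⟨a, hA ha, b, hB hb, h⟩

theorem cn_singleton (v : V) : Cn G {v} := by
  rintro X hX ⟨x, hx⟩ ⟨y, hy, hy'⟩
  have h1 := hX hx
  simp at h1 hy
  subst h1; subst hy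
  exact absurd hx hy'

theorem Cn.cut {S X : Set V} (h : Cn G S) (hx : (S ∩ X).Nonempty) (hy : (S \ X).Nonempty) :
    ∃ x ∈ S, x ∈ X ∧ ∃ y ∈ S, y ∉ X ∧ G.Adj x y := by
  obtain ⟨x, hx, y, hy, hxy⟩ := h (S ∩ X) Set.inter_subset_left hx (by
    obtain ⟨y, hy⟩ := hy
    exact ⟨y, hy.1, fun h => hy.2 h.2⟩)
  exact ⟨x, hx.1, hx.2, y, hy.1, fun h => hy.2 ⟨hy.1, h⟩, hxy⟩

theorem cn_iff {S : Set V} : Cn G S ↔ ∀ X : Set V, (S ∩ X).Nonempty → (S \ X).Nonempty →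
    ∃ x ∈ S, x ∈ X ∧ ∃ y ∈ S, y ∉ X ∧ G.Adj x y := by
  constructor
  · intro h X
    exact h.cut
  · intro h X hX hne hd
    obtain ⟨x, hx, hxX, y, hy, hyX, hxy⟩ := h X (by
      obtain ⟨x, hx⟩ := hne
      exact ⟨x, hX hx, hx⟩) hd
    exact ⟨x, hxX, y, ⟨hy, hyX⟩, hxy⟩

/-- Closure principle. -/
theorem Cn.closed {S X : Set V} (h : Cn G S) (hx : (S ∩ X).Nonempty)
    (hcl : ∀ x ∈ S, x ∈ X → ∀ y ∈ S, G.Adj x y → y ∈ X) : S ⊆ X := by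
  by_contra hn
  obtain ⟨y, hy, hy'⟩ := Set.not_subset.mp hn
  obtain ⟨x, hx, hxX, y, hy, hyX, hxy⟩ := h.cut hx ⟨y, hy, hy'⟩
  exact hyX (hcl x hx hxX y hy hxy)

theorem cn_of_closed {S : Set V} (h : ∀ X : Set V, (S ∩ X).Nonempty →
    (∀ x ∈ S, x ∈ X → ∀ y ∈ S, G.Adj x y → y ∈ X) → S ⊆ X) : Cn G S := by
  rw [cn_iff]
  intro X hX hd
  by_contra hc
  push Not at hc
  obtain ⟨y, hy, hy'⟩ := hd
  refine hy' (h X hX ?_ hy)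
  intro x hx hxX y hy hxy
  by_contra hyX
  exact hc x hx hxX y hy hyX hxy

theorem Cn.union {S T : Set V} (hS : Cn G S) (hT : Cn G T) (h : (S ∩ T).Nonempty) :
    Cn G (S ∪ T) := by
  apply cn_of_closed
  intro X hX hcl
  obtain ⟨z, hz⟩ := h
  have key : z ∈ X → S ∪ T ⊆ X := by
    intro hzX
    apply Set.union_subset
    · exact hS.closed ⟨z, hz.1, hzX⟩ fun x hx hxX y hy => hcl x (Or.inl hx) hxX y (Or.inl hy)
    · exact hT.closed ⟨z, hz.2, hzX⟩ fun x hx hxX y hy => hcl x (Or.inr hx) hxX y (Or.inr hy)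
  obtain ⟨x, hx | hx, hxX⟩ := hX
  · exact key (hS.closed ⟨x, hx, hxX⟩
      (fun x hx hxX y hy => hcl x (Or.inl hx) hxX y (Or.inl hy)) hz.1)
  · exact key (hT.closed ⟨x, hx, hxX⟩
      (fun x hx hxX y hy => hcl x (Or.inr hx) hxX y (Or.inr hy)) hz.2)

theorem cn_pair {a b : V} (h : G.Adj a b) : Cn G {a, b} := by
  apply cn_of_closed
  rintro X ⟨x, hx, hxX⟩ hcl
  have ha : a ∈ ({a, b} : Set V) := by simp
  have hb : b ∈ ({a, b} : Set V) := by simp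
  rintro y hy
  rcases hx with rfl | rfl <;> rcases hy with rfl | rfl
  · exact hxX
  · exact hcl _ ha hxX _ hb h
  · exact hcl _ hb hxX _ ha h.symm
  · exact hxX

theorem Cn.union_adj {S T : Set V} (hS : Cn G S) (hT : Cn G T) (h : Tch G S T) :
    Cn G (S ∪ T) := by
  obtain ⟨a, ha, b, hb, hab⟩ := h
  have h1 := (hS.union (cn_pair hab) ⟨a, ha, by simp⟩).union hT ⟨b, by simp, hb⟩
  have : S ∪ {a, b} ∪ T = S ∪ T := by
    ext x; simp only [Set.mem_union, Set.mem_insert_iff, Set.mem_singleton_iff]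
    constructor
    · rintro ((h | rfl | rfl) | h) <;> tauto
    · tauto
  rwa [this] at h1

theorem Cn.insert_adj {S : Set V} (hS : Cn G S) {a b : V} (hb : b ∈ S) (h : G.Adj a b) :
    Cn G (insert a S) := by
  have := (cn_singleton (G := G) a).union_adj hS ⟨a, rfl, b, hb, h⟩
  rwa [Set.singleton_union] at this

/-- union of a family of connected sets that all contain a common point -/
theorem cn_sUnion {C : Set (Set V)} {u : V} (h : ∀ X ∈ C, Cn G X ∧ u ∈ X) : Cn G (⋃₀ C) := by
  apply cn_of_closed
  rintro X ⟨x, ⟨A, hA, hxA⟩, hxX⟩ hcl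
  have huX : u ∈ X := (h A hA).1.closed ⟨x, hxA, hxX⟩
    (fun x hx hxX y hy => hcl x ⟨A, hA, hx⟩ hxX y ⟨A, hA, hy⟩) (h A hA).2
  rintro y ⟨B, hB, hy⟩
  exact (h B hB).1.closed ⟨u, (h B hB).2, huX⟩
    (fun x hx hxX y hy => hcl x ⟨B, hB, hx⟩ hxX y ⟨B, hB, hy⟩) hy

/-- the component of `u` in `S` -/
def comp (G : SimpleGraph V) (S : Set V) (u : V) : Set V :=
  ⋃₀ {X | X ⊆ S ∧ Cn G X ∧ u ∈ X}

theorem comp_subset (S : Set V) (u : V) : comp G S u ⊆ S := by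
  rintro x ⟨X, hX, hx⟩
  exact hX.1 hx

theorem comp_cn (S : Set V) (u : V) : Cn G (comp G S u) := cn_sUnion fun _ hX => hX.2

theorem mem_comp_self {S : Set V} {u : V} (h : u ∈ S) : u ∈ comp G S u :=
  ⟨{u}, ⟨by simpa using h, cn_singleton u, rfl⟩, rfl⟩

theorem subset_comp {S X : Set V} {u : V} (hX : X ⊆ S) (hc : Cn G X) (hu : u ∈ X) :
    X ⊆ comp G S u := fun _ hx => ⟨X, ⟨hX, hc, hu⟩, hx⟩

theorem comp_absorb {S X : Set V} {u : V} (hu : u ∈ S) (hX : X ⊆ S) (hc : Cn G X)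
    (ht : (X ∩ comp G S u).Nonempty) : X ⊆ comp G S u := by
  have h := (comp_cn (G := G) S u).union hc (by rwa [Set.inter_comm] at ht)
  exact (Set.subset_union_right).trans
    (subset_comp (Set.union_subset (comp_subset S u) hX) h (Or.inl (mem_comp_self hu)))

theorem comp_step {S : Set V} {u x y : V} (hx : x ∈ comp G S u) (hy : y ∈ S)
    (h : G.Adj x y) : y ∈ comp G S u := by
  have hu : u ∈ S := by
    obtain ⟨X, hX, _⟩ := hx
    exact hX.1 hX.2.2
  exact comp_absorb hu (X := {x, y}) (by
    rintro z (rfl | rfl)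
    · exact comp_subset _ _ hx
    · exact hy) (cn_pair h) ⟨x, by simp, hx⟩ Ψ

theorem comp_eq {S : Set V} {u v : V} (h : v ∈ comp G S u) : comp G S v = comp G S u := by
  have hu : u ∈ S := by
    obtain ⟨X, hX, _⟩ := h
    exact hX.1 hX.2.2
  have hv := comp_subset _ _ h
  apply Set.Subset.antisymm
  · exact comp_absorb hu (comp_subset _ _) (comp_cn _ _) ⟨v, mem_comp_self hv, h⟩
  · exact subset_comp (comp_subset _ _) (comp_cn _ _) h

theorem comp_disjoint {S : Set V} {u v : V} (h : v ∉ comp G S u) :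
    Disjoint (comp G S u) (comp G S v) := by
  rw [Set.disjoint_left]
  intro x hx hx'
  apply h
  rw [← comp_eq hx, comp_eq hx']
  apply mem_comp_self
  obtain ⟨X, hX, _⟩ := hx'
  exact hX.1 hX.2.2

/-- A chordless path inside a connected set. -/
theorem Cn.path {S : Set V} (hS : Cn G S) {u v : V} (hu : u ∈ S) (hv : v ∈ S) :
    ∃ (n : ℕ) (p : ℕ → V), p 0 = u ∧ p n = v ∧ (∀ i ≤ n, p i ∈ S) ∧
      (∀ i < n, G.Adj (p i) (p (i + 1))) ∧ (∀ i ≤ n, ∀ j ≤ n, p i = p j → i = j) ∧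
      (∀ i j, i < j → j ≤ n → G.Adj (p i) (p j) → j = i + 1) := by
  classical
  let Q : ℕ → Prop := fun n => ∃ p : ℕ → V, p 0 = u ∧ p n = v ∧ (∀ i ≤ n, p i ∈ S) ∧
      (∀ i < n, G.Adj (p i) (p (i + 1)))
  have hQ : ∃ n, Q n := by
    have := hS.closed (X := {w | ∃ n, ∃ p : ℕ → V, p 0 = u ∧ p n = w ∧ (∀ i ≤ n, p i ∈ S) ∧
      (∀ i < n, G.Adj (p i) (p (i + 1)))}) ⟨u, hu, 0, fun _ => u, rfl, rfl, fun _ _ => hu,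
        fun i hi => absurd hi Ω⟩ (by
        rintro x hx ⟨n, p, h0, hn, hpS, hp⟩ y hy hxy
        refine ⟨n + 1, fun i => if i ≤ n then p i else y, by simp [h0], by simp, ?_, ?_⟩
        · intro i hi
          dsimp only
          split_ifs with h
          · exact hpS i h
          · exact hy
        · intro i hi
          dsimp only
          by_cases h : i + 1 ≤ n
          · rw [if_pos Ω, if_pos h]
            exact hp i Ω
          · have : i = n := by omega
            subst this
            rw [if_pos le_rfl, if_neg h, hn]
            exact hxy)
    exact this hv
  obtain ⟨p, h0, hn, hpS, hp⟩ := Nat.find_spec hQ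
  have hmin : ∀ m, m < Nat.find hQ → ¬ Q m := fun m hm => Nat.find_min hQ hm
  generalize Nat.find hQ = n at *
  have short : ∀ i j, i < j → j ≤ n → G.Adj (p i) (p j) → j = i + 1 := by
    intro i j hij hj hadj
    by_contra hne
    apply hmin (n - (j - i - 1)) Ω
    refine ⟨fun m => if m ≤ i then p m else p (m + (j - i - 1)), by simp [h0], ?_, ?_, ?_⟩
    · dsimp only
      rw [if_neg Ω, ← hn]
      congr 1; omega
    · intro m hm
      dsimp only
      split_ifs with h
      · exact hpS m Ω
      · exact hpS _ Ω
    · intro m hm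
      dsimp only
      by_cases h : m + 1 ≤ i
      · rw [if_pos Ω, if_pos h]
        exact hp m Ω
      · by_cases h' : m = i
        · subst h'
          rw [if_pos le_rfl, if_neg Ω]
          have : m + 1 + (j - m - 1) = j := by omega
          rwa [this]
        · rw [if_neg Ω, if_neg Ω]
          have := hp (m + (j - i - 1)) Ω
          have e : m + 1 + (j - i - 1) = m + (j - i - 1) + 1 := by omega
          rwa [e]
  have inj : ∀ i j, i < j → j ≤ n → p i ≠ p j := by
    intro i j hij hj heq
    by_cases hjn : j = n
    · apply hmin i Ω
      exact ⟨p, h0, by rw [heq, hjn, hn], fun m hm => hpS m Ω, fun m hm => hp m Ω⟩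
    · have := short i (j + 1) Ω Ω (heq ▸ hp j Ω)
      omega
  refine ⟨n, p, h0, hn, hpS, hp, ?_, short⟩
  intro i hi j hj heq
  rcases lt_trichotomy i j with h | h | h
  · exact absurd heq (inj i j h hj)
  · exact h
  · exact absurd heq.symm (inj j i h hi)

/-- interval of a path is connected -/
theorem cn_interval {p : ℕ → V} {i j : ℕ} (hij : i ≤ j)
    (hp : ∀ m, i ≤ m → m < j → G.Adj (p m) (p (m + 1))) : Cn G (p '' Set.Icc i j) := by
  induction j, hij using Nat.le_induction with
  | base => simpa using cn_singleton (p i)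
  | succ j hj ih =>
    have h1 := (ih fun m hm hm' => hp m hm Ω).insert_adj (a := p (j + 1)) (b := p j)
      ⟨j, by simp [hj], rfl⟩ (hp j hj Ω).symm
    have : insert (p (j + 1)) (p '' Set.Icc i j) = p '' Set.Icc i (j + 1) := by
      rw [← Set.image_insert_eq]
      congr 1
      ext x; simp; omega
    rwa [this] at h1

theorem cn_iff_preconnected {S : Set V} : Cn G S ↔ (G.induce S).Preconnected := by
  constructor
  · rintro h ⟨u, hu⟩ ⟨v, hv⟩
    have := h.closed (X := {x | ∃ hx : x ∈ S, (G.induce S).Reachable ⟨u, hu⟩ ⟨x, hx⟩})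
      ⟨u, hu, hu, Reachable.refl _⟩ (by
        rintro x hx ⟨_, hr⟩ y hy hxy
        exact ⟨hy, hr.trans (Adj.reachable (by simpa using hxy))⟩)
    exact (this hv).2
  · intro h
    apply cn_of_closed
    rintro X ⟨x, hx, hxX⟩ hcl y hy
    obtain ⟨w⟩ := h ⟨x, hx⟩ ⟨y, hy⟩
    have : ∀ (a b : S) (w : (G.induce S).Walk a b), a.1 ∈ X → b.1 ∈ X := by
      intro a b w
      induction w with
      | nil => exact id
      | cons hadj _ ih => exact fun ha => ih (hcl _ (Subtype.property _) ha _ (Subtype.property _) (by simpa using hadj))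
    exact this _ _ w hxX

/-! ## Minor models -/

/-- A `K₅` model. -/
def K5m (G : SimpleGraph V) : Prop := ∃ A : Fin 5 → Set V, (∀ i, (A i).Nonempty) ∧
  (∀ i, Cn G (A i)) ∧ (∀ i j, i < j → Disjoint (A i) (A j)) ∧ ∀ i j, i < j → Tch G (A i) (A j)

/-- A `K₃,₃` model. -/
def K33m (G : SimpleGraph V) : Prop := ∃ A B : Fin 3 → Set V, (∀ i, (A i).Nonempty) ∧
  (∀ i, (B i).Nonempty) ∧ (∀ i, Cn G (A i)) ∧ (∀ i, Cn G (B i)) ∧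
  (∀ i j, i < j → Disjoint (A i) (A j)) ∧ (∀ i j, i < j → Disjoint (B i) (B j)) ∧
  (∀ i j, Disjoint (A i) (B j)) ∧ ∀ i j, Tch G (A i) (B j)

/-- Planarity through models. -/
def Pl (G : SimpleGraph V) : Prop := ¬ K5m G ∧ ¬ K33m G

theorem hasMinor_of_family {W : Type*} {H : SimpleGraph W} (A : W → Set V)
    (hne : ∀ i, (A i).Nonempty) (hcn : ∀ i, Cn G (A i))
    (hd : ∀ i j, i ≠ j → Disjoint (A i) (A j)) (ht : ∀ i j, H.Adj i j → Tch G (A i) (A j)) :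
    HasMinor G H := by
  classical
  let f : V → Option W := fun v => if h : ∃ i, v ∈ A i then some h.choose else none
  have hf : ∀ v i, f v = some i ↔ v ∈ A i := by
    intro v i
    constructor
    · intro h
      by_cases hv : ∃ i, v ∈ A i
      · have : f v = some hv.choose := dif_pos hv
        rw [this] at h
        rw [← Option.some.inj h]
        exact hv.choose_spec
      · have : f v = none := dif_neg hv
        rw [this] at h
        cases h
    · intro h
      have hv : ∃ i, v ∈ A i := ⟨i, h⟩
      have : f v = some hv.choose := dif_pos hv
      rw [this]
      congr 1
      by_contra hne
      exact Set.disjoint_left.mp (hd _ _ hne) hv.choose_spec h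
  refine ⟨f, ?_, ?_, ?_⟩
  · intro w
    obtain ⟨v, hv⟩ := hne w
    exact ⟨v, (hf v w).2 hv⟩
  · intro w
    have : {v | f v = some w} = A w := by ext v; exact hf v w
    rw [this]
    exact cn_iff_preconnected.1 (hcn w)
  · intro i j hij
    obtain ⟨a, ha, b, hb, h⟩ := ht i j hij
    exact ⟨a, b, (hf _ _).2 ha, (hf _ _).2 hb, h⟩

theorem IsPlanar.pl (h : IsPlanar G) : Pl G := by
  constructor
  · rintro ⟨A, hne, hcn, hd, ht⟩
    refine h.1 (hasMinor_of_family A hne hcn ?_ ?_)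
    · intro i j hij
      rcases lt_or_gt_of_ne hij with h | h
      · exact hd i j h
      · exact (hd j i h).symm
    · intro i j hij
      rcases lt_or_gt_of_ne (show i ≠ j from hij) with h | h
      · exact ht i j h
      · exact (ht j i h).symm
  · rintro ⟨A, B, hneA, hneB, hcA, hcB, hdA, hdB, hAB, ht⟩
    refine h.2 (hasMinor_of_family (Sum.elim A B) ?_ ?_ ?_ ?_)
    · rintro (i | i)
      · exact hneA i
      · exact hneB i
    · rintro (i | i)
      · exact hcA i
      · exact hcB i
    · rintro (i | i) (j | j) hij
      · rcases lt_or_gt_of_ne (show i ≠ j by rintro rfl; exact hij rfl) with h | h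
        · exact hdA i j h
        · exact (hdA j i h).symm
      · exact hAB i j
      · exact (hAB j i).symm
      · rcases lt_or_gt_of_ne (show i ≠ j by rintro rfl; exact hij rfl) with h | h
        · exact hdB i j h
        · exact (hdB j i h).symm
    · rintro (i | i) (j | j) hij
      · simp at hij
      · exact ht i j
      · exact (ht j i).symm
      · simp at hij

theorem Pl.k33 (h : Pl G) {A B C X Y Z : Set V} (hA : Cn G A) (hB : Cn G B) (hC : Cn G C)
    (hX : Cn G X) (hY : Cn G Y) (hZ : Cn G Z)
    (hAB : Disjoint A B) (hAC : Disjoint A C) (hBC : Disjoint B C)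
    (hXY : Disjoint X Y) (hXZ : Disjoint X Z) (hYZ : Disjoint Y Z)
    (d1 : Disjoint A X) (d2 : Disjoint A Y) (d3 : Disjoint A Z)
    (d4 : Disjoint B X) (d5 : Disjoint B Y) (d6 : Disjoint B Z)
    (d7 : Disjoint C X) (d8 : Disjoint C Y) (d9 : Disjoint C Z)
    (t1 : Tch G A X) (t2 : Tch G A Y) (t3 : Tch G A Z)
    (t4 : Tch G B X) (t5 : Tch G B Y) (t6 : Tch G B Z)
    (t7 : Tch G C X) (t8 : Tch G C Y) (t9 : Tch G C Z) : False := by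
  refine h.2 ⟨![A, B, C], ![X, Y, Z], ?_, ?_, ?_, ?_, ?_, ?_, ?_, ?_⟩
  · intro i; fin_cases i
    · obtain ⟨a, ha, _⟩ := t1; exact ⟨a, ha⟩
    · obtain ⟨a, ha, _⟩ := t4; exact ⟨a, ha⟩
    · obtain ⟨a, ha, _⟩ := t7; exact ⟨a, ha⟩
  · intro i; fin_cases i
    · obtain ⟨a, ha, b, hb, _⟩ := t1; exact ⟨b, hb⟩
    · obtain ⟨a, ha, b, hb, _⟩ := t2; exact ⟨b, hb⟩
    · obtain ⟨a, ha, b, hb, _⟩ := t3; exact ⟨b, hb⟩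
  · intro i; fin_cases i <;> assumption
  · intro i; fin_cases i <;> assumption
  · intro i j hij; fin_cases i <;> fin_cases j <;> first | assumption | exact absurd hij (by decide)
  · intro i j hij; fin_cases i <;> fin_cases j <;> first | assumption | exact absurd hij (by decide)
  · intro i j; fin_cases i <;> fin_cases j <;> assumption
  · intro i j; fin_cases i <;> fin_cases j <;> assumption

theorem Pl.k5 (h : Pl G) {A B C D E : Set V} (hA : Cn G A) (hB : Cn G B) (hC : Cn G C)
    (hD : Cn G D) (hE : Cn G E)
    (d1 : Disjoint A B) (d2 : Disjoint A C) (d3 : Disjoint A D) (d4 : Disjoint A E)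
    (d5 : Disjoint B C) (d6 : Disjoint B D) (d7 : Disjoint B E) (d8 : Disjoint C D)
    (d9 : Disjoint C E) (d10 : Disjoint D E)
    (t1 : Tch G A B) (t2 : Tch G A C) (t3 : Tch G A D) (t4 : Tch G A E)
    (t5 : Tch G B C) (t6 : Tch G B D) (t7 : Tch G B E) (t8 : Tch G C D)
    (t9 : Tch G C E) (t10 : Tch G D E) : False := by
  refine h.1 ⟨![A, B, C, D, E], ?_, ?_, ?_, ?_⟩
  · intro i; fin_cases i
    · obtain ⟨a, ha, _⟩ := t1; exact ⟨a, ha⟩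
    · obtain ⟨a, ha, _⟩ := t5; exact ⟨a, ha⟩
    · obtain ⟨a, ha, _⟩ := t8; exact ⟨a, ha⟩
    · obtain ⟨a, ha, _⟩ := t10; exact ⟨a, ha⟩
    · obtain ⟨a, ha, b, hb, _⟩ := t10; exact ⟨b, hb⟩
  · intro i; fin_cases i <;> assumption
  · intro i j hij; fin_cases i <;> fin_cases j <;> first | assumption | exact absurd hij (by decide)
  · intro i j hij; fin_cases i <;> fin_cases j <;> first | assumption | exact absurd hij (by decide)

/-! ## Theta graphs -/

theorem theta_of {a b c d e f : V} (h1 : G.Adj a b) (h2 : G.Adj b c) (h3 : G.Adj c d)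
    (h4 : G.Adj d e) (h5 : G.Adj e f) (h6 : G.Adj f a)
    (hnd : [a, b, c, d, e, f].Nodup)
    (hch : G.Adj a c ∨ G.Adj a d ∨ G.Adj a e ∨ G.Adj b d ∨ G.Adj b e ∨ G.Adj b f ∨
      G.Adj c e ∨ G.Adj c f ∨ G.Adj d f) : HasTheta6 G := by
  refine ⟨![a, b, c, d, e, f], ?_, ?_, ?_⟩
  · have := List.nodup_iff_injective_get.1 hnd
    intro i j hij
    apply this
    fin_cases i <;> fin_cases j <;> exact hij
  · intro i
    fin_cases i <;> assumption
  · rcases hch with h | h | h | h | h | h | h | h | h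
    · exact ⟨0, 2, by decide, by decide, by decide, h⟩
    · exact ⟨0, 3, by decide, by decide, by decide, h⟩
    · exact ⟨0, 4, by decide, by decide, by decide, h⟩
    · exact ⟨1, 3, by decide, by decide, by decide, h⟩
    · exact ⟨1, 4, by decide, by decide, by decide, h⟩
    · exact ⟨1, 5, by decide, by decide, by decide, h⟩
    · exact ⟨2, 4, by decide, by decide, by decide, h⟩
    · exact ⟨2, 5, by decide, by decide, by decide, h⟩
    · exact ⟨3, 5, by decide, by decide, by decide, h⟩

end Foundations

/-! ## Faces of 3-connected graphs: exactness -/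

section Exactness

variable {W : Type*} {H : SimpleGraph W} {φ : W → W → ZMod 2}

/-- `φ` is a coboundary on `S`. -/
def Exa (H : SimpleGraph W) (φ : W → W → ZMod 2) (S : Set W) : Prop :=
  ∃ h : W → ZMod 2, ∀ x ∈ S, ∀ y ∈ S, H.Adj x y → φ x y = h x + h y

theorem Exa.mono {S T : Set W} (h : Exa H φ T) (hST : S ⊆ T) : Exa H φ S := by
  obtain ⟨g, hg⟩ := h
  exact ⟨g, fun x hx y hy => hg x (hST hx) y (hST hy)⟩

theorem Exa.base {S : Set W} (h : Exa H φ S) (d : W) :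
    ∃ h : W → ZMod 2, h d = 0 ∧ ∀ x ∈ S, ∀ y ∈ S, H.Adj x y → φ x y = h x + h y := by
  obtain ⟨g, hg⟩ := h
  refine ⟨fun x => g x + g d, CharTwo.add_self_eq_zero _, fun x hx y hy hxy => ?_⟩
  rw [hg x hx y hy hxy]
  have := CharTwo.add_self_eq_zero (g d)
  linear_combination (-1) * this

theorem exa_agree {T : Set W} {h h' : W → ZMod 2} {d : W} (hT : Cn H T) (hd : d ∈ T)
    (h0 : h d = h' d) (h1 : ∀ x ∈ T, ∀ y ∈ T, H.Adj x y → φ x y = h x + h y)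
    (h2 : ∀ x ∈ T, ∀ y ∈ T, H.Adj x y → φ x y = h' x + h' y) : ∀ x ∈ T, h x = h' x := by
  apply hT.closed (X := {x | h x = h' x}) ⟨d, hd, h0⟩
  intro x hx hxX y hy hxy
  have e1 := h1 x hx y hy hxy
  have e2 := h2 x hx y hy hxy
  have hxX' : h x = h' x := hxX
  show h y = h' y
  linear_combination e2 - e1 - hxX'

theorem exa_glue (hsym : ∀ x y, φ x y = φ y x) {K : Set W} {a b : W} (hK : Cn H K)
    (hne : K.Nonempty) (hab : ¬ H.Adj a b)
    (ha : Exa H φ (insert a K)) (hb : Exa H φ (insert b K)) : Exa H φ (insert a (insert b K)) := by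
  classical
  by_cases hK1 : b ∈ K
  · rwa [Set.insert_eq_of_mem hK1]
  by_cases hK2 : a ∈ K
  · rwa [Set.insert_eq_of_mem (Set.mem_insert_of_mem _ hK2)]
  obtain ⟨d, hd⟩ := hne
  obtain ⟨g, hg0, hg⟩ := ha.base d
  obtain ⟨g', hg0', hg'⟩ := hb.base d
  have agree := exa_agree hK hd (hg0.trans hg0'.symm)
    (fun x hx y hy => hg x (Or.inr hx) y (Or.inr hy)) (fun x hx y hy => hg' x (Or.inr hx) y (Or.inr hy))
  by_cases hab' : a = b
  · subst hab'
    simpa using ha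
  have hba : ¬ H.Adj b a := fun h => hab h.symm
  refine ⟨fun x => if x = b then g' b else g x, ?_⟩
  have aux : ∀ y, y ∈ K → y ≠ b := fun y hy h => hK1 (h ▸ hy)
  rintro x (rfl | rfl | hx) y (rfl | rfl | hy) hxy <;> beta_reduce
  · exact absurd hxy (H.loopless.irrefl _)
  · exact absurd hxy hab
  · rw [if_neg hab', if_neg (aux y hy)]
    exact hg _ (Or.inl rfl) _ (Or.inr hy) hxy
  · exact absurd hxy hba
  · exact absurd hxy (H.loopless.irrefl _)
  · rw [if_pos rfl, if_neg (aux y hy), agree y hy]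
    exact hg' _ (Or.inl rfl) _ (Or.inr hy) hxy
  · rw [if_neg hab', if_neg (aux x hx)]
    exact hg _ (Or.inr hx) _ (Or.inl rfl) hxy
  · rw [if_pos rfl, if_neg (aux x hx), agree x hx]
    exact hg' _ (Or.inr hx) _ (Or.inl rfl) hxy
  · rw [if_neg (aux x hx), if_neg (aux y hy)]
    exact hg _ (Or.inr hx) _ (Or.inr hy) hxy

/-- chordless cycles, parametrised by `0, …, k-1` -/
structure ICyc (H : SimpleGraph W) (k : ℕ) (c : ℕ → W) : Prop where
  three : 3 ≤ k
  inj : ∀ i j, i < j → j < k → c i ≠ c j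
  adj : ∀ i j, i < j → j < k → (H.Adj (c i) (c j) ↔ j = i + 1 ∨ (i = 0 ∧ j + 1 = k))

/-- vertex set of a chordless cycle -/
def IndCyc (H : SimpleGraph W) (X : Set W) : Prop := ∃ k c, ICyc H k c ∧ X = c '' Set.Iio k

theorem ICyc.rotate {k : ℕ} {c : ℕ → W} (hc : ICyc H k c) {a : ℕ} (ha : a < k) :
    ∃ c', ICyc H k c' ∧ c' '' Set.Iio k = c '' Set.Iio k ∧ c' 0 = c a := by
  refine ⟨fun i => if i + a < k then c (i + a) else c (i + a - k), ⟨hc.three, ?_, ?_⟩, ?_, ?_⟩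
  · intro i j hij hj
    split_ifs with h1 h2 h2
    · exact hc.inj _ _ Ω h2
    · exact (hc.inj (j + a - k) (i + a) Ω h1).symm
    · omega
    · exact hc.inj _ _ Ω Ω
  · intro i j hij hj
    split_ifs with h1 h2 h2
    · rw [hc.adj _ _ Ω h2]; omega
    · rw [H.adj_comm, hc.adj _ _ Ω h1]; omega
    · omega
    · rw [hc.adj _ _ Ω Ω]; omega
  · ext x
    constructor
    · rintro ⟨i, hi, rfl⟩
      have : i < k := hi
      dsimp only
      split_ifs with h
      · exact ⟨_, h, rfl⟩
      · exact ⟨i + a - k, show _ < k by omega, rfl⟩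
    · rintro ⟨i, hi, rfl⟩
      have : i < k := hi
      by_cases h : a ≤ i
      · refine ⟨i - a, show _ < k by omega, ?_⟩
        dsimp only
        rw [if_pos Ω]
        congr 1; omega
      · refine ⟨i + k - a, show _ < k by omega, ?_⟩
        dsimp only
        rw [if_neg Ω]
        congr 1; omega
  · simp [ha]

theorem IndCyc.rot {X : Set W} (hX : IndCyc H X) {x : W} (hx : x ∈ X) :
    ∃ k c, ICyc H k c ∧ X = c '' Set.Iio k ∧ c 0 = x := by
  obtain ⟨k, c, hc, rfl⟩ := hX
  obtain ⟨a, ha, rfl⟩ := hx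
  obtain ⟨c', h1, h2, h3⟩ := hc.rotate ha
  exact ⟨k, c', h1, h2.symm, h3⟩

theorem exists_minimal_nonexact [Finite W] {S : Set W} (hS : ¬ Exa H φ S) :
    ∃ X ⊆ S, ¬ Exa H φ X ∧ ∀ Y ⊆ X, Y ≠ X → Exa H φ Y := by
  induction h : S.ncard using Nat.strong_induction_on generalizing S with
  | _ n ih =>
    by_cases hmin : ∀ Y ⊆ S, Y ≠ S → Exa H φ Y
    · exact ⟨S, subset_rfl, hS, hmin⟩
    · push Not at hmin
      obtain ⟨Y, hY, hne, hYe⟩ := hmin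
      obtain ⟨X, hX, h1, h2⟩ := ih Y.ncard
        (h ▸ Set.ncard_lt_ncard (hY.ssubset_of_ne hne) (Set.toFinite _)) hYe rfl
      exact ⟨X, hX.trans hY, h1, h2⟩

theorem minimal_nonexact_cyc (hsym : ∀ x y, φ x y = φ y x) {X : Set W} (hX : ¬ Exa H φ X)
    (hmin : ∀ Y ⊆ X, Y ≠ X → Exa H φ Y) : IndCyc H X := by
  classical
  have hne : X.Nonempty := by
    by_contra h
    rw [Set.not_nonempty_iff_eq_empty] at h
    subst h
    exact hX ⟨fun _ => 0, by simp⟩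
  obtain ⟨v, hv⟩ := hne
  obtain ⟨h, hh⟩ := hmin (X \ {v}) Set.sdiff_subset (fun e => by
    have : v ∈ X \ {v} := by rw [e]; exact hv
    exact this.2 rfl)
  -- conflicting neighbours in a common connected set
  have conf : ∃ u u' K, K ⊆ X \ {v} ∧ Cn H K ∧ u ∈ K ∧ u' ∈ K ∧ H.Adj v u ∧ H.Adj v u' ∧
      h u + φ v u ≠ h u' + φ v u' := by
    by_contra hcon
    push Not at hcon
    -- flip `h` on each component
    let f : W → ZMod 2 := fun x =>
      if hx : ∃ u ∈ comp H (X \ {v}) x, H.Adj v u then h x + h hx.choose + φ v hx.choose else h x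
    apply hX
    refine ⟨fun x => if x = v then 0 else f x, ?_⟩
    have key : ∀ y ∈ X, H.Adj v y → φ v y = f y := by
      intro y hy hvy
      have hyv : y ∈ X \ {v} := ⟨hy, fun e => H.loopless.irrefl _ ((show y = v from e) ▸ hvy)⟩
      have hx : ∃ u ∈ comp H (X \ {v}) y, H.Adj v u := ⟨y, mem_comp_self hyv, hvy⟩
      have e : f y = h y + h hx.choose + φ v hx.choose := dif_pos hx
      have := hcon y hx.choose (comp H (X \ {v}) y) (comp_subset _ _) (comp_cn _ _)
        (mem_comp_self hyv) hx.choose_spec.1 hvy hx.choose_spec.2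
      rw [e]
      have h2 := CharTwo.add_self_eq_zero (h y)
      linear_combination this - h2
    have key2 : ∀ x ∈ X \ {v}, ∀ y ∈ X \ {v}, H.Adj x y → φ x y = f x + f y := by
      intro x hx y hy hxy
      have e : comp H (X \ {v}) y = comp H (X \ {v}) x :=
        comp_eq (comp_step (mem_comp_self hx) hy hxy)
      have h1 := hh x hx y hy hxy
      by_cases hex : ∃ u ∈ comp H (X \ {v}) x, H.Adj v u
      · have hey : ∃ u ∈ comp H (X \ {v}) y, H.Adj v u := by rw [e]; exact hex
        have ex : f x = h x + h hex.choose + φ v hex.choose := dif_pos hex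
        have ey : f y = h y + h hey.choose + φ v hey.choose := dif_pos hey
        have h3 : h hex.choose + φ v hex.choose = h hey.choose + φ v hey.choose :=
          hcon _ _ (comp H (X \ {v}) x) (comp_subset _ _) (comp_cn _ _) hex.choose_spec.1
            (by rw [← e]; exact hey.choose_spec.1) hex.choose_spec.2 hey.choose_spec.2
        rw [ex, ey, h1]
        have h2 := CharTwo.add_self_eq_zero (h hey.choose + φ v hey.choose)
        linear_combination - h2 - h3
      · have hey : ¬ ∃ u ∈ comp H (X \ {v}) y, H.Adj v u := by rw [e]; exact hex
        have ex : f x = h x := dif_neg hex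
        have ey : f y = h y := dif_neg hey
        rw [ex, ey, h1]
    intro x hx y hy hxy
    beta_reduce
    by_cases hxv : x = v
    · subst hxv
      rw [if_pos rfl, if_neg (H.ne_of_adj hxy).symm, key y hy hxy, zero_add]
    · by_cases hyv : y = v
      · subst hyv
        rw [if_pos rfl, if_neg hxv, hsym, key x hx hxy.symm, add_zero]
      · rw [if_neg hxv, if_neg hyv]
        exact key2 x ⟨hx, hxv⟩ y ⟨hy, hyv⟩ hxy
  -- any connected set with conflicting neighbours gives everything
  have full : ∀ u u' K, K ⊆ X \ {v} → Cn H K → u ∈ K → u' ∈ K → H.Adj v u → H.Adj v u' →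
      h u + φ v u ≠ h u' + φ v u' → insert v K = X := by
    intro u u' K hK hc hu hu' hvu hvu' hneq
    by_contra hcon
    obtain ⟨g, hg⟩ := hmin (insert v K) (Set.insert_subset hv (hK.trans Set.sdiff_subset)) hcon
    apply hneq
    have agree := exa_agree (h := h) (h' := fun x => g x + (g u + h u)) hc hu (by
        have h2 := CharTwo.add_self_eq_zero (g u)
        linear_combination (-1) * h2)
      (fun x hx y hy => hh x (hK hx) y (hK hy)) (fun x hx y hy hxy => by
        rw [hg x (Or.inr hx) y (Or.inr hy) hxy]
        have h2 := CharTwo.add_self_eq_zero (g u + h u)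
        linear_combination (-1) * h2) u' hu'
    have e1 := hg v (Or.inl rfl) u (Or.inr hu) hvu
    have e2 := hg v (Or.inl rfl) u' (Or.inr hu') hvu'
    skip
    rw [e1, e2, agree]
    have h2 := CharTwo.add_self_eq_zero (g u')
    linear_combination (-1) * h2
  obtain ⟨u, u', K, hK, hc, hu, hu', hvu, hvu', hneq⟩ := conf
  obtain ⟨n, p, h0, hn, hpK, hp, hinj, hch⟩ := hc.path hu hu'
  have hn1 : 1 ≤ n := by
    by_contra hlt
    have : n = 0 := by omega
    subst this
    apply hneq
    rw [← h0, ← hn]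
  have sub : ∀ i j, i ≤ j → j ≤ n → p '' Set.Icc i j ⊆ X \ {v} := by
    rintro i j _ hj _ ⟨m, hm, rfl⟩
    exact hK (hpK m (hm.2.trans hj))
  have hall : insert v (p '' Set.Icc 0 n) = X :=
    full u u' _ (sub 0 n Ω le_rfl) (cn_interval Ω fun m _ hm => hp m hm)
      ⟨0, by simp, h0⟩ ⟨n, by simp, hn⟩ hvu hvu' hneq
  have hnv : ∀ i ≤ n, p i ≠ v := fun i hi => (hK (hpK i hi)).2
  have noch : ∀ j, 0 < j → j < n → ¬ H.Adj v (p j) := by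
    intro j hj0 hjn hadj
    by_cases hj : h u + φ v u = h (p j) + φ v (p j)
    · have := full (p j) u' _ (sub j n Ω le_rfl)
        (cn_interval Ω fun m _ hm => hp m hm)
        ⟨j, by simp; omega, rfl⟩ ⟨n, by simp; omega, hn⟩ hadj hvu' (hj ▸ hneq)
      have h3 : p 0 ∈ insert v (p '' Set.Icc j n) := by
        rw [this, ← hall]; exact Or.inr ⟨0, by simp, rfl⟩
      rcases h3 with h3 | ⟨m, hm, h3⟩
      · exact hnv 0 Ω h3
      · have := hinj m hm.2 0 Ω h3
        have := hm.1
        omega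
    · have := full u (p j) _ (sub 0 j Ω Ω)
        (cn_interval Ω fun m _ hm => hp m Ω)
        ⟨0, by simp, h0⟩ ⟨j, by simp, rfl⟩ hvu hadj hj
      have h3 : p n ∈ insert v (p '' Set.Icc 0 j) := by
        rw [this, ← hall]; exact Or.inr ⟨n, by simp, rfl⟩
      rcases h3 with h3 | ⟨m, hm, h3⟩
      · exact hnv n le_rfl h3
      · have := hinj m (hm.2.trans hjn.le) n le_rfl h3
        have := hm.2
        omega
  refine ⟨n + 2, fun i => if i = 0 then v else p (i - 1), ⟨by omega, ?_, ?_⟩, ?_⟩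
  · intro i j hij hj
    skip
    rw [if_neg (show j ≠ 0 by omega)]
    split_ifs with hi
    · exact (hnv _ Ω).symm
    · intro e
      have := hinj _ Ω _ Ω e
      omega
  · intro i j hij hj
    skip
    rw [if_neg (show j ≠ 0 by omega)]
    split_ifs with hi
    · subst hi
      constructor
      · intro hadj
        by_contra hcon
        exact noch (j - 1) Ω Ω hadj
      · rintro (h1 | h1)
        · subst h1; simpa [h0] using hvu
        · have : j - 1 = n := by omega
          rw [this, hn]; exact hvu'
    · constructor
      · intro hadj
        have := hch _ _ Ω Ω hadj
        omega
      · rintro (h1 | h1)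
        · have : j - 1 = i - 1 + 1 := by omega
          rw [this]; exact hp _ Ω
        · omega
  · rw [← hall]
    ext x
    constructor
    · rintro (rfl | ⟨m, hm, rfl⟩)
      · exact ⟨0, by simp, by simp⟩
      · have := hm.2
        exact ⟨m + 1, show m + 1 < n + 2 by omega, by simp⟩
    · rintro ⟨i, hi, rfl⟩
      have hi' : i < n + 2 := hi
      dsimp only
      split_ifs with h1
      · exact Or.inl rfl
      · exact Or.inr ⟨i - 1, by simp; omega, rfl⟩

theorem nonexact_cyc [Finite W] (hsym : ∀ x y, φ x y = φ y x) {S : Set W} (hS : ¬ Exa H φ S) :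
    ∃ X ⊆ S, IndCyc H X ∧ ¬ Exa H φ X := by
  obtain ⟨X, hX, h1, h2⟩ := exists_minimal_nonexact hS
  exact ⟨X, hX, minimal_nonexact_cyc hsym h1 h2, h1⟩

/-- 3-connectedness -/
def TC (H : SimpleGraph W) : Prop := 4 ≤ Nat.card W ∧ ∀ s t : W, Cn H {s, t}ᶜ

/-- Faces: chordless non-separating cycles. -/
def Fc (H : SimpleGraph W) (X : Set W) : Prop := IndCyc H X ∧ Cn H Xᶜ

theorem IndCyc.third {X : Set W} (hX : IndCyc H X) (s t : W) : ∃ x ∈ X, x ≠ s ∧ x ≠ t := by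
  obtain ⟨k, c, hc, rfl⟩ := hX
  have h3 := hc.three
  by_contra hcon
  replace hcon : ∀ x ∈ c '' Set.Iio k, x = s ∨ x = t := by
    intro x hx
    by_contra h
    push Not at h
    exact hcon ⟨x, hx, h⟩
  have h0 := hcon (c 0) ⟨0, show 0 < k by omega, rfl⟩
  have h1 := hcon (c 1) ⟨1, show 1 < k by omega, rfl⟩
  have h2 := hcon (c 2) ⟨2, show 2 < k by omega, rfl⟩
  have e1 := hc.inj 0 1 Ω Ω
  have e2 := hc.inj 0 2 Ω Ω
  have e3 := hc.inj 1 2 Ω Ω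
  grind

/-- attachments of a component -/
theorem attach3 (hTC : TC H) {X : Set W} (hX : IndCyc H X) {u : W} (hu : u ∉ X) {s t : W}
    (hs : s ∈ X) (ht : t ∈ X) : ∃ w ∈ X, w ≠ s ∧ w ≠ t ∧ ∃ x ∈ comp H Xᶜ u, H.Adj x w := by
  obtain ⟨z, hz, hzs, hzt⟩ := hX.third s t
  have hBX : ∀ x ∈ comp H Xᶜ u, x ∉ X := fun x hx => comp_subset _ _ hx
  obtain ⟨x, hx, hxB, y, hy, hyB, hxy⟩ := (hTC.2 s t).cut (X := comp H Xᶜ u)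
    ⟨u, by simp; exact ⟨fun e => hu (e ▸ hs), fun e => hu (e ▸ ht)⟩, mem_comp_self hu⟩
    ⟨z, by simp [hzs, hzt], fun hB => hBX z hB hz⟩
  simp at hy
  refine ⟨y, ?_, hy.1, hy.2, x, hxB, hxy⟩
  by_contra hyX
  exact hyB (comp_step hxB hyX hxy)

theorem key_aux [Finite W] (hsym : ∀ x y, φ x y = φ y x) (hTC : TC H) (p : W)
    (hno : ∀ F, Fc H F → p ∉ F → Exa H φ F) :
    ∀ m (X : Set W), IndCyc H X → p ∉ X → Nat.card W - (comp H Xᶜ p).ncard = m → Exa H φ X := by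
  classical
  intro m
  induction m using Nat.strong_induction_on with
  | _ m ih =>
  intro X hX hpX hm
  by_contra hnX
  set B := comp H Xᶜ p with hB
  have hpB : p ∈ B := mem_comp_self hpX
  have hBX : ∀ x ∈ B, x ∉ X := fun x hx => comp_subset _ _ hx
  have hBc : Cn H B := comp_cn _ _
  have hex : ∀ w ∈ X, (∃ x ∈ B, H.Adj x w) → Exa H φ (Bᶜ \ {w}) := by
    intro w hw ⟨x, hx, hxw⟩
    by_contra hne
    obtain ⟨Y, hY, hYc, hYe⟩ := nonexact_cyc hsym hne
    apply hYe
    have hsub : insert w B ⊆ comp H Yᶜ p := by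
      apply subset_comp
      · rintro z (rfl | hz) hzY
        · exact (hY hzY).2 rfl
        · exact (hY hzY).1 hz
      · exact hBc.insert_adj hx hxw.symm
      · exact Or.inr hpB
    have h1 : (insert w B).ncard ≤ (comp H Yᶜ p).ncard := Set.ncard_le_ncard hsub (Set.toFinite _)
    rw [Set.ncard_insert_of_notMem (fun h => hBX w h hw) (Set.toFinite _)] at h1
    have h2 : (comp H Yᶜ p).ncard ≤ Nat.card W := by
      rw [← Set.ncard_univ]; exact Set.ncard_le_ncard (Set.subset_univ _) (Set.toFinite _)
    exact ih _ Ω Y hYc (fun h => (hY h).1 hpB) rfl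
  have sep : ∀ w1 ∈ X, ∀ w2 ∈ X, (∃ x ∈ B, H.Adj x w1) → (∃ x ∈ B, H.Adj x w2) →
      ¬ H.Adj w1 w2 → w1 ≠ w2 →
      ∀ K, Cn H K → K ⊆ Bᶜ → w1 ∉ K → w2 ∉ K → ¬ (∀ x ∈ X, x ≠ w1 → x ≠ w2 → x ∈ K) := by
    intro w1 h1 w2 h2 hb1 hb2 hnadj hne K hKc hKB hw1 hw2 hXK
    have hKne : K.Nonempty := by
      obtain ⟨x, hx, hx1, hx2⟩ := hX.third w1 w2
      exact ⟨x, hXK x hx hx1 hx2⟩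
    apply hnX
    have := exa_glue hsym hKc hKne hnadj ((hex w2 h2 hb2).mono ?_) ((hex w1 h1 hb1).mono ?_)
    · refine this.mono ?_
      intro x hx
      by_cases e1 : x = w1
      · exact Or.inl e1
      · by_cases e2 : x = w2
        · exact Or.inr (Or.inl e2)
        · exact Or.inr (Or.inr (hXK x hx e1 e2))
    · rintro z (rfl | hz)
      · exact ⟨fun h => hBX _ h h1, hne⟩
      · exact ⟨hKB hz, fun e => hw2 ((show z = w2 from e) ▸ hz)⟩
    · rintro z (rfl | hz)
      · exact ⟨fun h => hBX _ h h2, hne.symm⟩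
      · exact ⟨hKB hz, fun e => hw1 ((show z = w1 from e) ▸ hz)⟩
  have hXB : X ⊆ Bᶜ := fun x hx hxB => hBX x hxB hx
  -- all cycle vertices are attachments of `B`
  have hN : ∀ x ∈ X, ∃ b ∈ B, H.Adj b x := by
    intro x0 hx0
    by_contra hx0N
    obtain ⟨k, c, hc, hXc, hc0⟩ := hX.rot hx0
    have hk3 := hc.three
    have hmem : ∀ i < k, c i ∈ X := fun i hi => by rw [hXc]; exact ⟨i, hi, rfl⟩
    let P : ℕ → Prop := fun i => i < k ∧ ∃ b ∈ B, H.Adj b (c i)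
    have hP0 : ¬ P 0 := fun h => hx0N (hc0 ▸ h.2)
    obtain ⟨d1, hd1, -, -, hd1B⟩ := attach3 hTC hX hpX hx0 hx0
    have hexP : ∃ i, P i := by
      rw [hXc] at hd1
      obtain ⟨i, hi, rfl⟩ := hd1
      exact ⟨i, hi, hd1B⟩
    -- least and greatest indices
    obtain ⟨a, haP, hamin⟩ : ∃ a, P a ∧ ∀ i, P i → a ≤ i :=
      ⟨Nat.find hexP, Nat.find_spec hexP, fun i hi => Nat.find_min' hexP hi⟩
    obtain ⟨b, hbP, hbmax⟩ : ∃ b, P b ∧ ∀ i, P i → i ≤ b := by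
      obtain ⟨i, hi⟩ := hexP
      exact ⟨Nat.findGreatest P k, Nat.findGreatest_spec hi.1.le hi,
        fun j hj => Nat.le_findGreatest hj.1.le hj⟩
    obtain ⟨d, hd, hda, hdb, hdB⟩ := attach3 hTC hX hpX (hmem a haP.1) (hmem b hbP.1)
    obtain ⟨e, heP, hce⟩ : ∃ e, P e ∧ c e = d := by
      have hd' := hd
      rw [hXc] at hd'
      obtain ⟨i, hi, rfl⟩ := hd'
      exact ⟨i, ⟨hi, hdB⟩, rfl⟩
    have hae : a < e := lt_of_le_of_ne (hamin e heP) (fun h => hda (by rw [← hce, h]))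
    have heb : e < b := lt_of_le_of_ne (hbmax e heP) (fun h => hdb (by rw [← hce, h]))
    have ha1 : 0 < a := Nat.pos_of_ne_zero (fun h => hP0 (h ▸ haP))
    have hbk := hbP.1
    set K := comp H (Bᶜ \ {c a, c b}) (c 0) with hK
    have h0 : c 0 ∈ Bᶜ \ {c a, c b} := by
      refine ⟨hXB (hmem 0 Ω), ?_⟩
      rintro (h | h)
      · exact hc.inj 0 a Ω Ω h
      · exact hc.inj 0 b Ω Ω h
    have hK0 : c 0 ∈ K := mem_comp_self h0
    have arcsub : ∀ i j, j < k → (∀ m, i ≤ m → m ≤ j → m ≠ a ∧ m ≠ b) →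
        c '' Set.Icc i j ⊆ Bᶜ \ {c a, c b} := by
      rintro i j hj hm _ ⟨m, hmij, rfl⟩
      have h1 := hmij.1
      have h2 := hmij.2
      have h3 := hm m h1 h2
      refine ⟨hXB (hmem m Ω), ?_⟩
      rintro (h | h)
      · rcases lt_or_gt_of_ne h3.1 with h4 | h4
        · exact hc.inj m a h4 Ω h
        · exact hc.inj a m h4 Ω h.symm
      · rcases lt_or_gt_of_ne h3.2 with h4 | h4
        · exact hc.inj m b h4 Ω h
        · exact hc.inj b m h4 Ω (show c m = c b from h).symm
    have arccn : ∀ i j, i ≤ j → j < k → Cn H (c '' Set.Icc i j) := fun i j hij hj =>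
      cn_interval hij fun m _ hm => (hc.adj m (m + 1) Ω Ω).2 (Or.inl rfl)
    have arcK : ∀ i j, i ≤ j → j < k → (∀ m, i ≤ m → m ≤ j → m ≠ a ∧ m ≠ b) →
        (∃ m, i ≤ m ∧ m ≤ j ∧ c m ∈ K) → ∀ m, i ≤ m → m ≤ j → c m ∈ K := by
      rintro i j hij hj hmab ⟨m, hm1, hm2, hmK⟩ m' h1 h2
      exact comp_absorb h0 (arcsub i j hj hmab) (arccn i j hij hj)
        ⟨c m, ⟨m, ⟨hm1, hm2⟩, rfl⟩, hmK⟩ ⟨m', ⟨h1, h2⟩, rfl⟩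
    have low : ∀ m, m < a → c m ∈ K := fun m hm =>
      arcK 0 (a - 1) Ω Ω (fun _ _ _ => by omega) ⟨0, by omega, by omega, hK0⟩ m
        Ω Ω
    have high : ∀ m, b < m → m < k → c m ∈ K := by
      intro m hm hmk
      refine arcK (b + 1) (k - 1) Ω Ω (fun _ _ _ => by omega)
        ⟨k - 1, by omega, by omega, ?_⟩ m Ω Ω
      refine comp_step hK0 (arcsub (k - 1) (k - 1) Ω (fun _ _ _ => by omega)
        ⟨k - 1, by simp, rfl⟩) ((hc.adj 0 (k - 1) Ω Ω).2 (Or.inr ⟨rfl, by omega⟩))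
    have hKN : ∀ m, P m → c m ∉ K := by
      intro m hmP hmK
      have hma : m ≠ a := by
        rintro rfl; exact (comp_subset _ _ hmK).2 Ψ
      have hmb : m ≠ b := by
        rintro rfl; exact (comp_subset _ _ hmK).2 Ψ
      have h1 := hamin m hmP
      have h2 := hbmax m hmP
      have mid := arcK (a + 1) (b - 1) Ω Ω (fun _ _ _ => by omega)
        ⟨m, by omega, by omega, hmK⟩
      refine sep (c a) (hmem a haP.1) (c b) (hmem b hbP.1) haP.2 hbP.2 ?_ (hc.inj a b Ω hbk)
        K (comp_cn _ _) (fun x hx => (comp_subset _ _ hx).1)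
        (fun h => (comp_subset _ _ h).2 Ψ) (fun h => (comp_subset _ _ h).2 Ψ) ?_
      · rw [hc.adj a b Ω hbk]; omega
      · intro x hx hxa hxb
        rw [hXc] at hx
        obtain ⟨i, hi, rfl⟩ := hx
        have hi' : i < k := hi
        have hia : i ≠ a := fun h => hxa (by rw [h])
        have hib : i ≠ b := fun h => hxb (by rw [h])
        by_cases h3 : i < a
        · exact low i h3
        · by_cases h4 : b < i
          · exact high i h4 hi'
          · exact mid i Ω Ω
    have hpab : p ≠ c a ∧ p ≠ c b := ⟨fun h => hpX (h ▸ hmem a haP.1), fun h => hpX (h ▸ hmem b hbP.1)⟩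
    obtain ⟨x, hx, hxK, y, hy, hyK, hxy⟩ := (hTC.2 (c a) (c b)).cut (X := K)
      ⟨c 0, h0.2, hK0⟩ ⟨p, by simpa using hpab, fun h => (comp_subset _ _ h).1 hpB⟩
    have hxB := (comp_subset _ _ hxK).1
    by_cases hyB : y ∈ B
    · have hxX : x ∈ X := by
        by_contra hxX
        exact hxB (comp_step hyB hxX hxy.symm)
      rw [hXc] at hxX
      obtain ⟨i, hi, rfl⟩ := hxX
      exact hKN i ⟨hi, y, hyB, hxy.symm⟩ hxK
    · exact hyK (comp_step hxK ⟨hyB, hy⟩ hxy)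
  -- another component
  have hD : ∃ z, z ∉ X ∧ z ∉ B := by
    by_contra hcon
    push Not at hcon
    have : Xᶜ = B := Set.Subset.antisymm (fun z hz => hcon z hz) (fun z hz => hBX z hz)
    exact hnX (hno X ⟨hX, this ▸ hBc⟩ hpX)
  obtain ⟨z, hzX, hzB⟩ := hD
  set D := comp H Xᶜ z with hDdef
  have hDB : Disjoint B D := comp_disjoint hzB
  have hDX : ∀ x ∈ D, x ∉ X := fun x hx => comp_subset _ _ hx
  have hDc : Cn H D := comp_cn _ _
  have hDsub : D ⊆ Bᶜ := fun x hx hxB => Set.disjoint_left.mp hDB hxB hx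
  by_cases hpair : ∃ d1 ∈ X, ∃ d2 ∈ X, d1 ≠ d2 ∧ ¬ H.Adj d1 d2 ∧ (∃ x ∈ D, H.Adj x d1) ∧
      ∃ x ∈ D, H.Adj x d2
  · obtain ⟨d1, hd1, d2, hd2, hne, hnadj, ⟨x1, hx1, hxd1⟩, ⟨x2, hx2, hxd2⟩⟩ := hpair
    obtain ⟨k, c, hc, hXc, hc0⟩ := hX.rot hd1
    have hk3 := hc.three
    have hmem : ∀ i < k, c i ∈ X := fun i hi => by rw [hXc]; exact ⟨i, hi, rfl⟩
    rw [hXc] at hd2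
    obtain ⟨b, hb, hcb⟩ := hd2
    have hb' : b < k := hb
    have hb0 : b ≠ 0 := by rintro rfl; exact hne (hc0 ▸ hcb)
    have hadj := hc.adj 0 b Ω hb'
    rw [hc0, hcb] at hadj
    have hb1 : ¬ (b = 0 + 1 ∨ (0 = 0 ∧ b + 1 = k)) := fun h => hnadj (hadj.2 h)
    have K1 : Cn H (insert (c 0) D) := hDc.insert_adj hx1 (by rw [hc0]; exact hxd1.symm)
    have K2 : Cn H (c '' Set.Icc 2 (k - 2)) := cn_interval Ω fun m _ hm =>
      (hc.adj m (m + 1) Ω Ω).2 (Or.inl rfl)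
    have K3 := K1.union_adj K2 ⟨x2, Or.inr hx2, c b, ⟨b, by simp; omega, rfl⟩, by rw [hcb]; exact hxd2⟩
    refine sep (c 1) (hmem 1 Ω) (c (k - 1)) (hmem _ Ω) (hN _ (hmem _ Ω))
      (hN _ (hmem _ Ω)) ?_ (hc.inj _ _ Ω Ω) _ K3 ?_ ?_ ?_ ?_
    · rw [hc.adj _ _ Ω Ω]; omega
    · rintro x ((rfl | hx) | ⟨i, hi, rfl⟩)
      · exact hXB (hmem 0 Ω)
      · exact hDsub hx
      · have := hi.2
        exact hXB (hmem i Ω)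
    · rintro ((h | h) | ⟨i, hi, h⟩)
      · exact hc.inj 0 1 Ω Ω h.symm
      · exact hDX _ h (hmem 1 Ω)
      · have h1 := hi.1
        have h2 := hi.2
        exact hc.inj 1 i Ω Ω h.symm
    · rintro ((h | h) | ⟨i, hi, h⟩)
      · exact hc.inj 0 (k - 1) Ω Ω h.symm
      · exact hDX _ h (hmem _ Ω)
      · have h1 := hi.1
        have h2 := hi.2
        exact hc.inj i (k - 1) Ω Ω h
    · intro x hx hx1 hx2
      rw [hXc] at hx
      obtain ⟨i, hi, rfl⟩ := hx
      have hi' : i < k := hi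
      have hi1 : i ≠ 1 := fun h => hx1 (by rw [h])
      have hi2 : i ≠ k - 1 := fun h => hx2 (by rw [h])
      by_cases hi0 : i = 0
      · subst hi0; exact Or.inl (Or.inl rfl)
      · exact Or.inr ⟨i, by simp; omega, rfl⟩
  · -- triangle case
    push Not at hpair
    obtain ⟨x0, hx0, -⟩ := hX.third p p
    obtain ⟨a, ha, -, -, xa, hxa, hxa'⟩ := attach3 hTC hX hzX hx0 hx0
    obtain ⟨b, hb, hba, -, xb, hxb, hxb'⟩ := attach3 hTC hX hzX ha ha
    obtain ⟨c, hc, hca, hcb, xc, hxc, hxc'⟩ := attach3 hTC hX hzX ha hb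
    have hab : H.Adj a b := by
      by_contra h
      exact hpair a ha b hb hba.symm h ⟨xa, hxa, hxa'⟩ xb hxb hxb'
    have hac : H.Adj a c := by
      by_contra h
      exact hpair a ha c hc hca.symm h ⟨xa, hxa, hxa'⟩ xc hxc hxc'
    have hbc : H.Adj b c := by
      by_contra h
      exact hpair b hb c hc hcb.symm h ⟨xb, hxb, hxb'⟩ xc hxc hxc'
    have hX3 : ∀ x ∈ X, x = a ∨ x = b ∨ x = c := by
      obtain ⟨k, f, hf, hXf, hf0⟩ := hX.rot ha
      have hk3 := hf.three
      intro x hx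
      have hb2 := hb
      have hc2 := hc
      rw [hXf] at hb2 hc2 hx
      obtain ⟨i, hi, rfl⟩ := hb2
      obtain ⟨j, hj, rfl⟩ := hc2
      obtain ⟨l, hl, rfl⟩ := hx
      have hi' : i < k := hi
      have hj' : j < k := hj
      have hl' : l < k := hl
      have hi0 : i ≠ 0 := by rintro rfl; exact hba hf0
      have hj0 : j ≠ 0 := by rintro rfl; exact hca hf0
      have hij : i ≠ j := by rintro rfl; exact hcb rfl
      rw [← hf0, hf.adj _ _ Ω hi'] at hab
      rw [← hf0, hf.adj _ _ Ω hj'] at hac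
      have hk : k = 3 := by
        rcases lt_or_gt_of_ne hij with h | h
        · rw [hf.adj _ _ h hj'] at hbc; omega
        · rw [H.adj_comm, hf.adj _ _ h hi'] at hbc; omega
      by_cases h1 : l = 0
      · left; rw [h1, hf0]
      · by_cases h2 : l = i
        · right; left; rw [h2]
        · right; right; congr 1; omega
    -- star argument
    have sD : ∀ {w : W} {y : W}, w ∈ X → y ∈ D → y ∈ Bᶜ \ {w} := fun {w y} hw hy =>
      ⟨hDsub hy, fun e => hDX y hy ((show y = w from e) ▸ hw)⟩
    have sX : ∀ {w y : W}, y ∈ X → y ≠ w → y ∈ Bᶜ \ {w} := fun {w y} hy hne => ⟨hXB hy, hne⟩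
    obtain ⟨ga, ga0, hga⟩ := (hex a ha (hN a ha)).base z
    obtain ⟨gb, gb0, hgb⟩ := (hex b hb (hN b hb)).base z
    obtain ⟨gc, gc0, hgc⟩ := (hex c hc (hN c hc)).base z
    have hzD : z ∈ D := mem_comp_self hzX
    have agree : ∀ {u v w : W} {g g' : W → ZMod 2} {t : W}, u ∈ X → v ∈ X → w ∈ X → u ≠ v → u ≠ w →
        (∀ x ∈ Bᶜ \ {v}, ∀ y ∈ Bᶜ \ {v}, H.Adj x y → φ x y = g x + g y) →
        (∀ x ∈ Bᶜ \ {w}, ∀ y ∈ Bᶜ \ {w}, H.Adj x y → φ x y = g' x + g' y) →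
        g z = 0 → g' z = 0 → t ∈ D → H.Adj t u → g u = g' u := by
      intro u v w g g' t hu hv hw huv huw hg hg' h0 h0' ht htu
      have hsub : ∀ {q : W}, q ∈ X → u ≠ q → ∀ x ∈ insert u D, x ∈ Bᶜ \ {q} := by
        rintro q hq huq x (rfl | hx)
        · exact sX hu huq
        · exact sD hq hx
      exact exa_agree (T := insert u D) (d := z) (hDc.insert_adj ht htu.symm) (Or.inr hzD)
        (h0.trans h0'.symm)
        (fun x hx y hy => hg x (hsub hv huv x hx) y (hsub hv huv y hy))
        (fun x hx y hy => hg' x (hsub hw huw x hx) y (hsub hw huw y hy)) u (Or.inl rfl)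
    have ea := agree ha hb hc hba.symm hca.symm hgb hgc gb0 gc0 hxa hxa'
    have eb := agree hb ha hc hba hcb.symm hga hgc ga0 gc0 hxb hxb'
    have ec := agree hc ha hb hca hcb hga hgb ga0 gb0 hxc hxc'
    apply hnX
    refine ⟨fun x => if x = a then gb a else ga x, ?_⟩
    have A1 := hga b (sX hb hba) c (sX hc hca) hbc
    have A2 := hgb a (sX ha hba.symm) c (sX hc hcb) hac
    have A3 := hgc a (sX ha hca.symm) b (sX hb hcb.symm) hab
    intro x hx y hy hxy
    have irr := fun v => H.loopless.irrefl v
    beta_reduce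
    rcases hX3 x hx with rfl | rfl | rfl <;> rcases hX3 y hy with rfl | rfl | rfl
    · exact absurd hxy (irr _)
    · rw [if_pos rfl, if_neg hba, A3, eb, ea]
    · rw [if_pos rfl, if_neg hca, A2, ec]
    · rw [if_pos rfl, if_neg hba, hsym, A3, eb, ea, add_comm]
    · exact absurd hxy (irr _)
    · rw [if_neg hba, if_neg hca, A1]
    · rw [if_pos rfl, if_neg hca, hsym, A2, ec, add_comm]
    · rw [if_neg hba, if_neg hca, hsym, A1, add_comm]
    · exact absurd hxy (irr _)

/-- KEY: a function that is not exact off `p` is not exact on some face avoiding `p`. -/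
theorem key_face [Finite W] (hsym : ∀ x y, φ x y = φ y x) (hTC : TC H) (p : W)
    (h : ¬ Exa H φ {p}ᶜ) : ∃ F, Fc H F ∧ p ∉ F ∧ ¬ Exa H φ F := by
  by_contra hcon
  push Not at hcon
  obtain ⟨X, hX, hc, hne⟩ := nonexact_cyc hsym h
  exact hne (key_aux hsym hTC p hcon _ X hc (fun hp => hX hp rfl) rfl)

end Exactness

/-! ## Faces of planar 3-connected graphs -/

section Faces

variable {W : Type*} {H : SimpleGraph W}

theorem IndCyc.nbrs {X : Set W} (hX : IndCyc H X) {v : W} (hv : v ∈ X) :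
    ∃ x ∈ X, ∃ y ∈ X, x ≠ y ∧ H.Adj v x ∧ H.Adj v y ∧ ∀ z ∈ X, H.Adj v z → z = x ∨ z = y := by
  obtain ⟨k, c, hc, hXc, hc0⟩ := hX.rot hv
  have h3 := hc.three
  subst hXc hc0
  refine ⟨c 1, ⟨1, show 1 < k by omega, rfl⟩, c (k - 1), ⟨k - 1, show k - 1 < k by omega, rfl⟩,
    hc.inj _ _ Ω Ω, (hc.adj _ _ Ω Ω).2 (Or.inl rfl),
    (hc.adj _ _ Ω Ω).2 (Or.inr ⟨rfl, by omega⟩), ?_⟩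
  rintro _ ⟨i, hi, rfl⟩ hadj
  have hi' : i < k := hi
  rcases Nat.eq_zero_or_pos i with rfl | hpos
  · exact absurd hadj (H.loopless.irrefl _)
  · rcases (hc.adj 0 i hpos hi').1 hadj with h | h
    · left; rw [h]
    · right; congr 1; omega

theorem IndCyc.cn {X : Set W} (hX : IndCyc H X) : Cn H X := by
  obtain ⟨k, c, hc, rfl⟩ := hX
  have h3 := hc.three
  have := cn_interval (G := H) (p := c) (i := 0) (j := k - 1) Ω
    (fun m _ hm => (hc.adj m (m + 1) Ω Ω).2 (Or.inl rfl))
  have e : Set.Icc 0 (k - 1) = Set.Iio k := by ext; simp; omega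
  rwa [e] at this

theorem IndCyc.eq_of_subset {X Y : Set W} (hX : IndCyc H X) (hY : IndCyc H Y) (h : X ⊆ Y) :
    X = Y := by
  apply Set.Subset.antisymm h
  obtain ⟨a, ha, -⟩ := hX.nbrs (v := _) (hX.third (Classical.choose
    (let ⟨k, c, _⟩ := hX; ⟨c 0, trivial⟩ : ∃ _ : W, True)) (Classical.choose
    (let ⟨k, c, _⟩ := hX; ⟨c 0, trivial⟩ : ∃ _ : W, True))).choose_spec.1
  refine hY.cn.closed ⟨a, h ha, ha⟩ ?_
  intro x hx hxX y hy hxy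
  obtain ⟨p, hp, q, hq, hpq, hxp, hxq, -⟩ := hX.nbrs hxX
  obtain ⟨p', hp', q', hq', hpq', hxp', hxq', hall⟩ := hY.nbrs hx
  have h1 := hall p (h hp) hxp
  have h2 := hall q (h hq) hxq
  have h3 := hall y hy hxy
  grind

/-- The two arcs between nonadjacent vertices of a chordless cycle. -/
theorem IndCyc.arcs {X : Set W} (hX : IndCyc H X) {g h : W} (hg : g ∈ X) (hh : h ∈ X)
    (hne : g ≠ h) (hnadj : ¬ H.Adj g h) : ∃ α β : Set W, Cn H α ∧ Cn H β ∧ α.Nonempty ∧ β.Nonempty ∧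
      Disjoint α β ∧ g ∉ α ∧ g ∉ β ∧ h ∉ α ∧ h ∉ β ∧ (∀ x, x ∈ X ↔ x = g ∨ x = h ∨ x ∈ α ∨ x ∈ β) ∧
      ¬ Tch H α β ∧ Tch H {g} α ∧ Tch H {g} β ∧ Tch H {h} α ∧ Tch H {h} β := by
  obtain ⟨k, c, hc, rfl, rfl⟩ := hX.rot hg
  have h3 := hc.three
  obtain ⟨b, hb, rfl⟩ := hh
  have hbk : b < k := hb
  have hb0 : b ≠ 0 := by rintro rfl; exact hne rfl
  rw [hc.adj 0 b Ω hbk] at hnadj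
  have inj : ∀ i j, i < k → j < k → i ≠ j → c i ≠ c j := by
    intro i j hi hj hij
    rcases lt_or_gt_of_ne hij with h | h
    · exact hc.inj i j h hj
    · exact (hc.inj j i h hi).symm
  refine ⟨c '' Set.Icc 1 (b - 1), c '' Set.Icc (b + 1) (k - 1),
    cn_interval Ω (fun m _ hm => (hc.adj m (m + 1) Ω Ω).2 (Or.inl rfl)),
    cn_interval Ω (fun m _ hm => (hc.adj m (m + 1) Ω Ω).2 (Or.inl rfl)),
    ⟨c 1, 1, by simp; omega, rfl⟩, ⟨c (b + 1), b + 1, by simp; omega, rfl⟩, ?_, ?_, ?_, ?_, ?_, ?_, ?_,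
    ?_, ?_, ?_, ?_⟩
  · rw [Set.disjoint_left]
    rintro _ ⟨i, ⟨hi1, hi2⟩, rfl⟩ ⟨j, ⟨hj1, hj2⟩, e⟩
    exact inj i j Ω Ω Ω e.symm
  · rintro ⟨i, ⟨hi1, hi2⟩, e⟩
    exact inj i 0 Ω Ω Ω e
  · rintro ⟨i, ⟨hi1, hi2⟩, e⟩
    exact inj i 0 Ω Ω Ω e
  · rintro ⟨i, ⟨hi1, hi2⟩, e⟩
    exact inj i b Ω Ω Ω e
  · rintro ⟨i, ⟨hi1, hi2⟩, e⟩
    exact inj i b Ω Ω Ω e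
  · intro x
    constructor
    · rintro ⟨i, hi, rfl⟩
      have hi' : i < k := hi
      by_cases h1 : i = 0
      · left; rw [h1]
      · by_cases h2 : i = b
        · right; left; rw [h2]
        · by_cases h4 : i < b
          · right; right; left; exact ⟨i, by simp; omega, rfl⟩
          · right; right; right; exact ⟨i, by simp; omega, rfl⟩
    · rintro (rfl | rfl | ⟨i, ⟨h1, h2⟩, rfl⟩ | ⟨i, ⟨h1, h2⟩, rfl⟩)
      · exact ⟨0, show 0 < k by omega, rfl⟩
      · exact ⟨b, hbk, rfl⟩
      · exact ⟨i, show i < k by omega, rfl⟩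
      · exact ⟨i, show i < k by omega, rfl⟩
  · rintro ⟨_, ⟨i, ⟨hi1, hi2⟩, rfl⟩, _, ⟨j, ⟨hj1, hj2⟩, rfl⟩, hadj⟩
    rw [hc.adj i j Ω Ω] at hadj
    omega
  · exact ⟨c 0, rfl, c 1, ⟨1, by simp; omega, rfl⟩, (hc.adj _ _ Ω Ω).2 (Or.inl rfl)⟩
  · exact ⟨c 0, rfl, c (k - 1), ⟨k - 1, by simp; omega, rfl⟩,
      (hc.adj _ _ Ω Ω).2 (Or.inr ⟨rfl, by omega⟩)⟩
  · exact ⟨c b, rfl, c (b - 1), ⟨b - 1, by simp; omega, rfl⟩,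
      ((hc.adj _ _ Ω Ω).2 (Or.inl Ω)).symm⟩
  · exact ⟨c b, rfl, c (b + 1), ⟨b + 1, by simp; omega, rfl⟩,
      ((hc.adj _ _ Ω Ω).2 (Or.inl Ω))⟩

theorem IndCyc.minus_edge {X : Set W} (hX : IndCyc H X) {x y : W} (hx : x ∈ X) (hy : y ∈ X)
    (hxy : H.Adj x y) : Cn H (X \ {x, y}) ∧ Tch H {x} (X \ {x, y}) ∧ Tch H {y} (X \ {x, y}) := by
  obtain ⟨k, c, hc, rfl, rfl⟩ := hX.rot hx
  have h3 := hc.three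
  obtain ⟨b, hb, rfl⟩ := hy
  have hbk : b < k := hb
  have hb0 : b ≠ 0 := by rintro rfl; exact H.loopless.irrefl _ hxy
  rw [hc.adj 0 b Ω hbk] at hxy
  have inj : ∀ i j, i < k → j < k → i ≠ j → c i ≠ c j := by
    intro i j hi hj hij
    rcases lt_or_gt_of_ne hij with h | h
    · exact hc.inj i j h hj
    · exact (hc.inj j i h hi).symm
  have cn : ∀ i j, i ≤ j → j < k → Cn H (c '' Set.Icc i j) := fun i j hij hj =>
    cn_interval hij (fun m _ hm => (hc.adj m (m + 1) Ω Ω).2 (Or.inl rfl))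
  have mem : ∀ i, i < k → i ≠ 0 → i ≠ b → c i ∈ c '' Set.Iio k \ {c 0, c b} := by
    intro i hi h1 h2
    refine ⟨⟨i, hi, rfl⟩, ?_⟩
    rintro (h | h)
    · exact inj i 0 hi Ω h1 h
    · exact inj i b hi Ω h2 h
  have eq : ∀ i j, (∀ m, m < k → ((i ≤ m ∧ m ≤ j) ↔ m ≠ 0 ∧ m ≠ b)) → j < k →
      c '' Set.Iio k \ {c 0, c b} = c '' Set.Icc i j := by
    intro i j hij hj
    ext z
    constructor
    · rintro ⟨⟨m, hm, rfl⟩, hz⟩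
      refine ⟨m, (hij m hm).2 ⟨?_, ?_⟩, rfl⟩
      · rintro rfl; exact hz Ψ
      · rintro rfl; exact hz Ψ
    · rintro ⟨m, hm, rfl⟩
      have hmk : m < k := lt_of_le_of_lt hm.2 hj
      have := (hij m hmk).1 hm
      exact mem m hmk this.1 this.2
  rcases hxy with rfl | ⟨-, hbk1⟩
  · refine ⟨?_, ⟨c 0, rfl, c (k - 1), mem _ Ω Ω Ω, ?_⟩,
      ⟨c 1, rfl, c 2, mem _ Ω Ω Ω, ?_⟩⟩
    · rw [eq 2 (k - 1) (fun m hm => by omega) Ω]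
      exact cn _ _ Ω Ω
    · exact (hc.adj _ _ Ω Ω).2 (Or.inr ⟨rfl, by omega⟩)
    · exact (hc.adj _ _ Ω Ω).2 (Or.inl rfl)
  · refine ⟨?_, ⟨c 0, rfl, c 1, mem _ Ω Ω Ω, ?_⟩,
      ⟨c b, rfl, c (b - 1), mem _ Ω Ω Ω, ?_⟩⟩
    · rw [eq 1 (k - 2) (fun m hm => by omega) Ω]
      exact cn _ _ Ω Ω
    · exact (hc.adj _ _ Ω Ω).2 (Or.inl rfl)
    · exact ((hc.adj _ _ Ω Ω).2 (Or.inl Ω)).symm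

theorem TC.exists_ne (hTC : TC H) (a b c : W) : ∃ z, z ≠ a ∧ z ≠ b ∧ z ≠ c := by
  by_contra hcon
  push Not at hcon
  have hsub : (Set.univ : Set W) ⊆ {a, b, c} := by
    intro z _
    by_contra h
    simp at h
    exact h.2.2 (hcon z h.1 h.2.1)
  have h1 := Set.ncard_le_ncard hsub (Set.toFinite _)
  rw [Set.ncard_univ] at h1
  have h2 : ({a, b, c} : Set W).ncard ≤ 3 := by
    have := Set.ncard_insert_le a ({b, c} : Set W)
    have := Set.ncard_insert_le b ({c} : Set W)
    have := Set.ncard_singleton c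
    omega
  have := hTC.1
  omega

theorem TC.deg3 (hTC : TC H) {v s t : W} (hs : v ≠ s) (ht : v ≠ t) :
    ∃ w, H.Adj v w ∧ w ≠ s ∧ w ≠ t := by
  obtain ⟨z, hz1, hz2, hz3⟩ := hTC.exists_ne v s t
  obtain ⟨x, hx, rfl, y, hy, -, hxy⟩ := (hTC.2 s t).cut (X := {v}) ⟨v, by simp [hs, ht], rfl⟩
    ⟨z, by simp [hz2, hz3], hz1⟩
  simp at hy
  exact ⟨y, hxy, hy.1, hy.2⟩

theorem face_avoid [Finite W] (hTC : TC H) {x y p : W} (hxy : H.Adj x y) (hx : p ≠ x)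
    (hy : p ≠ y) : ∃ F, Fc H F ∧ x ∈ F ∧ y ∈ F ∧ p ∉ F := by
  classical
  let φ : W → W → ZMod 2 := fun u v => if (u = x ∧ v = y) ∨ (u = y ∧ v = x) then 1 else 0
  have hsym : ∀ u v, φ u v = φ v u := by
    intro u v
    simp only [φ]
    congr 1
    apply propext; tauto
  have hne : ¬ Exa H φ {p}ᶜ := by
    rintro ⟨h, hh⟩
    obtain ⟨w, hxw, hwy, hwp⟩ := hTC.deg3 (v := x) (s := y) (t := p) (H.ne_of_adj hxy) hx.symm
    have hwx : w ≠ x := (H.ne_of_adj hxw).symm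
    have := (hTC.2 p x).closed (X := {z | h z = h y})
      ⟨y, by simp [hy.symm, (H.ne_of_adj hxy).symm], rfl⟩ (by
      intro a ha haX b hb hab
      simp at ha hb
      have e := hh a ha.1 b hb.1 hab
      have e0 : φ a b = 0 := if_neg (by tauto)
      have h2 := CharTwo.add_self_eq_zero (h a)
      have haX' : h a = h y := haX
      show h b = h y
      linear_combination e0 - e - h2 + haX')
    have hwy' : h w = h y := this (show w ∈ ({p, x} : Set W)ᶜ by simp [hwp, hwx])
    have e1 := hh x hx.symm y hy.symm hxy
    have e2 := hh x hx.symm w hwp hxw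
    have e3 : φ x y = 1 := if_pos (by tauto)
    have e4 : φ x w = 0 := if_neg (by
      rintro (h | h)
      · exact hwy h.2
      · exact hwx h.2)
    rw [hwy', ← e1, e3] at e2
    rw [e4] at e2
    exact absurd e2 (by decide)
  obtain ⟨F, hF, hpF, hFe⟩ := key_face hsym hTC p hne
  have : x ∈ F ∧ y ∈ F := by
    by_contra hcon
    apply hFe
    refine ⟨fun _ => 0, fun a ha b hb _ => ?_⟩
    rw [add_zero]
    apply if_neg
    rintro (⟨rfl, rfl⟩ | ⟨rfl, rfl⟩) <;> tauto
  exact ⟨F, hF, this.1, this.2, hpF⟩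

/-- closure argument: connecting two sets through a component -/
theorem link_aux {T P Q R : Set W} (hT : Cn H T) (hcov : ∀ x ∈ T, x ∈ P ∨ x ∈ Q ∨ x ∈ R)
    (hs : ∃ s ∈ T, s ∈ P ∨ (s ∈ R ∧ Tch H (comp H R s) P))
    (ht : ∃ t ∈ T, t ∈ Q ∨ (t ∈ R ∧ Tch H (comp H R t) Q))
    (hPQ : Disjoint P Q) (hPR : Disjoint P R) (hQR : Disjoint Q R) :
    Tch H P Q ∨ ∃ u ∈ R, Tch H (comp H R u) P ∧ Tch H (comp H R u) Q := by
  by_contra hcon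
  push Not at hcon
  obtain ⟨hnt, hno⟩ := hcon
  obtain ⟨s, hsT, hs⟩ := hs
  obtain ⟨t, htT, ht⟩ := ht
  have := hT.closed (X := {z | z ∈ P ∨ (z ∈ R ∧ Tch H (comp H R z) P)}) ⟨s, hsT, hs⟩ (by
    rintro x hxT hx y hyT hxy
    rcases hcov y hyT with hy | hy | hy
    · exact Or.inl hy
    · exfalso
      rcases hx with hx | ⟨hx, hxt⟩
      · exact hnt ⟨x, hx, y, hy, hxy⟩
      · exact hno x hx hxt ⟨x, mem_comp_self hx, y, hy, hxy⟩
    · rcases hx with hx | ⟨hx, hxt⟩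
      · exact Or.inr ⟨hy, y, mem_comp_self hy, x, hx, hxy.symm⟩
      · refine Or.inr ⟨hy, ?_⟩
        rw [comp_eq (comp_step (mem_comp_self hx) hy hxy)]
        exact hxt)
  rcases this htT with h | ⟨h, h'⟩
  · rcases ht with ht | ht
    · exact Set.disjoint_left.mp hPQ h ht
    · exact Set.disjoint_left.mp hPR h ht.1
  · rcases ht with ht | ht
    · exact Set.disjoint_left.mp hQR ht h
    · exact hno t h h' ht.2

theorem face_inter_adj (hTC : TC H) (hPl : Pl H) {X Y : Set W} (hX : Fc H X)
    (hY : Fc H Y) (hne : X ≠ Y) {a b : W} (haX : a ∈ X) (haY : a ∈ Y) (hbX : b ∈ X) (hbY : b ∈ Y)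
    (hab : a ≠ b) : H.Adj a b := by
  classical
  by_contra hnadj
  -- a vertex of Y off X
  obtain ⟨q, hqY, hqX⟩ : ∃ q ∈ Y, q ∉ X := by
    by_contra hcon
    push Not at hcon
    exact hne (hY.1.eq_of_subset hX.1 hcon).symm
  have run : ∃ g h Q, g ∈ X ∧ g ∈ Y ∧ h ∈ X ∧ h ∈ Y ∧ g ≠ h ∧ ¬ H.Adj g h ∧ Cn H Q ∧ Q.Nonempty ∧
      Q ⊆ Y \ X ∧ Tch H {g} Q ∧ Tch H {h} Q := by
    obtain ⟨k, c, hc, rfl, rfl⟩ := hY.1.rot hqY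
    have hk3 := hc.three
    obtain ⟨i, hi, rfl⟩ := haY
    obtain ⟨j, hj, rfl⟩ := hbY
    have hi' : i < k := hi
    have hj' : j < k := hj
    let P : ℕ → Prop := fun i => i < k ∧ c i ∈ X
    have hPi : P i := ⟨hi, haX⟩
    have hPj : P j := ⟨hj, hbX⟩
    have hexP : ∃ i, P i := ⟨i, hPi⟩
    obtain ⟨s, hsP, hsmin⟩ : ∃ a, P a ∧ ∀ i, P i → a ≤ i :=
      ⟨Nat.find hexP, Nat.find_spec hexP, fun i hi => Nat.find_min' hexP hi⟩
    obtain ⟨t, htP, htmax⟩ : ∃ b, P b ∧ ∀ i, P i → i ≤ b :=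
      ⟨Nat.findGreatest P k, Nat.findGreatest_spec hi'.le hPi,
        fun j hj => Nat.le_findGreatest hj.1.le hj⟩
    have hs0 : s ≠ 0 := by rintro rfl; exact hqX hsP.2
    have h1 := hsmin i hPi
    have h2 := hsmin j hPj
    have h3 := htmax i hPi
    have h4 := htmax j hPj
    have hij : i ≠ j := by rintro rfl; exact hab rfl
    have htk := htP.1
    have hst : s + 2 ≤ t := by
      rcases lt_or_gt_of_ne hij with h | h
      · rw [hc.adj i j h hj'] at hnadj; omega
      · rw [H.adj_comm, hc.adj j i h hi'] at hnadj; omega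
    have low : ∀ m, m < s → c m ∉ X := fun m hm hmX => by
      have := hsmin m ⟨by omega, hmX⟩; omega
    have high : ∀ m, t < m → m < k → c m ∉ X := fun m hm hmk hmX => by
      have := htmax m ⟨by omega, hmX⟩; omega
    have mem : ∀ m, m < k → c m ∈ c '' Set.Iio k := fun m hm => ⟨m, hm, rfl⟩
    have cn : ∀ i j, i ≤ j → j < k → Cn H (c '' Set.Icc i j) := fun i j hij hj =>
      cn_interval hij (fun m _ hm => (hc.adj m (m + 1) Ω Ω).2 (Or.inl rfl))
    have A1 : H.Adj (c s) (c (s - 1)) :=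
      ((hc.adj (s - 1) s Ω Ω).2 (Or.inl Ω)).symm
    have hna : ¬ H.Adj (c s) (c t) := by
      rw [hc.adj s t Ω htk]; omega
    by_cases htk1 : t + 1 = k
    · refine ⟨c s, c t, c '' Set.Icc 0 (s - 1), hsP.2, mem s hsP.1, htP.2, mem t htk,
        hc.inj s t Ω htk, hna, cn _ _ Ω Ω, ⟨c 0, 0, by simp, rfl⟩, ?_,
        ⟨c s, rfl, c (s - 1), ⟨s - 1, by simp, rfl⟩, A1⟩, ⟨c t, rfl, c 0, ⟨0, by simp, rfl⟩, ?_⟩⟩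
      · rintro _ ⟨m, hm, rfl⟩
        have := hm.2
        exact ⟨mem m Ω, low m Ω⟩
      · exact ((hc.adj 0 t Ω htk).2 (Or.inr ⟨rfl, htk1⟩)).symm
    · refine ⟨c s, c t, c '' Set.Icc 0 (s - 1) ∪ c '' Set.Icc (t + 1) (k - 1), hsP.2, mem s hsP.1,
        htP.2, mem t htk,
        hc.inj s t Ω htk, hna, (cn _ _ Ω Ω).union_adj
          (cn _ _ Ω Ω) ⟨c 0, ⟨0, by simp, rfl⟩, c (k - 1), ⟨k - 1, by simp; omega, rfl⟩,
            (hc.adj _ _ Ω Ω).2 (Or.inr ⟨rfl, by omega⟩)⟩,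
        ⟨c 0, Or.inl ⟨0, by simp, rfl⟩⟩, ?_,
        ⟨c s, rfl, c (s - 1), Or.inl ⟨s - 1, by simp, rfl⟩, A1⟩,
        ⟨c t, rfl, c (t + 1), Or.inr ⟨t + 1, by simp; omega, rfl⟩, ?_⟩⟩
      · rintro _ (⟨m, hm, rfl⟩ | ⟨m, hm, rfl⟩)
        · have := hm.2
          exact ⟨mem m Ω, low m Ω⟩
        · have := hm.2
          have := hm.1
          exact ⟨mem m Ω, high m Ω Ω⟩
      · exact (hc.adj t (t + 1) Ω Ω).2 (Or.inl rfl)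
  obtain ⟨g, h, Q, hgX, hgY, hhX, hhY, hgh, hnadj', hQc, hQne, hQs, hgQ, hhQ⟩ := run
  obtain ⟨α, β, hα, hβ, hαne, hβne, hαβ, hgα, hgβ, hhα, hhβ, hXiff, hnt, hgα', hgβ', hhα', hhβ'⟩ :=
    hX.1.arcs hgX hhX hgh hnadj'
  set R := (X ∪ Q)ᶜ with hR
  have third : ∀ a ∈ X, a ∈ Y → (∀ z ∈ X, H.Adj a z → z ∈ Y) → ∃ z, H.Adj a z ∧ z ∉ X ∧ z ∉ Y := by
    intro a haX haY hsub
    obtain ⟨x, hx, y, hy, hxy, hax, hay, hall⟩ := hX.1.nbrs haX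
    obtain ⟨x', hx', y', hy', hxy', hax', hay', hall'⟩ := hY.1.nbrs haY
    obtain ⟨z, haz, hzx, hzy⟩ := hTC.deg3 (H.ne_of_adj hax) (H.ne_of_adj hay)
    have h1 := hall' x (hsub x hx hax) hax
    have h2 := hall' y (hsub y hy hay) hay
    refine ⟨z, haz, fun hz => ?_, fun hz => ?_⟩
    · have := hall z hz haz; tauto
    · have := hall' z hz haz
      grind
  have seed : ∀ γ δ : Set W, γ.Nonempty → (∀ x ∈ γ, x ∈ X) →
      (∀ x ∈ γ, ∀ z ∈ X, H.Adj x z → z = g ∨ z = h ∨ z ∈ γ) →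
      ∃ s ∈ Yᶜ, s ∈ γ ∨ (s ∈ R ∧ Tch H (comp H R s) γ) := by
    intro γ δ hne hγX hnb
    by_cases hsub : γ ⊆ Y
    · obtain ⟨a, ha⟩ := hne
      obtain ⟨z, haz, hzX, hzY⟩ := third a (hγX a ha) (hsub ha) (by
        intro z hz haz
        rcases hnb a ha z hz haz with rfl | rfl | h
        · exact hgY
        · exact hhY
        · exact hsub h)
      have hzR : z ∈ R := by
        rintro (h | h)
        · exact hzX h
        · exact hzY (hQs h).1
      exact ⟨z, hzY, Or.inr ⟨hzR, z, mem_comp_self hzR, a, ha, haz.symm⟩⟩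
    · obtain ⟨s, hs, hs'⟩ := Set.not_subset.mp hsub
      exact ⟨s, hs', Or.inl hs⟩
  have hαX : ∀ x ∈ α, x ∈ X := fun x hx => (hXiff x).2 (by tauto)
  have hβX : ∀ x ∈ β, x ∈ X := fun x hx => (hXiff x).2 (by tauto)
  have hRX : ∀ x ∈ R, x ∉ X := fun x hx h => hx (Or.inl h)
  rcases link_aux (R := R) hY.2 (P := α) (Q := β) (by
      intro x hx
      by_cases hxX : x ∈ X
      · rcases (hXiff x).1 hxX with rfl | rfl | h | h
        · exact absurd hgY hx
        · exact absurd hhY hx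
        · exact Or.inl h
        · exact Or.inr (Or.inl h)
      · refine Or.inr (Or.inr ?_)
        rintro (h | h)
        · exact hxX h
        · exact hx (hQs h).1)
    (seed α β hαne hαX (by
      intro x hx z hz hxz
      rcases (hXiff z).1 hz with h | h | h | h
      · exact Or.inl h
      · exact Or.inr (Or.inl h)
      · exact Or.inr (Or.inr h)
      · exact absurd ⟨x, hx, z, h, hxz⟩ hnt))
    (seed β α hβne hβX (by
      intro x hx z hz hxz
      rcases (hXiff z).1 hz with h | h | h | h
      · exact Or.inl h
      · exact Or.inr (Or.inl h)
      · exact absurd ⟨z, h, x, hx, hxz.symm⟩ hnt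
      · exact Or.inr (Or.inr h)))
    hαβ (Set.disjoint_left.2 fun x hx hxR => hRX x hxR (hαX x hx))
    (Set.disjoint_left.2 fun x hx hxR => hRX x hxR (hβX x hx)) with h1 | ⟨u, hu, huα, huβ⟩
  · exact hnt h1
  · have hDR : comp H R u ⊆ R := comp_subset _ _
    have hDQ : Tch H (comp H R u) Q := by
      obtain ⟨q', hq'⟩ := hQne
      obtain ⟨x, hx, hxD, y, hy, hyD, hxy⟩ := hX.2.cut (X := comp H R u)
        ⟨u, hRX u hu, mem_comp_self hu⟩ ⟨q', (hQs hq').2, fun h => hDR h (Or.inr hq')⟩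
      refine ⟨x, hxD, y, ?_, hxy⟩
      by_contra hyQ
      exact hyD (comp_step hxD (by rintro (h | h); exacts [hy h, hyQ h]) hxy)
    have dg : ∀ {z : W} {T : Set W}, z ∉ T → Disjoint {z} T := fun h =>
      Set.disjoint_singleton_left.2 h
    have hXQ : ∀ x ∈ Q, x ∉ X := fun x hx => (hQs hx).2
    refine hPl.k33 (A := {g}) (B := {h}) (C := comp H R u) (X := α) (Y := β) (Z := Q)
      (cn_singleton _) (cn_singleton _) (comp_cn _ _) hα hβ hQc (dg hgh) (dg fun h => hRX _ (hDR h) hgX)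
      (dg fun h => hRX _ (hDR h) hhX) hαβ (Set.disjoint_left.2 fun x hx hxQ => hXQ x hxQ (hαX x hx))
      (Set.disjoint_left.2 fun x hx hxQ => hXQ x hxQ (hβX x hx)) (dg hgα) (dg hgβ)
      (dg fun h => hXQ _ h hgX) (dg hhα) (dg hhβ) (dg fun h => hXQ _ h hhX)
      (Set.disjoint_left.2 fun x hx hxα => hRX x (hDR hx) (hαX x hxα))
      (Set.disjoint_left.2 fun x hx hxα => hRX x (hDR hx) (hβX x hxα))
      (Set.disjoint_left.2 fun x hx hxQ => hDR hx (Or.inr hxQ))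
      hgα' hgβ' hgQ hhα' hhβ' hhQ huα huβ hDQ

theorem IndCyc.triangle {X : Set W} (hX : IndCyc H X) {a b c : W} (ha : a ∈ X) (hb : b ∈ X)
    (hc : c ∈ X) (hab : H.Adj a b) (hac : H.Adj a c) (hbc : H.Adj b c) : X = {a, b, c} := by
  have sub : ({a, b, c} : Set W) ⊆ X := by
    rintro z (rfl | rfl | rfl) <;> assumption
  refine Set.Subset.antisymm ?_ sub
  refine hX.cn.closed ⟨a, ha, by simp⟩ ?_
  have key : ∀ a b c, a ∈ X → b ∈ X → c ∈ X → H.Adj a b → H.Adj a c → H.Adj b c → ∀ y ∈ X,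
      H.Adj a y → y = b ∨ y = c := by
    intro a b c ha hb hc hab hac hbc y hy hay
    obtain ⟨p, hp, q, hq, hpq, hap, haq, hall⟩ := hX.nbrs ha
    have h1 := hall b hb hab
    have h2 := hall c hc hac
    have h3 := hall y hy hay
    have h4 := H.ne_of_adj hbc
    grind
  rintro x hx (rfl | rfl | rfl) y hy hxy
  · have := key _ _ _ hx hb hc hab hac hbc y hy hxy
    simp only [Set.mem_insert_iff, Set.mem_singleton_iff]; tauto
  · have := key _ _ _ hx ha hc hab.symm hbc hac y hy hxy
    simp only [Set.mem_insert_iff, Set.mem_singleton_iff]; tauto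
  · have := key _ _ _ hx ha hb hac.symm hbc.symm hab y hy hxy
    simp only [Set.mem_insert_iff, Set.mem_singleton_iff]; tauto

theorem face_inter (hTC : TC H) (hPl : Pl H) {X Y : Set W} (hX : Fc H X)
    (hY : Fc H Y) (hne : X ≠ Y) {a b : W} (haX : a ∈ X) (haY : a ∈ Y) (hbX : b ∈ X) (hbY : b ∈ Y)
    (hab : a ≠ b) {z : W} (hzX : z ∈ X) (hzY : z ∈ Y) : z = a ∨ z = b := by
  by_contra hcon
  push Not at hcon
  have h1 := face_inter_adj hTC hPl hX hY hne haX haY hbX hbY hab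
  have h2 := face_inter_adj hTC hPl hX hY hne haX haY hzX hzY hcon.1.symm
  have h3 := face_inter_adj hTC hPl hX hY hne hbX hbY hzX hzY hcon.2.symm
  exact hne ((hX.1.triangle haX hbX hzX h1 h2 h3).trans (hY.1.triangle haY hbY hzY h1 h2 h3).symm)

theorem face_le_two (hTC : TC H) (hPl : Pl H) {x y : W} (hxy : H.Adj x y) {A B C : Set W}
    (hA : Fc H A) (hB : Fc H B) (hC : Fc H C) (hAB : A ≠ B) (hAC : A ≠ C) (hBC : B ≠ C)
    (xA : x ∈ A) (yA : y ∈ A) (xB : x ∈ B) (yB : y ∈ B) (xC : x ∈ C) (yC : y ∈ C) : False := by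
  have hxyne := H.ne_of_adj hxy
  obtain ⟨cA, txA, tyA⟩ := hA.1.minus_edge xA yA hxy
  obtain ⟨cB, txB, tyB⟩ := hB.1.minus_edge xB yB hxy
  obtain ⟨cC, txC, tyC⟩ := hC.1.minus_edge xC yC hxy
  have dis : ∀ {X Y : Set W}, Fc H X → Fc H Y → X ≠ Y → x ∈ X → y ∈ X → x ∈ Y → y ∈ Y →
      Disjoint (X \ {x, y}) (Y \ {x, y}) := by
    intro X Y hX hY hne hx hy hx' hy'
    rw [Set.disjoint_left]
    intro z hz hz'
    exact hz.2 (by simpa using face_inter hTC hPl hX hY hne hx hx' hy hy' hxyne hz.1 hz'.1)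
  have dAB := dis hA hB hAB xA yA xB yB
  have dAC := dis hA hC hAC xA yA xC yC
  have dBC := dis hB hC hBC xB yB xC yC
  set PA := A \ {x, y}
  set PB := B \ {x, y}
  set PC := C \ {x, y}
  set R := (A ∪ B ∪ C)ᶜ with hR
  have nA : ∀ z ∈ R, z ∉ A := fun z hz h => hz (Or.inl (Or.inl h))
  have nB : ∀ z ∈ R, z ∉ B := fun z hz h => hz (Or.inl (Or.inr h))
  have nC : ∀ z ∈ R, z ∉ C := fun z hz h => hz (Or.inr h)
  have dA : Disjoint PA R := Set.disjoint_left.2 fun z hz hzR => nA z hzR hz.1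
  have dB : Disjoint PB R := Set.disjoint_left.2 fun z hz hzR => nB z hzR hz.1
  have dC : Disjoint PC R := Set.disjoint_left.2 fun z hz hzR => nC z hzR hz.1
  have sing : ∀ {z : W} {T : Set W}, z ∉ T → Disjoint {z} T := fun h =>
    Set.disjoint_singleton_left.2 h
  by_cases hall : ∃ u ∈ R, Tch H (comp H R u) PA ∧ Tch H (comp H R u) PB ∧ Tch H (comp H R u) PC
  · obtain ⟨u, hu, t1, t2, t3⟩ := hall
    have hs : comp H R u ⊆ R := comp_subset _ _
    exact hPl.k33 (cn_singleton x) (cn_singleton y) (comp_cn R u) cA cB cC (sing hxyne)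
      (sing fun h => nA x (hs h) xA) (sing fun h => nA y (hs h) yA) dAB dAC dBC
      (sing fun h => h.2 Ψ) (sing fun h => h.2 Ψ) (sing fun h => h.2 Ψ)
      (sing fun h => h.2 Ψ) (sing fun h => h.2 Ψ) (sing fun h => h.2 Ψ)
      (dA.symm.mono_left hs) (dB.symm.mono_left hs) (dC.symm.mono_left hs)
      txA txB txC tyA tyB tyC t1 t2 t3
  · have link : ∀ {X Y Z : Set W}, Cn H (X \ {x, y}) → Fc H Z → x ∈ Z → y ∈ Z →
        (∀ z, z ∈ R ↔ z ∉ X ∧ z ∉ Y ∧ z ∉ Z) →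
        Disjoint (X \ {x, y}) (Y \ {x, y}) → Disjoint (X \ {x, y}) (Z \ {x, y}) →
        Disjoint (Y \ {x, y}) (Z \ {x, y}) → Disjoint (X \ {x, y}) R → Disjoint (Y \ {x, y}) R →
        (X \ {x, y}).Nonempty → (Y \ {x, y}).Nonempty →
        ∃ E : Set W, E ⊆ R ∧ Cn H (X \ {x, y} ∪ E) ∧ Tch H (X \ {x, y} ∪ E) (Y \ {x, y}) ∧
          ∀ e ∈ E, Tch H (comp H R e) (X \ {x, y}) ∧ Tch H (comp H R e) (Y \ {x, y}) := by
      intro X Y Z cX hZ hxZ hyZ hRi d1 d2 d3 d4 d5 n1 n2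
      have hZ' : ∀ {z : W} {T : Set W}, Disjoint (T \ {x, y}) (Z \ {x, y}) → z ∈ T \ {x, y} →
          z ∈ Zᶜ := by
        intro z T hd hz hzZ
        exact Set.disjoint_left.mp hd hz ⟨hzZ, hz.2⟩
      obtain ⟨a, ha⟩ := n1
      obtain ⟨b, hb⟩ := n2
      rcases link_aux (R := R) hZ.2 (P := X \ {x, y}) (Q := Y \ {x, y}) (by
          intro z hz
          have hzx : z ∉ ({x, y} : Set W) := by
            rintro (rfl | rfl)
            · exact hz hxZ
            · exact hz hyZ
          by_cases h1 : z ∈ X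
          · exact Or.inl ⟨h1, hzx⟩
          · by_cases h2 : z ∈ Y
            · exact Or.inr (Or.inl ⟨h2, hzx⟩)
            · exact Or.inr (Or.inr ((hRi z).2 ⟨h1, h2, hz⟩)))
        ⟨a, hZ' d2 ha, Or.inl ha⟩ ⟨b, hZ' d3 hb, Or.inl hb⟩ d1 d4 d5 with h | ⟨u, hu, h1, h2⟩
      · refine ⟨∅, by simp, ?_, by simpa using h, by simp⟩
        rw [Set.union_empty]
        exact cX
      · refine ⟨comp H R u, comp_subset _ _, cX.union_adj (comp_cn _ _) h1.symm,
          h2.mono Set.subset_union_right subset_rfl, ?_⟩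
        intro e he
        rw [comp_eq he]
        exact ⟨h1, h2⟩
    have neA : PA.Nonempty := by obtain ⟨_, _, b, hb, _⟩ := txA; exact ⟨b, hb⟩
    have neB : PB.Nonempty := by obtain ⟨_, _, b, hb, _⟩ := txB; exact ⟨b, hb⟩
    have neC : PC.Nonempty := by obtain ⟨_, _, b, hb, _⟩ := txC; exact ⟨b, hb⟩
    have hRmem : ∀ z, z ∈ R ↔ z ∉ A ∧ z ∉ B ∧ z ∉ C := by
      intro z; rw [hR]; simp only [Set.mem_compl_iff, Set.mem_union]; tauto
    obtain ⟨E1, e1R, c1, t1, k1⟩ := link cA hC xC yC (fun z => by rw [hRmem]) dAB dAC dBC dA dB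
      neA neB
    obtain ⟨E2, e2R, c2, t2, k2⟩ := link cB hA xA yA (fun z => by rw [hRmem]; tauto) dBC dAB.symm
      dAC.symm dB dC neB neC
    obtain ⟨E3, e3R, c3, t3, k3⟩ := link cC hB xB yB (fun z => by rw [hRmem]; tauto) dAC.symm
      dBC.symm dAB dC dA neC neA
    have d12 : Disjoint E1 E2 := Set.disjoint_left.2 fun e h h' =>
      hall ⟨e, e1R h, (k1 e h).1, (k1 e h).2, (k2 e h').2⟩
    have d13 : Disjoint E1 E3 := Set.disjoint_left.2 fun e h h' =>
      hall ⟨e, e1R h, (k1 e h).1, (k1 e h).2, (k3 e h').1⟩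
    have d23 : Disjoint E2 E3 := Set.disjoint_left.2 fun e h h' =>
      hall ⟨e, e2R h, (k3 e h').2, (k2 e h).1, (k2 e h).2⟩
    have un : ∀ {P Q E E' : Set W}, Disjoint P Q → Disjoint P R → Disjoint Q R → E ⊆ R → E' ⊆ R →
        Disjoint E E' → Disjoint (P ∪ E) (Q ∪ E') := by
      intro P Q E E' h1 h2 h3 h4 h5 h6
      rw [Set.disjoint_union_left, Set.disjoint_union_right, Set.disjoint_union_right]
      exact ⟨⟨h1, h2.mono_right h5⟩, (h3.mono_right h4).symm, h6⟩
    have nx : ∀ {T E : Set W}, E ⊆ R → Disjoint ((T \ {x, y}) ∪ E) {x} := by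
      intro T E hE
      rw [Set.disjoint_singleton_right]
      rintro (h | h)
      · exact h.2 Ψ
      · exact nA x (hE h) xA
    have ny : ∀ {T E : Set W}, E ⊆ R → Disjoint ((T \ {x, y}) ∪ E) {y} := by
      intro T E hE
      rw [Set.disjoint_singleton_right]
      rintro (h | h)
      · exact h.2 Ψ
      · exact nA y (hE h) yA
    exact hPl.k5 c1 c2 c3 (cn_singleton x) (cn_singleton y) (un dAB dA dB e1R e2R d12)
      (un dAC dA dC e1R e3R d13) (nx e1R) (ny e1R) (un dBC dB dC e2R e3R d23) (nx e2R) (ny e2R)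
      (nx e3R) (ny e3R) (sing hxyne)
      (t1.mono subset_rfl Set.subset_union_left) (t3.mono subset_rfl Set.subset_union_left).symm
      (txA.symm.mono Set.subset_union_left subset_rfl)
      (tyA.symm.mono Set.subset_union_left subset_rfl)
      (t2.mono subset_rfl Set.subset_union_left)
      (txB.symm.mono Set.subset_union_left subset_rfl)
      (tyB.symm.mono Set.subset_union_left subset_rfl)
      (txC.symm.mono Set.subset_union_left subset_rfl)
      (tyC.symm.mono Set.subset_union_left subset_rfl)
      ⟨x, rfl, y, rfl, hxy⟩

end Faces

section FacesCount

variable {W : Type*} {H : SimpleGraph W}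

theorem key_univ [Finite W] {φ : W → W → ZMod 2} (hsym : ∀ x y, φ x y = φ y x) (hTC : TC H)
    (h : ¬ Exa H φ Set.univ) : ∃ F, Fc H F ∧ ¬ Exa H φ F := by
  obtain ⟨X, -, hX, hne⟩ := nonexact_cyc hsym h
  by_cases hu : X = Set.univ
  · exfalso
    obtain ⟨v, hv, -, -⟩ := hX.third (Classical.choose (let ⟨k, c, _⟩ := hX; ⟨c 0, trivial⟩ :
      ∃ _ : W, True)) (Classical.choose (let ⟨k, c, _⟩ := hX; ⟨c 0, trivial⟩ : ∃ _ : W, True))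
    obtain ⟨x, hx, y, hy, hxy, h1, h2, h3⟩ := hX.nbrs hv
    obtain ⟨w, hw, hwx, hwy⟩ := hTC.deg3 (H.ne_of_adj h1) (H.ne_of_adj h2)
    rcases h3 w (hu ▸ Set.mem_univ w) hw with h | h
    · exact hwx h
    · exact hwy h
  · obtain ⟨p, hp⟩ := (Set.ne_univ_iff_exists_notMem X).1 hu
    obtain ⟨F, hF, -, hF'⟩ := key_face hsym hTC p (fun h => hne (h.mono (fun x hx e => hp (by
      rw [← (show x = p from e)]; exact hx))))
    exact ⟨F, hF, hF'⟩

theorem TC.cn_compl (hTC : TC H) (v : W) : Cn H {v}ᶜ := by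
  have := hTC.2 v v
  simpa using this

/-- Around a vertex, the faces link all neighbours. -/
theorem face_link [Finite W] (hTC : TC H) {v a b : W} {A : Set W} (ha : H.Adj v a) (haA : a ∈ A)
    (hb : H.Adj v b) (hbA : b ∉ A) : ∃ F, Fc H F ∧ v ∈ F ∧ ∃ x ∈ F, ∃ y ∈ F, H.Adj v x ∧ H.Adj v y ∧
      x ∈ A ∧ y ∉ A := by
  classical
  let φ : W → W → ZMod 2 := fun u w => if (u = v ∧ w ∈ A) ∨ (w = v ∧ u ∈ A) then 1 else 0
  have hsym : ∀ x y, φ x y = φ y x := by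
    intro x y
    simp only [φ]
    congr 1
    exact propext (by tauto)
  have hva := H.ne_of_adj ha
  have hvb := H.ne_of_adj hb
  have key : ∀ (F : Set W) (s : ZMod 2), (∀ x ∈ F, H.Adj v x → (x ∈ A ↔ s = 1)) → (s = 0 ∨ s = 1) →
      Exa H φ F := by
    intro F s hs h01
    refine ⟨fun x => if x = v then s else 0, ?_⟩
    intro x hx y hy hxy
    have hne := H.ne_of_adj hxy
    by_cases h1 : x = v
    · subst h1
      have hy' := hs y hy hxy
      rcases h01 with rfl | rfl
      · have : y ∉ A := by simpa using hy'
        simp [φ, this, hne.symm]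
      · have : y ∈ A := by simpa using hy'
        simp [φ, this, hne.symm]
    · by_cases h2 : y = v
      · subst h2
        have hx' := hs x hx hxy.symm
        rcases h01 with rfl | rfl
        · have : x ∉ A := by simpa using hx'
          simp [φ, this, h1]
        · have : x ∈ A := by simpa using hx'
          simp [φ, this, h1]
      · simp [φ, h1, h2]
  have hn : ¬ Exa H φ Set.univ := by
    rintro ⟨h, hh⟩
    have hconst : ∀ x ∈ ({v}ᶜ : Set W), h x = h a := by
      apply (hTC.cn_compl v).closed (X := {x | h x = h a}) ⟨a, hva.symm, rfl⟩
      intro x hx hxX y hy hxy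
      have := hh x trivial y trivial hxy
      have e : φ x y = 0 := by
        have hx' : x ≠ v := hx
        have hy' : y ≠ v := hy
        simp [φ, hx', hy']
      rw [e, show h x = h a from hxX] at this
      have h2 := CharTwo.add_self_eq_zero (h a)
      show h y = h a
      linear_combination -this - h2
    have e1 := hh v trivial a trivial ha
    have e2 := hh v trivial b trivial hb
    rw [hconst b hvb.symm, ← e1] at e2
    simp [φ, haA, hbA, hvb.symm] at e2
  obtain ⟨F, hF, hnF⟩ := key_univ hsym hTC hn
  refine ⟨F, hF, ?_⟩
  have hvF : v ∈ F := by
    by_contra hvF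
    apply hnF
    refine ⟨fun _ => 0, fun x hx y hy _ => ?_⟩
    have h1 : x ≠ v := fun e => hvF (e ▸ hx)
    have h2 : y ≠ v := fun e => hvF (e ▸ hy)
    simp [φ, h1, h2]
  refine ⟨hvF, ?_⟩
  obtain ⟨x, hx, y, hy, hxy, h1, h2, h3⟩ := hF.1.nbrs hvF
  by_cases hxA : x ∈ A <;> by_cases hyA : y ∈ A
  · refine absurd (key F 1 ?_ Ψ) hnF
    intro z hz hvz
    rcases h3 z hz hvz with rfl | rfl <;> simp [hxA, hyA]
  · exact ⟨x, hx, y, hy, h1, h2, hxA, hyA⟩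
  · exact ⟨y, hy, x, hx, h2, h1, hyA, hxA⟩
  · refine absurd (key F 0 ?_ Ψ) hnF
    intro z hz hvz
    rcases h3 z hz hvz with rfl | rfl <;> simp [hxA, hyA]

/-- Every edge lies on exactly two faces. -/
theorem face_two [Finite W] (hTC : TC H) (hPl : Pl H) {x y : W} (hxy : H.Adj x y) :
    ∃ A B, Fc H A ∧ Fc H B ∧ A ≠ B ∧ x ∈ A ∧ y ∈ A ∧ x ∈ B ∧ y ∈ B ∧
      ∀ C, Fc H C → x ∈ C → y ∈ C → C = A ∨ C = B := by
  obtain ⟨z, hz1, hz2, -⟩ := hTC.exists_ne x y y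
  obtain ⟨A, hA, xA, yA, -⟩ := face_avoid hTC hxy hz1 hz2
  obtain ⟨p, hpA, hp1, hp2⟩ := hA.1.third x y
  obtain ⟨B, hB, xB, yB, hpB⟩ := face_avoid hTC hxy hp1 hp2
  have hne : A ≠ B := fun e => hpB (e ▸ hpA)
  refine ⟨A, B, hA, hB, hne, xA, yA, xB, yB, ?_⟩
  intro C hC xC yC
  by_contra hcon
  push Not at hcon
  exact face_le_two hTC hPl hxy hA hB hC hne hcon.1.symm hcon.2.symm xA yA xB yB xC yC

end FacesCount

section Euler

variable {W : Type*} [Fintype W] {H : SimpleGraph W}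

open Classical in
/-- the faces as a finset -/
noncomputable def Fcs (H : SimpleGraph W) : Finset (Finset W) :=
  Finset.univ.filter fun F => Fc H (F : Set W)

theorem mem_Fcs {F : Finset W} : F ∈ Fcs H ↔ Fc H (F : Set W) := by
  classical
  simp [Fcs]

open Classical in
/-- cochain -/
noncomputable def coch (H : SimpleGraph W) (f : H.edgeSet → ZMod 2) (u v : W) : ZMod 2 :=
  if h : H.Adj u v then f ⟨s(u, v), h⟩ else 0

theorem coch_symm (f : H.edgeSet → ZMod 2) (u v : W) : coch H f u v = coch H f v u := by
  unfold coch
  by_cases h : H.Adj u v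
  · rw [dif_pos h, dif_pos h.symm]
    congr 2
    exact Sym2.eq_swap
  · rw [dif_neg h, dif_neg (fun h' => h h'.symm)]

open Classical in
theorem face_sum {F : Set W} (hF : IndCyc H F) (f : H.edgeSet → ZMod 2)
    (hs : ∑ e : H.edgeSet, (if ∀ x ∈ e.1, x ∈ F then f e else 0) = 0) : Exa H (coch H f) F := by
  obtain ⟨k, c, hc, rfl⟩ := hF
  have h3 := hc.three
  set φ := coch H f with hφ
  -- the sum around the cycle
  have adj1 : ∀ i, i + 1 < k → H.Adj (c i) (c (i + 1)) := fun i hi =>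
    (hc.adj i (i + 1) Ω hi).2 (Or.inl rfl)
  have adj2 : H.Adj (c (k - 1)) (c 0) :=
    ((hc.adj 0 (k - 1) Ω Ω).2 (Or.inr ⟨rfl, by omega⟩)).symm
  have inj : ∀ i j, i < k → j < k → c i = c j → i = j := by
    intro i j hi hj e
    rcases lt_trichotomy i j with h | h | h
    · exact absurd e (hc.inj i j h hj)
    · exact h
    · exact absurd e.symm (hc.inj j i h hi)
  let nx : ℕ → ℕ := fun i => if i + 1 < k then i + 1 else 0
  have adjn : ∀ i, i < k → H.Adj (c i) (c (nx i)) := by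
    intro i hi
    simp only [nx]
    split_ifs with h
    · exact adj1 i h
    · have : i = k - 1 := by omega
      rw [this]; exact adj2
  have hnx : ∀ i, i < k → nx i < k := by
    intro i hi; simp only [nx]; split_ifs <;> omega
  have cyc : ∑ i ∈ Finset.range k, φ (c i) (c (nx i)) = 0 := by
    rw [← hs, ← Finset.sum_filter]
    refine Finset.sum_bij (fun i hi => (⟨s(c i, c (nx i)), adjn i (Finset.mem_range.1 hi)⟩ :
      H.edgeSet)) ?_ ?_ ?_ ?_
    · intro i hi
      have hi' := Finset.mem_range.1 hi
      simp only [Finset.mem_filter, Finset.mem_univ, true_and, Sym2.mem_iff]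
      rintro x (rfl | rfl)
      · exact ⟨i, hi', rfl⟩
      · exact ⟨nx i, hnx i hi', rfl⟩
    · intro i hi j hj e
      have hi' := Finset.mem_range.1 hi
      have hj' := Finset.mem_range.1 hj
      have e' := congrArg Subtype.val e
      simp only [Sym2.eq_iff] at e'
      rcases e' with ⟨e1, -⟩ | ⟨e1, e2⟩
      · exact inj i j hi' hj' e1
      · have a1 := inj _ _ hi' (hnx j hj') e1
        have a2 := inj _ _ (hnx i hi') hj' e2
        simp only [nx] at a1 a2
        split_ifs at a1 a2 <;> omega
    · rintro ⟨e, he⟩ hmem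
      induction e using Sym2.ind with
      | _ x y =>
        simp only [Finset.mem_filter, Finset.mem_univ, true_and, Sym2.mem_iff] at hmem
        obtain ⟨i, hi, rfl⟩ := hmem x (Or.inl rfl)
        obtain ⟨j, hj, rfl⟩ := hmem y (Or.inr rfl)
        have hi' : i < k := hi
        have hj' : j < k := hj
        have he' : H.Adj (c i) (c j) := he
        have gen : ∀ i j, i < j → j < k → H.Adj (c i) (c j) →
            ∃ m < k, s(c m, c (nx m)) = s(c i, c j) := by
          intro i j hij hj h
          rcases (hc.adj i j hij hj).1 h with rfl | ⟨rfl, h⟩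
          · exact ⟨i, by omega, by simp only [nx]; rw [if_pos hj]⟩
          · refine ⟨j, hj, ?_⟩
            simp only [nx]; rw [if_neg Ω]; exact Sym2.eq_swap
        have hne : i ≠ j := fun e => H.loopless.irrefl _ (e ▸ he')
        obtain ⟨m, hm, hme⟩ : ∃ m < k, s(c m, c (nx m)) = s(c i, c j) := by
          rcases lt_or_gt_of_ne hne with h | h
          · exact gen i j h hj' he'
          · obtain ⟨m, hm, e⟩ := gen j i h hi' he'.symm
            exact ⟨m, hm, e.trans Sym2.eq_swap⟩
        exact ⟨m, Finset.mem_range.2 hm, Subtype.ext hme⟩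
    · intro i hi
      simp only [hφ, coch]
      rw [dif_pos (adjn i (Finset.mem_range.1 hi))]
  -- the potential
  let P : ℕ → ZMod 2 := fun i => ∑ j ∈ Finset.range i, φ (c j) (c (j + 1))
  let h : W → ZMod 2 := fun x => if hx : ∃ i, i < k ∧ c i = x then P hx.choose else 0
  have hh : ∀ i, i < k → h (c i) = P i := by
    intro i hi
    have hx : ∃ j, j < k ∧ c j = c i := ⟨i, hi, rfl⟩
    simp only [h]
    rw [dif_pos hx]
    rw [inj _ _ hx.choose_spec.1 hi hx.choose_spec.2]
  have step : ∀ i, i + 1 < k → φ (c i) (c (i + 1)) = h (c i) + h (c (i + 1)) := by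
    intro i hi
    rw [hh i Ω, hh _ hi]
    simp only [P]
    rw [Finset.sum_range_succ, ← add_assoc, CharTwo.add_self_eq_zero, zero_add]
  have last : φ (c (k - 1)) (c 0) = h (c (k - 1)) + h (c 0) := by
    rw [hh _ Ω, hh 0 Ω]
    have e : k = (k - 1) + 1 := by omega
    rw [e, Finset.sum_range_succ] at cyc
    have e1 : ∑ i ∈ Finset.range (k - 1), φ (c i) (c (nx i)) = P (k - 1) := by
      apply Finset.sum_congr rfl
      intro i hi
      have := Finset.mem_range.1 hi
      simp only [nx]; rw [if_pos Ω]
    have e2 : nx (k - 1) = 0 := by simp only [nx]; rw [if_neg Ω]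
    rw [e1, e2] at cyc
    have : P 0 = 0 := by simp [P]
    rw [this, add_zero]
    have h2 := CharTwo.add_self_eq_zero (P (k - 1))
    linear_combination cyc - h2
  have gen : ∀ i j, i < j → j < k → H.Adj (c i) (c j) → φ (c i) (c j) = h (c i) + h (c j) := by
    intro i j hij hj hadj
    rcases (hc.adj i j hij hj).1 hadj with rfl | ⟨rfl, h'⟩
    · exact step i hj
    · have : j = k - 1 := by omega
      rw [this, hφ, coch_symm, ← hφ, last, add_comm]
  refine ⟨h, ?_⟩
  rintro _ ⟨i, hi, rfl⟩ _ ⟨j, hj, rfl⟩ hadj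
  have hi' : i < k := hi
  have hj' : j < k := hj
  have hne : i ≠ j := fun e => H.loopless.irrefl _ (e ▸ hadj)
  rcases lt_or_gt_of_ne hne with h' | h'
  · exact gen i j h' hj' hadj
  · rw [hφ, coch_symm, ← hφ, gen j i h' hi' hadj.symm, add_comm]

theorem face_two_card (hTC : TC H) (hPl : Pl H) {x y : W} (hxy : H.Adj x y) :
    ∃ A B, A ≠ B ∧ ∀ C, (C ∈ Fcs H ∧ x ∈ C ∧ y ∈ C) ↔ C = A ∨ C = B := by
  classical
  obtain ⟨A, B, hA, hB, hne, xA, yA, xB, yB, h⟩ := face_two hTC hPl hxy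
  refine ⟨A.toFinset, B.toFinset, fun e => hne (Set.toFinset_inj.1 e), ?_⟩
  intro C
  rw [mem_Fcs]
  constructor
  · rintro ⟨h1, h2, h3⟩
    rcases h C h1 h2 h3 with h | h
    · left; ext z; simp [← h]
    · right; ext z; simp [← h]
  · rintro (rfl | rfl) <;> simp [*]

open Classical in
theorem euler (hTC : TC H) (hPl : Pl H) :
    H.edgeSet.ncard + 2 ≤ Fintype.card W + (Fcs H).card := by
  classical
  let T : (H.edgeSet → ZMod 2) →ₗ[ZMod 2] (Fcs H → ZMod 2) :=
    { toFun := fun f F => ∑ e : H.edgeSet, (if ∀ x ∈ e.1, x ∈ (F.1 : Set W) then f e else 0)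
      map_add' := by
        intro f g; funext F
        simp only [Pi.add_apply, ← Finset.sum_add_distrib]
        refine Finset.sum_congr rfl fun e _ => ?_
        split_ifs <;> simp
      map_smul' := by
        intro a f; funext F
        simp only [Pi.smul_apply, smul_eq_mul, Finset.mul_sum, RingHom.id_apply]
        refine Finset.sum_congr rfl fun e _ => ?_
        split_ifs <;> simp }
  let δ : (W → ZMod 2) →ₗ[ZMod 2] (H.edgeSet → ZMod 2) :=
    { toFun := fun h e => Sym2.lift ⟨fun x y => h x + h y, fun x y => add_comm _ _⟩ e.1
      map_add' := by
        intro f g; funext ⟨e, he⟩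
        induction e using Sym2.ind with
        | _ x y => simp; ring
      map_smul' := by
        intro a f; funext ⟨e, he⟩
        induction e using Sym2.ind with
        | _ x y => simp; ring }
  let Sg : (Fcs H → ZMod 2) →ₗ[ZMod 2] ZMod 2 := ∑ F, LinearMap.proj F
  obtain ⟨w0, -, -, -⟩ : ∃ z : W, z = z ∧ True ∧ True := by
    have : 0 < Nat.card W := by have := hTC.1; omega
    obtain ⟨z⟩ := (Nat.card_pos_iff.1 this).1
    exact ⟨z, rfl, trivial, trivial⟩
  have hk : LinearMap.ker T ≤ LinearMap.range δ := by
    intro f hf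
    have hE : Exa H (coch H f) Set.univ := by
      by_contra hn
      obtain ⟨F, hF, hnF⟩ := key_univ (coch_symm f) hTC hn
      apply hnF
      apply face_sum hF.1
      have hm : F.toFinset ∈ Fcs H := by rw [mem_Fcs]; simpa using hF
      have := congrFun (LinearMap.mem_ker.1 hf) ⟨F.toFinset, hm⟩
      simpa [T] using this
    obtain ⟨h, hh⟩ := hE
    refine ⟨h, ?_⟩
    funext ⟨e, he⟩
    induction e using Sym2.ind with
    | _ x y =>
      have he' : H.Adj x y := he
      have := hh x trivial y trivial he'
      simp only [coch, dif_pos he'] at this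
      simp [δ, this]
  have hδ : Module.finrank (ZMod 2) (LinearMap.range δ) + 1 ≤ Fintype.card W := by
    have h1 := LinearMap.finrank_range_add_finrank_ker δ
    rw [Module.finrank_pi] at h1
    have h2 : 0 < Module.finrank (ZMod 2) (LinearMap.ker δ) := by
      rw [Module.finrank_pos_iff_exists_ne_zero]
      refine ⟨⟨fun _ => 1, ?_⟩, ?_⟩
      · rw [LinearMap.mem_ker]
        funext ⟨e, he⟩
        induction e using Sym2.ind with
        | _ x y => exact CharTwo.add_self_eq_zero (1 : ZMod 2)
      · intro h
        have := congrFun (congrArg Subtype.val h) w0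
        simp at this
    omega
  have hSg : LinearMap.range T ≤ LinearMap.ker Sg := by
    rintro _ ⟨f, rfl⟩
    rw [LinearMap.mem_ker]
    simp only [Sg, LinearMap.sum_apply, LinearMap.proj_apply]
    show ∑ F : Fcs H, ∑ e : H.edgeSet, (if ∀ x ∈ e.1, x ∈ (F.1 : Set W) then f e else 0) = 0
    rw [Finset.sum_comm]
    apply Finset.sum_eq_zero
    rintro ⟨e, he⟩ -
    induction e using Sym2.ind with
    | _ x y =>
      have he' : H.Adj x y := he
      obtain ⟨A, B, hne, hAB⟩ := face_two_card hTC hPl he'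
      have hA := (hAB A).2 (Or.inl rfl)
      have hB := (hAB B).2 (Or.inr rfl)
      rw [← Finset.sum_filter]
      have : (Finset.univ.filter fun F : Fcs H => ∀ z ∈ s(x, y), z ∈ (F.1 : Set W)) =
          {⟨A, hA.1⟩, ⟨B, hB.1⟩} := by
        ext ⟨F, hF⟩
        simp only [Finset.mem_filter, Finset.mem_univ, true_and, Sym2.mem_iff, Finset.mem_insert,
          Finset.mem_singleton, Subtype.mk.injEq]
        rw [← hAB F]
        constructor
        · intro h; exact ⟨hF, h x (Or.inl rfl), h y (Or.inr rfl)⟩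
        · rintro ⟨_, h1, h2⟩ z (rfl | rfl) <;> assumption
      rw [this, Finset.sum_pair (by simpa using hne)]
      exact CharTwo.add_self_eq_zero _
  have hf : 1 ≤ (Fcs H).card := by
    obtain ⟨w, hw, -, -⟩ := hTC.exists_ne w0 w0 w0
    obtain ⟨y, hy, -, -⟩ := hTC.deg3 hw hw
    obtain ⟨A, B, hne, hAB⟩ := face_two_card hTC hPl hy
    exact Finset.card_pos.2 ⟨A, ((hAB A).2 (Or.inl rfl)).1⟩
  have hK : Module.finrank (ZMod 2) (LinearMap.ker Sg) + 1 ≤ (Fcs H).card := by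
    have h1 := LinearMap.finrank_range_add_finrank_ker Sg
    rw [Module.finrank_pi, Fintype.card_coe] at h1
    have h2 : 0 < Module.finrank (ZMod 2) (LinearMap.range Sg) := by
      rw [Module.finrank_pos_iff_exists_ne_zero]
      obtain ⟨F, hF⟩ := Finset.card_pos.1 hf
      refine ⟨⟨Sg (Pi.single ⟨F, hF⟩ 1), ⟨_, rfl⟩⟩, ?_⟩
      intro h
      have := congrArg Subtype.val h
      simp [Sg, LinearMap.sum_apply, Finset.sum_pi_single] at this
    omega
  have h1 := LinearMap.finrank_range_add_finrank_ker T
  rw [Module.finrank_pi] at h1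
  have h2 := Submodule.finrank_mono hk
  have h3 := Submodule.finrank_mono hSg
  have h4 : H.edgeSet.ncard = Fintype.card H.edgeSet := by
    rw [← Nat.card_coe_set_eq, Nat.card_eq_fintype_card]
  omega

end Euler

section Local

open Classical

variable {W : Type*} [Fintype W]

/-- `F` contains a marked edge: a virtual edge (in `H` not `R`) or an edge of `M`. -/
def Mk (H R M : SimpleGraph W) (F : Finset W) : Prop :=
  ∃ x ∈ F, ∃ y ∈ F, H.Adj x y ∧ (¬ R.Adj x y ∨ M.Adj x y)

/-- unmarked faces of length `k` -/
def Sf (H R M : SimpleGraph W) (k : ℕ) (F : Finset W) : Prop :=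
  F ∈ Fcs H ∧ ¬ Mk H R M F ∧ F.card = k

/-- The standing assumptions for the counting part. -/
structure Ctx (H R M : SimpleGraph W) : Prop where
  tc : TC H
  pl : Pl H
  rh : R ≤ H
  mr : M ≤ R
  free : ¬ HasTheta6 R
  long : ∀ F ∈ Fcs H, Mk H R M F → 12 ≤ 2 * F.card +
    ((F ×ˢ F).filter fun p => H.Adj p.1 p.2 ∧ ¬ R.Adj p.1 p.2).card
  six : (∃ F, Sf H R M 3 F) → 6 ≤ Fintype.card W

/-- triangular faces -/
def Tri (H R M : SimpleGraph W) (x y z : W) : Prop := Sf H R M 3 {x, y, z}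

variable {H R M : SimpleGraph W}

theorem Tri.rot {x y z : W} (h : Tri H R M x y z) : Tri H R M y z x := by
  unfold Tri at *
  convert h using 1
  ext; simp; tauto

theorem Tri.swap {x y z : W} (h : Tri H R M x y z) : Tri H R M y x z := by
  unfold Tri at *
  convert h using 1
  ext; simp; tauto

theorem Tri.swap' {x y z : W} (h : Tri H R M x y z) : Tri H R M x z y := h.rot.swap.rot.rot

theorem Tri.ne {x y z : W} (h : Tri H R M x y z) : x ≠ y := by
  rintro rfl
  have := h.2.2
  have h2 := Finset.card_le_two (a := x) (b := z)
  simp at this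
  omega

theorem Sf.radj {k : ℕ} {F : Finset W} (h : Sf H R M k F) {x y : W} (hx : x ∈ F) (hy : y ∈ F)
    (hxy : H.Adj x y) : R.Adj x y := by
  by_contra hn
  exact h.2.1 ⟨x, hx, y, hy, hxy, Or.inl hn⟩

/-- in a triangle (IndCyc on three vertices) all pairs are adjacent -/
theorem Tri.hadj {x y z : W} (h : Tri H R M x y z) : H.Adj x y := by
  obtain ⟨a, ha, b, hb, hab, h1, h2, h3⟩ := (mem_Fcs.1 h.1).1.nbrs (v := x) Ψ
  have := H.ne_of_adj h1
  have := H.ne_of_adj h2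
  simp at ha hb
  grind

theorem Tri.radj {x y z : W} (h : Tri H R M x y z) : R.Adj x y := by
  exact Sf.radj h Ψ Ψ h.hadj

/-- faces through an edge: at most two -/
theorem Ctx.two (hc : Ctx H R M) {x y : W} (hxy : H.Adj x y) {A B C : Finset W}
    (hA : A ∈ Fcs H) (hB : B ∈ Fcs H) (hC : C ∈ Fcs H) (hAB : A ≠ B)
    (xA : x ∈ A) (yA : y ∈ A) (xB : x ∈ B) (yB : y ∈ B) (xC : x ∈ C) (yC : y ∈ C) :
    C = A ∨ C = B := by
  obtain ⟨P, Q, hPQ, h⟩ := face_two_card hc.tc hc.pl hxy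
  have h1 := (h A).1 ⟨hA, xA, yA⟩
  have h2 := (h B).1 ⟨hB, xB, yB⟩
  have h3 := (h C).1 ⟨hC, xC, yC⟩
  grind

/-- another face through an edge -/
theorem Ctx.other (hc : Ctx H R M) {x y : W} (hxy : H.Adj x y) (A : Finset W) :
    ∃ B ∈ Fcs H, x ∈ B ∧ y ∈ B ∧ B ≠ A := by
  obtain ⟨P, Q, hPQ, h⟩ := face_two_card hc.tc hc.pl hxy
  have h1 := (h P).2 (Or.inl rfl)
  have h2 := (h Q).2 (Or.inr rfl)
  by_cases e : P = A
  · exact ⟨Q, h2.1, h2.2.1, h2.2.2, fun e' => hPQ (e.trans e'.symm)⟩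
  · exact ⟨P, h1.1, h1.2.1, h1.2.2, e⟩

theorem fc_inter (hc : Ctx H R M) {A B : Finset W} (hA : A ∈ Fcs H) (hB : B ∈ Fcs H) (hAB : A ≠ B)
    {x y z : W} (xA : x ∈ A) (xB : x ∈ B) (yA : y ∈ A) (yB : y ∈ B) (hxy : x ≠ y) (zA : z ∈ A)
    (zB : z ∈ B) : z = x ∨ z = y :=
  face_inter hc.tc hc.pl (mem_Fcs.1 hA) (mem_Fcs.1 hB) (fun e => hAB (Finset.coe_injective e))
    xA xB yA yB hxy zA zB

theorem Tri.eq (hc : Ctx H R M) {x y z : W} (h : Tri H R M x y z) {F : Finset W} (hF : F ∈ Fcs H)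
    (hx : x ∈ F) (hy : y ∈ F) (hz : z ∈ F) : Sf H R M 3 F := by
  by_contra hn
  have hne : F ≠ {x, y, z} := fun e => hn (e ▸ h)
  have := fc_inter hc hF h.1 hne (x := x) (y := y) (z := z) hx Ψ hy Ψ h.ne hz
    Ψ
  rcases this with e | e
  · exact h.rot.rot.ne e
  · exact h.rot.ne e.symm

/-- unmarked triangular face as `Tri` -/
theorem Sf.tri {F : Finset W} (h : Sf H R M 3 F) {x y : W} (hx : x ∈ F) (hy : y ∈ F)
    (hxy : x ≠ y) : ∃ z, Tri H R M x y z ∧ F = {x, y, z} := by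
  have h3 := h.2.2
  obtain ⟨z, hz⟩ : ∃ z, F = {x, y, z} := by
    obtain ⟨a, b, c, h1, h2, h3, rfl⟩ := Finset.card_eq_three.1 h3
    simp at hx hy
    rcases hx with rfl | rfl | rfl <;> rcases hy with rfl | rfl | rfl <;> first
      | exact absurd rfl hxy
      | exact ⟨a, by ext; simp <;> tauto⟩
      | exact ⟨b, by ext; simp <;> tauto⟩
      | exact ⟨c, by ext; simp <;> tauto⟩
  refine ⟨z, ?_, hz⟩
  unfold Tri
  rw [← hz]; exact h

/-- neighbours within a face at `v` are at most two -/
theorem fc_nb {F : Finset W} (hF : F ∈ Fcs H) {v a b z : W} (hv : v ∈ F) (ha : a ∈ F) (hb : b ∈ F)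
    (hz : z ∈ F) (hab : a ≠ b) (h1 : H.Adj v a) (h2 : H.Adj v b) (h3 : H.Adj v z) :
    z = a ∨ z = b := by
  obtain ⟨p, hp, q, hq, hpq, e1, e2, h⟩ := (mem_Fcs.1 hF).1.nbrs hv
  have := h a ha h1
  have := h b hb h2
  have := h z hz h3
  grind

/-- two triangles on an edge: uniqueness -/
theorem Tri.uniq (hc : Ctx H R M) {v x p q : W} (h1 : Tri H R M v x p) (h2 : Tri H R M v x q)
    (hpq : p ≠ q) {F : Finset W} (hF : F ∈ Fcs H) (hv : v ∈ F) (hx : x ∈ F) :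
    Sf H R M 3 F ∧ (p ∈ F ∨ q ∈ F) ∧ ∀ z ∈ F, z = v ∨ z = x ∨ z = p ∨ z = q := by
  have hne : ({v, x, p} : Finset W) ≠ {v, x, q} := by
    intro e
    have : p ∈ ({v, x, q} : Finset W) := by rw [← e]; simp
    simp at this
    rcases this with e | e | e
    · exact h1.rot.rot.ne e
    · exact h1.rot.ne e.symm
    · exact hpq e
  rcases hc.two h1.hadj h1.1 h2.1 hF hne Ψ Ψ Ψ Ψ hv hx with e | e
  · subst e; exact ⟨h1, by simp, by simp⟩
  · subst e; exact ⟨h2, by simp, by simp⟩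

/-- closed rotation -/
theorem closed_nb (hc : Ctx H R M) {v a : W} {A : Set W} (ha : a ∈ A) (hva : H.Adj v a)
    (h : ∀ x ∈ A, ∃ p ∈ A, ∃ q ∈ A, p ≠ q ∧ Tri H R M v x p ∧ Tri H R M v x q) :
    ∀ z, H.Adj v z → z ∈ A := by
  intro z hz
  by_contra hn
  obtain ⟨F, hF, hvF, x, hx, y, hy, hvx, hvy, hxA, hyA⟩ := face_link hc.tc hva ha hz hn
  obtain ⟨p, hp, q, hq, hpq, t1, t2⟩ := h x hxA
  have hF' : F.toFinset ∈ Fcs H := by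
    rw [mem_Fcs]; simpa using hF
  obtain ⟨-, -, h3⟩ := Tri.uniq hc t1 t2 hpq hF' (by simpa using hvF) (by simpa using hx)
  rcases h3 y (by simpa using hy) with rfl | rfl | rfl | rfl
  · exact H.loopless.irrefl _ hvy
  · exact hyA hxA
  · exact hyA hp
  · exact hyA hq

/-- no small closed pockets -/
theorem five (hc : Ctx H R M) (h6 : 6 ≤ Fintype.card W) {a b c s t : W} (hs : a ≠ s) (ht : a ≠ t)
    (ha : ∀ z, H.Adj a z → z = a ∨ z = b ∨ z = c ∨ z = s ∨ z = t)
    (hb : ∀ z, H.Adj b z → z = a ∨ z = b ∨ z = c ∨ z = s ∨ z = t)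
    (hd : ∀ z, H.Adj c z → z = a ∨ z = b ∨ z = c ∨ z = s ∨ z = t) : False := by
  have := (hc.tc.2 s t).closed (X := {a, b, c}) ⟨a, by simp [hs, ht], by simp⟩ (by
    rintro x hx hxX y hy hxy
    simp at hx hxX hy ⊢
    rcases hxX with rfl | rfl | rfl
    · have := ha y hxy; tauto
    · have := hb y hxy; tauto
    · have := hd y hxy; tauto)
  have hu : (Finset.univ : Finset W) ⊆ {a, b, c, s, t} := by
    intro z _
    by_cases hz : z = s ∨ z = t
    · simp; tauto
    · have := this (show z ∈ ({s, t} : Set W)ᶜ by simpa using hz)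
      simp at this ⊢; tauto
  have h5 : ({a, b, c, s, t} : Finset W).card ≤ 5 := Finset.card_le_five
  have := Finset.card_le_card hu
  rw [Finset.card_univ] at this
  omega

theorem Tri.six (hc : Ctx H R M) {x y z : W} (h : Tri H R M x y z) : 6 ≤ Fintype.card W :=
  hc.six ⟨_, h⟩

/-- quadrilateral faces -/
def Q4 (H R M : SimpleGraph W) (x y p r : W) : Prop :=
  Sf H R M 4 {x, y, p, r} ∧ H.Adj x y ∧ H.Adj y p ∧ H.Adj p r ∧ H.Adj r x ∧ ¬ H.Adj x p ∧
    ¬ H.Adj y r ∧ x ≠ p ∧ y ≠ r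

/-- an edge on a big face -/
def Bg (H R M : SimpleGraph W) (x y : W) : Prop :=
  ∃ F ∈ Fcs H, x ∈ F ∧ y ∈ F ∧ (Mk H R M F ∨ 6 ≤ F.card)

theorem ICyc.card {k : ℕ} {c : ℕ → W} (hc : ICyc H k c) {F : Finset W}
    (hF : (F : Set W) = c '' Set.Iio k) : F.card = k := by
  have : F = (Finset.range k).image c := by
    apply Finset.coe_injective
    rw [hF]; simp
  rw [this, Finset.card_image_of_injOn]
  · simp
  · intro i hi j hj e
    simp at hi hj
    rcases lt_trichotomy i j with h | h | h
    · exact absurd e (hc.inj i j h hj)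
    · exact h
    · exact absurd e.symm (hc.inj j i h hi)

/-- cyclic listing of a face starting with a given edge -/
theorem fc_list {F : Finset W} (hF : F ∈ Fcs H) {x y : W} (hx : x ∈ F) (hy : y ∈ F)
    (hxy : H.Adj x y) : ∃ c, ICyc H F.card c ∧ (F : Set W) = c '' Set.Iio F.card ∧ c 0 = x ∧
      c 1 = y := by
  obtain ⟨k, c, hc, hFc, h0⟩ := (mem_Fcs.1 hF).1.rot hx
  have hk := hc.card hFc
  subst hk
  have h3 := hc.three
  have hy' : y ∈ (F : Set W) := hy
  rw [hFc] at hy'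
  obtain ⟨j, hj, rfl⟩ := hy'
  have hj' : j < F.card := hj
  subst h0
  have hj0 : j ≠ 0 := by rintro rfl; exact H.loopless.irrefl _ hxy
  rcases (hc.adj 0 j Ω hj').1 hxy with h | ⟨-, h⟩
  · simp at h; subst h
    exact ⟨c, hc, hFc, rfl, rfl⟩
  · -- reverse
    refine ⟨fun i => if i = 0 then c 0 else c (F.card - i), ⟨h3, ?_, ?_⟩, ?_, ?_, ?_⟩
    · intro i l hil hl
      beta_reduce
      rw [if_neg (show l ≠ 0 by omega)]
      split_ifs with h0
      · exact hc.inj _ _ Ω Ω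
      · exact (hc.inj _ _ Ω Ω).symm
    · intro i l hil hl
      beta_reduce
      rw [if_neg (show l ≠ 0 by omega)]
      split_ifs with h0
      · rw [hc.adj _ _ Ω Ω]; omega
      · rw [H.adj_comm, hc.adj _ _ Ω Ω]; omega
    · rw [hFc]
      ext z
      constructor
      · rintro ⟨i, hi, rfl⟩
        have hi' : i < F.card := hi
        by_cases h0 : i = 0
        · exact ⟨0, show 0 < F.card by omega, by simp [h0]⟩
        · refine ⟨F.card - i, show F.card - i < F.card by omega, ?_⟩
          beta_reduce
          rw [if_neg Ω]
          congr 1; omega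
      · rintro ⟨i, hi, rfl⟩
        have hi' : i < F.card := hi
        beta_reduce
        split_ifs with h0
        · exact ⟨0, show 0 < F.card by omega, rfl⟩
        · exact ⟨F.card - i, show F.card - i < F.card by omega, rfl⟩
    · simp
    · simp; congr 1; omega

theorem Sf.q4 {F : Finset W} (h : Sf H R M 4 F) {x y : W} (hx : x ∈ F) (hy : y ∈ F)
    (hxy : H.Adj x y) : ∃ p r, Q4 H R M x y p r ∧ F = {x, y, p, r} := by
  obtain ⟨c, hc, hF, rfl, rfl⟩ := fc_list h.1 hx hy hxy
  rw [h.2.2] at hc hF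
  have e : F = {c 0, c 1, c 2, c 3} := by
    apply Finset.coe_injective
    rw [hF]
    ext z
    simp only [Set.mem_image, Set.mem_Iio, Finset.coe_insert, Finset.coe_singleton,
      Set.mem_insert_iff, Set.mem_singleton_iff]
    constructor
    · rintro ⟨i, hi, rfl⟩
      interval_cases i <;> simp
    · rintro (rfl | rfl | rfl | rfl)
      exacts [⟨0, by simp⟩, ⟨1, by simp⟩, ⟨2, by simp⟩, ⟨3, by simp⟩]
  refine ⟨c 2, c 3, ⟨e ▸ h, hxy, ?_, ?_, ?_, ?_, ?_, ?_, ?_⟩, e⟩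
  · rw [hc.adj _ _ Ω Ω]; omega
  · rw [hc.adj _ _ Ω Ω]; omega
  · rw [H.adj_comm, hc.adj _ _ Ω Ω]; omega
  · rw [hc.adj _ _ Ω Ω]; omega
  · rw [hc.adj _ _ Ω Ω]; omega
  · exact hc.inj _ _ Ω Ω
  · exact hc.inj _ _ Ω Ω

/-- The edge of a triangle: the other face is a triangle, a quadrilateral or big. -/
theorem Tri.cases (hc : Ctx H R M) {x y z : W} (h : Tri H R M x y z) :
    (∃ w, w ≠ z ∧ Tri H R M x y w) ∨
    (∃ p r, Q4 H R M x y p r ∧ z ≠ p ∧ z ≠ r) ∨ Bg H R M x y := by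
  obtain ⟨F, hF, hx, hy, hne⟩ := hc.other h.hadj {x, y, z}
  by_cases hb : Mk H R M F ∨ 6 ≤ F.card
  · exact Or.inr (Or.inr ⟨F, hF, hx, hy, hb⟩)
  push Not at hb
  have hz : z ∉ F := by
    intro hz
    rcases fc_inter hc hF h.1 hne (x := x) (y := y) hx Ψ hy Ψ h.ne hz Ψ
      with e | e
    · exact h.rot.rot.ne e
    · exact h.rot.ne e.symm
  obtain ⟨c, hcy, hFc, h0, h1⟩ := fc_list hF hx hy h.hadj
  have h3 := hcy.three
  have hcard : F.card = 3 ∨ F.card = 4 ∨ F.card = 5 := by omega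
  rcases hcard with h3 | h4 | h5
  · left
    obtain ⟨w, hw, e⟩ := Sf.tri ⟨hF, hb.1, h3⟩ hx hy h.ne
    refine ⟨w, ?_, hw⟩
    rintro rfl
    exact hne e
  · right; left
    obtain ⟨p, r, hq, e⟩ := Sf.q4 ⟨hF, hb.1, h4⟩ hx hy h.hadj
    refine ⟨p, r, hq, ?_, ?_⟩
    · rintro rfl; apply hz; rw [e]; simp
    · rintro rfl; apply hz; rw [e]; simp
  · exfalso
    rw [h5] at hcy hFc
    have S : Sf H R M 5 F := ⟨hF, hb.1, h5⟩
    have m : ∀ i, i < 5 → c i ∈ F := by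
      intro i hi
      have : c i ∈ (F : Set W) := by rw [hFc]; exact ⟨i, hi, rfl⟩
      exact this
    have r : ∀ i j, i < j → j < 5 → (j = i + 1 ∨ (i = 0 ∧ j + 1 = 5)) → R.Adj (c i) (c j) :=
      fun i j hij hj hh => S.radj (m i Ω) (m j hj) ((hcy.adj i j hij hj).2 hh)
    subst h0 h1
    have zn : ∀ i, i < 5 → z ≠ c i := by
      rintro i hi rfl; exact hz (m i hi)
    have inj := hcy.inj
    refine hc.free (theta_of (a := c 0) (b := z) (c := c 1) (d := c 2) (e := c 3) (f := c 4)
      h.rot.rot.radj.symm h.rot.radj.symm (r 1 2 Ω Ω Ω)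
      (r 2 3 Ω Ω Ω) (r 3 4 Ω Ω Ω)
      (r 0 4 Ω Ω Ω).symm ?_ (Or.inl h.radj))
    have := zn 0 Ω
    have := zn 1 Ω
    have := zn 2 Ω
    have := zn 3 Ω
    have := zn 4 Ω
    have := inj 0 1 Ω Ω
    have := inj 0 2 Ω Ω
    have := inj 0 3 Ω Ω
    have := inj 0 4 Ω Ω
    have := inj 1 2 Ω Ω
    have := inj 1 3 Ω Ω
    have := inj 1 4 Ω Ω
    have := inj 2 3 Ω Ω
    have := inj 2 4 Ω Ω
    have := inj 3 4 Ω Ω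
    simp; grind

/-- two quadrilaterals cannot share an edge -/
theorem q4q4 (hc : Ctx H R M) {x y : W} {A B : Finset W} (hA : Sf H R M 4 A) (hB : Sf H R M 4 B)
    (hAB : A ≠ B) (xA : x ∈ A) (yA : y ∈ A) (xB : x ∈ B) (yB : y ∈ B) (hxy : H.Adj x y) : False := by
  obtain ⟨p, r, hq, e⟩ := hA.q4 xA yA hxy
  obtain ⟨p', r', hq', e'⟩ := hB.q4 xB yB hxy
  have I : ∀ z, z ∈ A → z ∈ B → z = x ∨ z = y := fun z h1 h2 =>
    fc_inter hc hA.1 hB.1 hAB xA xB yA yB (H.ne_of_adj hxy) h1 h2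
  have pA : p ∈ A := by rw [e]; simp
  have rA : r ∈ A := by rw [e]; simp
  have pB : p' ∈ B := by rw [e']; simp
  have rB : r' ∈ B := by rw [e']; simp
  have i1 := I p pA
  have i2 := I r rA
  obtain ⟨-, -, a1, a2, a3, -, -, n1, n2⟩ := hq
  obtain ⟨-, -, b1, b2, b3, -, -, m1, m2⟩ := hq'
  have := H.ne_of_adj a1
  have := H.ne_of_adj a2
  have := H.ne_of_adj a3
  have := H.ne_of_adj b1
  have := H.ne_of_adj b2
  have := H.ne_of_adj b3
  have := H.ne_of_adj hxy
  refine hc.free (theta_of (a := x) (b := r) (c := p) (d := y) (e := p') (f := r')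
    (hA.radj rA xA a3).symm (hA.radj pA rA a2).symm (hA.radj yA pA a1).symm (hB.radj yB pB b1)
    (hB.radj pB rB b2) (hB.radj rB xB b3) ?_ (Or.inr (Or.inl (hA.radj xA yA hxy))))
  simp; grind

end Local

section Local2

open Classical

variable {W : Type*} [Fintype W] {H R M : SimpleGraph W} {x y z : W}

theorem Tri.d (h : Tri H R M x y z) : R.Adj x y ∧ R.Adj y z ∧ R.Adj z x ∧ R.Adj y x ∧
    R.Adj z y ∧ R.Adj x z ∧ x ≠ y ∧ y ≠ z ∧ z ≠ x :=
  ⟨h.radj, h.rot.radj, h.rot.rot.radj, h.radj.symm, h.rot.radj.symm, h.rot.rot.radj.symm, h.ne,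
    h.rot.ne, h.rot.rot.ne⟩

theorem Q4.d {x y z w : W} (h : Q4 H R M x y z w) : R.Adj x y ∧ R.Adj y z ∧ R.Adj z w ∧ R.Adj w x ∧
    R.Adj y x ∧ R.Adj z y ∧ R.Adj w z ∧ R.Adj x w ∧ x ≠ y ∧ y ≠ z ∧ z ≠ w ∧ w ≠ x ∧ x ≠ z ∧ y ≠ w := by
  obtain ⟨hs, h1, h2, h3, h4, h5, h6, h7, h8⟩ := h
  have a1 := hs.radj Ψ Ψ h1
  have a2 := hs.radj Ψ Ψ h2
  have a3 := hs.radj Ψ Ψ h3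
  have a4 := hs.radj Ψ Ψ h4
  exact ⟨a1, a2, a3, a4, a1.symm, a2.symm, a3.symm, a4.symm, a1.ne, a2.ne, a3.ne, a4.ne, h7, h8⟩

theorem Ctx.th (hc : Ctx H R M) (a b c d e f : W) (h : R.Adj a b ∧ R.Adj b c ∧ R.Adj c d ∧
    R.Adj d e ∧ R.Adj e f ∧ R.Adj f a ∧ (R.Adj a c ∨ R.Adj a d ∨ R.Adj a e ∨ R.Adj b d ∨ R.Adj b e ∨
      R.Adj b f ∨ R.Adj c e ∨ R.Adj c f ∨ R.Adj d f)) (hn : a ≠ c ∧ a ≠ d ∧ a ≠ e ∧ b ≠ d ∧ b ≠ e ∧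
      b ≠ f ∧ c ≠ e ∧ c ≠ f ∧ d ≠ f) : False := by
  obtain ⟨h1, h2, h3, h4, h5, h6, h7⟩ := h
  refine hc.free (theta_of h1 h2 h3 h4 h5 h6 ?_ h7)
  have := h1.ne
  have := h2.ne
  have := h3.ne
  have := h4.ne
  have := h5.ne
  have := h6.ne
  simp; grind

theorem closed_gen (hc : Ctx H R M) {v a : W} {A : Set W} (ha : a ∈ A) (hva : H.Adj v a)
    (h : ∀ x ∈ A, ∀ F ∈ Fcs H, v ∈ F → x ∈ F → ∀ y ∈ F, H.Adj v y → y ∈ A) :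
    ∀ z, H.Adj v z → z ∈ A := by
  intro z hz
  by_contra hn
  obtain ⟨F, hF, hvF, x, hx, y, hy, hvx, hvy, hxA, hyA⟩ := face_link hc.tc hva ha hz hn
  have hF' : F.toFinset ∈ Fcs H := by
    rw [mem_Fcs]; simpa using hF
  exact hyA (h x hxA _ hF' (by simpa using hvF) (by simpa using hx) y (by simpa using hy) hvy)

/-- The fan around a vertex all of whose faces except possibly one are triangles. -/
theorem fan (hc : Ctx H R M) {v c d : W} {B : Finset W} (hB : B ∈ Fcs H) (vB : v ∈ B) (cB : c ∈ B)
    (dB : d ∈ B) (hvc : H.Adj v c) (hvd : H.Adj v d) (hcd : c ≠ d)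
    (hall : ∀ F ∈ Fcs H, v ∈ F → F ≠ B → Sf H R M 3 F) :
    (∃ x, (∀ z, H.Adj v z → z = c ∨ z = x ∨ z = d) ∧ Tri H R M v c x ∧ Tri H R M v x d) ∨
    (∃ x y, (∀ z, H.Adj v z → z = c ∨ z = x ∨ z = y ∨ z = d) ∧ Tri H R M v c x ∧ Tri H R M v x y ∧
      Tri H R M v y d ∧ c ≠ y ∧ x ≠ d) := by
  have nbB : ∀ z ∈ B, H.Adj v z → z = c ∨ z = d := fun z hz h =>
    fc_nb hB vB cB dB hz hcd hvc hvd h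
  have ext : ∀ {w : W} {A : Finset W}, H.Adj v w → (A = B ∨ w ∉ B) →
      ∃ x, Tri H R M v w x ∧ ({v, w, x} : Finset W) ≠ A := by
    intro w A hw hA
    obtain ⟨F, hF, h1, h2, hne⟩ := hc.other hw A
    have hFB : F ≠ B := by
      rintro rfl
      rcases hA with rfl | h
      · exact hne rfl
      · exact h h2
    obtain ⟨x, hx, e⟩ := (hall F hF h1 hFB).tri h1 h2 hw.ne
    exact ⟨x, hx, by rw [← e]; exact hne⟩
  have nxt : ∀ {w u : W}, Tri H R M v u w → w ∉ B → ∃ x, Tri H R M v w x ∧ x ≠ u := by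
    intro w u h hw
    obtain ⟨x, hx, hne⟩ := ext (A := {v, u, w}) h.swap'.hadj (Or.inr hw)
    refine ⟨x, hx, ?_⟩
    rintro rfl
    apply hne
    ext; simp; tauto
  have inB : ∀ {w : W}, H.Adj v w → w ∈ B → w = c ∨ w = d := fun h h' => nbB _ h' h
  -- faces at the edge `vc`
  have key : ∀ {w x : W}, Tri H R M v w x → ({v, w, x} : Finset W) ≠ B → w ∈ B → ∀ F ∈ Fcs H, v ∈ F →
      w ∈ F → F = B ∨ F = {v, w, x} := by
    intro w x h hne hw F hF h1 h2
    exact hc.two h.hadj hB h.1 hF hne.symm vB hw Ψ Ψ h1 h2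
  obtain ⟨x1, t1, n1⟩ := ext (A := B) hvc (Or.inl rfl)
  have D1 := t1.d
  have hx1B : x1 ∉ B := by
    intro h
    rcases fc_inter hc hB t1.1 n1.symm (x := v) (y := c) vB Ψ cB Ψ t1.ne h Ψ
      with e | e <;> grind
  obtain ⟨x2, t2, n2⟩ := nxt t1 hx1B
  have D2 := t2.d
  have fc1 := key t1 n1 cB
  have fx1 : ∀ F ∈ Fcs H, v ∈ F → x1 ∈ F → ∀ z ∈ F, z = v ∨ z = x1 ∨ z = c ∨ z = x2 :=
    fun F hF h1 h2 => (Tri.uniq hc t1.swap' t2 n2.symm hF h1 h2).2.2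
  have hx2c : x2 ≠ c := n2
  have closeD : ∀ {y : W}, Tri H R M v y d → y ∉ B → ∀ F ∈ Fcs H, v ∈ F → d ∈ F →
      ∀ z ∈ F, H.Adj v z → z = c ∨ z = y ∨ z = d := by
    intro y ht hy F hF h1 h2 z hz hvz
    rcases key ht.swap' (by intro e; apply hy; rw [← e]; simp) dB F hF h1 h2 with e | e
    · rw [e] at hz
      rcases nbB z hz hvz with e | e <;> simp [e]
    · rw [e] at hz
      have := hvz.ne
      simp at hz
      grind
  have closeC : ∀ F ∈ Fcs H, v ∈ F → c ∈ F → ∀ z ∈ F, H.Adj v z → z = c ∨ z = x1 ∨ z = d := by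
    intro F hF h1 h2 z hz hvz
    rcases fc1 F hF h1 h2 with e | e
    · rw [e] at hz
      rcases nbB z hz hvz with e | e <;> simp [e]
    · rw [e] at hz
      have := hvz.ne
      simp at hz
      grind
  by_cases h2d : x2 = d
  · subst h2d
    left
    refine ⟨x1, ?_, t1, t2⟩
    have := closed_gen hc (v := v) (a := c) (A := {c, x1, x2}) Ψ hvc (by
      rintro x (rfl | rfl | rfl) F hF h1 h2 y hy hvy
      · simpa using closeC F hF h1 h2 y hy hvy
      · have := fx1 F hF h1 h2 y hy
        have := hvy.ne
        simp; grind
      · simpa using closeD t2 hx1B F hF h1 h2 y hy hvy)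
    intro z hz
    simpa using this z hz
  have hx2B : x2 ∉ B := by
    intro h
    rcases inB t2.swap'.hadj h with e | e
    · exact hx2c e
    · exact h2d e
  obtain ⟨x3, t3, n3⟩ := nxt t2 hx2B
  have D3 := t3.d
  have fx2 : ∀ F ∈ Fcs H, v ∈ F → x2 ∈ F → ∀ z ∈ F, z = v ∨ z = x2 ∨ z = x1 ∨ z = x3 :=
    fun F hF h1 h2 => (Tri.uniq hc t2.swap' t3 n3.symm hF h1 h2).2.2
  have hx3c : x3 ≠ c := by
    rintro rfl
    rcases fc1 _ t3.1 Ψ Ψ with e | e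
    · exact hx2B (by rw [← e]; simp)
    · have : x2 ∈ ({v, x3, x1} : Finset W) := by rw [← e]; simp
      simp at this
      grind
  by_cases h3d : x3 = d
  · subst h3d
    right
    refine ⟨x1, x2, ?_, t1, t2, t3, hx2c.symm, n3.symm⟩
    have := closed_gen hc (v := v) (a := c) (A := {c, x1, x2, x3}) Ψ hvc (by
      rintro x (rfl | rfl | rfl | rfl) F hF h1 h2 y hy hvy
      · have := closeC F hF h1 h2 y hy hvy
        simp; tauto
      · have := fx1 F hF h1 h2 y hy
        have := hvy.ne
        simp; grind
      · have := fx2 F hF h1 h2 y hy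
        have := hvy.ne
        simp; grind
      · have := closeD t3 hx2B F hF h1 h2 y hy hvy
        simp; tauto)
    intro z hz
    simpa using this z hz
  exfalso
  have hx3B : x3 ∉ B := by
    intro h
    rcases inB t3.swap'.hadj h with e | e
    · exact hx3c e
    · exact h3d e
  obtain ⟨x4, t4, n4⟩ := nxt t3 hx3B
  have D4 := t4.d
  have hx4c : x4 ≠ c := by
    rintro rfl
    rcases fc1 _ t4.1 Ψ Ψ with e | e
    · exact hx3B (by rw [← e]; simp)
    · have : x3 ∈ ({v, x4, x1} : Finset W) := by rw [← e]; simp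
      simp at this
      grind
  have hx41 : x4 ≠ x1 := by
    rintro rfl
    have := fx1 _ t4.1 Ψ Ψ x3 Ψ
    grind
  exact hc.th v c x1 x2 x3 x4 (by grind) (by grind)

/-- vertex with only triangles, degree 3 -/
def A3 (H R M : SimpleGraph W) (v a b c : W) : Prop :=
  (∀ z, H.Adj v z → z = a ∨ z = b ∨ z = c) ∧ Tri H R M v a b ∧ Tri H R M v b c ∧ Tri H R M v c a

def A4 (H R M : SimpleGraph W) (v a b c d : W) : Prop :=
  (∀ z, H.Adj v z → z = a ∨ z = b ∨ z = c ∨ z = d) ∧ Tri H R M v a b ∧ Tri H R M v b c ∧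
    Tri H R M v c d ∧ Tri H R M v d a ∧ a ≠ c ∧ b ≠ d

def B3 (H R M : SimpleGraph W) (v c x d : W) (B : Finset W) : Prop :=
  (∀ z, H.Adj v z → z = c ∨ z = x ∨ z = d) ∧ Tri H R M v c x ∧ Tri H R M v x d ∧ c ≠ d ∧
    B ∈ Fcs H ∧ v ∈ B ∧ c ∈ B ∧ d ∈ B ∧ ¬ Sf H R M 3 B

def B4 (H R M : SimpleGraph W) (v c x y d : W) (B : Finset W) : Prop :=
  (∀ z, H.Adj v z → z = c ∨ z = x ∨ z = y ∨ z = d) ∧ Tri H R M v c x ∧ Tri H R M v x y ∧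
    Tri H R M v y d ∧ c ≠ y ∧ x ≠ d ∧ c ≠ d ∧
    B ∈ Fcs H ∧ v ∈ B ∧ c ∈ B ∧ d ∈ B ∧ ¬ Sf H R M 3 B

/-- number of nontriangular faces is 0 -/
def q0 (H R M : SimpleGraph W) (v : W) : Prop := ∀ F ∈ Fcs H, v ∈ F → Sf H R M 3 F

def q1 (H R M : SimpleGraph W) (v : W) : Prop :=
  ∃ B ∈ Fcs H, v ∈ B ∧ ¬ Sf H R M 3 B ∧ ∀ F ∈ Fcs H, v ∈ F → F ≠ B → Sf H R M 3 F

theorem q0.cases (hc : Ctx H R M) {v : W} (h : q0 H R M v) :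
    (∃ a b c, A3 H R M v a b c) ∨ ∃ a b c d, A4 H R M v a b c d := by
  obtain ⟨w, hw, -, -⟩ := hc.tc.exists_ne v v v
  obtain ⟨a, ha, -, -⟩ := hc.tc.deg3 hw.symm hw.symm
  obtain ⟨F, hF, h1, h2, -⟩ := hc.other ha ∅
  obtain ⟨b, hb, rfl⟩ := (h F hF h1).tri h1 h2 ha.ne
  have D := hb.d
  rcases fan hc hb.1 Ψ (c := a) (d := b) Ψ Ψ ha hb.swap'.hadj (by grind)
    (fun F hF h1 _ => h F hF h1) with ⟨x, h1, h2, h3⟩ | ⟨x, y, h1, h2, h3, h4, h5, h6⟩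
  · exact Or.inl ⟨a, x, b, h1, h2, h3, hb.swap'⟩
  · exact Or.inr ⟨a, x, y, b, h1, h2, h3, h4, hb.swap', h5, h6⟩

/-- a `q1` vertex, with its exceptional face. -/
theorem q1.cases (hc : Ctx H R M) {v : W} (h : q1 H R M v) :
    (∃ c x d B, B3 H R M v c x d B) ∨ ∃ c x y d B, B4 H R M v c x y d B := by
  obtain ⟨B, hB, vB, hn, hall⟩ := h
  obtain ⟨c, hc', d, hd, hcd, h1, h2, -⟩ := (mem_Fcs.1 hB).1.nbrs vB
  rcases fan hc hB vB hc' hd h1 h2 hcd hall with ⟨x, h1, h2, h3⟩ | ⟨x, y, h1, h2, h3, h4, h5, h6⟩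
  · exact Or.inl ⟨c, x, d, B, h1, h2, h3, hcd, hB, vB, hc', hd, hn⟩
  · exact Or.inr ⟨c, x, y, d, B, h1, h2, h3, h4, h5, h6, hcd, hB, vB, hc', hd, hn⟩

theorem close3 (hc : Ctx H R M) {v a b c : W} (h1 : Tri H R M v a b) (h2 : Tri H R M v b c)
    (h3 : Tri H R M v c a) : A3 H R M v a b c := by
  have D1 := h1.d
  have D2 := h2.d
  have D3 := h3.d
  refine ⟨?_, h1, h2, h3⟩
  have := closed_nb hc (v := v) (a := a) (A := {a, b, c}) Ψ h1.hadj (by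
    rintro x (rfl | rfl | rfl)
    · exact ⟨b, by simp, c, by simp, by grind, h1, h3.swap'⟩
    · exact ⟨a, by simp, c, by simp, by grind, h1.swap', h2⟩
    · exact ⟨b, by simp, a, by simp, by grind, h2.swap', h3⟩)
  intro z hz
  simpa using this z hz

theorem close4 (hc : Ctx H R M) {v a b c d : W} (h1 : Tri H R M v a b) (h2 : Tri H R M v b c)
    (h3 : Tri H R M v c d) (h4 : Tri H R M v d a) (hac : a ≠ c) (hbd : b ≠ d) :
    A4 H R M v a b c d := by
  refine ⟨?_, h1, h2, h3, h4, hac, hbd⟩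
  have := closed_nb hc (v := v) (a := a) (A := {a, b, c, d}) Ψ h1.hadj (by
    rintro x (rfl | rfl | rfl | rfl)
    · exact ⟨b, by simp, d, by simp, hbd, h1, h4.swap'⟩
    · exact ⟨a, by simp, c, by simp, hac, h1.swap', h2⟩
    · exact ⟨b, by simp, d, by simp, hbd, h2.swap', h3⟩
    · exact ⟨c, by simp, a, by simp, hac.symm, h3.swap', h4⟩)
  intro z hz
  simpa using this z hz

/-- closing with a quadrilateral face `a v c r` between two triangles -/
theorem closeQ (hc : Ctx H R M) {v a b c r : W} (h1 : Tri H R M v a b) (h2 : Tri H R M v b c)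
    (h3 : Q4 H R M a v c r) (hac : a ≠ c) : ∀ z, H.Adj v z → z = a ∨ z = b ∨ z = c := by
  have D1 := h1.d
  have D2 := h2.d
  have D3 := h3.d
  have hq : ∀ {x y z : W}, Tri H R M x y z → ({x, y, z} : Finset W) ≠ {a, v, c, r} := by
    intro x y z h e
    have := h.2.2
    rw [e, h3.1.2.2] at this
    omega
  have nbB : ∀ z ∈ ({a, v, c, r} : Finset W), H.Adj v z → z = a ∨ z = c := fun z hz h =>
    fc_nb h3.1.1 Ψ Ψ Ψ hz hac h1.hadj h2.swap'.hadj h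
  have := closed_gen hc (v := v) (a := a) (A := {a, b, c}) Ψ h1.hadj (by
    rintro x (rfl | rfl | rfl) F hF hv hx y hy hvy
    · rcases hc.two h1.hadj h1.1 h3.1.1 hF (hq h1) Ψ Ψ Ψ Ψ hv hx
        with rfl | rfl
      · have := hvy.ne
        simp at hy ⊢; grind
      · have := nbB y hy hvy
        simp; tauto
    · have := (Tri.uniq hc h1.swap' h2 hac hF hv hx).2.2 y hy
      have := hvy.ne
      simp; grind
    · rcases hc.two h2.swap'.hadj h2.1 h3.1.1 hF (hq h2) Ψ Ψ Ψ Ψ hv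
        hx with rfl | rfl
      · have := hvy.ne
        simp at hy ⊢; grind
      · have := nbB y hy hvy
        simp; tauto)
  intro z hz
  simpa using this z hz

/-- a triangle all of whose edges lie on two triangles has an `A3` vertex -/
theorem tri333 (hc : Ctx H R M) {a b c x y z : W} (h : Tri H R M a b c) (hx : Tri H R M a b x)
    (hy : Tri H R M b c y) (hz : Tri H R M c a z) (hxc : x ≠ c) (hya : y ≠ a) (hzb : z ≠ b) :
    ∃ v, (v = a ∨ v = b ∨ v = c) ∧ ∃ p q r, A3 H R M v p q r := by
  have D1 := h.d
  have D2 := hx.d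
  have D3 := hy.d
  have D4 := hz.d
  by_cases h1 : x = y
  · subst h1
    exact ⟨b, by simp, a, c, x, close3 hc h.swap hy hx.rot⟩
  by_cases h2 : y = z
  · subst h2
    exact ⟨c, by simp, b, a, y, close3 hc h.rot.rot.swap' hz hy.swap.swap'⟩
  by_cases h3 : x = z
  · subst h3
    exact ⟨a, by simp, b, c, x, close3 hc h hz.swap hx.swap'⟩
  exact (hc.th a x b y c z (by grind) (by grind)).elim

theorem Q4.rot {x y p r : W} (h : Q4 H R M x y p r) : Q4 H R M y p r x := by
  obtain ⟨h0, h1, h2, h3, h4, h5, h6, h7, h8⟩ := h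
  refine ⟨?_, h2, h3, h4, h1, h6, fun h => h5 h.symm, h8, h7.symm⟩
  convert h0 using 1
  ext; simp; tauto

theorem Q4.flip {x y p r : W} (h : Q4 H R M x y p r) : Q4 H R M y x r p := by
  obtain ⟨h0, h1, h2, h3, h4, h5, h6, h7, h8⟩ := h
  refine ⟨?_, h1.symm, h4.symm, h3.symm, h2.symm, h6, h5, h8, h7⟩
  convert h0 using 1
  ext; simp; tauto

theorem Bg.symm (h : Bg H R M x y) : Bg H R M y x := by
  obtain ⟨F, h1, h2, h3, h4⟩ := h
  exact ⟨F, h1, h3, h2, h4⟩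

/-- both faces at `xy` are triangles -/
def E3 (H R M : SimpleGraph W) (x y : W) : Prop :=
  ∃ z w, z ≠ w ∧ Tri H R M x y z ∧ Tri H R M x y w

theorem E3.symm (h : E3 H R M x y) : E3 H R M y x := by
  obtain ⟨z, w, h, h1, h2⟩ := h
  exact ⟨z, w, h, h1.swap, h2.swap⟩

/-- some face at `xy` is not a triangle -/
def NT (H R M : SimpleGraph W) (x y : W) : Prop :=
  ∃ F ∈ Fcs H, x ∈ F ∧ y ∈ F ∧ ¬ Sf H R M 3 F

theorem NT.symm (h : NT H R M x y) : NT H R M y x := by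
  obtain ⟨F, h1, h2, h3, h4⟩ := h
  exact ⟨F, h1, h3, h2, h4⟩

theorem Bg.nt (h : Bg H R M x y) : NT H R M x y := by
  obtain ⟨F, h1, h2, h3, h4⟩ := h
  refine ⟨F, h1, h2, h3, fun h => ?_⟩
  rcases h4 with h4 | h4
  · exact h.2.1 h4
  · have := h.2.2
    omega

theorem Q4.nt {x y p r : W} (h : Q4 H R M x y p r) : NT H R M x y :=
  ⟨_, h.1.1, by simp, by simp, fun h' => by have := h.1.2.2; have := h'.2.2; omega⟩

theorem E3.not_nt (hc : Ctx H R M) (h : E3 H R M x y) : ¬ NT H R M x y := by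
  obtain ⟨z, w, h, h1, h2⟩ := h
  rintro ⟨F, hF, hx, hy, hn⟩
  exact hn (Tri.uniq hc h1 h2 h hF hx hy).1

theorem q0.not_nt (h : q0 H R M x) : ¬ NT H R M x y := by
  rintro ⟨F, hF, hx, hy, hn⟩
  exact hn (h F hF hx)

/-- the third vertex is unique when the other face is not a triangle -/
theorem Tri.third (hc : Ctx H R M) {x y z w : W} (h1 : Tri H R M x y z) (h2 : Tri H R M x y w)
    (hn : NT H R M x y) : z = w := by
  by_contra h
  exact E3.not_nt hc ⟨z, w, h, h1, h2⟩ hn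

theorem Tri.mid (hc : Ctx H R M) {x y z w u : W} (h1 : Tri H R M x y z) (h2 : Tri H R M x y w)
    (hn : z ≠ w) (h3 : Tri H R M x y u) : u = z ∨ u = w := by
  have D := h3.d
  rcases (Tri.uniq hc h1 h2 hn h3.1 Ψ Ψ).2.2 u Ψ with h | h | h | h
  · exact absurd h D.2.2.2.2.2.2.2.2
  · exact absurd h.symm D.2.2.2.2.2.2.2.1
  · exact Or.inl h
  · exact Or.inr h

theorem Tri.cases' (hc : Ctx H R M) (h : Tri H R M x y z) :
    E3 H R M x y ∨ (∃ p r, Q4 H R M x y p r ∧ z ≠ p ∧ z ≠ r) ∨ Bg H R M x y := by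
  rcases h.cases hc with ⟨w, h1, h2⟩ | h | h
  · exact Or.inl ⟨w, z, h1, h2, h⟩
  · exact Or.inr (Or.inl h)
  · exact Or.inr (Or.inr h)

theorem E3.other (h : E3 H R M x y) : ∃ w, w ≠ z ∧ Tri H R M x y w := by
  obtain ⟨a, b, hab, h1, h2⟩ := h
  by_cases e : a = z
  · exact ⟨b, by rw [← e]; exact hab.symm, h2⟩
  · exact ⟨a, e, h1⟩

theorem nb3 {v p q r a b c : W} (h : ∀ z, H.Adj v z → z = p ∨ z = q ∨ z = r) (ha : H.Adj v a)
    (hb : H.Adj v b) (hc : H.Adj v c) (hab : a ≠ b) (hbc : b ≠ c) (hac : a ≠ c) :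
    ∀ z, H.Adj v z → z = a ∨ z = b ∨ z = c := by
  intro z hz
  have := h z hz
  have := h a ha
  have := h b hb
  have := h c hc
  grind

theorem nb4 {v p q r s a b c d : W} (h : ∀ z, H.Adj v z → z = p ∨ z = q ∨ z = r ∨ z = s)
    (ha : H.Adj v a) (hb : H.Adj v b) (hc : H.Adj v c) (hd : H.Adj v d) (hab : a ≠ b) (hbc : b ≠ c)
    (hac : a ≠ c) (had : a ≠ d) (hbd : b ≠ d) (hcd : c ≠ d) :
    ∀ z, H.Adj v z → z = a ∨ z = b ∨ z = c ∨ z = d := by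
  intro z hz
  have := h z hz
  have := h a ha
  have := h b hb
  have := h c hc
  have := h d hd
  grind

def A3' (H R M : SimpleGraph W) (v : W) : Prop := ∃ a b c, A3 H R M v a b c

theorem A3.rot {v a b c : W} (h : A3 H R M v a b c) : A3 H R M v b c a :=
  ⟨fun z hz => by have := h.1 z hz; tauto, h.2.2.1, h.2.2.2, h.2.1⟩

theorem A3.align {v p q r a b c : W} (h : A3 H R M v p q r) (ha : H.Adj v a)
    (hb : H.Adj v b) (hc : H.Adj v c) (hab : a ≠ b) (hbc : b ≠ c) (hac : a ≠ c) :
    A3 H R M v a b c := by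
  have key : ∀ s t, H.Adj v s → H.Adj v t → s ≠ t → Tri H R M v s t := by
    intro s t hs ht hst
    obtain ⟨h1, h2, h3, h4⟩ := h
    rcases h1 s hs with rfl | rfl | rfl <;> rcases h1 t ht with rfl | rfl | rfl <;>
      first
      | exact absurd rfl hst
      | assumption
      | exact Tri.swap' (by assumption)
  exact ⟨nb3 h.1 ha hb hc hab hbc hac, key _ _ ha hb hab, key _ _ hb hc hbc,
    key _ _ hc ha hac.symm⟩

theorem A3.q0 (hc : Ctx H R M) {v a b c : W} (h : A3 H R M v a b c) : q0 H R M v := by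
  intro F hF hv
  obtain ⟨w, hw, -, -, -, h1, -, -⟩ := (mem_Fcs.1 hF).1.nbrs hv
  have D1 := h.2.1.d
  have D2 := h.2.2.1.d
  have D3 := h.2.2.2.d
  rcases h.1 w h1 with rfl | rfl | rfl
  · exact (Tri.uniq hc h.2.1 h.2.2.2.swap' (by grind) hF hv hw).1
  · exact (Tri.uniq hc h.2.1.swap' h.2.2.1 (by grind) hF hv hw).1
  · exact (Tri.uniq hc h.2.2.1.swap' h.2.2.2 (by grind) hF hv hw).1

theorem A3'.not_nt (hc : Ctx H R M) {v w : W} (h : A3' H R M v) : ¬ NT H R M v w := by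
  obtain ⟨a, b, c, h⟩ := h
  exact (h.q0 hc).not_nt

theorem A4.rot {v a b c d : W} (h : A4 H R M v a b c d) : A4 H R M v b c d a :=
  ⟨fun z hz => by have := h.1 z hz; tauto, h.2.2.1, h.2.2.2.1, h.2.2.2.2.1, h.2.1, h.2.2.2.2.2.2,
    h.2.2.2.2.2.1.symm⟩

theorem A4.refl {v a b c d : W} (h : A4 H R M v a b c d) : A4 H R M v b a d c :=
  ⟨fun z hz => by have := h.1 z hz; tauto, h.2.1.swap', h.2.2.2.2.1.swap', h.2.2.2.1.swap',
    h.2.2.1.swap', h.2.2.2.2.2.2, h.2.2.2.2.2.1⟩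

theorem B3.refl {v c x d : W} {B : Finset W} (h : B3 H R M v c x d B) : B3 H R M v d x c B := by
  obtain ⟨h1, h2, h3, h4, h5, h6, h7, h8, h9⟩ := h
  exact ⟨fun z hz => by have := h1 z hz; tauto, h3.swap', h2.swap', h4.symm, h5, h6, h8, h7, h9⟩

theorem B4.refl {v c x y d : W} {B : Finset W} (h : B4 H R M v c x y d B) :
    B4 H R M v d y x c B := by
  obtain ⟨h1, h2, h3, h4, h5, h6, h7, h8, h9, h10, h11, h12⟩ := h
  exact ⟨fun z hz => by have := h1 z hz; tauto, h4.swap', h3.swap', h2.swap', h6.symm, h5.symm,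
    h7.symm, h8, h9, h11, h10, h12⟩

theorem B3.align (hc : Ctx H R M) {v c x d b w : W} {B : Finset W} (h : B3 H R M v c x d B)
    (hn : NT H R M v b) (ht : Tri H R M v b w) : ∃ d', B3 H R M v b w d' B := by
  have h' := h
  obtain ⟨h1, h2, h3, h4, h5, h6, h7, h8, h9⟩ := h
  rcases h1 b ht.hadj with rfl | rfl | rfl
  · obtain rfl := h2.third hc ht hn
    exact ⟨d, h'⟩
  · exact absurd hn (E3.not_nt hc ⟨c, d, h4, h2.swap', h3⟩)
  · obtain rfl := h3.swap'.third hc ht hn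
    exact ⟨c, h'.refl⟩

theorem B4.align (hc : Ctx H R M) {v c x y d b w : W} {B : Finset W} (h : B4 H R M v c x y d B)
    (hn : NT H R M v b) (ht : Tri H R M v b w) : ∃ y' d', B4 H R M v b w y' d' B := by
  have h' := h
  obtain ⟨h1, h2, h3, h4, h5, h6, h7, h8, h9, h10, h11, h12⟩ := h
  rcases h1 b ht.hadj with rfl | rfl | rfl | rfl
  · obtain rfl := h2.third hc ht hn
    exact ⟨y, d, h'⟩
  · exact absurd hn (E3.not_nt hc ⟨c, y, h5, h2.swap', h3⟩)
  · exact absurd hn (E3.not_nt hc ⟨x, d, h6, h3.swap', h4⟩)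
  · obtain rfl := h4.swap'.third hc ht hn
    exact ⟨x, c, h'.refl⟩

theorem A4.start {x p q r s v : W} (h : A4 H R M x p q r s) (hv : H.Adj x v) :
    ∃ q r s, A4 H R M x v q r s := by
  rcases h.1 v hv with rfl | rfl | rfl | rfl
  · exact ⟨_, _, _, h⟩
  · exact ⟨_, _, _, h.rot⟩
  · exact ⟨_, _, _, h.rot.rot⟩
  · exact ⟨_, _, _, h.rot.rot.rot⟩

theorem A4.align (hc : Ctx H R M) {x p q r s c v y : W} (h : A4 H R M x p q r s)
    (h1 : Tri H R M x c v) (h2 : Tri H R M x v y) (hcy : c ≠ y) : ∃ w, A4 H R M x c v y w := by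
  obtain ⟨q, r, s, h⟩ := h.start h2.hadj
  have e := (h.2.1).mid hc h.2.2.2.2.1.swap' h.2.2.2.2.2.2 h1.swap'
  have e' := (h.2.1).mid hc h.2.2.2.2.1.swap' h.2.2.2.2.2.2 h2
  rcases e with rfl | rfl
  · rcases e' with rfl | rfl
    · exact absurd rfl hcy
    · exact ⟨_, h.refl⟩
  · rcases e' with rfl | rfl
    · exact ⟨_, h.rot.rot.rot⟩
    · exact absurd rfl hcy

/-- The demanding vertices of a triangle. -/
def dem (H R M : SimpleGraph W) (v : W) (T : Finset W) : Prop :=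
  v ∈ T ∧ (A3' H R M v ∨ ((∀ w ∈ T, ¬ A3' H R M w) ∧
    (q0 H R M v ∨ (q1 H R M v ∧ ¬ ∀ w ∈ T, w ≠ v → E3 H R M v w))))

theorem dem.cases (hc : Ctx H R M) {v a b : W} {T : Finset W} (h : dem H R M v T)
    (hn : NT H R M v a) (ht : Tri H R M v a b) : (∃ d' B, B3 H R M v a b d' B) ∨
      ∃ y d' B, B4 H R M v a b y d' B := by
  rcases h.2 with h | ⟨-, h | ⟨h, -⟩⟩
  · exact absurd hn (h.not_nt hc)
  · exact absurd hn h.not_nt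
  · rcases h.cases hc with ⟨_, _, _, _, h⟩ | ⟨_, _, _, _, _, h⟩
    · obtain ⟨d', h⟩ := h.align hc hn ht
      exact Or.inl ⟨_, _, h⟩
    · obtain ⟨_, d', h⟩ := h.align hc hn ht
      exact Or.inr ⟨_, _, _, h⟩

theorem dem.two (hc : Ctx H R M) {v : W} {T : Finset W} (h : dem H R M v T) {A B : Finset W}
    (hA : A ∈ Fcs H) (hB : B ∈ Fcs H) (vA : v ∈ A) (vB : v ∈ B) (nA : ¬ Sf H R M 3 A)
    (nB : ¬ Sf H R M 3 B) : A = B := by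
  rcases h.2 with h | ⟨-, h | ⟨h, -⟩⟩
  · obtain ⟨a, b, c, h⟩ := h
    exact absurd (h.q0 hc A hA vA) nA
  · exact absurd (h A hA vA) nA
  · obtain ⟨D, hD, vD, nD, h⟩ := h
    have h1 : A = D := by
      by_contra e
      exact nA (h A hA vA e)
    have h2 : B = D := by
      by_contra e
      exact nB (h B hB vB e)
    rw [h1, h2]

theorem dem.mid {v a b : W} (h : dem H R M v {v, a, b}) (ha : E3 H R M v a)
    (hb : E3 H R M v b) : q0 H R M v ∨ A3' H R M v := by
  rcases h.2 with h | ⟨-, h | ⟨h, h'⟩⟩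
  · exact Or.inr h
  · exact Or.inl h
  · exfalso
    apply h'
    intro w hw hwv
    simp at hw
    rcases hw with rfl | rfl | rfl
    · exact absurd rfl hwv
    · exact ha
    · exact hb

theorem A3.rim (hc : Ctx H R M) {v a b c : W} (h : A3 H R M v a b c) : ¬ A3' H R M a := by
  rintro ⟨p, q, r, h'⟩
  have D1 := h.2.1.d
  have D2 := h.2.2.1.d
  have D3 := h.2.2.2.d
  have h' := h'.align h.2.1.swap.hadj h.2.1.rot.hadj h.2.2.2.swap'.rot.hadj (by grind)
    (by grind) (by grind)
  refine five hc (h.2.1.six hc) (a := v) (b := a) (c := a) (s := b) (t := c) ?_ ?_ ?_ ?_ ?_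
  · grind
  · grind
  · intro z hz; have := h.1 z hz; tauto
  · intro z hz; have := h'.1 z hz; tauto
  · intro z hz; have := h'.1 z hz; tauto

theorem Tri.hd (h : Tri H R M x y z) : H.Adj x y ∧ H.Adj y z ∧ H.Adj z x ∧ H.Adj y x ∧
    H.Adj z y ∧ H.Adj x z :=
  ⟨h.hadj, h.rot.hadj, h.rot.rot.hadj, h.hadj.symm, h.rot.hadj.symm, h.rot.rot.hadj.symm⟩

theorem Tri.h12 (h : Tri H R M x y z) : H.Adj x y := h.hd.1
theorem Tri.h23 (h : Tri H R M x y z) : H.Adj y z := h.hd.2.1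
theorem Tri.h31 (h : Tri H R M x y z) : H.Adj z x := h.hd.2.2.1
theorem Tri.h21 (h : Tri H R M x y z) : H.Adj y x := h.hd.2.2.2.1
theorem Tri.h32 (h : Tri H R M x y z) : H.Adj z y := h.hd.2.2.2.2.1
theorem Tri.h13 (h : Tri H R M x y z) : H.Adj x z := h.hd.2.2.2.2.2
theorem Tri.n12 (h : Tri H R M x y z) : x ≠ y := h.h12.ne
theorem Tri.n23 (h : Tri H R M x y z) : y ≠ z := h.h23.ne
theorem Tri.n31 (h : Tri H R M x y z) : z ≠ x := h.h31.ne
theorem Tri.n21 (h : Tri H R M x y z) : y ≠ x := h.h21.ne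
theorem Tri.n32 (h : Tri H R M x y z) : z ≠ y := h.h32.ne
theorem Tri.n13 (h : Tri H R M x y z) : x ≠ z := h.h13.ne

theorem not_three {b p q r v a c d : W} (h : ∀ z, H.Adj b z → z = p ∨ z = q ∨ z = r)
    (hv : H.Adj b v) (ha : H.Adj b a) (hc : H.Adj b c) (hd : H.Adj b d) (h1 : v ≠ a) (h2 : v ≠ c)
    (h3 : v ≠ d) (h4 : a ≠ c) (h5 : a ≠ d) (h6 : c ≠ d) : False := by
  have := h v hv
  have := h a ha
  have := h c hc
  have := h d hd
  grind

theorem A3.link (hc : Ctx H R M) {v a b c : W} (h : A3 H R M v a b c) :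
    E3 H R M a b ∨ Bg H R M a b := by
  have D1 := h.2.1.d
  have D2 := h.2.2.1.d
  have D3 := h.2.2.2.d
  have E1 := h.2.1.hd
  have E2 := h.2.2.1.hd
  have E3 := h.2.2.2.hd
  rcases h.2.1.rot.cases' hc with h | ⟨p, r, hq, n1, n2⟩ | h
  · exact Or.inl h
  · exfalso
    have D := hq.d
    obtain ⟨-, -, -, -, -, q1, q2, -⟩ := hq
    have : c ≠ p := by rintro rfl; exact q1 E3.2.2.2.2.1
    have : c ≠ r := by rintro rfl; exact q2 E2.2.1
    exact hc.th a c v b p r (by grind) (by grind)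
  · exact Or.inr h

theorem A3.not_all (hc : Ctx H R M) {v a b c : W} (h : A3 H R M v a b c) (h1 : E3 H R M a b)
    (h2 : E3 H R M b c) (h3 : E3 H R M c a) : False := by
  obtain ⟨x, hx, t1⟩ := h1.other (z := v)
  obtain ⟨y, hy, t2⟩ := h2.other (z := v)
  obtain ⟨z, hz, t3⟩ := h3.other (z := v)
  have A := h.2.1
  have B := h.2.2.1
  have C := h.2.2.2
  have D1 := A.d
  have D2 := B.d
  have D3 := C.d
  have D4 := t1.d
  have D5 := t2.d
  have D6 := t3.d
  have n1 : x ≠ c := by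
    rintro rfl
    exact h.rim hc ⟨_, _, _, close3 hc A.swap t1 C.rot.rot.swap'⟩
  have n2 : y ≠ a := by
    rintro rfl
    exact h.rot.rim hc ⟨_, _, _, close3 hc B.swap t2 A.rot.rot.swap'⟩
  have n3 : z ≠ b := by
    rintro rfl
    exact h.rot.rot.rim hc ⟨_, _, _, close3 hc C.swap t3 B.rot.rot.swap'⟩
  by_cases e1 : x = y
  · by_cases e2 : y = z
    · subst e1 e2
      have f1 := (close4 hc A.swap t1 t3.rot C.rot.rot.swap' (by grind) (by grind)).1
      have f2 := (close4 hc B.swap t2 t1.rot A.rot.rot.swap' (by grind) (by grind)).1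
      refine five hc (A.six hc) (a := v) (b := a) (c := b) (s := c) (t := x) ?_ ?_ ?_ ?_ ?_
      · grind
      · grind
      · intro z hz; have := h.1 z hz; tauto
      · intro z hz; have := f1 z hz; tauto
      · intro z hz; have := f2 z hz; tauto
    · exact hc.th b y c z a v (by grind) (by grind)
  · exact hc.th a x b y c v (by grind) (by grind)

/-- R2, with a rim vertex of type A3. -/
theorem A4.ra (hc : Ctx H R M) {v a b c d : W} (h : A4 H R M v a b c d) (hA : A3' H R M a) :
    Bg H R M b c ∧ ¬ A3' H R M b ∧ ¬ A3' H R M c ∧ ¬ dem H R M b {v, b, c} ∧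
      ¬ dem H R M c {v, b, c} := by
  obtain ⟨hv, T1, T2, T3, T4, nac, nbd⟩ := h
  obtain ⟨_, _, _, hA⟩ := hA
  obtain ⟨ha, -, T5, -⟩ := hA.align (a := v) (b := b) (c := d) T1.h21 T1.h23 T4.h32 T1.n13 nbd
    T4.n12
  have five' : ∀ u, (∀ z, H.Adj u z → z = v ∨ z = a ∨ z = b ∨ z = c ∨ z = d) →
      (u = b ∨ u = c) → False := by
    rintro u hu (rfl | rfl)
    · refine five hc (T1.six hc) (a := v) (b := a) (c := u) (s := c) (t := d) T2.n13 T3.n13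
        ?_ ?_ ?_
      · intro z hz; rcases hv z hz with h | h | h | h <;> simp [h]
      · intro z hz; rcases ha z hz with h | h | h <;> simp [h]
      · intro z hz; rcases hu z hz with h | h | h | h | h <;> simp [h]
    · refine five hc (T1.six hc) (a := v) (b := a) (c := u) (s := b) (t := d) T2.n12 T3.n13
        ?_ ?_ ?_
      · intro z hz; rcases hv z hz with h | h | h | h <;> simp [h]
      · intro z hz; rcases ha z hz with h | h | h <;> simp [h]
      · intro z hz; rcases hu z hz with h | h | h | h | h <;> simp [h]
  have nadj : ¬ H.Adj a c := fun h => by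
    rcases ha c h with h | h | h
    · exact T2.n31 h
    · exact T2.n32 h
    · exact T3.n23 h
  have nb : ¬ A3' H R M b := by
    rintro ⟨p, q, r, h⟩
    exact not_three h.1 T2.h21 T1.h32 T2.h23 T5.h23 T1.n12 T2.n13 T3.n13 nac T5.n13 T3.n23
  have nc : ¬ A3' H R M c := by
    rintro ⟨p, q, r, h⟩
    have h := h.align (a := v) (b := b) (c := d) T2.h31 T2.h32 T3.h23 T2.n12 nbd T3.n13
    exact five' c (fun z hz => by rcases h.1 z hz with h | h | h <;> simp [h]) (Or.inr rfl)
  have D1 := T1.d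
  have D2 := T2.d
  have D3 := T3.d
  have D4 := T4.d
  have D5 := T5.d
  have big : Bg H R M b c := by
    rcases T2.rot.cases' hc with h | ⟨p, r, hq, n1, n2⟩ | h
    · exfalso
      obtain ⟨x, hx, t⟩ := h.other (z := v)
      have D := t.d
      by_cases e : x = d
      · subst e
        exact nc ⟨_, _, _, close3 hc T2.rot.rot t.swap T3.rot⟩
      · have : x ≠ a := by rintro rfl; exact nadj t.h32
        exact hc.th b x c v d a (by grind) (by grind)
    · exfalso
      have D := hq.d
      have : a ≠ p := by rintro rfl; exact nadj hq.2.2.1.symm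
      have : a ≠ r := by
        rintro rfl
        rcases ha p hq.2.2.2.1.symm with h | h | h
        · exact n1 h.symm
        · exact hq.2.2.2.2.2.2.2.1 h.symm
        · exact hq.2.2.2.2.2.1 (by rw [h]; exact T5.h23)
      exact hc.th b a v c p r (by grind) (by grind)
    · exact h
  refine ⟨big, nb, nc, fun hd => ?_, fun hd => ?_⟩
  · rcases hd.cases hc big.nt T2.rot with ⟨_, _, h⟩ | ⟨_, _, _, h⟩
    · exact not_three h.1 T2.h21 T1.h32 T2.h23 T5.h23 T1.n12 T2.n13 T3.n13 nac T5.n13 T3.n23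
    · have h := nb4 h.1 (a := v) (b := a) (c := c) (d := d) T2.h21 T1.h32 T2.h23 T5.h23 T1.n12 nac
        T2.n13 T3.n13 T5.n13 T3.n23
      exact five' b (fun z hz => by rcases h z hz with h | h | h | h <;> simp [h]) (Or.inl rfl)
  · rcases hd.cases hc big.symm.nt T2.rot.swap with ⟨_, _, h⟩ | ⟨y, d', B, h⟩
    · have h := nb3 h.1 (a := v) (b := b) (c := d) T2.h31 T2.h32 T3.h23 T2.n12 nbd T3.n13
      exact five' c (fun z hz => by rcases h z hz with h | h | h <;> simp [h]) (Or.inr rfl)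
    · have e : y = d := by
        rcases T3.swap.mid hc T2.rot.rot nbd.symm h.2.2.1 with e | e
        · exact e
        · exact absurd e.symm h.2.2.2.2.1
      subst e
      have t := h.2.2.2.1
      have D := t.d
      have : d' ≠ a := by rintro rfl; exact nadj t.h31
      have := h.2.2.2.2.2.1
      have := h.2.2.2.2.2.2.1
      exact hc.th c d' y a b v (by grind) (by grind)

/-- R2, no rim vertex of type A3. -/
theorem A4.rb (hc : Ctx H R M) {v a b c d : W} (h : A4 H R M v a b c d) (na : ¬ A3' H R M a)
    (nb : ¬ A3' H R M b) (nc : ¬ A3' H R M c) (nd : ¬ A3' H R M d) :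
    Bg H R M a b ∧ ¬ (dem H R M a {v, a, b} ∧ dem H R M b {v, a, b}) := by
  have five' : ∀ {a b c d : W}, A4 H R M v a b c d → (∀ z, H.Adj a z → z = d ∨ z = v ∨ z = b) →
      (∀ z, H.Adj b z → z = a ∨ z = v ∨ z = c) → False := by
    intro a b c d h h1 h2
    obtain ⟨hv, T1, T2, T3, T4, nac, nbd⟩ := h
    refine five hc (T1.six hc) (a := v) (b := a) (c := b) (s := c) (t := d) T2.n13 T3.n13
        ?_ ?_ ?_
    · intro z hz; rcases hv z hz with h | h | h | h <;> simp [h]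
    · intro z hz; rcases h1 z hz with h | h | h <;> simp [h]
    · intro z hz; rcases h2 z hz with h | h | h <;> simp [h]
  have five' := five' h
  have h0 := h
  obtain ⟨hv, T1, T2, T3, T4, nac, nbd⟩ := h
  have big : Bg H R M a b := by
    rcases T1.rot.cases' hc with h | ⟨p, r, hq, n1, n2⟩ | h
    · exfalso
      obtain ⟨x, hx, t⟩ := h.other (z := v)
      obtain ⟨w, hw, hA⟩ := tri333 hc (a := a) (b := b) (c := v) (x := x) (y := c) (z := d)
        T1.rot t T2.swap T4.swap' hx nac.symm nbd.symm
      rcases hw with rfl | rfl | rfl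
      · exact na hA
      · exact nb hA
      · obtain ⟨_, _, _, h⟩ := hA
        exact not_three h.1 T1.h12 T2.h12 T3.h12 T4.h12 T1.n23 nac T4.n32 T2.n23 nbd T3.n23
    · exfalso
      have D := hq.d
      have D1 := T1.d
      have D2 := T2.d
      have D4 := T4.d
      have hdp : d ≠ p := by rintro rfl; exact hq.2.2.2.2.2.1 T4.h32
      have hcr : c ≠ r := by rintro rfl; exact hq.2.2.2.2.2.2.1 T2.h23
      by_cases e1 : r = d
      · by_cases e2 : p = c
        · subst e1 e2
          refine five' (fun z hz => ?_) (fun z hz => ?_)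
          · rcases closeQ hc T1.rot T4.rot.rot hq.flip (by grind) z hz with h | h | h <;> simp [h]
          · rcases closeQ hc (a := a) (b := v) (c := p) (v := b) (r := r) T1.rot.rot.swap' T2.swap hq (by grind) z hz with h | h | h <;> simp [h]
        · exact hc.th a v c b p r (by grind) (by grind)
      · exact hc.th a d v b p r (by grind) (by grind)
    · exact h
  refine ⟨big, fun ⟨hda, hdb⟩ => ?_⟩
  have key : ∀ {a b c d : W}, A4 H R M v a b c d → ¬ A3' H R M d → dem H R M a {v, a, b} →
      Bg H R M a b → (∀ z, H.Adj a z → z = d ∨ z = v ∨ z = b) := by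
    intro a b c d h nd hd big
    obtain ⟨hv, T1, T2, T3, T4, nac, nbd⟩ := h
    rcases hd.cases hc big.nt T1.rot with ⟨_, _, h⟩ | ⟨y, d', B, h⟩
    · exact nb3 h.1 T4.h32 T1.h21 T1.h23 T4.n21 T1.n13 nbd.symm
    · exfalso
      have e : y = d := by
        rcases T1.swap.mid hc T4.rot.rot nbd h.2.2.1 with e | e
        · exact absurd e.symm h.2.2.2.2.1
        · exact e
      subst e
      have t := h.2.2.2.1
      by_cases e : d' = c
      · subst e
        exact nd ⟨_, _, _, close3 hc T3.rot.rot t.rot T4.rot⟩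
      · have D := t.d
        have D1 := T1.d
        have D2 := T2.d
        have D3 := T3.d
        have D4 := T4.d
        have := h.2.2.2.2.2.1
        have := h.2.2.2.2.2.2.1
        exact hc.th a d' y c b v (by grind) (by grind)
  refine five' (key h0 nd hda big) (fun z hz => ?_)
  have := key h0.refl nc (by convert hdb using 1; ext; simp; tauto) big.symm z hz
  tauto

/-- R2' -/
theorem A4.r (hc : Ctx H R M) {v a b c d : W} (h : A4 H R M v a b c d) (na : ¬ A3' H R M a)
    (nb : ¬ A3' H R M b) :
    Bg H R M a b ∧ ¬ (dem H R M a {v, a, b} ∧ dem H R M b {v, a, b}) := by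
  by_cases hd : A3' H R M d
  · have := h.rot.rot.rot.ra hc hd
    exact ⟨this.1, fun h => this.2.2.2.1 h.1⟩
  by_cases hcc : A3' H R M c
  · have := h.rot.rot.refl.ra hc
    have := h.refl.rot.rot.rot.ra hc hcc
    refine ⟨this.1.symm, fun h => this.2.2.2.1 ?_⟩
    convert h.2 using 1; ext; simp; tauto
  exact h.rb hc na nb hcc hd

theorem Tri.nin (hc : Ctx H R M) (h : Tri H R M x y z) {B : Finset W} (hB : B ∈ Fcs H)
    (hx : x ∈ B) (hy : y ∈ B) (hn : ¬ Sf H R M 3 B) : z ∉ B :=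
  fun hz => hn (h.eq hc hB hx hy hz)

theorem B_cases (hc : Ctx H R M) {v c x d : W} {B : Finset W} (h : Tri H R M v c x)
    (hB : B ∈ Fcs H) (hv : v ∈ B) (hcB : c ∈ B) (hd : d ∈ B) (hcd : c ≠ d) (hvd : H.Adj v d)
    (hn : ¬ Sf H R M 3 B) :
    (∃ z, Q4 H R M c v d z ∧ B = {c, v, d, z}) ∨ (Bg H R M v c ∧ Bg H R M v d) := by
  have hx := h.nin hc hB hv hcB hn
  have hne : B ≠ {v, c, x} := by rintro rfl; simp at hx
  have two : ∀ F ∈ Fcs H, v ∈ F → c ∈ F → x ∉ F → F = B := by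
    intro F hF h1 h2 h3
    rcases hc.two h.h12 hB h.1 hF hne hv hcB Ψ Ψ h1 h2 with e | e
    · exact e
    · rw [e] at h3; simp at h3
  rcases h.cases' hc with h' | ⟨p, r, hq, n1, n2⟩ | ⟨F, hF, h1, h2, h3⟩
  · exact absurd ⟨B, hB, hv, hcB, hn⟩ (h'.not_nt hc)
  · left
    have e := two _ hq.1.1 Ψ Ψ (by
      have := h.n31; have := h.n32; simp; tauto)
    have e' : d = r := by
      rw [← e] at hd
      simp at hd
      rcases hd with rfl | rfl | rfl | rfl
      · exact absurd hvd (H.loopless.irrefl _)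
      · exact absurd rfl hcd
      · exact absurd hvd hq.2.2.2.2.2.1
      · rfl
    subst e'
    refine ⟨p, hq.flip, ?_⟩
    rw [← e]; ext; simp; tauto
  · right
    have e : F = B := by
      by_contra e
      by_cases hxF : x ∈ F
      · have := h.eq hc hF h1 h2 hxF
        rcases h3 with h3 | h3
        · exact this.2.1 h3
        · have := this.2.2
          omega
      · exact e (two F hF h1 h2 hxF)
    subst e
    exact ⟨⟨F, hF, h1, h2, h3⟩, ⟨F, hF, h1, hd, h3⟩⟩

/-- the exceptional face of a B4 vertex is big -/
theorem B4.big (hc : Ctx H R M) {v c x y d : W} {B : Finset W} (h : B4 H R M v c x y d B) :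
    Bg H R M v c ∧ Bg H R M v d := by
  obtain ⟨hv, T1, T2, T3, n1, n2, n3, hB, vB, cB, dB, nB⟩ := h
  rcases B_cases hc T1 hB vB cB dB n3 T3.h13 nB with ⟨z, hq, e⟩ | h
  · exfalso
    have := T1.nin hc hB vB cB nB
    have := T3.swap'.nin hc hB vB dB nB
    have : z ∈ B := by rw [e]; simp
    have : z ≠ x := by rintro rfl; contradiction
    have : z ≠ y := by rintro rfl; contradiction
    have D := hq.d
    have D1 := T1.d
    have D2 := T2.d
    have D3 := T3.d
    exact hc.th c x v y d z (by grind) (by grind)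
  · exact h

/-- R3c -/
theorem B4.rc (hc : Ctx H R M) {v c x y d : W} {B : Finset W} (h : B4 H R M v c x y d B) :
    E3 H R M c x ∨ Bg H R M c x := by
  obtain ⟨hv, T1, T2, T3, n1, n2, n3, -⟩ := h
  rcases T1.rot.cases' hc with h | ⟨p, r, hq, m1, m2⟩ | h
  · exact Or.inl h
  · exfalso
    have D := hq.d
    have D1 := T1.d
    have D2 := T2.d
    have D3 := T3.d
    have hyr : y ≠ r := by rintro rfl; exact hq.2.2.2.2.2.2.1 T2.h23
    by_cases e : y = p
    · subst e
      have f1 := closeQ hc T1.rot.rot.swap' T2.swap hq (by grind)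
      by_cases e : r = d
      · subst e
        have f2 := closeQ hc T2.rot.rot.swap' T3.swap hq.rot (by grind)
        refine five hc (T1.six hc) (a := v) (b := x) (c := y) (s := c) (t := r) T1.n12 T3.n13
          ?_ ?_ ?_
        · intro z hz; rcases hv z hz with h | h | h | h <;> simp [h]
        · intro z hz; rcases f1 z hz with h | h | h <;> simp [h]
        · intro z hz; rcases f2 z hz with h | h | h <;> simp [h]
      · exact hc.th c r y d v x (by grind) (by grind)
    · exact hc.th c r p x y v (by grind) (by grind)
  · exact Or.inr h

/-- R3, `x` of type A3 -/
theorem B4.ra (hc : Ctx H R M) {v c x y d : W} {B : Finset W} (h : B4 H R M v c x y d B)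
    (hA : A3' H R M x) : Bg H R M y d ∧ ¬ A3' H R M y ∧ ¬ A3' H R M d ∧
      ¬ dem H R M y {v, y, d} ∧ ¬ dem H R M d {v, y, d} := by
  obtain ⟨hv, T1, T2, T3, n1, n2, n3, hB, vB, cB, dB, nB⟩ := h
  obtain ⟨_, _, _, hA⟩ := hA
  obtain ⟨hx, -, -, T5⟩ := hA.align (a := c) (b := v) (c := y) T1.h32 T1.h31 T2.h23 T1.n21 T2.n13
    n1
  have five' : (∀ z, H.Adj y z → z = v ∨ z = x ∨ z = c ∨ z = d) → False := by
    intro hy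
    refine five hc (T1.six hc) (a := v) (b := x) (c := y) (s := c) (t := d) T1.n12 T3.n13
      ?_ ?_ ?_
    · intro z hz; rcases hv z hz with h | h | h | h <;> simp [h]
    · intro z hz; rcases hx z hz with h | h | h <;> simp [h]
    · intro z hz; rcases hy z hz with h | h | h | h <;> simp [h]
  have nxd : ¬ H.Adj x d := fun h => by
    rcases hx d h with h | h | h
    · exact n3 h.symm
    · exact T3.n31 h
    · exact T3.n32 h
  have D1 := T1.d
  have D2 := T2.d
  have D3 := T3.d
  have D5 := T5.d
  have big : Bg H R M y d := by
    rcases T3.rot.cases' hc with h | ⟨p, r, hq, m1, m2⟩ | h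
    · exfalso
      obtain ⟨w, hw, t⟩ := h.other (z := v)
      have D := t.d
      by_cases e : w = c
      · subst e
        exact five' (close4 hc T2.rot.rot T5.swap t.swap' T3.rot (by grind) (by grind)).1
      · have : w ≠ x := by rintro rfl; exact nxd t.h32
        exact hc.th v d w y c x (by grind) (by grind)
    · exfalso
      have D := hq.d
      have : x ≠ p := by rintro rfl; exact nxd hq.2.2.1.symm
      have : x ≠ r := by
        rintro rfl
        rcases hx p hq.2.2.2.1.symm with h | h | h
        · exact hq.2.2.2.2.2.1 (by rw [h]; exact T5.h23)
        · exact m1 h.symm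
        · exact hq.2.2.2.2.2.2.2.1 h.symm
      exact hc.th y x v d p r (by grind) (by grind)
    · exact h
  refine ⟨big, fun h => h.not_nt hc big.nt, fun h => h.not_nt hc big.symm.nt, fun hd => ?_,
    fun hd => ?_⟩
  · rcases hd.cases hc big.nt T3.rot with ⟨_, _, h⟩ | ⟨_, _, _, h⟩
    · exact not_three h.1 T3.h21 T2.h32 T5.h23 T3.h23 T1.n13 T1.n12 T3.n13 T1.n32 n2 n3
    · exact five' (nb4 h.1 T3.h21 T2.h32 T5.h23 T3.h23 T1.n13 T1.n32 T1.n12 T3.n13 n2 n3)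
  · obtain ⟨F, hF, h1, h2, h3⟩ := big.nt
    have := hd.two hc hF hB h2 dB h3 nB
    subst this
    exact T3.nin hc hF vB h1 nB h2

/-- R3, neither -/
theorem B4.rb (hc : Ctx H R M) {v c x y d : W} {B : Finset W} (h : B4 H R M v c x y d B)
    (nx : ¬ A3' H R M x) (ny : ¬ A3' H R M y) (h3 : E3 H R M c x) : ¬ dem H R M x {v, c, x} := by
  obtain ⟨hv, T1, T2, T3, n1, n2, n3, hB, vB, cB, dB, nB⟩ := h
  intro hd
  have hd' : dem H R M x {x, v, c} := by
    convert hd using 1; ext; simp; tauto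
  rcases hd'.mid ⟨c, y, n1, T1.rot.rot, T2.swap⟩ h3.symm with h | h
  · rcases h.cases hc with h | ⟨_, _, _, _, h⟩
    · exact nx h
    · obtain ⟨w, h⟩ := h.align hc T1.rot.rot.swap' T2.swap n1
      have t1 := h.2.2.2.1
      have t2 := h.2.2.2.2.1
      by_cases e : w = d
      · subst e
        exact ny ⟨_, _, _, close3 hc T2.rot.rot t1.swap T3.rot⟩
      · have D1 := T1.d
        have D2 := T2.d
        have D3 := T3.d
        have D4 := t1.d
        have D5 := t2.d
        have := h.2.2.2.2.2.2
        exact hc.th v c w x y d (by grind) (by grind)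
  · exact nx h

theorem B3.x_not (hc : Ctx H R M) {v c x d : W} {B : Finset W} (h : B3 H R M v c x d B)
    (hx : ∀ z, H.Adj x z → z = v ∨ z = c ∨ z = d) : False := by
  obtain ⟨hv, T1, T2, n, -⟩ := h
  refine five hc (T1.six hc) (a := v) (b := x) (c := x) (s := c) (t := d) T1.n12 T2.n13 ?_ ?_ ?_
  · intro z hz; rcases hv z hz with h | h | h <;> simp [h]
  · intro z hz; rcases hx z hz with h | h | h <;> simp [h]
  · intro z hz; rcases hx z hz with h | h | h <;> simp [h]

theorem B3.xA (hc : Ctx H R M) {v c x d : W} {B : Finset W} (h : B3 H R M v c x d B) :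
    ¬ A3' H R M x := by
  rintro ⟨_, _, _, h'⟩
  have h0 := h
  obtain ⟨hv, T1, T2, n, -⟩ := h
  exact h0.x_not hc (nb3 h'.1 T1.h31 T1.h32 T2.h23 T1.n12 n T2.n13)

theorem B3.rc (hc : Ctx H R M) {v c x d : W} {B : Finset W} (h : B3 H R M v c x d B) :
    E3 H R M c x ∨ Bg H R M c x := by
  have h0 := h
  obtain ⟨hv, T1, T2, n3, -⟩ := h
  rcases T1.rot.cases' hc with h | ⟨p, r, hq, m1, m2⟩ | h
  · exact Or.inl h
  · exfalso
    have D := hq.d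
    have D1 := T1.d
    have D2 := T2.d
    have hyr : d ≠ r := by rintro rfl; exact hq.2.2.2.2.2.2.1 T2.h23
    by_cases e : d = p
    · subst e
      have f1 := closeQ hc T1.rot.rot.swap' T2.swap hq (by grind)
      exact h0.x_not hc (fun z hz => by rcases f1 z hz with h | h | h <;> simp [h])
    · exact hc.th c v d x p r (by grind) (by grind)
  · exact Or.inr h

/-- R4, big face -/
theorem B3.ra (hc : Ctx H R M) {v c x d : W} {B : Finset W} (h : B3 H R M v c x d B)
    (hb : Bg H R M v c) (h3 : E3 H R M c x) : ¬ (dem H R M v {v, c, x} ∧ dem H R M c {v, c, x} ∧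
      dem H R M x {v, c, x}) := by
  rintro ⟨hd1, hd2, hd3⟩
  have nx := h.xA hc
  obtain ⟨hv, T1, T2, n3, hB, vB, cB, dB, nB⟩ := h
  have s1 : ({v, c, x} : Finset W) = {x, v, c} := by ext; simp; tauto
  have s2 : ({v, c, x} : Finset W) = {x, c, v} := by ext; simp; tauto
  rcases (s1 ▸ hd3).mid ⟨c, d, n3, T1.rot.rot, T2.swap⟩ h3.symm with h | h
  · rcases h.cases hc with h | ⟨_, _, _, _, h⟩
    · exact nx h
    · obtain ⟨w, h⟩ := h.align hc T1.rot.rot.swap' T2.swap n3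
      exact (h.r hc (fun h => h.not_nt hc hb.symm.nt) (fun h => h.not_nt hc hb.nt)).2
        ⟨s2 ▸ hd2, s2 ▸ hd1⟩
  · exact nx h

theorem B3.qq1 (hc : Ctx H R M) {v c x d z : W} {B : Finset W} (h : B3 H R M v c x d B)
    (hq : Q4 H R M c v d z) (e : B = {c, v, d, z}) (h1 : E3 H R M c x) (h2 : E3 H R M d x) :
    False := by
  have nx := h.xA hc
  obtain ⟨hv, T1, T2, n3, hB, vB, cB, dB, nB⟩ := h
  obtain ⟨w, hw, t1⟩ := h1.other (z := v)
  obtain ⟨w', hw', t2⟩ := h2.other (z := v)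
  have D := hq.d
  have D1 := T1.d
  have D2 := T2.d
  have D3 := t1.d
  have D4 := t2.d
  have m1 : w ≠ d := by
    rintro rfl
    exact nx ⟨_, _, _, close3 hc T1.rot.rot.swap' T2.swap t1.rot.swap.swap⟩
  have m2 : w' ≠ c := by
    rintro rfl
    exact nx ⟨_, _, _, close3 hc T1.rot.rot.swap' T2.swap t2.swap⟩
  by_cases e1 : w = w'
  · subst e1
    have hx := T1.nin hc hB vB cB nB
    have : z ≠ x := by rintro rfl; rw [e] at hx; simp at hx
    by_cases e2 : z = w
    · subst e2
      have f1 := (close4 hc T1.rot.rot.swap' T2.swap t2.swap t1.rot (by grind) (by grind)).1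
      have f2 := closeQ hc T1.swap t1 hq.flip (by grind)
      refine five hc (T1.six hc) (a := v) (b := x) (c := c) (s := d) (t := z) T2.n13 hw.symm
        ?_ ?_ ?_
      · intro z hz; rcases hv z hz with h | h | h <;> simp [h]
      · intro z hz; rcases f1 z hz with h | h | h | h <;> simp [h]
      · intro z hz; rcases f2 z hz with h | h | h <;> simp [h]
    · exact hc.th c w x v d z (by grind) (by grind)
  · exact hc.th c w x w' d v (by grind) (by grind)

theorem B3.qq2 (hc : Ctx H R M) {v c x d z : W} {B : Finset W} (h : B3 H R M v c x d B)
    (hq : Q4 H R M c v d z) (e : B = {c, v, d, z}) (h1 : Bg H R M c x) :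
    ¬ dem H R M c {v, c, x} ∧ ¬ dem H R M x {v, c, x} := by
  have h0 := h
  obtain ⟨hv, T1, T2, n3, hB, vB, cB, dB, nB⟩ := h
  constructor
  · intro hd
    obtain ⟨F, hF, h1, h2, h3⟩ := h1.nt
    have := hd.two hc hF hB h1 cB h3 nB
    subst this
    exact T1.nin hc hF vB cB nB h2
  · intro hd
    rcases hd.cases hc h1.symm.nt T1.rot.swap with ⟨_, _, h⟩ | ⟨_, _, _, h⟩
    · exact h0.x_not hc (nb3 h.1 T1.h31 T1.h32 T2.h23 T1.n12 n3 T2.n13)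
    · rcases h.rc hc with h | h
      · exact h.not_nt hc hq.nt
      · obtain ⟨F, hF, a1, a2, a3⟩ := h
        have hx := T1.nin hc hB vB cB nB
        have hne : B ≠ {v, c, x} := by rintro rfl; simp at hx
        rcases hc.two T1.h12 hB T1.1 hF hne vB cB Ψ Ψ a2 a1 with e' | e'
        · subst e'
          have := hq.1
          rw [← e] at this
          rcases a3 with a3 | a3
          · exact this.2.1 a3
          · have := this.2.2
            omega
        · subst e'
          rcases a3 with a3 | a3
          · exact T1.2.1 a3
          · have := T1.2.2
            omega

/-- value of an edge -/
noncomputable def val (H R M : SimpleGraph W) (x y : W) : ℚ :=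
  if Bg H R M x y then 4 else if E3 H R M x y then 1 else 0

noncomputable def om (H R M : SimpleGraph W) (T : Finset W) : ℚ :=
  ∑ p ∈ (T ×ˢ T).filter (fun p => H.Adj p.1 p.2), val H R M p.1 p.2

noncomputable def kk (H R M : SimpleGraph W) (T : Finset W) : ℕ :=
  (T.filter (fun v => dem H R M v T)).card

noncomputable def sh (H R M : SimpleGraph W) (v : W) (T : Finset W) : ℚ :=
  if dem H R M v T then om H R M T / kk H R M T else 0

noncomputable def tris (H R M : SimpleGraph W) : Finset (Finset W) :=
  (Fcs H).filter (Sf H R M 3)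

theorem val_symm (x y : W) : val H R M x y = val H R M y x := by
  have h1 : Bg H R M x y ↔ Bg H R M y x := ⟨Bg.symm, Bg.symm⟩
  have h2 : E3 H R M x y ↔ E3 H R M y x := ⟨E3.symm, E3.symm⟩
  simp only [val, h1, h2]

theorem val_nonneg (x y : W) : 0 ≤ val H R M x y := by
  unfold val; split_ifs <;> norm_num

theorem val_bg (h : Bg H R M x y) : 4 ≤ val H R M x y := by simp [val, h]

theorem val_e3 (h : E3 H R M x y) : 1 ≤ val H R M x y := by
  unfold val; split_ifs <;> norm_num

theorem om_nonneg (T : Finset W) : 0 ≤ om H R M T := Finset.sum_nonneg (fun _ _ => val_nonneg _ _)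

theorem om_tri {a b c : W} (h : Tri H R M a b c) :
    om H R M {a, b, c} = 2 * (val H R M a b + val H R M b c + val H R M c a) := by
  have E := h.hd
  unfold om
  have n1 : a ∉ ({b, c} : Finset W) := by
    have := h.n12
    have := h.n13
    simp; tauto
  have n2 : b ∉ ({c} : Finset W) := by
    have := h.n23
    simp; tauto
  rw [Finset.sum_filter, Finset.sum_product]
  simp only [Finset.sum_insert n1, Finset.sum_insert n2, Finset.sum_singleton]
  simp [E, val_symm b a, val_symm c b, val_symm a c]
  ring

theorem sh_nonneg (v : W) (T : Finset W) : 0 ≤ sh H R M v T := by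
  unfold sh
  split_ifs
  · exact div_nonneg (om_nonneg T) (by positivity)
  · exact le_rfl

theorem sh_le {v a b : W} (h : Tri H R M v a b) (hd : dem H R M v {v, a, b}) (w : ℚ) (k : ℕ)
    (hw : w ≤ val H R M v a + val H R M a b + val H R M b v)
    (hk : kk H R M {v, a, b} ≤ k) : 2 * w / k ≤ sh H R M v {v, a, b} := by
  have h1 : 1 ≤ kk H R M {v, a, b} := by
    unfold kk
    rw [Nat.one_le_iff_ne_zero, Finset.card_ne_zero]
    exact ⟨v, by simpa using hd⟩
  have h0 := om_nonneg (H := H) (R := R) (M := M) {v, a, b}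
  rw [sh, if_pos hd]
  have e := om_tri h
  have h2 : (1 : ℚ) ≤ kk H R M {v, a, b} := by exact_mod_cast h1
  have h3 : (kk H R M {v, a, b} : ℚ) ≤ k := by exact_mod_cast hk
  rw [div_le_div_iff₀ (by linarith) (by linarith)]
  nlinarith

theorem kk3 {v a b : W} : kk H R M {v, a, b} ≤ 3 :=
  (Finset.card_filter_le _ _).trans Finset.card_le_three

theorem kk2a {v a b : W} (h : ¬ dem H R M a {v, a, b}) : kk H R M {v, a, b} ≤ 2 := by
  refine (Finset.card_le_card (t := {v, b}) ?_).trans Finset.card_le_two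
  intro z hz
  simp only [Finset.mem_filter, Finset.mem_insert, Finset.mem_singleton] at hz ⊢
  rcases hz with ⟨rfl | rfl | rfl, h'⟩
  · simp
  · exact absurd h' h
  · simp

theorem kk2b {v a b : W} (h : ¬ dem H R M b {v, a, b}) : kk H R M {v, a, b} ≤ 2 := by
  refine (Finset.card_le_card (t := {v, a}) ?_).trans Finset.card_le_two
  intro z hz
  simp only [Finset.mem_filter, Finset.mem_insert, Finset.mem_singleton] at hz ⊢
  rcases hz with ⟨rfl | rfl | rfl, h'⟩
  · simp
  · simp
  · exact absurd h' h

theorem kk1 {v a b : W} (h : ¬ dem H R M a {v, a, b}) (h' : ¬ dem H R M b {v, a, b}) :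
    kk H R M {v, a, b} ≤ 1 := by
  refine (Finset.card_le_card (t := {v}) ?_).trans Ψ
  intro z hz
  simp only [Finset.mem_filter, Finset.mem_insert, Finset.mem_singleton] at hz ⊢
  rcases hz with ⟨rfl | rfl | rfl, h''⟩
  · simp
  · exact absurd h'' h
  · exact absurd h'' h'

theorem Tri.mem {a b c : W} (h : Tri H R M a b c) : ({a, b, c} : Finset W) ∈ tris H R M :=
  Finset.mem_filter.2 ⟨h.1, h⟩

theorem sum_sh {v : W} {S : Finset (Finset W)} (h : S ⊆ tris H R M) :
    ∑ T ∈ S, sh H R M v T ≤ ∑ T ∈ tris H R M, sh H R M v T :=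
  Finset.sum_le_sum_of_subset_of_nonneg h (fun _ _ _ => sh_nonneg _ _)

theorem ne_set {v a b c d : W} (h1 : a ≠ v) (h2 : a ≠ c) (h3 : a ≠ d) :
    ({v, a, b} : Finset W) ≠ {v, c, d} := by
  intro e
  have : a ∈ ({v, c, d} : Finset W) := by rw [← e]; simp
  simp at this
  tauto

theorem ne_set' {v a b c d : W} (h1 : b ≠ v) (h2 : b ≠ c) (h3 : b ≠ d) :
    ({v, a, b} : Finset W) ≠ {v, c, d} := by
  intro e
  have : b ∈ ({v, c, d} : Finset W) := by rw [← e]; simp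
  simp at this
  tauto

theorem A3.sum (hc : Ctx H R M) {v a b c : W} (h : A3 H R M v a b c) :
    24 ≤ ∑ T ∈ tris H R M, sh H R M v T := by
  have key : ∀ {a b c : W}, A3 H R M v a b c → 4 + 2 * val H R M a b ≤ sh H R M v {v, a, b} := by
    intro a b c h
    have na := h.rim hc
    have nb := h.rot.rim hc
    have hvA : A3' H R M v := ⟨_, _, _, h⟩
    have hd : dem H R M v {v, a, b} := ⟨by simp, Or.inl hvA⟩
    have no : ∀ u, ¬ A3' H R M u → ¬ dem H R M u {v, a, b} := by
      rintro u hu ⟨-, h | ⟨h, -⟩⟩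
      · exact hu h
      · exact h v Ψ hvA
    obtain ⟨-, T1, T2, T3⟩ := h
    have v1 := val_e3 (H := H) (R := R) (M := M) (x := v) (y := a) ⟨b, c, T2.n23, T1, T3.swap'⟩
    have v2 := val_e3 (H := H) (R := R) (M := M) (x := b) (y := v) ⟨a, c, T3.n32, T1.rot.rot, T2.swap⟩
    have := sh_le T1 hd (2 + val H R M a b) 1 (by linarith) (kk1 (no _ na) (no _ nb))
    norm_num at this
    linarith
  have k1 := key h
  have k2 := key h.rot
  have k3 := key h.rot.rot
  have h0 := h
  obtain ⟨-, T1, T2, T3⟩ := h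
  have hs := sum_sh (v := v) (S := {{v, a, b}, {v, b, c}, {v, c, a}}) (H := H) (R := R) (M := M) (by
    intro T hT
    simp at hT
    rcases hT with rfl | rfl | rfl
    · exact T1.mem
    · exact T2.mem
    · exact T3.mem)
  have e1 := ne_set (b := b) T1.n21 T1.n23 T3.n32
  have e2 := ne_set' (a := a) T1.n31 T2.n23 T1.n32
  have e3 := ne_set (b := c) T1.n31 T2.n23 T1.n32
  rw [Finset.sum_insert (by simp [e1, e2]), Finset.sum_insert (by simp [e3]),
    Finset.sum_singleton] at hs
  have L : ∀ {x y}, E3 H R M x y ∨ Bg H R M x y → 1 ≤ val H R M x y := by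
    rintro x y (h | h)
    · exact val_e3 h
    · linarith [val_bg h]
  have l1 := L (h0.link hc)
  have l2 := L (h0.rot.link hc)
  have l3 := L (h0.rot.rot.link hc)
  rcases h0.link hc with g1 | g1
  · rcases h0.rot.link hc with g2 | g2
    · rcases h0.rot.rot.link hc with g3 | g3
      · exact (h0.not_all hc g1 g2 g3).elim
      · linarith [val_bg g3]
    · linarith [val_bg g2]
  · linarith [val_bg g1]

theorem A4.sum (hc : Ctx H R M) {v a b c d : W} (h : A4 H R M v a b c d) (hv : q0 H R M v) :
    24 ≤ ∑ T ∈ tris H R M, sh H R M v T := by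
  have nv : ¬ A3' H R M v := by
    rintro ⟨_, _, _, h'⟩
    obtain ⟨-, T1, T2, T3, T4, nac, nbd⟩ := h
    exact not_three h'.1 T1.h12 T2.h12 T3.h12 T4.h12 T1.n23 nac T4.n32 T2.n23 nbd T3.n23
  have hd : ∀ {a b : W}, ¬ A3' H R M a → ¬ A3' H R M b → dem H R M v {v, a, b} := by
    intro a b ha hb
    refine ⟨by simp, Or.inr ⟨?_, Or.inl hv⟩⟩
    intro w hw
    simp at hw
    rcases hw with rfl | rfl | rfl <;> assumption
  have vals : ∀ {a b c d : W}, A4 H R M v a b c d → Bg H R M a b →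
      6 ≤ val H R M v a + val H R M a b + val H R M b v := by
    rintro a b c d ⟨-, T1, T2, T3, T4, nac, nbd⟩ hb
    have v1 := val_e3 (H := H) (R := R) (M := M) (x := v) (y := a) ⟨b, d, nbd, T1, T4.swap'⟩
    have v2 := val_e3 (H := H) (R := R) (M := M) (x := b) (y := v) ⟨a, c, nac, T1.rot.rot, T2.swap⟩
    linarith [val_bg hb]
  have ra : ∀ {a b c d : W}, A4 H R M v a b c d → A3' H R M a →
      24 ≤ ∑ T ∈ tris H R M, sh H R M v T := by
    intro a b c d h hA
    have key : ∀ {a b c d : W}, A4 H R M v a b c d → A3' H R M a → 12 ≤ sh H R M v {v, b, c} := by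
      intro a b c d h hA
      obtain ⟨h1, h2, h3, h4, h5⟩ := h.ra hc hA
      have := sh_le h.2.2.1 (hd h2 h3) 6 1 (vals h.rot h1) (kk1 h4 h5)
      norm_num at this
      linarith
    have k1 := key h hA
    have k2 := key h.refl.rot hA
    obtain ⟨-, T1, T2, T3, T4, nac, nbd⟩ := h
    have hs := sum_sh (v := v) (S := {{v, b, c}, {v, d, c}}) (H := H) (R := R) (M := M) (by
      intro T hT
      simp at hT
      rcases hT with rfl | rfl
      · exact T2.mem
      · exact T3.swap'.mem)
    have e1 := ne_set (b := c) T1.n31 nbd T2.n23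
    rw [Finset.sum_insert (by simp [e1]), Finset.sum_singleton] at hs
    linarith
  by_cases ha : A3' H R M a
  · exact ra h ha
  by_cases hb : A3' H R M b
  · exact ra h.rot hb
  by_cases hcc : A3' H R M c
  · exact ra h.rot.rot hcc
  by_cases hdd : A3' H R M d
  · exact ra h.rot.rot.rot hdd
  have key : ∀ {a b c d : W}, A4 H R M v a b c d → ¬ A3' H R M a → ¬ A3' H R M b →
      6 ≤ sh H R M v {v, a, b} := by
    intro a b c d h ha hb
    obtain ⟨h1, h2⟩ := h.r hc ha hb
    have k : kk H R M {v, a, b} ≤ 2 := by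
      by_cases h3 : dem H R M a {v, a, b}
      · exact kk2b (fun h4 => h2 ⟨h3, h4⟩)
      · exact kk2a h3
    have := sh_le h.2.1 (hd ha hb) 6 2 (vals h h1) k
    norm_num at this
    linarith
  have k1 := key h ha hb
  have k2 := key h.rot hb hcc
  have k3 := key h.rot.rot hcc hdd
  have k4 := key h.rot.rot.rot hdd ha
  obtain ⟨-, T1, T2, T3, T4, nac, nbd⟩ := h
  have hs := sum_sh (v := v) (S := {{v, a, b}, {v, b, c}, {v, c, d}, {v, d, a}}) (H := H) (R := R)
    (M := M) (by
      intro T hT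
      simp at hT
      rcases hT with rfl | rfl | rfl | rfl
      · exact T1.mem
      · exact T2.mem
      · exact T3.mem
      · exact T4.mem)
  have e1 := ne_set (b := b) T1.n21 T1.n23 nac
  have e2 := ne_set (b := b) T1.n21 nac T4.n32
  have e3 := ne_set' (a := a) T1.n31 nbd T1.n32
  have e4 := ne_set (b := c) T1.n31 T2.n23 nbd
  have e5 := ne_set' (a := b) T2.n31 T3.n23 nac.symm
  have e6 := ne_set (b := d) T2.n31 T3.n23 nac.symm
  rw [Finset.sum_insert (by simp [e1, e2, e3]), Finset.sum_insert (by simp [e4, e5]),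
    Finset.sum_insert (by simp [e6]), Finset.sum_singleton] at hs
  linarith

theorem dem_q1 (hc : Ctx H R M) {v a b : W} (hv : q1 H R M v) (hn : NT H R M v a) (hav : a ≠ v)
    (ha : ¬ A3' H R M a) (hb : ¬ A3' H R M b) : dem H R M v {v, a, b} := by
  refine ⟨by simp, Or.inr ⟨?_, Or.inr ⟨hv, fun h => ?_⟩⟩⟩
  · intro w hw
    simp at hw
    rcases hw with rfl | rfl | rfl
    · exact fun h => h.not_nt hc hn
    · assumption
    · assumption
  · exact (h a Ψ hav).not_nt hc hn

theorem B4.sum (hc : Ctx H R M) {v c x y d : W} {B : Finset W} (h : B4 H R M v c x y d B)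
    (hv : q1 H R M v) : 12 ≤ ∑ T ∈ tris H R M, sh H R M v T := by
  have ra : ∀ {c x y d : W}, B4 H R M v c x y d B → A3' H R M x →
      12 ≤ ∑ T ∈ tris H R M, sh H R M v T := by
    intro c x y d h hA
    have hb := (h.big hc).2
    obtain ⟨h1, h2, h3, h4, h5⟩ := h.ra hc hA
    obtain ⟨-, T1, T2, T3, m1, m2, m3, -⟩ := h
    have e : ({v, y, d} : Finset W) = {v, d, y} := by ext; simp; tauto
    rw [e] at h4 h5
    have v1 := val_e3 (H := H) (R := R) (M := M) (x := y) (y := v) ⟨x, d, m2, T2.rot.rot, T3.swap⟩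
    have := sh_le T3.swap' (dem_q1 hc hv hb.nt T3.n31 h3 h2) 9 1
      (by linarith [val_bg hb, val_bg h1.symm]) (kk1 h5 h4)
    have hs := sum_sh (v := v) (S := {{v, d, y}}) (H := H) (R := R) (M := M) (by
      intro T hT
      simp at hT
      rw [hT]
      exact T3.swap'.mem)
    rw [Finset.sum_singleton] at hs
    norm_num at this
    linarith
  by_cases hx : A3' H R M x
  · exact ra h hx
  by_cases hy : A3' H R M y
  · exact ra h.refl hy
  have key : ∀ {c x y d : W}, B4 H R M v c x y d B → ¬ A3' H R M x → ¬ A3' H R M y →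
      6 ≤ sh H R M v {v, c, x} := by
    intro c x y d h hx hy
    have hb := (h.big hc).1
    have h0 := h
    obtain ⟨-, T1, T2, T3, m1, m2, m3, -⟩ := h
    have v1 := val_e3 (H := H) (R := R) (M := M) (x := x) (y := v) ⟨c, y, m1, T1.rot.rot, T2.swap⟩
    have v2 := val_bg hb
    have nc : ¬ A3' H R M c := fun h => h.not_nt hc hb.symm.nt
    have D := dem_q1 hc hv hb.nt T1.n21 nc hx
    rcases h0.rc hc with h3 | h3
    · have := sh_le T1 D 6 2 (by linarith [val_e3 h3]) (kk2b (h0.rb hc hx hy h3))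
      norm_num at this
      linarith
    · have := sh_le T1 D 9 3 (by linarith [val_bg h3]) kk3
      norm_num at this
      linarith
  have k1 := key h hx hy
  have k2 := key h.refl hy hx
  obtain ⟨-, T1, T2, T3, m1, m2, m3, -⟩ := h
  have hs := sum_sh (v := v) (S := {{v, c, x}, {v, d, y}}) (H := H) (R := R) (M := M) (by
    intro T hT
    simp at hT
    rcases hT with rfl | rfl
    · exact T1.mem
    · exact T3.swap'.mem)
  have e1 := ne_set (b := x) T1.n21 m3 m1
  rw [Finset.sum_insert (by simp [e1]), Finset.sum_singleton] at hs
  linarith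

theorem B3.sum (hc : Ctx H R M) {v c x d : W} {B : Finset W} (h : B3 H R M v c x d B)
    (hv : q1 H R M v) : 12 ≤ ∑ T ∈ tris H R M, sh H R M v T := by
  have nx := h.xA hc
  suffices hh : 12 ≤ sh H R M v {v, c, x} + sh H R M v {v, d, x} by
    obtain ⟨-, T1, T2, m1, -⟩ := h
    have hs := sum_sh (v := v) (S := {{v, c, x}, {v, d, x}}) (H := H) (R := R) (M := M) (by
      intro T hT
      simp at hT
      rcases hT with rfl | rfl
      · exact T1.mem
      · exact T2.swap'.mem)
    have e1 := ne_set (b := x) T1.n21 m1 T1.n23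
    rw [Finset.sum_insert (by simp [e1]), Finset.sum_singleton] at hs
    linarith
  have D : ∀ {c d : W}, B3 H R M v c x d B → dem H R M v {v, c, x} := by
    rintro c d ⟨-, T1, T2, m1, hB, vB, cB, dB, nB⟩
    have hn : NT H R M v c := ⟨B, hB, vB, cB, nB⟩
    exact dem_q1 hc hv hn T1.n21 (fun h => h.not_nt hc hn.symm) nx
  have V : ∀ {c d : W}, B3 H R M v c x d B → 1 ≤ val H R M x v := by
    rintro c d ⟨-, T1, T2, m1, -⟩
    exact val_e3 ⟨c, d, m1, T1.rot.rot, T2.swap⟩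
  rcases B_cases hc h.2.1 h.2.2.2.2.1 h.2.2.2.2.2.1 h.2.2.2.2.2.2.1 h.2.2.2.2.2.2.2.1 h.2.2.2.1
    h.2.2.1.h13 h.2.2.2.2.2.2.2.2 with ⟨z, hq, e⟩ | ⟨b1, b2⟩
  · have e' : B = {d, v, c, z} := by rw [e]; ext; simp; tauto
    have hq' : Q4 H R M d v c z := hq.flip.rot.rot.rot
    have vn := val_nonneg (H := H) (R := R) (M := M)
    have kb : ∀ {c d : W}, B3 H R M v c x d B → Q4 H R M c v d z → B = {c, v, d, z} →
        Bg H R M c x → 10 ≤ sh H R M v {v, c, x} := by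
      intro c d h hq e hb
      obtain ⟨h1, h2⟩ := h.qq2 hc hq e hb
      have := sh_le h.2.1 (D h) 5 1 (by linarith [val_bg hb, V h, vn v c]) (kk1 h1 h2)
      norm_num at this
      linarith
    have ke : ∀ {c d : W}, B3 H R M v c x d B → E3 H R M c x → Bg H R M d x →
        2 ≤ sh H R M v {v, c, x} := by
      intro c d h h3 hb
      have hn : ¬ dem H R M x {v, c, x} := by
        intro hd
        have s1 : ({v, c, x} : Finset W) = {x, v, c} := by ext; simp; tauto
        rcases (s1 ▸ hd).mid ⟨c, d, h.2.2.2.1, h.2.1.rot.rot, h.2.2.1.swap⟩ h3.symm with h | h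
        · exact h.not_nt hb.symm.nt
        · exact nx h
      have := sh_le h.2.1 (D h) 2 2 (by linarith [val_e3 h3, V h, vn v c]) (kk2b hn)
      norm_num at this
      linarith
    rcases h.rc hc with g1 | g1 <;> rcases h.refl.rc hc with g2 | g2
    · exact (h.qq1 hc hq e g1 g2).elim
    · linarith [ke h g1 g2, kb h.refl hq' e' g2]
    · linarith [kb h hq e g1, ke h.refl g2 g1]
    · linarith [kb h hq e g1, kb h.refl hq' e' g2]
  · have key : ∀ {c d : W}, B3 H R M v c x d B → Bg H R M v c → 6 ≤ sh H R M v {v, c, x} := by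
      intro c d h hb
      rcases h.rc hc with h3 | h3
      · have hk : kk H R M {v, c, x} ≤ 2 := by
          have := h.ra hc hb h3
          by_cases h4 : dem H R M c {v, c, x}
          · exact kk2b (fun h5 => this ⟨D h, h4, h5⟩)
          · exact kk2a h4
        have := sh_le h.2.1 (D h) 6 2 (by linarith [val_e3 h3, V h, val_bg hb]) hk
        norm_num at this
        linarith
      · have := sh_le h.2.1 (D h) 9 3 (by linarith [val_bg h3, V h, val_bg hb]) kk3
        norm_num at this
        linarith
    linarith [key h b1, key h.refl b2]

theorem sum_lb (hc : Ctx H R M) (v : W) :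
    (if q0 H R M v then 24 else if q1 H R M v then 12 else 0) ≤
      ∑ T ∈ tris H R M, sh H R M v T := by
  split_ifs with h h'
  · rcases h.cases hc with ⟨_, _, _, h1⟩ | ⟨_, _, _, _, h1⟩
    · exact h1.sum hc
    · exact h1.sum hc h
  · rcases h'.cases hc with ⟨_, _, _, _, h1⟩ | ⟨_, _, _, _, _, h1⟩
    · exact h1.sum hc h'
    · exact h1.sum hc h'
  · exact Finset.sum_nonneg (fun _ _ => sh_nonneg _ _)

theorem sum_ub (hc : Ctx H R M) :
    ∑ v, (if q0 H R M v then 24 else if q1 H R M v then 12 else 0 : ℚ) ≤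
      ∑ T ∈ tris H R M, om H R M T := by
  refine (Finset.sum_le_sum (fun v _ => sum_lb hc v)).trans ?_
  rw [Finset.sum_comm]
  refine Finset.sum_le_sum (fun T _ => ?_)
  have : ∑ v, sh H R M v T = kk H R M T * (om H R M T / kk H R M T) := by
    unfold sh
    rw [← Finset.sum_filter, Finset.sum_const, nsmul_eq_mul]
    congr 2
    unfold kk
    congr 1
    ext v
    simp only [Finset.mem_filter, Finset.mem_univ, true_and]
    exact ⟨fun h => ⟨h.1, h⟩, fun h => h.2⟩
  rw [this]
  by_cases h : (kk H R M T : ℚ) = 0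
  · rw [h]; simp; exact om_nonneg T
  · rw [mul_div_cancel₀ _ h]

/-- ordered adjacent pairs -/
noncomputable def Drt (H : SimpleGraph W) : Finset (W × W) :=
  Finset.univ.filter fun p => H.Adj p.1 p.2

theorem drt_card : (Drt H).card = 2 * H.edgeSet.ncard := by
  have h1 := H.sum_degrees_eq_twice_card_edges
  rw [Set.ncard_eq_toFinset_card']
  have : H.edgeSet.toFinset = H.edgeFinset := by rfl
  rw [this, ← h1]
  unfold Drt
  rw [Finset.card_filter, Fintype.sum_prod_type]
  refine Finset.sum_congr rfl fun x _ => ?_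
  rw [← Finset.card_filter, ← SimpleGraph.card_neighborFinset_eq_degree]
  congr 1
  ext y; simp

/-- darts inside a face -/
noncomputable def Din (H : SimpleGraph W) (F : Finset W) : Finset (W × W) :=
  (F ×ˢ F).filter fun p => H.Adj p.1 p.2

theorem din_card {F : Finset W} (hF : F ∈ Fcs H) : (Din H F).card = 2 * F.card := by
  unfold Din
  rw [Finset.card_filter, Finset.sum_product]
  have : ∀ x ∈ F, ∑ y ∈ F, (if H.Adj (x, y).1 (x, y).2 then 1 else 0) = 2 := by
    intro x hx
    rw [← Finset.card_filter]
    obtain ⟨a, ha, b, hb, hab, h1, h2, h3⟩ := (mem_Fcs.1 hF).1.nbrs (v := x) (by simpa using hx)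
    have : (F.filter fun y => H.Adj (x, y).1 (x, y).2) = {a, b} := by
      ext z
      simp only [Finset.mem_filter, Finset.mem_insert, Finset.mem_singleton]
      constructor
      · rintro ⟨h4, h5⟩; exact h3 z (by simpa using h4) h5
      · rintro (rfl | rfl)
        · exact ⟨by simpa using ha, h1⟩
        · exact ⟨by simpa using hb, h2⟩
    rw [this, Finset.card_pair hab]
  rw [Finset.sum_congr rfl this]
  simp [mul_comm]

/-- exchange of summation between faces and darts -/
theorem swap_sum (f : Finset W → W × W → ℚ) :
    ∑ F ∈ Fcs H, ∑ d ∈ Din H F, f F d =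
      ∑ d ∈ Drt H, ∑ F ∈ (Fcs H).filter (fun F => d.1 ∈ F ∧ d.2 ∈ F), f F d := by
  refine Finset.sum_comm' ?_
  intro F d
  simp [Din, Drt]
  tauto

theorem dart_faces (hc : Ctx H R M) {d : W × W} (hd : H.Adj d.1 d.2) : ∃ A B, A ≠ B ∧
    A ∈ Fcs H ∧ B ∈ Fcs H ∧ d.1 ∈ A ∧ d.2 ∈ A ∧ d.1 ∈ B ∧ d.2 ∈ B ∧
    (Fcs H).filter (fun F => d.1 ∈ F ∧ d.2 ∈ F) = {A, B} := by
  obtain ⟨A, B, hAB, h⟩ := face_two_card hc.tc hc.pl hd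
  have hA := (h A).2 (Or.inl rfl)
  have hB := (h B).2 (Or.inr rfl)
  refine ⟨A, B, hAB, hA.1, hB.1, hA.2.1, hA.2.2, hB.2.1, hB.2.2, ?_⟩
  ext C
  have := h C
  simp only [Finset.mem_filter, Finset.mem_insert, Finset.mem_singleton]
  exact this

noncomputable def sg (H R M : SimpleGraph W) (F : Finset W) (d : W × W) : ℚ :=
  if Sf H R M 3 F then -1 else if Sf H R M 4 F then 1 else if Sf H R M 5 F then -1 else
    -3 + (if R.Adj d.1 d.2 then 0 else 8)

theorem face_card3 {F : Finset W} (hF : F ∈ Fcs H) : 3 ≤ F.card := by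
  have hI := (mem_Fcs.1 hF).1
  obtain ⟨x, hx⟩ : ∃ x, x ∈ F := by
    obtain ⟨k, c, h, e⟩ := hI
    have := h.1
    have : c 0 ∈ (F : Set W) := by
      rw [e]; exact ⟨0, by simp; omega⟩
    exact ⟨c 0, by simpa using this⟩
  obtain ⟨a, ha, b, hb, hab, h1, h2, h3⟩ := hI.nbrs (v := x) (by simpa using hx)
  have n1 := H.ne_of_adj h1
  have n2 := H.ne_of_adj h2
  have : ({x, a, b} : Finset W) ⊆ F := by
    intro z hz
    simp at hz ha hb
    rcases hz with rfl | rfl | rfl <;> assumption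
  have h4 := Finset.card_le_card this
  rwa [Finset.card_eq_three.2 ⟨x, a, b, n1, n2, hab, rfl⟩] at h4

theorem face_kinds {F : Finset W} (hF : F ∈ Fcs H) : Sf H R M 3 F ∨ Sf H R M 4 F ∨ Sf H R M 5 F ∨
    ((Mk H R M F ∨ 6 ≤ F.card) ∧ ∀ k ≤ 5, ¬ Sf H R M k F) := by
  have h3 := face_card3 hF
  by_cases hm : Mk H R M F
  · right; right; right; exact ⟨Or.inl hm, fun k _ h => h.2.1 hm⟩
  by_cases h6 : 6 ≤ F.card
  · right; right; right; exact ⟨Or.inr h6, fun k hk h => by have := h.2.2; omega⟩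
  have : F.card = 3 ∨ F.card = 4 ∨ F.card = 5 := by omega
  rcases this with h | h | h
  · left; exact ⟨hF, hm, h⟩
  · right; left; exact ⟨hF, hm, h⟩
  · right; right; left; exact ⟨hF, hm, h⟩

theorem Sf.ne {k l : ℕ} {F : Finset W} (h : Sf H R M k F) (hkl : k ≠ l) : ¬ Sf H R M l F :=
  fun h' => hkl (h.2.2.symm.trans h'.2.2)

theorem face_ineq (hc : Ctx H R M) {F : Finset W} (hF : F ∈ Fcs H) :
    96 - 34 * (F.card : ℚ) + 12 * (if Sf H R M 3 F then 0 else (F.card : ℚ)) ≤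
      ∑ d ∈ Din H F, sg H R M F d := by
  have hd := din_card hF
  rcases face_kinds (R := R) (M := M) hF with h | h | h | ⟨h, hk⟩
  · simp [sg, h, hd, h.2.2]; norm_num
  · have h3 := h.ne (l := 3) (by norm_num)
    simp [sg, h, h3, hd, h.2.2]; norm_num
  · have h3 := h.ne (l := 3) (by norm_num)
    have h4 := h.ne (l := 4) (by norm_num)
    simp [sg, h, h3, h4, hd, h.2.2]; norm_num
  · have h3 := hk 3 (by norm_num)
    have h4 := hk 4 (by norm_num)
    have h5 := hk 5 (by norm_num)
    simp only [sg, h3, h4, h5, if_false]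
    have e : ((F ×ˢ F).filter fun p => H.Adj p.1 p.2 ∧ ¬ R.Adj p.1 p.2).card =
        ((Din H F).filter fun p => ¬ R.Adj p.1 p.2).card := by
      congr 1
      ext p; simp [Din]; tauto
    have hl : 12 ≤ 2 * F.card + ((Din H F).filter fun p => ¬ R.Adj p.1 p.2).card := by
      rcases h with h | h
      · rw [← e]; exact hc.long F hF h
      · omega
    have e2 : ∑ d ∈ Din H F, (if R.Adj d.1 d.2 then (0:ℚ) else 8) =
        8 * ((Din H F).filter fun p => ¬ R.Adj p.1 p.2).card := by
      rw [Finset.card_filter]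
      push_cast
      rw [Finset.mul_sum]
      refine Finset.sum_congr rfl fun d _ => ?_
      by_cases h : R.Adj d.1 d.2 <;> simp [h]
    rw [Finset.sum_add_distrib, e2, Finset.sum_const, hd]
    have hl' : (12:ℚ) ≤ 2 * F.card + ((Din H F).filter fun p => ¬ R.Adj p.1 p.2).card := by
      exact_mod_cast hl
    simp
    linarith

theorem small_unmarked {F : Finset W} {k : ℕ} (hF : Sf H R M k F) (hx : x ∈ F) (hy : y ∈ F)
    (h : H.Adj x y) : R.Adj x y ∧ ¬ M.Adj x y := by
  constructor
  · exact hF.radj hx hy h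
  · intro hm; exact hF.2.1 ⟨x, hx, y, hy, h, Or.inr hm⟩

theorem not_bg {A B : Finset W} (hcov : ∀ C ∈ Fcs H, x ∈ C → y ∈ C → C = A ∨ C = B)
    {k l : ℕ} (hk : k ≤ 5) (hl : l ≤ 5) (hA : Sf H R M k A) (hB : Sf H R M l B) : ¬ Bg H R M x y := by
  rintro ⟨F, h1, h2, h3, h4⟩
  rcases hcov F h1 h2 h3 with rfl | rfl
  · rcases h4 with h | h
    · exact hA.2.1 h
    · have := hA.2.2; omega
  · rcases h4 with h | h
    · exact hB.2.1 h
    · have := hB.2.2; omega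

theorem not_e3 (hc : Ctx H R M) {A : Finset W} (hA : A ∈ Fcs H) (h3 : ¬ Sf H R M 3 A)
    (hx : x ∈ A) (hy : y ∈ A) : ¬ E3 H R M x y :=
  fun h => E3.not_nt hc h ⟨A, hA, hx, hy, h3⟩

/-- half of the dart inequality -/
theorem dart_aux (hc : Ctx H R M) {A B : Finset W} (hxy : H.Adj x y) (hAB : A ≠ B)
    (hA : A ∈ Fcs H) (hB : B ∈ Fcs H) (xA : x ∈ A) (yA : y ∈ A) (xB : x ∈ B) (yB : y ∈ B)
    (hcov : ∀ C ∈ Fcs H, x ∈ C → y ∈ C → C = A ∨ C = B) :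
    (sg H R M A (x, y) + if Sf H R M 3 A then val H R M x y else 0) +
    (sg H R M B (x, y) + if Sf H R M 3 B then val H R M x y else 0) ≤
      10 * (if R.Adj x y then 0 else 1) - 6 * (if M.Adj x y then 1 else 0) := by
  have mr : M.Adj x y → R.Adj x y := fun h => hc.mr h
  rcases face_kinds (R := R) (M := M) hA with h | h | h | ⟨h, hk⟩ <;>
  rcases face_kinds (R := R) (M := M) hB with h' | h' | h' | ⟨h', hk'⟩
  · obtain ⟨m1, m2⟩ := small_unmarked h xA yA hxy
    have nb := not_bg hcov (by norm_num) (by norm_num) h h'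
    have : val H R M x y ≤ 1 := by
      unfold val; simp [nb]; split_ifs <;> norm_num
    simp [sg, h, h', m1, m2]; linarith
  · obtain ⟨m1, m2⟩ := small_unmarked h xA yA hxy
    have n3 := h'.ne (l := 3) (by norm_num)
    have nb := not_bg hcov (by norm_num) (by norm_num) h h'
    have ne := not_e3 hc hB n3 xB yB
    simp [sg, h, h', m1, m2, n3, val, nb, ne]
  · obtain ⟨m1, m2⟩ := small_unmarked h xA yA hxy
    have n3 := h'.ne (l := 3) (by norm_num)
    have n4 := h'.ne (l := 4) (by norm_num)
    have nb := not_bg hcov (by norm_num) (by norm_num) h h'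
    have ne := not_e3 hc hB n3 xB yB
    simp [sg, h, h', m1, m2, n3, n4, val, nb, ne]
  · obtain ⟨m1, m2⟩ := small_unmarked h xA yA hxy
    have nb : Bg H R M x y := ⟨B, hB, xB, yB, h'⟩
    simp [sg, h, m1, m2, hk' 3, hk' 4, hk' 5, val, nb]; norm_num
  · obtain ⟨m1, m2⟩ := small_unmarked h xA yA hxy
    have n3 := h.ne (l := 3) (by norm_num)
    have nb := not_bg hcov (by norm_num) (by norm_num) h h'
    have ne := not_e3 hc hA n3 xA yA
    simp [sg, h, h', m1, m2, n3, val, nb, ne]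
  · exact (q4q4 hc h h' hAB xA yA xB yB hxy).elim
  · obtain ⟨m1, m2⟩ := small_unmarked h xA yA hxy
    simp [sg, h, h', m1, m2, h.ne (l := 3), h'.ne (l := 3), h'.ne (l := 4)]
  · obtain ⟨m1, m2⟩ := small_unmarked h xA yA hxy
    simp [sg, h, m1, m2, h.ne (l := 3), hk' 3, hk' 4, hk' 5]
  · obtain ⟨m1, m2⟩ := small_unmarked h xA yA hxy
    have n3 := h.ne (l := 3) (by norm_num)
    have n4 := h.ne (l := 4) (by norm_num)
    have nb := not_bg hcov (by norm_num) (by norm_num) h h'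
    have ne := not_e3 hc hA n3 xA yA
    simp [sg, h, h', m1, m2, n3, n4, val, nb, ne]
  · obtain ⟨m1, m2⟩ := small_unmarked h xA yA hxy
    simp [sg, h, h', m1, m2, h.ne (l := 3), h'.ne (l := 3), h.ne (l := 4)]
  · obtain ⟨m1, m2⟩ := small_unmarked h xA yA hxy
    simp [sg, h, h', m1, m2, h.ne (l := 3), h'.ne (l := 3), h.ne (l := 4), h'.ne (l := 4)]
    try norm_num
  · obtain ⟨m1, m2⟩ := small_unmarked h xA yA hxy
    simp [sg, h, m1, m2, h.ne (l := 3), h.ne (l := 4), hk' 3, hk' 4, hk' 5]; norm_num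
  · obtain ⟨m1, m2⟩ := small_unmarked h' xB yB hxy
    have nb : Bg H R M x y := ⟨A, hA, xA, yA, h⟩
    simp [sg, h', m1, m2, hk 3, hk 4, hk 5, val, nb]; norm_num
  · obtain ⟨m1, m2⟩ := small_unmarked h' xB yB hxy
    simp [sg, h', m1, m2, h'.ne (l := 3), hk 3, hk 4, hk 5]
  · obtain ⟨m1, m2⟩ := small_unmarked h' xB yB hxy
    simp [sg, h', m1, m2, h'.ne (l := 3), h'.ne (l := 4), hk 3, hk 4, hk 5]; norm_num
  · by_cases hr : R.Adj x y
    · by_cases hm : M.Adj x y <;>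
      · simp [sg, hr, hm, hk 3, hk 4, hk 5, hk' 3, hk' 4, hk' 5]; try norm_num
    · have hm : ¬ M.Adj x y := fun h => hr (mr h)
      simp [sg, hr, hm, hk 3, hk 4, hk 5, hk' 3, hk' 4, hk' 5]; norm_num

theorem vert_count (v : W) : (24:ℚ) ≤ 12 * (((Fcs H).filter fun F => v ∈ F ∧ ¬ Sf H R M 3 F).card : ℚ) +
    (if q0 H R M v then 24 else if q1 H R M v then 12 else 0 : ℚ) := by
  set Q := (Fcs H).filter fun F => v ∈ F ∧ ¬ Sf H R M 3 F with hQ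
  by_cases h0 : Q.card = 0
  · have : q0 H R M v := by
      intro F hF hv
      by_contra hn
      have : F ∈ Q := by simp [hQ, hF, hv, hn]
      rw [Finset.card_eq_zero] at h0
      simp [h0] at this
    simp [this]
  by_cases h1 : Q.card = 1
  · obtain ⟨B, hB⟩ := Finset.card_eq_one.1 h1
    have hBQ : B ∈ Q := by simp [hB]
    have : q1 H R M v := by
      simp only [hQ, Finset.mem_filter] at hBQ
      refine ⟨B, hBQ.1, hBQ.2.1, hBQ.2.2, ?_⟩
      intro F hF hv hne
      by_contra hn
      have : F ∈ Q := by simp [hQ, hF, hv, hn]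
      rw [hB] at this
      simp at this; exact hne this
    rw [h1]
    by_cases h0 : q0 H R M v <;> simp [this, h0] <;> norm_num
  have : (2:ℚ) ≤ Q.card := by
    have : 2 ≤ Q.card := by omega
    exact_mod_cast this
  split_ifs <;> linarith

theorem count (hc : Ctx H R M) : 7 * (H.edgeSet.ncard : ℤ) - 18 * Fintype.card W + 48 ≤
    5 * ((H.edgeSet.ncard : ℤ) - R.edgeSet.ncard) - 3 * M.edgeSet.ncard := by
  have eu := euler hc.tc hc.pl
  have ub := sum_ub hc
  -- vertices
  have hv : (24:ℚ) * Fintype.card W ≤ 12 * ∑ F ∈ Fcs H, (if Sf H R M 3 F then 0 else (F.card : ℚ)) +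
      ∑ v, (if q0 H R M v then 24 else if q1 H R M v then 12 else 0 : ℚ) := by
    have h1 := Finset.sum_le_sum fun v (_ : v ∈ (Finset.univ : Finset W)) =>
      vert_count (H := H) (R := R) (M := M) v
    rw [Finset.sum_add_distrib, ← Finset.mul_sum] at h1
    have h2 : ∑ v : W, (((Fcs H).filter fun F => v ∈ F ∧ ¬ Sf H R M 3 F).card : ℚ) =
        ∑ F ∈ Fcs H, (if Sf H R M 3 F then 0 else (F.card : ℚ)) := by
      simp only [Finset.card_filter]
      push_cast
      rw [Finset.sum_comm]
      refine Finset.sum_congr rfl fun F _ => ?_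
      by_cases h : Sf H R M 3 F <;> simp [h]
    rw [h2] at h1
    simp at h1
    linarith
  -- darts
  have hd2 : ∑ F ∈ Fcs H, (F.card : ℚ) = (Drt H).card := by
    have h1 := swap_sum (H := H) fun _ _ => 1
    have h2 : ∑ F ∈ Fcs H, ∑ d ∈ Din H F, (1:ℚ) = ∑ F ∈ Fcs H, 2 * (F.card : ℚ) := by
      refine Finset.sum_congr rfl fun F hF => ?_
      simp [din_card hF]
    have h3 : ∑ d ∈ Drt H, ∑ F ∈ (Fcs H).filter (fun F => d.1 ∈ F ∧ d.2 ∈ F), (1:ℚ) =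
        ∑ d ∈ Drt H, 2 := by
      refine Finset.sum_congr rfl fun d hd => ?_
      obtain ⟨A, B, hAB, _, _, _, _, _, _, e⟩ := dart_faces hc (d := d) (by simpa [Drt] using hd)
      rw [e]; simp [Finset.card_pair hAB]
    rw [h2, h3, ← Finset.mul_sum] at h1
    simp at h1
    linarith
  have hf := Finset.sum_le_sum fun F (hF : F ∈ Fcs H) => face_ineq hc hF
  rw [Finset.sum_add_distrib, Finset.sum_sub_distrib, ← Finset.mul_sum, ← Finset.mul_sum, hd2] at hf
  have hom : ∑ T ∈ tris H R M, om H R M T =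
      ∑ F ∈ Fcs H, ∑ d ∈ Din H F, (if Sf H R M 3 F then val H R M d.1 d.2 else 0) := by
    unfold tris
    rw [Finset.sum_filter]
    refine Finset.sum_congr rfl fun F _ => ?_
    by_cases h : Sf H R M 3 F <;> simp [h, om, Din]
  have hdart : ∑ F ∈ Fcs H, ∑ d ∈ Din H F,
      (sg H R M F d + if Sf H R M 3 F then val H R M d.1 d.2 else 0) ≤
      ∑ d ∈ Drt H, (10 * (if R.Adj d.1 d.2 then 0 else 1) - 6 * (if M.Adj d.1 d.2 then 1 else 0) : ℚ) := by
    rw [swap_sum]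
    refine Finset.sum_le_sum fun d hd => ?_
    have hd : H.Adj d.1 d.2 := by simpa [Drt] using hd
    obtain ⟨A, B, hAB, hA, hB, xA, yA, xB, yB, e⟩ := dart_faces hc hd
    rw [e, Finset.sum_pair hAB]
    refine dart_aux hc hd hAB hA hB xA yA xB yB ?_
    intro C hC h1 h2
    have : C ∈ (Fcs H).filter (fun F => d.1 ∈ F ∧ d.2 ∈ F) := by simp [hC, h1, h2]
    rw [e] at this
    simpa using this
  simp only [Finset.sum_add_distrib] at hdart
  rw [← hom, Finset.sum_sub_distrib, ← Finset.mul_sum, ← Finset.mul_sum] at hdart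
  have hR : ∑ d ∈ Drt H, (if R.Adj d.1 d.2 then 0 else 1 : ℚ) = (Drt H).card - (Drt R).card := by
    have h1 : ∑ d ∈ Drt H, (if R.Adj d.1 d.2 then 1 else 0 : ℚ) = (Drt R).card := by
      rw [← Finset.sum_filter]
      simp
      congr 1
      ext d; simp [Drt]; exact fun h => hc.rh h
    have h2 : ∑ d ∈ Drt H, (if R.Adj d.1 d.2 then 0 else 1 : ℚ) =
        ∑ d ∈ Drt H, (1 - (if R.Adj d.1 d.2 then 1 else 0 : ℚ)) := by
      refine Finset.sum_congr rfl fun d _ => ?_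
      by_cases h : R.Adj d.1 d.2 <;> simp [h]
    rw [h2, Finset.sum_sub_distrib, h1]
    simp
  have hM : ∑ d ∈ Drt H, (if M.Adj d.1 d.2 then 1 else 0 : ℚ) = (Drt M).card := by
    rw [← Finset.sum_filter]
    simp
    congr 1
    ext d; simp [Drt]; exact fun h => hc.rh (hc.mr h)
  rw [hR, hM, drt_card, drt_card, drt_card] at hdart
  rw [drt_card] at hf
  simp only [Finset.sum_const, nsmul_eq_mul] at hf
  push_cast at hf hdart
  have eu' : (H.edgeSet.ncard : ℚ) + 2 ≤ Fintype.card W + (Fcs H).card := by exact_mod_cast eu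
  have : 7 * (H.edgeSet.ncard : ℚ) - 18 * Fintype.card W + 48 ≤
    5 * ((H.edgeSet.ncard : ℚ) - R.edgeSet.ncard) - 3 * M.edgeSet.ncard := by
    linarith
  exact_mod_cast this

end Local2

section Pieces

open Classical

variable {V : Type*} [Fintype V] {G : SimpleGraph V} {S A B : Finset V} {a b : V}

/-- number of edges inside `S` -/
noncomputable def en (G : SimpleGraph V) (S : Finset V) : ℕ :=
  (G.edgeFinset.filter fun e => ∀ x ∈ e, x ∈ S).card

theorem en_union (h : ∀ x ∈ A, x ∉ B → ∀ y ∈ B, y ∉ A → ¬ G.Adj x y) :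
    en G (A ∪ B) + en G (A ∩ B) = en G A + en G B := by
  unfold en
  rw [← Finset.card_union_add_card_inter (G.edgeFinset.filter fun e => ∀ x ∈ e, x ∈ A)]
  congr 2
  · ext e
    induction e using Sym2.ind with
    | _ u v =>
      simp only [Finset.mem_filter, mem_edgeFinset, mem_edgeSet, Sym2.mem_iff, forall_eq_or_imp,
        forall_eq, Finset.mem_union]
      constructor
      · rintro ⟨h1, h2, h3⟩
        by_cases uA : u ∈ A
        · by_cases vA : v ∈ A
          · exact Or.inl ⟨h1, uA, vA⟩
          · have vB := h3.resolve_left vA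
            by_cases uB : u ∈ B
            · exact Or.inr ⟨h1, uB, vB⟩
            · exact absurd h1 (h u uA uB v vB vA)
        · have uB := h2.resolve_left uA
          by_cases vB : v ∈ B
          · exact Or.inr ⟨h1, uB, vB⟩
          · exact absurd h1.symm (h v (h3.resolve_right vB) vB u uB uA)
      · rintro (⟨h1, h2, h3⟩ | ⟨h1, h2, h3⟩)
        · exact ⟨h1, Or.inl h2, Or.inl h3⟩
        · exact ⟨h1, Or.inr h2, Or.inr h3⟩
  · ext e
    simp only [Finset.mem_filter, Finset.mem_inter]
    constructor
    · rintro ⟨h1, h2⟩; exact ⟨⟨h1, fun x hx => (h2 x hx).1⟩, h1, fun x hx => (h2 x hx).2⟩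
    · rintro ⟨⟨h1, h2⟩, -, h3⟩; exact ⟨h1, fun x hx => ⟨h2 x hx, h3 x hx⟩⟩

theorem en_insert {v : V} (hv : v ∉ S) :
    en G (insert v S) = en G S + (S.filter fun u => G.Adj v u).card := by
  unfold en
  have e : (G.edgeFinset.filter fun e => ∀ x ∈ e, x ∈ insert v S) =
      (G.edgeFinset.filter fun e => ∀ x ∈ e, x ∈ S) ∪
        (S.filter fun u => G.Adj v u).image (fun u => s(v, u)) := by
    ext e
    induction e using Sym2.ind with
    | _ a b =>
      simp only [Finset.mem_filter, mem_edgeFinset, mem_edgeSet, Sym2.mem_iff, forall_eq_or_imp,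
        forall_eq, Finset.mem_union, Finset.mem_insert, Finset.mem_image]
      constructor
      · rintro ⟨h1, rfl | h2, rfl | h3⟩
        · exact absurd h1 (G.loopless.irrefl _)
        · exact Or.inr ⟨b, ⟨h3, h1⟩, rfl⟩
        · exact Or.inr ⟨a, ⟨h2, h1.symm⟩, Sym2.eq_swap⟩
        · exact Or.inl ⟨h1, h2, h3⟩
      · rintro (⟨h1, h2, h3⟩ | ⟨u, ⟨h2, h3⟩, h4⟩)
        · exact ⟨h1, Or.inr h2, Or.inr h3⟩
        · rw [Sym2.eq_iff] at h4
          rcases h4 with ⟨rfl, rfl⟩ | ⟨rfl, rfl⟩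
          · exact ⟨h3, Or.inl rfl, Or.inr h2⟩
          · exact ⟨h3.symm, Or.inr h2, Or.inl rfl⟩
  rw [e, Finset.card_union_of_disjoint, Finset.card_image_of_injective]
  · intro x y h
    simp only [Sym2.eq_iff] at h
    rcases h with ⟨-, h⟩ | ⟨h1, h2⟩
    · exact h
    · rw [h2, h1]
  · rw [Finset.disjoint_left]
    intro e h1 h2
    simp only [Finset.mem_filter, Finset.mem_image] at h1 h2
    obtain ⟨u, _, rfl⟩ := h2
    exact hv (h1.2 v Ψ)

theorem en_empty : en G ∅ = 0 := by
  unfold en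
  rw [Finset.card_eq_zero, Finset.filter_eq_empty_iff]
  intro e _ h
  induction e using Sym2.ind with
  | _ a b =>
    have := h a Ψ
    simp at this

theorem en_le (S : Finset V) : 2 * en G S ≤ S.card * (S.card - 1) := by
  induction S using Finset.induction_on with
  | empty => simp [en_empty]
  | insert v S hv ih =>
    rw [en_insert hv, Finset.card_insert_of_notMem hv]
    have := Finset.card_filter_le S fun u => G.Adj v u
    have h2 : (S.card + 1) * (S.card + 1 - 1) = S.card * (S.card - 1) + 2 * S.card := by
      rcases S.card with _ | k
      · simp
      · simp; ring
    omega

theorem en_single (c : V) : en G {c} = 0 := by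
  have h := en_le (G := G) {c}
  simpa using h

theorem en_sum {v : V} (hv : v ∉ S) :
    en G (insert v S) = en G S + ∑ u ∈ S, (if G.Adj v u then 1 else 0) := by
  rw [en_insert hv, Finset.card_filter]

theorem en_pair (h : a ≠ b) : en G {a, b} = if G.Adj a b then 1 else 0 := by
  have h1 : a ∉ ({b} : Finset V) := by simpa using h
  rw [en_sum h1, en_single, Finset.sum_singleton, zero_add]

theorem en_univ : en G Finset.univ = G.edgeSet.ncard := by
  unfold en
  rw [Set.ncard_eq_toFinset_card']
  congr 1
  ext e; simp

/-- `X` is closed under adjacency inside `S \ {v}` -/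
def Clo (G : SimpleGraph V) (S : Finset V) (v : V) (X : V → Prop) : Prop :=
  ∀ x ∈ S, x ≠ v → X x → ∀ y ∈ S, y ≠ v → G.Adj x y → X y

theorem Clo.compl {v : V} {X : V → Prop} (h : Clo G S v X) :
    Clo G S v (fun z => ¬ X z) := by
  intro x hx hxv hX y hy hyv hxy hY
  exact hX (h y hy hyv hY x hx hxv hxy.symm)

/-- `G[S]` is 2-connected -/
def T2 (G : SimpleGraph V) (S : Finset V) : Prop :=
  3 ≤ S.card ∧ ∀ v X, Clo G S v X → (∃ x ∈ S, x ≠ v ∧ X x) → ∀ x ∈ S, x ≠ v → X x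

/-- a separation with separator `{a, b}` -/
structure Sp (G : SimpleGraph V) (A B : Finset V) (a b : V) : Prop where
  ne : a ≠ b
  aA : a ∈ A
  bA : b ∈ A
  aB : a ∈ B
  bB : b ∈ B
  inter : ∀ x ∈ A, x ∈ B → x = a ∨ x = b
  nx : ∀ x ∈ A, x ∉ B → ∀ y ∈ B, y ∉ A → ¬ G.Adj x y

theorem Sp.symm (h : Sp G A B a b) : Sp G B A a b :=
  ⟨h.ne, h.aB, h.bB, h.aA, h.bA, fun x h1 h2 => h.inter x h2 h1,
    fun x h1 h2 y h3 h4 hxy => h.nx y h3 h4 x h1 h2 hxy.symm⟩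

theorem Sp.int (h : Sp G A B a b) : A ∩ B = {a, b} := by
  ext x
  simp only [Finset.mem_inter, Finset.mem_insert, Finset.mem_singleton]
  constructor
  · rintro ⟨h1, h2⟩; exact h.inter x h1 h2
  · rintro (rfl | rfl)
    · exact ⟨h.aA, h.aB⟩
    · exact ⟨h.bA, h.bB⟩

theorem Sp.card (h : Sp G A B a b) :
    (A ∪ B).card + 2 = A.card + B.card := by
  rw [← Finset.card_union_add_card_inter, h.int, Finset.card_pair h.ne]

theorem Sp.en (h : Sp G A B a b) :
    en G (A ∪ B) + (if G.Adj a b then 1 else 0) = en G A + en G B := by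
  rw [← en_union h.nx, h.int, en_pair h.ne]

/-- a piece with terminals `a`, `b`: adding `ab` makes it 2-connected, and there is a connection
outside between the terminals -/
structure Pc (G : SimpleGraph V) (S : Finset V) (a b : V) : Prop where
  aS : a ∈ S
  bS : b ∈ S
  ne : a ≠ b
  cl : ∀ v X, Clo G S v X → (∃ x ∈ S, x ≠ v ∧ X x) → (a ≠ v → b ≠ v → (X a ↔ X b)) →
    ∀ x ∈ S, x ≠ v → X x
  two : (∀ x ∈ S, x = a ∨ x = b) → G.Adj a b
  ou : ∃ Q : Set V, Cn G Q ∧ (∀ x ∈ Q, x ∉ S) ∧ (∃ x ∈ Q, G.Adj a x) ∧ ∃ x ∈ Q, G.Adj b x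

theorem Pc.symm (h : Pc G S a b) : Pc G S b a := by
  refine ⟨h.bS, h.aS, h.ne.symm, ?_, ?_, ?_⟩
  · intro v X h1 h2 h3
    exact h.cl v X h1 h2 fun h4 h5 => (h3 h5 h4).symm
  · intro h1
    exact (h.two fun x hx => (h1 x hx).symm).symm
  · obtain ⟨Q, h1, h2, h3, h4⟩ := h.ou
    exact ⟨Q, h1, h2, h4, h3⟩

theorem Pc.t2 (h : Pc G S a b) (hab : G.Adj a b) (h3 : 3 ≤ S.card) :
    T2 G S := by
  refine ⟨h3, fun v X h1 h2 => h.cl v X h1 h2 fun h4 h5 => ⟨fun h6 => ?_, fun h6 => ?_⟩⟩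
  · exact h1 a h.aS h4 h6 b h.bS h5 hab
  · exact h1 b h.bS h5 h6 a h.aS h4 hab.symm

/-- the sides of a separation of a 2-connected set are pieces -/
theorem T2.piece (hT : T2 G (A ∪ B)) (h : Sp G A B a b)
    (hA : ∃ x ∈ A, x ∉ B) (hB : ∃ x ∈ B, x ∉ A) : Pc G A a b := by
  refine ⟨h.aA, h.bA, h.ne, ?_, ?_, ?_⟩
  · intro v X h1 h2 h3 x hx hxv
    have := hT.2 v (fun z => if z ∈ A then X z else ((a ≠ v ∧ X a) ∨ (b ≠ v ∧ X b))) ?_ ?_ x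
      (by simp [hx]) hxv
    · simpa [hx] using this
    · intro y hy hyv hXy z hz hzv hyz
      rw [Finset.mem_union] at hy hz
      by_cases yA : y ∈ A <;> by_cases zA : z ∈ A
      · rw [if_pos yA] at hXy
        rw [if_pos zA]
        exact h1 y yA hyv hXy z zA hzv hyz
      · rw [if_pos yA] at hXy
        rw [if_neg zA]
        have zB : z ∈ B := by tauto
        have yB : y ∈ B := by
          by_contra hn
          exact h.nx y yA hn z zB zA hyz
        rcases h.inter y yA yB with rfl | rfl
        · exact Or.inl ⟨hyv, hXy⟩
        · exact Or.inr ⟨hyv, hXy⟩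
      · rw [if_neg yA] at hXy
        rw [if_pos zA]
        have yB : y ∈ B := by tauto
        have zB : z ∈ B := by
          by_contra hn
          exact h.nx z zA hn y yB yA hyz.symm
        rcases h.inter z zA zB with rfl | rfl
        · rcases hXy with h4 | h4
          · exact h4.2
          · exact (h3 hzv h4.1).2 h4.2
        · rcases hXy with h4 | h4
          · exact (h3 h4.1 hzv).1 h4.2
          · exact h4.2
      · rw [if_neg yA] at hXy
        rw [if_neg zA]
        exact hXy
    · obtain ⟨y, hy, hyv, hXy⟩ := h2
      exact ⟨y, by simp [hy], hyv, by simpa [hy] using hXy⟩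
  · intro hall
    obtain ⟨x, h1, h2⟩ := hA
    rcases hall x h1 with rfl | rfl
    · exact absurd h.aB h2
    · exact absurd h.bB h2
  · obtain ⟨q, qB, qA⟩ := hB
    obtain ⟨r, rA, rB⟩ := hA
    set Q := comp G ((B : Set V) \ A) q with hQ
    have hqQ : q ∈ Q := mem_comp_self ⟨qB, qA⟩
    have key : ∀ v, v ∈ A → v ∈ B → ∃ x ∈ Q, ∃ w, w ≠ v ∧ w ∈ A ∧ w ∈ B ∧ G.Adj w x := by
      intro v vA vB
      by_contra hn
      push Not at hn
      have := hT.2 v (fun z => z ∈ Q) ?_ ⟨q, by simp [qB], by rintro rfl; exact qA vA, hqQ⟩ r (by simp [rA])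
        (by rintro rfl; exact rB vB)
      · exact rB (comp_subset _ _ this).1
      · intro x hx hxv xQ y hy hyv hxy
        have xm := comp_subset _ _ xQ
        rw [Finset.mem_union] at hy
        by_cases yA : y ∈ A
        · by_cases yB : y ∈ B
          · exact absurd hxy.symm (hn x xQ y hyv yA yB)
          · exact absurd hxy.symm (h.nx y yA yB x xm.1 xm.2)
        · exact comp_step xQ ⟨by simpa [yA] using hy, yA⟩ hxy
    refine ⟨Q, comp_cn _ _, fun x hx => (comp_subset _ _ hx).2, ?_, ?_⟩
    · obtain ⟨x, xQ, w, h1, h2, h3, h4⟩ := key b h.bA h.bB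
      rcases h.inter w h2 h3 with rfl | rfl
      · exact ⟨x, xQ, h4⟩
      · exact absurd rfl h1
    · obtain ⟨x, xQ, w, h1, h2, h3, h4⟩ := key a h.aA h.aB
      rcases h.inter w h2 h3 with rfl | rfl
      · exact absurd rfl h1
      · exact ⟨x, xQ, h4⟩

/-- gluing at a cut vertex `c` -/
structure Ch (G : SimpleGraph V) (A B : Finset V) (c : V) : Prop where
  cA : c ∈ A
  cB : c ∈ B
  inter : ∀ x ∈ A, x ∈ B → x = c
  nx : ∀ x ∈ A, x ∉ B → ∀ y ∈ B, y ∉ A → ¬ G.Adj x y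

theorem Ch.symm {c : V} (h : Ch G A B c) : Ch G B A c :=
  ⟨h.cB, h.cA, fun x h1 h2 => h.inter x h2 h1,
    fun x h1 h2 y h3 h4 hxy => h.nx y h3 h4 x h1 h2 hxy.symm⟩

theorem Ch.int {c : V} (h : Ch G A B c) : A ∩ B = {c} := by
  ext x
  simp only [Finset.mem_inter, Finset.mem_singleton]
  constructor
  · rintro ⟨h1, h2⟩; exact h.inter x h1 h2
  · rintro rfl; exact ⟨h.cA, h.cB⟩

theorem Ch.card {c : V} (h : Ch G A B c) :
    (A ∪ B).card + 1 = A.card + B.card := by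
  rw [← Finset.card_union_add_card_inter, h.int, Finset.card_singleton]

theorem Ch.en {c : V} (h : Ch G A B c) :
    en G (A ∪ B) = en G A + en G B := by
  rw [← en_union h.nx, h.int]
  rw [en_single, add_zero]

theorem Pc.conn (h : Pc G S a b) (h3 : 3 ≤ S.card) {X : V → Prop}
    (hX : ∀ x ∈ S, X x → ∀ y ∈ S, G.Adj x y → X y) (hx : ∃ x ∈ S, X x) : ∀ x ∈ S, X x := by
  have c1 : ∀ v, Clo G S v X := fun v x hx _ hX1 y hy _ hxy => hX x hx hX1 y hy hxy
  have cov : ∀ v, (v = a ∨ v = b) → (∃ x ∈ S, x ≠ v ∧ X x) → ∀ x ∈ S, x ≠ v → X x := by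
    rintro v (rfl | rfl) h4
    · exact h.cl v X (c1 v) h4 fun h5 => absurd rfl h5
    · exact h.cl v X (c1 v) h4 fun _ h5 => absurd rfl h5
  obtain ⟨t, tS, ta, tb⟩ : ∃ t ∈ S, t ≠ a ∧ t ≠ b := by
    by_contra hn
    push Not at hn
    have : S ⊆ {a, b} := by
      intro x hx
      have := hn x hx
      simp; tauto
    have := Finset.card_le_card this
    have := Finset.card_le_two (a := a) (b := b)
    omega
  obtain ⟨z, zS, hz⟩ := hx
  have ht : X t := by
    by_cases za : z = a
    · exact cov b (Or.inr rfl) ⟨z, zS, by rw [za]; exact h.ne, hz⟩ t tS tb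
    · exact cov a (Or.inl rfl) ⟨z, zS, za, hz⟩ t tS ta
  intro x hx
  by_cases xa : x = a
  · exact cov b (Or.inr rfl) ⟨t, tS, tb, ht⟩ x hx (by rw [xa]; exact h.ne)
  · exact cov a (Or.inl rfl) ⟨t, tS, ta, ht⟩ x hx xa

theorem Ch.piece {a b c : V} (h : Pc G (A ∪ B) a b) (hc : Ch G A B c) (aA : a ∈ A)
    (bB : b ∈ B) (ac : a ≠ c) (bc : b ≠ c) : Pc G A a c := by
  have bA : b ∉ A := fun hn => bc (hc.inter b hn bB)
  have aB : a ∉ B := fun hn => ac (hc.inter a aA hn)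
  have h3 : 3 ≤ (A ∪ B).card := by
    have : ({a, b, c} : Finset V) ⊆ A ∪ B := by
      intro x hx
      simp at hx
      rcases hx with rfl | rfl | rfl <;> simp [aA, bB, hc.cA]
    have h4 := Finset.card_le_card this
    rwa [Finset.card_eq_three.2 ⟨a, b, c, h.ne, ac, bc, rfl⟩] at h4
  refine ⟨aA, hc.cA, ac, ?_, ?_, ?_⟩
  · intro v X h1 h2 h3 x hx hxv
    have := h.cl v (fun z => if z ∈ A then X z else ((a ≠ v ∧ X a) ∨ (c ≠ v ∧ X c))) ?_ ?_ ?_ x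
      (by simp [hx]) hxv
    · simpa [hx] using this
    · intro y hy hyv hXy z hz hzv hyz
      rw [Finset.mem_union] at hy hz
      by_cases yA : y ∈ A <;> by_cases zA : z ∈ A
      · rw [if_pos yA] at hXy
        rw [if_pos zA]
        exact h1 y yA hyv hXy z zA hzv hyz
      · rw [if_pos yA] at hXy
        rw [if_neg zA]
        have zB : z ∈ B := by tauto
        have yB : y ∈ B := by
          by_contra hn
          exact hc.nx y yA hn z zB zA hyz
        have := hc.inter y yA yB
        subst this
        exact Or.inr ⟨hyv, hXy⟩
      · rw [if_neg yA] at hXy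
        rw [if_pos zA]
        have yB : y ∈ B := by tauto
        have zB : z ∈ B := by
          by_contra hn
          exact hc.nx z zA hn y yB yA hyz.symm
        have := hc.inter z zA zB
        subst this
        rcases hXy with h4 | h4
        · exact (h3 h4.1 hzv).1 h4.2
        · exact h4.2
      · rw [if_neg yA] at hXy
        rw [if_neg zA]
        exact hXy
    · obtain ⟨y, hy, hyv, hXy⟩ := h2
      exact ⟨y, by simp [hy], hyv, by simpa [hy] using hXy⟩
    · intro h4 h5
      simp only [aA, bA, if_true, if_false]
      constructor
      · intro h6; exact Or.inl ⟨h4, h6⟩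
      · rintro (h6 | h6)
        · exact h6.2
        · exact (h3 h4 h6.1).2 h6.2
  · intro hall
    by_contra hn
    have := h.conn h3 (X := fun z => z = a) ?_ ⟨a, by simp [aA], rfl⟩ b (by simp [bB])
    · exact h.ne this.symm
    · rintro x hx rfl y hy hxy
      exfalso
      rw [Finset.mem_union] at hy
      by_cases yA : y ∈ A
      · rcases hall y yA with rfl | rfl
        · exact G.loopless.irrefl _ hxy
        · exact hn hxy
      · exact hc.nx x aA aB y (by tauto) yA hxy
  · obtain ⟨Q, q1, q2, ⟨s, sQ, s1⟩, ⟨t, tQ, t1⟩⟩ := h.ou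
    have hBc : Cn G ((B : Set V) \ {c}) := by
      apply cn_of_closed
      intro X hX hcl x hx
      obtain ⟨z, ⟨zB, zc⟩, zX⟩ := hX
      -- argue with removal of c
      by_cases bX : b ∈ X
      · by_contra hxX
        have := h.cl c (fun z => z ∈ B ∧ z ∉ X) ?_ ⟨x, Finset.mem_union_right _ hx.1, by simpa using hx.2, hx.1, hxX⟩ ?_ a
          (by simp [aA]) ac
        · exact aB this.1
        · intro y hy hyc hyX w hw hwc hyw
          rw [Finset.mem_union] at hw
          have wB : w ∈ B := by
            by_contra hn
            have wA : w ∈ A := by tauto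
            have yA : y ∉ A := fun hh => hyc (hc.inter y hh hyX.1)
            exact hc.nx w wA hn y hyX.1 yA hyw.symm
          refine ⟨wB, fun hwX => hyX.2 (hcl w ⟨wB, hwc⟩ hwX y ⟨hyX.1, hyc⟩ hyw.symm)⟩
        · intro _ _
          simp [aB, bX]
      · exfalso
        have := h.cl c (fun z => z ∈ B ∧ z ∈ X) ?_ ⟨z, by simp [show z ∈ B from zB], zc, zB, zX⟩ ?_ a
          (by simp [aA]) ac
        · exact aB this.1
        · intro y hy hyc hyX w hw hwc hyw
          rw [Finset.mem_union] at hw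
          have wB : w ∈ B := by
            by_contra hn
            have wA : w ∈ A := by tauto
            have yA : y ∉ A := fun hh => hyc (hc.inter y hh hyX.1)
            exact hc.nx w wA hn y hyX.1 yA hyw.symm
          exact ⟨wB, hcl y ⟨hyX.1, hyc⟩ hyX.2 w ⟨wB, hwc⟩ hyw⟩
        · intro _ _
          simp [aB, bX]
    refine ⟨Q ∪ ((B : Set V) \ {c}), q1.union_adj hBc ⟨t, tQ, b, ⟨bB, bc⟩, t1.symm⟩, ?_,
      ⟨s, Or.inl sQ, s1⟩, ?_⟩
    · rintro x (hx | hx) xA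
      · exact q2 x hx (by simp [xA])
      · exact hx.2 (hc.inter x xA hx.1)
    · by_contra hn
      have := h.conn h3 (X := fun z => z ∈ B ∧ z ≠ c) ?_ ⟨b, by simp [bB], bB, bc⟩ a (by simp [aA])
      · exact aB this.1
      · rintro x hx ⟨xB, xc⟩ y hy hxy
        rw [Finset.mem_union] at hy
        have yc : y ≠ c := by
          rintro rfl
          exact hn ⟨x, Or.inr ⟨xB, xc⟩, hxy.symm⟩
        refine ⟨?_, yc⟩
        by_contra yB
        exact hc.nx y (by tauto) yB x xB (fun hh => xc (hc.inter x hh xB)) hxy.symm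

/-- a piece which is neither an edge nor 2-connected is a chain -/
theorem Pc.chain (h : Pc G S a b) (hT : ¬ T2 G S) (h3 : 3 ≤ S.card) :
    ∃ c A B, S = A ∪ B ∧ Ch G A B c ∧ Pc G A a c ∧ Pc G B c b ∧ a ∉ B ∧ b ∉ A := by
  have : ∃ v X, Clo G S v X ∧ a ≠ v ∧ b ≠ v ∧ X a ∧ ¬ X b := by
    unfold T2 at hT
    push Not at hT
    obtain ⟨v, X, h1, h2, y, hy, hyv, hyX⟩ := hT h3
    by_cases hh : a ≠ v → b ≠ v → (X a ↔ X b)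
    · exact absurd (h.cl v X h1 h2 hh y hy hyv) hyX
    · push Not at hh
      obtain ⟨h4, h5, h6⟩ := hh
      rcases h6 with h6 | h6
      · exact ⟨v, X, h1, h4, h5, h6⟩
      · exact ⟨v, fun z => ¬ X z, h1.compl, h4, h5, h6.1, by simpa using h6.2⟩
  obtain ⟨v, X, h1, h4, h5, Xa, Xb⟩ := this
  have vS : v ∈ S := by
    by_contra hn
    refine Xb (h.conn h3 (X := X) ?_ ⟨a, h.aS, Xa⟩ b h.bS)
    intro x hx hX y hy hxy
    exact h1 x hx (by rintro rfl; exact hn hx) hX y hy (by rintro rfl; exact hn hy) hxy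
  set A := S.filter fun z => z = v ∨ X z with hA
  set B := S.filter fun z => z = v ∨ ¬ X z with hB
  have hS : S = A ∪ B := by
    ext z
    simp only [hA, hB, Finset.mem_union, Finset.mem_filter]
    tauto
  have aB : a ∉ B := by simp [hB, h4, Xa]
  have bA : b ∉ A := by simp [hA, h5, Xb]
  have aA : a ∈ A := by simp [hA, h.aS, Xa]
  have bB : b ∈ B := by simp [hB, h.bS, Xb]
  have hc : Ch G A B v := by
    refine ⟨by simp [hA, vS], by simp [hB, vS], ?_, ?_⟩
    · intro x hx hx'
      simp only [hA, hB, Finset.mem_filter] at hx hx'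
      tauto
    · intro x hx hx' y hy hy' hxy
      simp only [hA, hB, Finset.mem_filter] at hx hx' hy hy'
      have x1 : x ≠ v := by tauto
      have y1 : y ≠ v := by tauto
      have x2 : X x := by tauto
      have y2 : ¬ X y := by tauto
      exact y2 (h1 x hx.1 x1 x2 y hy.1 y1 hxy)
  rw [hS] at h
  refine ⟨v, A, B, hS, hc, Ch.piece h hc aA bB h4 h5, ?_, aB, bA⟩
  have h' : Pc G (B ∪ A) b a := by rw [Finset.union_comm]; exact h.symm
  exact (Ch.piece h' hc.symm bB aA h5 h4).symm

end Pieces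

/-! Boolean tables for five vertices -/

set_option synthInstance.maxHeartbeats 1000000 in
set_option synthInstance.maxSize 2000 in
set_option maxRecDepth 100000 in
theorem tab_leafB : ∀ ax ay az bx yb bz xy xz yz : Bool,
    8 ≤ ax.toNat + ay.toNat + az.toNat + bx.toNat + yb.toNat + bz.toNat + xy.toNat + xz.toNat + yz.toNat →
    (((ax && bx) || (ay && yb) || (az && bz)) &&
    ((ax && xy && yb && (ay || bx)) || (ax && xz && bz && (az || bx)) || (ay && xy && bx && (ax || yb)) ||
      (ay && yz && bz && (az || yb)) || (az && xz && bx && (ax || bz)) || (az && yz && yb && (ay || bz))) &&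
    ((ax && xy && yz && bz && (ay || az || xz || bx || yb)) || (ax && xz && yz && yb && (az || ay || xy || bx || bz)) ||
      (ay && xy && xz && bz && (ax || az || yz || yb || bx)) || (ay && yz && xz && bx && (az || ax || xy || yb || bz)) ||
      (az && xz && xy && yb && (ax || ay || yz || bz || bx)) || (az && yz && xy && bx && (ay || ax || xz || bz || yb)))) = true := by
  decide +kernel

theorem tab_leaf : ∀ ax ay az bx yb bz xy xz yz : Bool,
    8 ≤ ax.toNat + ay.toNat + az.toNat + bx.toNat + yb.toNat + bz.toNat + xy.toNat + xz.toNat + yz.toNat →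
    ((ax ∧ bx) ∨ (ay ∧ yb) ∨ (az ∧ bz)) ∧
    ((ax ∧ xy ∧ yb ∧ (ay ∨ bx)) ∨ (ax ∧ xz ∧ bz ∧ (az ∨ bx)) ∨ (ay ∧ xy ∧ bx ∧ (ax ∨ yb)) ∨
      (ay ∧ yz ∧ bz ∧ (az ∨ yb)) ∨ (az ∧ xz ∧ bx ∧ (ax ∨ bz)) ∨ (az ∧ yz ∧ yb ∧ (ay ∨ bz))) ∧
    ((ax ∧ xy ∧ yz ∧ bz ∧ (ay ∨ az ∨ xz ∨ bx ∨ yb)) ∨ (ax ∧ xz ∧ yz ∧ yb ∧ (az ∨ ay ∨ xy ∨ bx ∨ bz)) ∨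
      (ay ∧ xy ∧ xz ∧ bz ∧ (ax ∨ az ∨ yz ∨ yb ∨ bx)) ∨ (ay ∧ yz ∧ xz ∧ bx ∧ (az ∨ ax ∨ xy ∨ yb ∨ bz)) ∨
      (az ∧ xz ∧ xy ∧ yb ∧ (ax ∨ ay ∨ yz ∨ bz ∨ bx)) ∨ (az ∧ yz ∧ xy ∧ bx ∧ (ay ∨ ax ∨ xz ∨ bz ∨ yb))) := by
  intro ax ay az bx yb bz xy xz yz h0
  have := tab_leafB _ _ _ _ _ _ _ _ _ h0
  simpa only [Bool.and_eq_true, Bool.or_eq_true, and_assoc, or_assoc] using this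

set_option synthInstance.maxHeartbeats 1000000 in
set_option synthInstance.maxSize 2000 in
set_option maxRecDepth 100000 in
theorem tab_sevenB : ∀ ax ay az bx yb bz xy xz yz : Bool,
    7 ≤ ax.toNat + ay.toNat + az.toNat + bx.toNat + yb.toNat + bz.toNat + xy.toNat + xz.toNat + yz.toNat →
    3 ≤ ax.toNat + bx.toNat + xy.toNat + xz.toNat → 3 ≤ ay.toNat + yb.toNat + xy.toNat + yz.toNat →
    3 ≤ az.toNat + bz.toNat + xz.toNat + yz.toNat → 2 ≤ ax.toNat + ay.toNat + az.toNat →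
    2 ≤ bx.toNat + yb.toNat + bz.toNat →
    (((ax && bx) || (ay && yb) || (az && bz)) &&
    ((ax && xy && yb && (ay || bx)) || (ax && xz && bz && (az || bx)) || (ay && xy && bx && (ax || yb)) ||
      (ay && yz && bz && (az || yb)) || (az && xz && bx && (ax || bz)) || (az && yz && yb && (ay || bz))) &&
    ((ax && xy && yz && bz && (ay || az || xz || bx || yb)) || (ax && xz && yz && yb && (az || ay || xy || bx || bz)) ||
      (ay && xy && xz && bz && (ax || az || yz || yb || bx)) || (ay && yz && xz && bx && (az || ax || xy || yb || bz)) ||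
      (az && xz && xy && yb && (ax || ay || yz || bz || bx)) || (az && yz && xy && bx && (ay || ax || xz || bz || yb)))) = true := by
  decide +kernel

theorem tab_seven : ∀ ax ay az bx yb bz xy xz yz : Bool,
    7 ≤ ax.toNat + ay.toNat + az.toNat + bx.toNat + yb.toNat + bz.toNat + xy.toNat + xz.toNat + yz.toNat →
    3 ≤ ax.toNat + bx.toNat + xy.toNat + xz.toNat → 3 ≤ ay.toNat + yb.toNat + xy.toNat + yz.toNat →
    3 ≤ az.toNat + bz.toNat + xz.toNat + yz.toNat → 2 ≤ ax.toNat + ay.toNat + az.toNat →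
    2 ≤ bx.toNat + yb.toNat + bz.toNat →
    ((ax ∧ bx) ∨ (ay ∧ yb) ∨ (az ∧ bz)) ∧
    ((ax ∧ xy ∧ yb ∧ (ay ∨ bx)) ∨ (ax ∧ xz ∧ bz ∧ (az ∨ bx)) ∨ (ay ∧ xy ∧ bx ∧ (ax ∨ yb)) ∨
      (ay ∧ yz ∧ bz ∧ (az ∨ yb)) ∨ (az ∧ xz ∧ bx ∧ (ax ∨ bz)) ∨ (az ∧ yz ∧ yb ∧ (ay ∨ bz))) ∧
    ((ax ∧ xy ∧ yz ∧ bz ∧ (ay ∨ az ∨ xz ∨ bx ∨ yb)) ∨ (ax ∧ xz ∧ yz ∧ yb ∧ (az ∨ ay ∨ xy ∨ bx ∨ bz)) ∨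
      (ay ∧ xy ∧ xz ∧ bz ∧ (ax ∨ az ∨ yz ∨ yb ∨ bx)) ∨ (ay ∧ yz ∧ xz ∧ bx ∧ (az ∨ ax ∨ xy ∨ yb ∨ bz)) ∨
      (az ∧ xz ∧ xy ∧ yb ∧ (ax ∨ ay ∨ yz ∨ bz ∨ bx)) ∨ (az ∧ yz ∧ xy ∧ bx ∧ (ay ∨ ax ∨ xz ∨ bz ∨ yb))) := by
  intro ax ay az bx yb bz xy xz yz h0 h1 h2 h3 h4 h5
  have := tab_sevenB _ _ _ _ _ _ _ _ _ h0 h1 h2 h3 h4 h5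
  simpa only [Bool.and_eq_true, Bool.or_eq_true, and_assoc, or_assoc] using this

set_option synthInstance.maxHeartbeats 1000000 in
set_option synthInstance.maxSize 2000 in
set_option maxRecDepth 100000 in
theorem tab_three : ∀ ax ay az bx yb bz xy xz yz : Bool,
    3 ≤ ax.toNat + bx.toNat + xy.toNat + xz.toNat → 3 ≤ ay.toNat + yb.toNat + xy.toNat + yz.toNat →
    3 ≤ az.toNat + bz.toNat + xz.toNat + yz.toNat → 1 ≤ ax.toNat + ay.toNat + az.toNat →
    1 ≤ bx.toNat + yb.toNat + bz.toNat →
    ((ax ∧ xy ∧ yb) ∨ (ax ∧ xz ∧ bz) ∨ (ay ∧ xy ∧ bx) ∨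
      (ay ∧ yz ∧ bz) ∨ (az ∧ xz ∧ bx) ∨ (az ∧ yz ∧ yb)) := by
  decide +kernel

section Paths

open Classical

variable {V : Type*} [Fintype V] {G : SimpleGraph V} {S A B : Finset V} {a b : V}

theorem th6 (hf : ¬ HasTheta6 G) (a b c d e f : V) (h : G.Adj a b ∧ G.Adj b c ∧ G.Adj c d ∧
    G.Adj d e ∧ G.Adj e f ∧ G.Adj f a) (hch : G.Adj a c ∨ G.Adj a d ∨ G.Adj a e ∨ G.Adj b d ∨ G.Adj b e ∨
      G.Adj b f ∨ G.Adj c e ∨ G.Adj c f ∨ G.Adj d f) (hn : a ≠ c ∧ a ≠ d ∧ a ≠ e ∧ b ≠ d ∧ b ≠ e ∧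
      b ≠ f ∧ c ≠ e ∧ c ≠ f ∧ d ≠ f) : False := by
  obtain ⟨h1, h2, h3, h4, h5, h6⟩ := h
  refine hf (theta_of h1 h2 h3 h4 h5 h6 ?_ hch)
  have := h1.ne
  have := h2.ne
  have := h3.ne
  have := h4.ne
  have := h5.ne
  have := h6.ne
  simp; grind

def P2 (G : SimpleGraph V) (S : Finset V) (a b : V) : Prop := ∃ x ∈ S, G.Adj a x ∧ G.Adj x b

def P3 (G : SimpleGraph V) (S : Finset V) (a b : V) : Prop :=
  ∃ x ∈ S, ∃ y ∈ S, G.Adj a x ∧ G.Adj x y ∧ G.Adj y b ∧ x ≠ b ∧ y ≠ a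

def P3c (G : SimpleGraph V) (S : Finset V) (a b : V) : Prop :=
  ∃ x ∈ S, ∃ y ∈ S, G.Adj a x ∧ G.Adj x y ∧ G.Adj y b ∧ x ≠ b ∧ y ≠ a ∧
    (G.Adj a y ∨ G.Adj x b ∨ G.Adj a b)

def P4c (G : SimpleGraph V) (S : Finset V) (a b : V) : Prop :=
  ∃ x ∈ S, ∃ y ∈ S, ∃ z ∈ S, G.Adj a x ∧ G.Adj x y ∧ G.Adj y z ∧ G.Adj z b ∧ x ≠ b ∧ y ≠ a ∧ y ≠ b ∧
    z ≠ a ∧ x ≠ z ∧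
    (G.Adj a y ∨ G.Adj a z ∨ G.Adj x z ∨ G.Adj x b ∨ G.Adj y b ∨ G.Adj a b)

theorem P2.symm (h : P2 G S a b) : P2 G S b a := by
  obtain ⟨x, hx, h1, h2⟩ := h
  exact ⟨x, hx, h2.symm, h1.symm⟩

theorem P3.symm (h : P3 G S a b) : P3 G S b a := by
  obtain ⟨x, hx, y, hy, h1, h2, h3, h4, h5⟩ := h
  exact ⟨y, hy, x, hx, h3.symm, h2.symm, h1.symm, h5, h4⟩

theorem P3c.p3 (h : P3c G S a b) : P3 G S a b := by
  obtain ⟨x, hx, y, hy, h1, h2, h3, h4, h5, h6⟩ := h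
  exact ⟨x, hx, y, hy, h1, h2, h3, h4, h5⟩

theorem P3c.symm (h : P3c G S a b) : P3c G S b a := by
  obtain ⟨x, hx, y, hy, h1, h2, h3, h4, h5, h6⟩ := h
  refine ⟨y, hy, x, hx, h3.symm, h2.symm, h1.symm, h5, h4, ?_⟩
  simp only [G.adj_comm b x, G.adj_comm y a, G.adj_comm b a]
  tauto

theorem P4c.symm (h : P4c G S a b) : P4c G S b a := by
  obtain ⟨x, hx, y, hy, z, hz, h1, h2, h3, h4, n1, n2, n3, n4, n5, h6⟩ := h
  refine ⟨z, hz, y, hy, x, hx, h4.symm, h3.symm, h2.symm, h1.symm, n4, n3, n2, n1, n5.symm, ?_⟩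
  simp only [G.adj_comm b y, G.adj_comm b x, G.adj_comm z x, G.adj_comm z a, G.adj_comm y a,
    G.adj_comm b a]
  tauto

theorem Sp.out {a b x y : V} (h : Sp G A B a b) (hx : x ∈ A) (hy : y ∈ B) (h1 : x ≠ a)
    (h2 : x ≠ b) : x ≠ y := by
  rintro rfl
  rcases h.inter x hx hy with h | h
  · exact h1 h
  · exact h2 h

theorem glue24 (hf : ¬ HasTheta6 G) (h : Sp G A B a b) (hA : P2 G A a b)
    (hB : P4c G B a b) : False := by
  obtain ⟨w, wA, w1, w2⟩ := hA
  obtain ⟨x, hx, y, hy, z, hz, h1, h2, h3, h4, n1, n2, n3, n4, n5, h6⟩ := hB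
  have o := fun y (hy : y ∈ B) => h.out wA hy w1.ne.symm w2.ne
  refine th6 hf a x y z b w ⟨h1, h2, h3, h4, w2.symm, w1.symm⟩ (by tauto) ?_
  exact ⟨n2.symm, n4.symm, h.ne, n5, n1, (o x hx).symm, n3, (o y hy).symm, (o z hz).symm⟩

theorem glue33 (hf : ¬ HasTheta6 G) (h : Sp G A B a b) (hA : P3 G A a b)
    (hB : P3c G B a b) : False := by
  obtain ⟨u, uA, w, wA, u1, u2, u3, u4, u5⟩ := hA
  obtain ⟨x, hx, y, hy, h1, h2, h3, n1, n2, h6⟩ := hB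
  have o := fun y (hy : y ∈ B) => h.out uA hy u1.ne.symm u4
  have o' := fun y (hy : y ∈ B) => h.out wA hy u5 u3.ne
  refine th6 hf a x y b w u ⟨h1, h2, h3, u3.symm, u2.symm, u1.symm⟩ (by tauto) ?_
  exact ⟨n2.symm, h.ne, u5.symm, n1, (o' x hx).symm, (o x hx).symm, (o' y hy).symm, (o y hy).symm, u4.symm⟩

/-- indicator of adjacency -/
noncomputable def bn (G : SimpleGraph V) (x y : V) : ℕ := (decide (G.Adj x y)).toNat

theorem bn_eq (x y : V) : (if G.Adj x y then 1 else 0) = bn G x y := by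
  unfold bn
  by_cases h : G.Adj x y <;> simp [h]

theorem bn_symm (x y : V) : bn G x y = bn G y x := by
  simp only [bn, G.adj_comm]

theorem bn_self (x : V) : bn G x x = 0 := by simp [bn]

theorem deg_sum (x : V) (S : Finset V) : (S.filter (G.Adj x)).card = ∑ u ∈ S, bn G x u := by
  rw [Finset.card_filter]
  exact Finset.sum_congr rfl fun u _ => bn_eq x u

theorem en_bn {v : V} (hv : v ∉ S) :
    en G (insert v S) = en G S + ∑ u ∈ S, bn G v u := by
  rw [en_insert hv, ← deg_sum]

theorem nd5 {a b x y z : V} (hn : [a, b, x, y, z].Nodup) : a ∉ ({b, x, y, z} : Finset V) ∧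
    b ∉ ({x, y, z} : Finset V) ∧ x ∉ ({y, z} : Finset V) ∧ y ∉ ({z} : Finset V) := by
  simp at hn
  simp; tauto

theorem sum5 {a b x y z : V} (hn : [a, b, x, y, z].Nodup) (f : V → ℕ) :
    ∑ u ∈ {a, b, x, y, z}, f u = f a + f b + f x + f y + f z := by
  obtain ⟨h1, h2, h3, h4⟩ := nd5 hn
  rw [Finset.sum_insert h1, Finset.sum_insert h2, Finset.sum_insert h3, Finset.sum_insert h4,
    Finset.sum_singleton]
  ring

theorem en5 {a b x y z : V} (hn : [a, b, x, y, z].Nodup) :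
    en G {a, b, x, y, z} = bn G a b + (bn G a x + bn G a y + bn G a z + bn G b x + bn G b y + bn G b z +
      bn G x y + bn G x z + bn G y z) := by
  obtain ⟨h1, h2, h3, h4⟩ := nd5 hn
  rw [en_bn h1, en_bn h2, en_bn h3, en_bn h4, en_single, Finset.sum_insert h2, Finset.sum_insert h3,
    Finset.sum_insert h4, Finset.sum_singleton, Finset.sum_insert h3,
    Finset.sum_insert h4, Finset.sum_singleton, Finset.sum_insert h4, Finset.sum_singleton,
    Finset.sum_singleton]
  ring

theorem deg5 {a b x y z : V} (hn : [a, b, x, y, z].Nodup) (v : V) :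
    ((({a, b, x, y, z} : Finset V)).filter (G.Adj v)).card = bn G v a + bn G v b + bn G v x + bn G v y + bn G v z := by
  rw [deg_sum, sum5 hn]

theorem set5 (ha : a ∈ S) (hb : b ∈ S) (hab : a ≠ b) (h : S.card = 5) :
    ∃ x y z, [a, b, x, y, z].Nodup ∧ S = {a, b, x, y, z} := by
  have h3 : ((S.erase a).erase b).card = 3 := by
    rw [Finset.card_erase_of_mem (by simp [hab.symm, hb]), Finset.card_erase_of_mem ha, h]
  obtain ⟨x, y, z, n1, n2, n3, e⟩ := Finset.card_eq_three.1 h3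
  have e2 : S = {a, b, x, y, z} := by
    rw [← Finset.insert_erase ha, ← Finset.insert_erase (s := S.erase a) (a := b) (by simp [hab.symm, hb]), e]
  refine ⟨x, y, z, ?_, e2⟩
  have key : ∀ u ∈ ({x, y, z} : Finset V), u ≠ a ∧ u ≠ b := by
    intro u hu
    rw [← e] at hu
    simp at hu
    exact ⟨hu.2.1, hu.1⟩
  have kx := key x Ψ
  have ky := key y Ψ
  have kz := key z Ψ
  simp
  exact ⟨⟨hab, kx.1.symm, ky.1.symm, kz.1.symm⟩, ⟨kx.2.symm, ky.2.symm, kz.2.symm⟩, ⟨n1, n2⟩, n3⟩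

theorem set4 (ha : a ∈ S) (hb : b ∈ S) (hab : a ≠ b) (h : S.card = 4) :
    ∃ x y, [a, b, x, y].Nodup ∧ S = {a, b, x, y} := by
  have h3 : ((S.erase a).erase b).card = 2 := by
    rw [Finset.card_erase_of_mem (by simp [hab.symm, hb]), Finset.card_erase_of_mem ha, h]
  obtain ⟨x, y, n1, e⟩ := Finset.card_eq_two.1 h3
  have e2 : S = {a, b, x, y} := by
    rw [← Finset.insert_erase ha, ← Finset.insert_erase (s := S.erase a) (a := b) (by simp [hab.symm, hb]), e]
  refine ⟨x, y, ?_, e2⟩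
  have key : ∀ u ∈ ({x, y} : Finset V), u ≠ a ∧ u ≠ b := by
    intro u hu
    rw [← e] at hu
    simp at hu
    exact ⟨hu.2.1, hu.1⟩
  have kx := key x Ψ
  have ky := key y Ψ
  simp
  exact ⟨⟨hab, kx.1.symm, ky.1.symm⟩, ⟨kx.2.symm, ky.2.symm⟩, n1⟩

def D3 (G : SimpleGraph V) (S : Finset V) (a b : V) : Prop :=
  ∀ x ∈ S, x ≠ a → x ≠ b → 3 ≤ (S.filter (G.Adj x)).card

/-- the interior edges of a five-vertex set -/
noncomputable def i9 (G : SimpleGraph V) (a b x y z : V) : ℕ :=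
  bn G a x + bn G a y + bn G a z + bn G b x + bn G b y + bn G b z + bn G x y + bn G x z + bn G y z

theorem conv5 {a b x y z : V} (hn : [a, b, x, y, z].Nodup)
    (h : ((G.Adj a x ∧ G.Adj b x) ∨ (G.Adj a y ∧ G.Adj b y) ∨ (G.Adj a z ∧ G.Adj b z)) ∧
    ((G.Adj a x ∧ G.Adj x y ∧ G.Adj b y ∧ (G.Adj a y ∨ G.Adj b x)) ∨ (G.Adj a x ∧ G.Adj x z ∧ G.Adj b z ∧ (G.Adj a z ∨ G.Adj b x)) ∨
      (G.Adj a y ∧ G.Adj x y ∧ G.Adj b x ∧ (G.Adj a x ∨ G.Adj b y)) ∨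
      (G.Adj a y ∧ G.Adj y z ∧ G.Adj b z ∧ (G.Adj a z ∨ G.Adj b y)) ∨ (G.Adj a z ∧ G.Adj x z ∧ G.Adj b x ∧ (G.Adj a x ∨ G.Adj b z)) ∨
      (G.Adj a z ∧ G.Adj y z ∧ G.Adj b y ∧ (G.Adj a y ∨ G.Adj b z))) ∧
    ((G.Adj a x ∧ G.Adj x y ∧ G.Adj y z ∧ G.Adj b z ∧ (G.Adj a y ∨ G.Adj a z ∨ G.Adj x z ∨ G.Adj b x ∨ G.Adj b y)) ∨
      (G.Adj a x ∧ G.Adj x z ∧ G.Adj y z ∧ G.Adj b y ∧ (G.Adj a z ∨ G.Adj a y ∨ G.Adj x y ∨ G.Adj b x ∨ G.Adj b z)) ∨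
      (G.Adj a y ∧ G.Adj x y ∧ G.Adj x z ∧ G.Adj b z ∧ (G.Adj a x ∨ G.Adj a z ∨ G.Adj y z ∨ G.Adj b y ∨ G.Adj b x)) ∨
      (G.Adj a y ∧ G.Adj y z ∧ G.Adj x z ∧ G.Adj b x ∧ (G.Adj a z ∨ G.Adj a x ∨ G.Adj x y ∨ G.Adj b y ∨ G.Adj b z)) ∨
      (G.Adj a z ∧ G.Adj x z ∧ G.Adj x y ∧ G.Adj b y ∧ (G.Adj a x ∨ G.Adj a y ∨ G.Adj y z ∨ G.Adj b z ∨ G.Adj b x)) ∨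
      (G.Adj a z ∧ G.Adj y z ∧ G.Adj x y ∧ G.Adj b x ∧ (G.Adj a y ∨ G.Adj a x ∨ G.Adj x z ∨ G.Adj b z ∨ G.Adj b y)))) :
    P2 G {a, b, x, y, z} a b ∧ P3c G {a, b, x, y, z} a b ∧ P4c G {a, b, x, y, z} a b := by
  simp only [List.nodup_cons, List.mem_cons, List.not_mem_nil, or_false, not_or] at hn
  obtain ⟨⟨n1, n2, n3, n4⟩, ⟨n5, n6, n7⟩, ⟨n8, n9⟩, n10, -⟩ := hn
  obtain ⟨h1, h2, h3⟩ := h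
  have sy : ∀ u v, G.Adj u v ↔ G.Adj v u := fun u v => G.adj_comm u v
  refine ⟨?_, ?_, ?_⟩
  · rcases h1 with ⟨h, h'⟩ | ⟨h, h'⟩ | ⟨h, h'⟩
    · exact ⟨x, by simp, h, h'.symm⟩
    · exact ⟨y, by simp, h, h'.symm⟩
    · exact ⟨z, by simp, h, h'.symm⟩
  · have mk : ∀ u ∈ ({a, b, x, y, z} : Finset V), ∀ v ∈ ({a, b, x, y, z} : Finset V), b ≠ u → a ≠ v →
        G.Adj a u → (G.Adj u v) → G.Adj b v → (G.Adj a v ∨ G.Adj b u) → P3c G {a, b, x, y, z} a b := by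
      intro u hu v hv g1 g2 e1 e2 e3 e4
      refine ⟨u, hu, v, hv, e1, e2, e3.symm, g1.symm, g2.symm, ?_⟩
      rcases e4 with e4 | e4
      · exact Or.inl e4
      · exact Or.inr (Or.inl e4.symm)
    rcases h2 with ⟨e1, e2, e3, e4⟩ | ⟨e1, e2, e3, e4⟩ | ⟨e1, e2, e3, e4⟩ | ⟨e1, e2, e3, e4⟩ | ⟨e1, e2, e3, e4⟩ | ⟨e1, e2, e3, e4⟩
    · exact mk x Ψ y Ψ n5 n3 e1 e2 e3 e4
    · exact mk x Ψ z Ψ n5 n4 e1 e2 e3 e4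
    · exact mk y Ψ x Ψ n6 n2 e1 e2.symm e3 e4
    · exact mk y Ψ z Ψ n6 n4 e1 e2 e3 e4
    · exact mk z Ψ x Ψ n7 n2 e1 e2.symm e3 e4
    · exact mk z Ψ y Ψ n7 n3 e1 e2.symm e3 e4
  · have mk : ∀ u ∈ ({a, b, x, y, z} : Finset V), ∀ v ∈ ({a, b, x, y, z} : Finset V),
        ∀ w ∈ ({a, b, x, y, z} : Finset V), b ≠ u → a ≠ v → b ≠ v → a ≠ w → u ≠ w →
        G.Adj a u → G.Adj u v → G.Adj v w → G.Adj b w →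
        (G.Adj a v ∨ G.Adj a w ∨ G.Adj u w ∨ G.Adj b u ∨ G.Adj b v) → P4c G {a, b, x, y, z} a b := by
      intro u hu v hv w hw g1 g2 g3 g4 g5 e1 e2 e3 e4 e5
      refine ⟨u, hu, v, hv, w, hw, e1, e2, e3, e4.symm, g1.symm, g2.symm, g3.symm, g4.symm, g5, ?_⟩
      rcases e5 with e5 | e5 | e5 | e5 | e5
      · exact Or.inl e5
      · exact Or.inr (Or.inl e5)
      · exact Or.inr (Or.inr (Or.inl e5))
      · exact Or.inr (Or.inr (Or.inr (Or.inl e5.symm)))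
      · exact Or.inr (Or.inr (Or.inr (Or.inr (Or.inl e5.symm))))
    rcases h3 with ⟨e1, e2, e3, e4, e5⟩ | ⟨e1, e2, e3, e4, e5⟩ | ⟨e1, e2, e3, e4, e5⟩ | ⟨e1, e2, e3, e4, e5⟩ |
      ⟨e1, e2, e3, e4, e5⟩ | ⟨e1, e2, e3, e4, e5⟩
    · exact mk x Ψ y Ψ z Ψ n5 n3 n6 n4 n9 e1 e2 e3 e4 e5
    · exact mk x Ψ z Ψ y Ψ n5 n4 n7 n3 n8 e1 e2 e3.symm e4 e5
    · exact mk y Ψ x Ψ z Ψ n6 n2 n5 n4 n10 e1 e2.symm e3 e4 e5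
    · exact mk y Ψ z Ψ x Ψ n6 n4 n7 n2 (Ne.symm n8) e1 e2 e3.symm e4
        (by rw [sy y x]; exact e5)
    · exact mk z Ψ x Ψ y Ψ n7 n2 n5 n3 (Ne.symm n10) e1 e2.symm e3 e4
        (by rw [sy z y]; exact e5)
    · exact mk z Ψ y Ψ x Ψ n7 n3 n6 n2 (Ne.symm n9) e1 e2.symm e3.symm e4
        (by rw [sy z x]; exact e5)

theorem leaf_paths {a b x y z : V} (hn : [a, b, x, y, z].Nodup) (h : 8 ≤ i9 G a b x y z) :
    P2 G {a, b, x, y, z} a b ∧ P3c G {a, b, x, y, z} a b ∧ P4c G {a, b, x, y, z} a b := by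
  apply conv5 hn
  have := tab_leaf _ _ _ _ _ _ _ _ _ h
  simpa only [decide_eq_true_eq] using this

theorem seven_paths {a b x y z : V} (hn : [a, b, x, y, z].Nodup) (h : 7 ≤ i9 G a b x y z)
    (hab : ¬ G.Adj a b) (hd : D3 G {a, b, x, y, z} a b)
    (ha : 2 ≤ (({a, b, x, y, z} : Finset V).filter (G.Adj a)).card)
    (hb : 2 ≤ (({a, b, x, y, z} : Finset V).filter (G.Adj b)).card) :
    P2 G {a, b, x, y, z} a b ∧ P3c G {a, b, x, y, z} a b ∧ P4c G {a, b, x, y, z} a b := by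
  apply conv5 hn
  have hn' := hn
  simp only [List.nodup_cons, List.mem_cons, List.not_mem_nil, or_false, not_or] at hn'
  obtain ⟨⟨n1, n2, n3, n4⟩, ⟨n5, n6, n7⟩, ⟨n8, n9⟩, n10, -⟩ := hn'
  have dx := hd x Ψ (Ne.symm n2) (Ne.symm n5)
  have dy := hd y Ψ (Ne.symm n3) (Ne.symm n6)
  have dz := hd z Ψ (Ne.symm n4) (Ne.symm n7)
  rw [deg5 hn] at ha hb dx dy dz
  have e : bn G a b = 0 := by simp [bn, hab]
  rw [bn_self, bn_symm x a, bn_symm x b] at dx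
  rw [bn_self, bn_symm y a, bn_symm y b, bn_symm y x] at dy
  rw [bn_self, bn_symm z a, bn_symm z b, bn_symm z x, bn_symm z y] at dz
  rw [bn_self, e] at ha
  rw [bn_self, bn_symm b a, e] at hb
  have := tab_seven _ _ _ _ _ _ _ _ _ h (by simp only [bn] at dx; omega) (by simp only [bn] at dy; omega) (by simp only [bn] at dz; omega)
    (by simp only [bn] at ha; omega) (by simp only [bn] at hb; omega)
  simpa only [decide_eq_true_eq] using this

/-- three inner vertices of degree at least three give a path of length three -/
theorem three_path (ha : a ∈ S) (hb : b ∈ S) (hab : a ≠ b) (h5 : S.card = 5)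
    (hd : D3 G S a b) (h1 : ∃ x ∈ S, x ≠ b ∧ G.Adj a x) (h2 : ∃ x ∈ S, x ≠ a ∧ G.Adj b x) :
    P3 G S a b := by
  obtain ⟨x, y, z, hn, rfl⟩ := set5 ha hb hab h5
  have hn' := hn
  simp only [List.nodup_cons, List.mem_cons, List.not_mem_nil, or_false, not_or] at hn'
  obtain ⟨⟨n1, n2, n3, n4⟩, ⟨n5, n6, n7⟩, ⟨n8, n9⟩, n10, -⟩ := hn'
  have dx := hd x Ψ (Ne.symm n2) (Ne.symm n5)
  have dy := hd y Ψ (Ne.symm n3) (Ne.symm n6)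
  have dz := hd z Ψ (Ne.symm n4) (Ne.symm n7)
  rw [deg5 hn] at dx dy dz
  rw [bn_self, bn_symm x a, bn_symm x b] at dx
  rw [bn_self, bn_symm y a, bn_symm y b, bn_symm y x] at dy
  rw [bn_self, bn_symm z a, bn_symm z b, bn_symm z x, bn_symm z y] at dz
  have d1 : ∀ u v, G.Adj u v → bn G u v = 1 := by intro u v h; simp [bn, h]
  have ea : 1 ≤ bn G a x + bn G a y + bn G a z := by
    obtain ⟨u, hu, h3, h4⟩ := h1
    have := d1 _ _ h4
    simp only [Finset.mem_insert, Finset.mem_singleton] at hu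
    rcases hu with rfl | rfl | rfl | rfl | rfl
    · exact absurd h4 (G.loopless.irrefl _)
    · exact absurd rfl h3
    all_goals omega
  have eb : 1 ≤ bn G b x + bn G b y + bn G b z := by
    obtain ⟨u, hu, h3, h4⟩ := h2
    have := d1 _ _ h4
    simp only [Finset.mem_insert, Finset.mem_singleton] at hu
    rcases hu with rfl | rfl | rfl | rfl | rfl
    · exact absurd rfl h3
    · exact absurd h4 (G.loopless.irrefl _)
    all_goals omega
  have := tab_three _ _ _ _ _ _ _ _ _ (by simp only [bn] at dx; omega) (by simp only [bn] at dy; omega) (by simp only [bn] at dz; omega)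
    ea eb
  simp only [decide_eq_true_eq] at this
  rcases this with ⟨e1, e2, e3⟩ | ⟨e1, e2, e3⟩ | ⟨e1, e2, e3⟩ | ⟨e1, e2, e3⟩ | ⟨e1, e2, e3⟩ | ⟨e1, e2, e3⟩
  · exact ⟨x, by simp, y, by simp, e1, e2, e3.symm, Ne.symm n5, Ne.symm n3⟩
  · exact ⟨x, by simp, z, by simp, e1, e2, e3.symm, Ne.symm n5, Ne.symm n4⟩
  · exact ⟨y, by simp, x, by simp, e1, e2.symm, e3.symm, Ne.symm n6, Ne.symm n2⟩
  · exact ⟨y, by simp, z, by simp, e1, e2, e3.symm, Ne.symm n6, Ne.symm n4⟩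
  · exact ⟨z, by simp, x, by simp, e1, e2.symm, e3.symm, Ne.symm n7, Ne.symm n2⟩
  · exact ⟨z, by simp, y, by simp, e1, e2.symm, e3.symm, Ne.symm n7, Ne.symm n3⟩

theorem en_full (h : S.card * (S.card - 1) ≤ 2 * en G S) {x y : V} (hx : x ∈ S) (hy : y ∈ S)
    (hxy : x ≠ y) : G.Adj x y := by
  have h1 := en_insert (G := G) (Finset.notMem_erase x S)
  rw [Finset.insert_erase hx] at h1
  have h2 := en_le (G := G) (S.erase x)
  have h3 := Finset.card_erase_of_mem hx
  have h4 : 0 < S.card := Finset.card_pos.2 ⟨x, hx⟩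
  obtain ⟨m, hm⟩ : ∃ m, S.card = m + 1 := ⟨S.card - 1, by omega⟩
  have hc : (S.erase x).card = m := by omega
  rw [hc] at h2
  rw [hm] at h
  have h5 : (S.erase x).card ≤ ((S.erase x).filter fun u => G.Adj x u).card := by
    rw [hc]
    have e1 : (m + 1) * (m + 1 - 1) = m * (m - 1) + 2 * m := by
      cases m with
      | zero => simp
      | succ k => simp; ring
    omega
  have h6 := Finset.eq_of_subset_of_card_le (Finset.filter_subset (fun u => G.Adj x u) (S.erase x)) h5
  have h7 : y ∈ (S.erase x).filter fun u => G.Adj x u := by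
    rw [h6]; simp [hy, hxy.symm]
  exact (Finset.mem_filter.1 h7).2

theorem T2.nbr (h : T2 G S) {v : V} (hv : v ∈ S) (u : V) (huv : v ≠ u) :
    ∃ x ∈ S, x ≠ u ∧ G.Adj v x := by
  by_contra hn
  push Not at hn
  have := h.2 u (fun z => z = v) (by
    rintro x hx hxu rfl y hy hyu hxy
    exact absurd hxy (hn y hy hyu)) ⟨v, hv, huv, rfl⟩
  have h2 : S ⊆ {u, v} := by
    intro x hx
    by_cases hxu : x = u
    · simp [hxu]
    · simp [this x hx hxu]
  have := Finset.card_le_card h2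
  have := Finset.card_le_two (a := u) (b := v)
  have := h.1
  omega

theorem T2.deg (h : T2 G S) {v : V} (hv : v ∈ S) : 2 ≤ (S.filter (G.Adj v)).card := by
  obtain ⟨w, hw, hwv⟩ : ∃ w ∈ S, w ≠ v := by
    by_contra hn
    push Not at hn
    have : S ⊆ {v} := fun x hx => by simpa using hn x hx
    have := Finset.card_le_card this
    have := h.1
    simp at *
    omega
  obtain ⟨x, hx, _, hvx⟩ := h.nbr hv w hwv.symm
  obtain ⟨y, hy, hyx, hvy⟩ := h.nbr hv x hvx.ne
  exact Finset.one_lt_card.2 ⟨x, by simp [hx, hvx], y, by simp [hy, hvy], hyx.symm⟩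

theorem Pc.nbr' (h : Pc G S a b) (h3 : 3 ≤ S.card) : ∃ x ∈ S, x ≠ b ∧ G.Adj a x := by
  by_contra hn
  push Not at hn
  have := h.cl b (fun z => z = a) (by
    rintro x hx hxu rfl y hy hyu hxy
    exact absurd hxy (hn y hy hyu)) ⟨a, h.aS, h.ne, rfl⟩ (fun _ h => absurd rfl h)
  have h2 : S ⊆ {a, b} := by
    intro x hx
    by_cases hxu : x = b
    · simp [hxu]
    · simp [this x hx hxu]
  have := Finset.card_le_card h2
  have := Finset.card_le_two (a := a) (b := b)
  omega

theorem Pc.card2 (h : Pc G S a b) : 2 ≤ S.card :=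
  Finset.one_lt_card.2 ⟨a, h.aS, b, h.bS, h.ne⟩

theorem Pc.eq2 (h : Pc G S a b) (h2 : S.card = 2) : S = {a, b} := by
  symm
  apply Finset.eq_of_subset_of_card_le
  · intro x hx
    simp at hx
    rcases hx with rfl | rfl
    · exact h.aS
    · exact h.bS
  · rw [h2, Finset.card_pair h.ne]

theorem Pc.adj2 (h : Pc G S a b) (h2 : S.card = 2) : G.Adj a b :=
  h.two fun x hx => by rw [h.eq2 h2] at hx; simpa using hx

def Book (G : SimpleGraph V) (S : Finset V) : Prop :=
  ∃ p ∈ S, ∃ q ∈ S, ∃ x ∈ S, ∃ y ∈ S, G.Adj p q ∧ G.Adj x y ∧ x ≠ p ∧ x ≠ q ∧ y ≠ p ∧ y ≠ q ∧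
    (∀ z ∈ S, z ≠ p → z ≠ q → G.Adj z p ∧ G.Adj z q) ∧
    ∀ z ∈ S, z ≠ p → z ≠ q → z ≠ x → z ≠ y → ∀ w ∈ S, G.Adj z w → w = p ∨ w = q

def Bd (G : SimpleGraph V) (S : Finset V) : Prop :=
  (6 ≤ S.card → S.card ≤ 8 → en G S + 2 ≤ 2 * S.card ∧ (en G S + 2 = 2 * S.card → Book G S)) ∧
    (9 ≤ S.card → 7 * en G S + 48 ≤ 18 * S.card)

structure Gl (G : SimpleGraph V) (N : ℕ) : Prop where
  pl : Pl G
  fr : ¬ HasTheta6 G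
  ih : ∀ S : Finset V, S.card < N → T2 G S → Bd G S

noncomputable def cv (G : SimpleGraph V) (S : Finset V) : ℤ := 7 * en G S - 18 * ((S.card : ℤ) - 1)

theorem k5_of (hp : Pl G) {D : Set V} (hD : Cn G D) {b x y z : V} (hn : [b, x, y, z].Nodup)
    (h1 : b ∉ D) (h2 : x ∉ D) (h3 : y ∉ D) (h4 : z ∉ D)
    (ad : ∀ u ∈ [b, x, y, z], ∀ w ∈ [b, x, y, z], u ≠ w → G.Adj u w)
    (t : ∀ u ∈ [b, x, y, z], ∃ d ∈ D, G.Adj d u) : False := by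
  simp only [List.nodup_cons, List.mem_cons, List.not_mem_nil, or_false, not_or] at hn
  obtain ⟨⟨n1, n2, n3⟩, ⟨n4, n5⟩, n6, -⟩ := hn
  have tc : ∀ u ∈ [b, x, y, z], ∀ w ∈ [b, x, y, z], u ≠ w →
      Tch G {u} {w} := fun u hu w hw huw => ⟨u, rfl, w, rfl, ad u hu w hw huw⟩
  have tD : ∀ u ∈ [b, x, y, z], Tch G D {u} := fun u hu => by
    obtain ⟨d, hd, e⟩ := t u hu
    exact ⟨d, hd, u, rfl, e⟩
  refine hp.k5 hD (cn_singleton b) (cn_singleton x) (cn_singleton y) (cn_singleton z)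
    (by simpa using h1) (by simpa using h2) (by simpa using h3) (by simpa using h4)
    (by simpa using n1) (by simpa using n2) (by simpa using n3) (by simpa using n4)
    (by simpa using n5) (by simpa using n6) (tD _ Ψ) (tD _ Ψ) (tD _ Ψ) (tD _ Ψ)
    (tc _ Ψ _ Ψ n1) (tc _ Ψ _ Ψ n2) (tc _ Ψ _ Ψ n3)
    (tc _ Ψ _ Ψ n4) (tc _ Ψ _ Ψ n5) (tc _ Ψ _ Ψ n6)

theorem no_k5 (hp : Pl G) (h : S.card = 5) : en G S ≤ 9 := by
  by_contra hn
  have hfull := fun x (hx : x ∈ S) y (hy : y ∈ S) => en_full (G := G) (S := S) (by rw [h]; omega) hx hy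
  obtain ⟨a, ha, b, hb, hab⟩ := Finset.one_lt_card.1 (by omega : 1 < S.card)
  obtain ⟨x, y, z, hnd, rfl⟩ := set5 ha hb hab h
  have hnd' := hnd
  simp only [List.nodup_cons, List.mem_cons, List.not_mem_nil, or_false, not_or] at hnd'
  obtain ⟨⟨n1, n2, n3, n4⟩, -⟩ := hnd'
  rw [List.nodup_cons] at hnd
  have hm : ∀ u ∈ [b, x, y, z], u ∈ ({a, b, x, y, z} : Finset V) := by
    intro u hu; simp at hu ⊢; tauto
  refine k5_of hp (cn_singleton a) hnd.2 (by simpa using Ne.symm n1) (by simpa using Ne.symm n2)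
    (by simpa using Ne.symm n3) (by simpa using Ne.symm n4) (fun u hu w hw => hfull u (hm u hu) w (hm w hw)) ?_
  intro u hu
  refine ⟨a, rfl, hfull a Ψ u (hm u hu) ?_⟩
  rintro rfl
  exact hnd.1 hu

theorem bn_le (x y : V) : bn G x y ≤ 1 := by
  unfold bn; exact Bool.toNat_le _

theorem bn_adj {x y : V} (h : 1 ≤ bn G x y) : G.Adj x y := by
  by_contra hn
  simp [bn, hn] at h

theorem bn_zero {x y : V} (h : ¬ G.Adj x y) : bn G x y = 0 := by simp [bn, h]

theorem bn_one {x y : V} (h : G.Adj x y) : bn G x y = 1 := by simp [bn, h]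

theorem en5' {a b x y z : V} (hn : [a, b, x, y, z].Nodup) :
    en G {a, b, x, y, z} = bn G a b + i9 G a b x y z := en5 hn

/-- a nonadjacent piece on five vertices has at most eight edges -/
theorem no_k5m (hp : Pl G) (hP : Pc G S a b) (hab : ¬ G.Adj a b) (h : S.card = 5) :
    en G S ≤ 8 := by
  by_contra hn
  obtain ⟨x, y, z, hnd, rfl⟩ := set5 hP.aS hP.bS hP.ne h
  rw [en5 hnd, bn_zero hab] at hn
  have := bn_le (G := G) a x
  have := bn_le (G := G) a y
  have := bn_le (G := G) a z
  have := bn_le (G := G) b x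
  have := bn_le (G := G) b y
  have := bn_le (G := G) b z
  have := bn_le (G := G) x y
  have := bn_le (G := G) x z
  have := bn_le (G := G) y z
  have h1 : G.Adj a x := bn_adj Ω
  have h2 : G.Adj a y := bn_adj Ω
  have h3 : G.Adj a z := bn_adj Ω
  have h4 : G.Adj b x := bn_adj Ω
  have h5 : G.Adj b y := bn_adj Ω
  have h6 : G.Adj b z := bn_adj Ω
  have h7 : G.Adj x y := bn_adj Ω
  have h8 : G.Adj x z := bn_adj Ω
  have h9 : G.Adj y z := bn_adj Ω
  clear hn
  have hnd' := hnd
  simp only [List.nodup_cons, List.mem_cons, List.not_mem_nil, or_false, not_or] at hnd'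
  obtain ⟨⟨n1, n2, n3, n4⟩, -⟩ := hnd'
  rw [List.nodup_cons] at hnd
  obtain ⟨Q, hQ, hQS, ⟨q, hq, haq⟩, q', hq', hbq⟩ := hP.ou
  have out : ∀ u ∈ [b, x, y, z], a ≠ u → u ∉ insert a Q := by
    intro u hu hau hu2
    rcases hu2 with rfl | hu2
    · exact hau rfl
    · refine hQS u hu2 ?_
      simp at hu ⊢; tauto
  refine k5_of hp (hQ.insert_adj hq haq) hnd.2 (out b Ψ n1) (out x Ψ n2) (out y Ψ n3)
    (out z Ψ n4) ?_ ?_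
  · intro u hu w hw huw
    simp only [List.mem_cons, List.not_mem_nil, or_false] at hu hw
    rcases hu with rfl | rfl | rfl | rfl <;> rcases hw with rfl | rfl | rfl | rfl <;>
      first
      | exact absurd rfl huw
      | assumption
      | (apply SimpleGraph.Adj.symm; assumption)
  · intro u hu
    simp only [List.mem_cons, List.not_mem_nil, or_false] at hu
    rcases hu with rfl | rfl | rfl | rfl
    · exact ⟨q', Or.inr hq', hbq.symm⟩
    · exact ⟨a, Or.inl rfl, h1⟩
    · exact ⟨a, Or.inl rfl, h2⟩
    · exact ⟨a, Or.inl rfl, h3⟩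

theorem Gl.num {N : ℕ} (hg : Gl G N) (hT : T2 G S) (hS : S.card < N) :
    (S.card = 3 ∧ en G S ≤ 3) ∨ (S.card = 4 ∧ en G S ≤ 6) ∨ (S.card = 5 ∧ en G S ≤ 9) ∨
    (6 ≤ S.card ∧ cv G S ≤ -20 ∧ (¬ Book G S → cv G S ≤ -27 ∧ (7 ≤ S.card → cv G S ≤ -30))) := by
  have h0 := hT.1
  have h1 := en_le (G := G) S
  obtain ⟨h2, h3⟩ := hg.ih S hS hT
  by_cases e3 : S.card = 3
  · rw [e3] at h1; exact Or.inl ⟨e3, by omega⟩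
  by_cases e4 : S.card = 4
  · rw [e4] at h1; exact Or.inr (Or.inl ⟨e4, by omega⟩)
  by_cases e5 : S.card = 5
  · exact Or.inr (Or.inr (Or.inl ⟨e5, no_k5 hg.pl e5⟩))
  refine Or.inr (Or.inr (Or.inr ⟨by omega, ?_⟩))
  unfold cv
  clear h1
  by_cases h9 : 9 ≤ S.card
  · have := h3 h9
    refine ⟨by omega, fun _ => ⟨by omega, fun _ => by omega⟩⟩
  · obtain ⟨h4, h5⟩ := h2 Ω Ω
    refine ⟨by omega, fun hb => ?_⟩
    have h6 : en G S + 2 ≠ 2 * S.card := fun h => hb (h5 h)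
    exact ⟨by omega, fun _ => by omega⟩

theorem cv_chain {c : V} (h : Ch G A B c) : cv G (A ∪ B) = cv G A + cv G B := by
  unfold cv
  have := h.card
  have := h.en
  omega

theorem Pc.cv2 (h : Pc G S a b) (h2 : S.card = 2) : en G S = 1 ∧ cv G S = -11 := by
  have : en G S = 1 := by rw [h.eq2 h2, en_pair h.ne, if_pos (h.adj2 h2)]
  exact ⟨this, by unfold cv; omega⟩

theorem chain_lt {a b c : V} (hc : Ch G A B c) (hA : Pc G A a c) (hB : Pc G B c b) :
    A.card < (A ∪ B).card ∧ B.card < (A ∪ B).card := by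
  have := hc.card
  have := hA.card2
  have := hB.card2
  omega

theorem Gl.pc9 {N : ℕ} (hg : Gl G N) : ∀ (m : ℕ) {S : Finset V} {a b : V}, S.card = m → Pc G S a b → S.card < N →
    cv G S ≤ -9 := by
  intro m
  induction m using Nat.strong_induction_on with
  | _ m ih =>
    intro S a b hm hP hS
    by_cases h2 : S.card = 2
    · have := (hP.cv2 h2).2
      omega
    have h3 : 3 ≤ S.card := by have := hP.card2; omega
    by_cases hT : T2 G S
    · rcases hg.num hT hS with h | h | h | h
      · unfold cv; omega
      · unfold cv; omega
      · unfold cv; omega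
      · omega
    · obtain ⟨c, A, B, rfl, hc, hA, hB, -⟩ := hP.chain hT h3
      obtain ⟨l1, l2⟩ := chain_lt hc hA hB
      have := ih A.card Ω rfl hA Ω
      have := ih B.card Ω rfl hB Ω
      rw [cv_chain hc]
      omega

theorem Gl.pc9' {N : ℕ} (hg : Gl G N) (hP : Pc G S a b) (hS : S.card < N) :
    cv G S ≤ -9 := hg.pc9 _ rfl hP hS

theorem Gl.pc18 {N : ℕ} (hg : Gl G N) (hP : Pc G S a b) (hS : S.card < N)
    (h3 : 3 ≤ S.card) (hT : ¬ T2 G S) : cv G S ≤ -18 := by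
  obtain ⟨c, A, B, rfl, hc, hA, hB, -⟩ := hP.chain hT h3
  obtain ⟨l1, l2⟩ := chain_lt hc hA hB
  have := hg.pc9' hA Ω
  have := hg.pc9' hB Ω
  rw [cv_chain hc]
  omega

theorem nadj_lt (ha : a ∈ S) (hb : b ∈ S) (hn : a ≠ b) (hab : ¬ G.Adj a b) :
    2 * en G S < S.card * (S.card - 1) := by
  by_contra h
  exact hab (en_full Ω ha hb hn)

theorem Pc.p2_5 (hP : Pc G S a b) (h : S.card = 5) (h8 : 8 ≤ en G S)
    (h' : G.Adj a b → 9 ≤ en G S) : P2 G S a b ∧ P3c G S a b ∧ P4c G S a b := by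
  obtain ⟨x, y, z, hnd, rfl⟩ := set5 hP.aS hP.bS hP.ne h
  apply leaf_paths hnd
  rw [en5' hnd] at h8 h'
  have := bn_le (G := G) a b
  by_cases hab : G.Adj a b
  · have := h' hab; omega
  · rw [bn_zero hab] at h8; omega

theorem Gl.pc16 {N : ℕ} (hg : Gl G N) (hP : Pc G S a b) (hS : S.card < N)
    (hab : ¬ G.Adj a b) : cv G S ≤ -16 ∧ (¬ P2 G S a b → cv G S ≤ -18) := by
  by_cases h2 : S.card = 2
  · exact absurd (hP.adj2 h2) hab
  have h3 : 3 ≤ S.card := by have := hP.card2; omega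
  by_cases hT : T2 G S
  · have hl := nadj_lt hP.aS hP.bS hP.ne hab
    rcases hg.num hT hS with h | h | h | h
    · unfold cv; rw [h.1] at hl; omega
    · unfold cv; rw [h.1] at hl; omega
    · have h8 := no_k5m hg.pl hP hab h.1
      refine ⟨by unfold cv; omega, fun hp => ?_⟩
      have : ¬ 8 ≤ en G S := fun h8 => hp (hP.p2_5 h.1 h8 (fun h => absurd h hab)).1
      unfold cv; omega
    · omega
  · have := hg.pc18 hP hS h3 hT
    exact ⟨by omega, fun _ => this⟩

theorem Gl.pc14 {N : ℕ} (hg : Gl G N) (hP : Pc G S a b) (hS : S.card < N)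
    (h : -14 ≤ cv G S) : G.Adj a b ∧ (S.card = 2 ∨ (S.card = 4 ∧ en G S = 6) ∨ (S.card = 5 ∧ en G S = 9)) := by
  constructor
  · by_contra hab
    have := (hg.pc16 hP hS hab).1
    omega
  · by_cases h2 : S.card = 2
    · exact Or.inl h2
    have h3 : 3 ≤ S.card := by have := hP.card2; omega
    by_cases hT : T2 G S
    · rcases hg.num hT hS with h' | h' | h' | h'
      · unfold cv at h; omega
      · unfold cv at h; omega
      · unfold cv at h; omega
      · omega
    · have := hg.pc18 hP hS h3 hT
      omega

/-- an adjacent complete or nearly complete piece -/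
theorem Pc.p23 (hP : Pc G S a b)
    (h : (S.card = 4 ∧ en G S = 6) ∨ (S.card = 5 ∧ en G S = 9)) : P2 G S a b ∧ P3 G S a b := by
  rcases h with h | h
  · have hf := fun x (hx : x ∈ S) y (hy : y ∈ S) => en_full (G := G) (S := S) (by rw [h.1]; omega) hx hy
    obtain ⟨x, y, hn, rfl⟩ := set4 hP.aS hP.bS hP.ne h.1
    simp only [List.nodup_cons, List.mem_cons, List.not_mem_nil, or_false, not_or] at hn
    obtain ⟨⟨n1, n2, n3⟩, ⟨n4, n5⟩, n6, -⟩ := hn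
    refine ⟨⟨x, by simp, hf a Ψ x Ψ n2, hf x Ψ b Ψ (Ne.symm n4)⟩,
      x, by simp, y, by simp, hf a Ψ x Ψ n2, hf x Ψ y Ψ n6,
      hf y Ψ b Ψ (Ne.symm n5), Ne.symm n4, Ne.symm n3⟩
  · obtain ⟨h1, h2, -⟩ := hP.p2_5 h.1 Ω Ω
    exact ⟨h1, h2.p3⟩

theorem deg_mono {A S : Finset V} {x : V} (h : ∀ y ∈ S, G.Adj x y → y ∈ A) :
    (S.filter (G.Adj x)).card ≤ (A.filter (G.Adj x)).card := by
  apply Finset.card_le_card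
  intro y hy
  rw [Finset.mem_filter] at hy ⊢
  exact ⟨h y hy.1 hy.2, hy.2⟩

theorem D3.symm (h : D3 G S a b) : D3 G S b a :=
  fun x hx h1 h2 => h x hx h2 h1

theorem D3.left {a b c : V} (h : D3 G (A ∪ B) a b) (hc : Ch G A B c) (hb : b ∉ A) :
    D3 G A a c := by
  intro x hx h1 h2
  refine le_trans (h x (by simp [hx]) h1 (fun e => hb (e ▸ hx))) (deg_mono ?_)
  intro y hy hxy
  by_contra hyA
  have hyB : y ∈ B := by simpa [hyA] using hy
  exact hc.nx x hx (fun hxB => h2 (hc.inter x hx hxB)) y hyB hyA hxy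

theorem D3.right {a b c : V} (h : D3 G (A ∪ B) a b) (hc : Ch G A B c) (ha : a ∉ B) :
    D3 G B c b := by
  have h' : D3 G (B ∪ A) b a := by rw [Finset.union_comm]; exact h.symm
  exact (h'.left hc.symm ha).symm

theorem D3.side (h : ∀ x ∈ A ∪ B, 3 ≤ ((A ∪ B).filter (G.Adj x)).card)
    (hs : Sp G A B a b) : D3 G A a b := by
  intro x hx h1 h2
  refine le_trans (h x (by simp [hx])) (deg_mono ?_)
  intro y hy hxy
  by_contra hyA
  have hyB : y ∈ B := by simpa [hyA] using hy
  refine hs.nx x hx (fun hxB => ?_) y hyB hyA hxy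
  rcases hs.inter x hx hxB with h | h
  · exact h1 h
  · exact h2 h

theorem deg_le {x : V} (hx : x ∈ S) : (S.filter (G.Adj x)).card + 1 ≤ S.card := by
  have : (S.filter (G.Adj x)) ⊆ S.erase x := by
    intro y hy
    rw [Finset.mem_filter] at hy
    simp [hy.1, hy.2.ne.symm]
  have := Finset.card_le_card this
  rw [Finset.card_erase_of_mem hx] at this
  have : 0 < S.card := Finset.card_pos.2 ⟨x, hx⟩
  omega

theorem Pc.third (hP : Pc G S a b) (h3 : 3 ≤ S.card) : ∃ x ∈ S, x ≠ a ∧ x ≠ b := by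
  by_contra hn
  push Not at hn
  have h2 : S ⊆ {a, b} := by
    intro x hx
    by_cases hxu : x = a
    · simp [hxu]
    · simp [hn x hx hxu]
  have := Finset.card_le_card h2
  have := Finset.card_le_two (a := a) (b := b)
  omega

theorem D3.card4 (hD : D3 G S a b) (hP : Pc G S a b) (h3 : 3 ≤ S.card) : 4 ≤ S.card := by
  obtain ⟨x, hx, h1, h2⟩ := hP.third h3
  have := hD x hx h1 h2
  have := deg_le (G := G) hx
  omega

/-- a vertex of full degree -/
theorem deg_full {x : V} (hx : x ∈ S) (h : S.card ≤ (S.filter (G.Adj x)).card + 1) {y : V}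
    (hy : y ∈ S) (hxy : x ≠ y) : G.Adj x y := by
  have hs : (S.filter (G.Adj x)) ⊆ S.erase x := by
    intro y hy
    rw [Finset.mem_filter] at hy
    simp [hy.1, hy.2.ne.symm]
  have h0 := Finset.card_erase_of_mem hx
  have h1 : 0 < S.card := Finset.card_pos.2 ⟨x, hx⟩
  have := Finset.eq_of_subset_of_card_le hs Ω
  have h2 : y ∈ S.filter (G.Adj x) := by rw [this]; simp [hy, hxy.symm]
  exact (Finset.mem_filter.1 h2).2

theorem D3.four (hD : D3 G S a b) (ha : a ∈ S) (hb : b ∈ S) (hab : a ≠ b) (h4 : S.card = 4) :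
    P2 G S a b ∧ P3c G S a b ∧ 5 ≤ en G S := by
  obtain ⟨x, y, hn, rfl⟩ := set4 ha hb hab h4
  simp only [List.nodup_cons, List.mem_cons, List.not_mem_nil, or_false, not_or] at hn
  obtain ⟨⟨n1, n2, n3⟩, ⟨n4, n5⟩, n6, -⟩ := hn
  have hx := fun w hw => deg_full (G := G) (S := {a, b, x, y}) (x := x) (y := w) Ψ
    (by rw [h4]; have := hD x Ψ (Ne.symm n2) (Ne.symm n4); omega) hw
  have hy := fun w hw => deg_full (G := G) (S := {a, b, x, y}) (x := y) (y := w) Ψ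
    (by rw [h4]; have := hD y Ψ (Ne.symm n3) (Ne.symm n5); omega) hw
  have xa := hx a Ψ (Ne.symm n2)
  have xb := hx b Ψ (Ne.symm n4)
  have xy := hx y Ψ n6
  have ya := hy a Ψ (Ne.symm n3)
  have yb := hy b Ψ (Ne.symm n5)
  refine ⟨⟨x, by simp, xa.symm, xb⟩, ⟨x, by simp, y, by simp, xa.symm, xy, yb, Ne.symm n4, Ne.symm n3,
    Or.inl ya.symm⟩, ?_⟩
  rw [en_bn (v := a) (by simp; tauto), en_bn (v := b) (by simp; tauto), en_bn (v := x) (by simp; tauto), en_single,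
    Finset.sum_insert (by simp; tauto), Finset.sum_insert (by simp; tauto), Finset.sum_insert (by simp; tauto)]
  simp only [Finset.sum_singleton]
  rw [bn_one xa.symm, bn_one ya.symm, bn_one xb.symm, bn_one yb.symm, bn_one xy]
  omega

theorem Book.piece (hB : Book G S) (h6 : 6 ≤ S.card) (hD : D3 G S a b) (hab : a ≠ b) :
    S.card = 6 ∧ ¬ G.Adj a b ∧ P2 G S a b ∧ P3c G S a b ∧ P4c G S a b := by
  obtain ⟨p, hp, q, hq, x, hx, y, hy, pq, xy, n1, n2, n3, n4, hall, hdeg⟩ := hB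
  have key : ∀ z ∈ S, z ≠ p → z ≠ q → z ≠ x → z ≠ y → z = a ∨ z = b := by
    intro z hz m1 m2 m3 m4
    by_contra hn
    push Not at hn
    have h1 := hD z hz hn.1 hn.2
    have h2 : S.filter (G.Adj z) ⊆ {p, q} := by
      intro w hw
      rw [Finset.mem_filter] at hw
      simpa using hdeg z hz m1 m2 m3 m4 w hw.1 hw.2
    have := Finset.card_le_card h2
    have := Finset.card_le_two (a := p) (b := q)
    omega
  have hsub : S ⊆ {p, q, x, y, a, b} := by
    intro z hz
    by_cases m1 : z = p
    · simp [m1]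
    by_cases m2 : z = q
    · simp [m2]
    by_cases m3 : z = x
    · simp [m3]
    by_cases m4 : z = y
    · simp [m4]
    rcases key z hz m1 m2 m3 m4 with h | h <;> simp [h]
  have hle := Finset.card_le_card hsub
  have hl6 : ({p, q, x, y, a, b} : Finset V).card ≤ 6 := Finset.card_le_six
  have hS := Finset.eq_of_subset_of_card_le hsub Ω
  have ha : a ∈ S := by rw [hS]; simp
  have hb : b ∈ S := by rw [hS]; simp
  have hnot : ∀ u, (u = p ∨ u = q ∨ u = x ∨ u = y) → (u ≠ a ∧ u ≠ b) := by
    intro u hu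
    constructor
    · intro e
      have : ({p, q, x, y, a, b} : Finset V) ⊆ {p, q, x, y, b} := by
        intro w hw; simp at hw ⊢; rcases hu with rfl | rfl | rfl | rfl <;> rcases hw with h | h | h | h | h | h <;> simp [h, e]
      have := Finset.card_le_card this
      have : ({p, q, x, y, b} : Finset V).card ≤ 5 := Finset.card_le_five
      omega
    · intro e
      have : ({p, q, x, y, a, b} : Finset V) ⊆ {p, q, x, y, a} := by
        intro w hw; simp at hw ⊢; rcases hu with rfl | rfl | rfl | rfl <;> rcases hw with h | h | h | h | h | h <;> simp [h, e]
      have := Finset.card_le_card this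
      have : ({p, q, x, y, a} : Finset V).card ≤ 5 := Finset.card_le_five
      omega
  obtain ⟨kp1, kp2⟩ := hnot p Ψ
  obtain ⟨kq1, kq2⟩ := hnot q Ψ
  obtain ⟨kx1, kx2⟩ := hnot x Ψ
  obtain ⟨ky1, ky2⟩ := hnot y Ψ
  obtain ⟨ap, aq⟩ := hall a ha kp1.symm kq1.symm
  obtain ⟨bp, bq⟩ := hall b hb kp2.symm kq2.symm
  obtain ⟨xp, xq⟩ := hall x hx n1 n2
  refine ⟨by omega, ?_, ⟨p, hp, ap, bp.symm⟩, ⟨p, hp, q, hq, ap, pq, bq.symm, kp2, kq1, Or.inl aq⟩,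
    p, hp, x, hx, q, hq, ap, xp.symm, xq, bq.symm, kp2, kx1, kx2, kq1, pq.ne, Or.inr (Or.inl aq)⟩
  intro h
  rcases hdeg a ha kp1.symm kq1.symm kx1.symm ky1.symm b hb h with h | h
  · exact kp2 h.symm
  · exact kq2 h.symm

theorem disj_nbr (hT : T2 G S) (ha : a ∈ S) (hb : b ∈ S) (hne : a ≠ b) (hab : ¬ G.Adj a b)
    (hP : ¬ P2 G S a b) : 6 ≤ S.card ∧ (S.card = 6 → ∀ x ∈ S, x = a ∨ x = b ∨ G.Adj a x ∨ G.Adj b x) := by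
  have h1 := hT.deg ha
  have h2 := hT.deg hb
  have hd : Disjoint (S.filter (G.Adj a)) (S.filter (G.Adj b)) := by
    rw [Finset.disjoint_left]
    intro x hx hx'
    rw [Finset.mem_filter] at hx hx'
    exact hP ⟨x, hx.1, hx.2, hx'.2.symm⟩
  have hd2 : Disjoint ({a, b} : Finset V) (S.filter (G.Adj a) ∪ S.filter (G.Adj b)) := by
    rw [Finset.disjoint_left]
    intro x hx hx'
    simp at hx hx'
    rcases hx with rfl | rfl
    · rcases hx' with h | h
      · exact h.2.ne rfl
      · exact hab h.2.symm
    · rcases hx' with h | h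
      · exact hab h.2
      · exact h.2.ne rfl
  have hs : ({a, b} : Finset V) ∪ (S.filter (G.Adj a) ∪ S.filter (G.Adj b)) ⊆ S := by
    intro x hx
    simp at hx
    rcases hx with rfl | rfl | h | h
    · exact ha
    · exact hb
    · exact h.1
    · exact h.1
  have hc := Finset.card_union_of_disjoint hd2
  rw [Finset.card_union_of_disjoint hd, Finset.card_pair hne] at hc
  have hle := Finset.card_le_card hs
  refine ⟨by omega, fun h6 x hx => ?_⟩
  have := Finset.eq_of_subset_of_card_le hs Ω
  rw [← this] at hx
  simp at hx
  tauto

theorem Gl.b1 {N : ℕ} (hg : Gl G N) (hP : Pc G S a b) (hS : S.card < N)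
    (hD : D3 G S a b) (hab : ¬ G.Adj a b) (h2 : ¬ P2 G S a b) : cv G S ≤ -25 := by
  have hc2 : S.card ≠ 2 := fun h => hab (hP.adj2 h)
  have h3 : 3 ≤ S.card := by have := hP.card2; omega
  by_cases hT : T2 G S
  · have h6 := (disj_nbr hT hP.aS hP.bS hP.ne hab h2).1
    have hB : ¬ Book G S := fun hB => h2 (hB.piece h6 hD hP.ne).2.2.1
    rcases hg.num hT hS with h | h | h | h
    · omega
    · omega
    · omega
    · have := (h.2.2 hB).1; omega
  · obtain ⟨c, A, B, rfl, hc, hA, hB, -⟩ := hP.chain hT h3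
    obtain ⟨l1, l2⟩ := chain_lt hc hA hB
    have p1 := hg.pc9' hA Ω
    have p2 := hg.pc9' hB Ω
    rw [cv_chain hc]
    by_cases e1 : G.Adj a c
    · by_cases e2 : G.Adj c b
      · exact absurd ⟨c, by simp [hc.cA], e1, e2⟩ h2
      · have := (hg.pc16 hB Ω e2).1; omega
    · have := (hg.pc16 hA Ω e1).1; omega

theorem Gl.b2 {N : ℕ} (hg : Gl G N) (hP : Pc G S a b) (hS : S.card < N)
    (hD : D3 G S a b) (hab : ¬ G.Adj a b) (h2 : ¬ P2 G S a b) (h3 : ¬ P3 G S a b) : cv G S ≤ -30 := by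
  have hc2 : S.card ≠ 2 := fun h => hab (hP.adj2 h)
  have hc3 : 3 ≤ S.card := by have := hP.card2; omega
  by_cases hT : T2 G S
  · obtain ⟨h6, h6'⟩ := disj_nbr hT hP.aS hP.bS hP.ne hab h2
    have hB : ¬ Book G S := fun hB => h2 (hB.piece h6 hD hP.ne).2.2.1
    rcases hg.num hT hS with h | h | h | h
    · omega
    · omega
    · omega
    · by_cases h7 : 7 ≤ S.card
      · exact (h.2.2 hB).2 h7
      exfalso
      have hcov := h6' Ω
      have := hP.conn hc3 (X := fun z => z = a ∨ G.Adj a z) ?_ ⟨a, hP.aS, Or.inl rfl⟩ b hP.bS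
      · rcases this with h | h
        · exact hP.ne h.symm
        · exact hab h
      · rintro x hx (rfl | hax) y hy hxy
        · exact Or.inr hxy
        · rcases hcov y hy with rfl | rfl | h | h
          · exact Or.inl rfl
          · exact absurd ⟨x, hx, hax, hxy⟩ h2
          · exact Or.inr h
          · by_cases hya : y = a
            · exact Or.inl hya
            refine absurd ⟨x, hx, y, hy, hax, hxy, h.symm, ?_, hya⟩ h3
            rintro rfl
            exact hab hax
  · obtain ⟨c, A, B, rfl, hc, hA, hB, aB, bA⟩ := hP.chain hT hc3
    obtain ⟨l1, l2⟩ := chain_lt hc hA hB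
    have p1 := hg.pc9' hA Ω
    have p2 := hg.pc9' hB Ω
    have bc : c ≠ b := fun e => bA (e ▸ hc.cA)
    have ac : c ≠ a := fun e => aB (e ▸ hc.cB)
    rw [cv_chain hc]
    by_cases e1 : G.Adj a c
    · by_cases e2 : G.Adj c b
      · exact absurd ⟨c, by simp [hc.cA], e1, e2⟩ h2
      · have : ¬ P2 G B c b := by
          rintro ⟨z, hz, z1, z2⟩
          exact h3 ⟨c, by simp [hc.cA], z, by simp [hz], e1, z1, z2, bc, fun e => aB (e ▸ hz)⟩
        have := hg.b1 hB Ω (hD.right hc aB) e2 this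
        omega
    · have := (hg.pc16 hA Ω e1).1
      by_cases e2 : G.Adj c b
      · have : ¬ P2 G A a c := by
          rintro ⟨z, hz, z1, z2⟩
          exact h3 ⟨z, by simp [hz], c, by simp [hc.cA], z1, z2, e2, fun e => bA (e ▸ hz), ac⟩
        have := hg.b1 hA Ω (hD.left hc bA) e1 this
        omega
      · have := (hg.pc16 hB Ω e2).1; omega

theorem np2_i9 {a b x y z : V} (h : ¬ P2 G {a, b, x, y, z} a b) : i9 G a b x y z ≤ 6 := by
  have k : ∀ u ∈ ({a, b, x, y, z} : Finset V), bn G a u + bn G b u ≤ 1 := by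
    intro u hu
    by_contra hn
    have h1 := bn_le (G := G) a u
    have h2 := bn_le (G := G) b u
    exact h ⟨u, hu, bn_adj Ω, (bn_adj (by omega : 1 ≤ bn G b u)).symm⟩
  have := k x Ψ
  have := k y Ψ
  have := k z Ψ
  have := bn_le (G := G) x y
  have := bn_le (G := G) x z
  have := bn_le (G := G) y z
  unfold i9
  omega

theorem Gl.b3 {N : ℕ} (hg : Gl G N) (hP : Pc G S a b) (hS : S.card < N)
    (hD : D3 G S a b) (hab : G.Adj a b) (h2 : ¬ P2 G S a b) : S.card = 2 ∨ cv G S ≤ -23 := by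
  by_cases hc2 : S.card = 2
  · exact Or.inl hc2
  right
  have hc3 : 3 ≤ S.card := by have := hP.card2; omega
  have hc4 := hD.card4 hP hc3
  have hT := hP.t2 hab hc3
  rcases hg.num hT hS with h | h | h | h
  · omega
  · exact absurd (hD.four hP.aS hP.bS hP.ne h.1).1 h2
  · obtain ⟨x, y, z, hnd, rfl⟩ := set5 hP.aS hP.bS hP.ne h.1
    have e := en5' (G := G) hnd
    have := np2_i9 h2
    have := bn_le (G := G) a b
    unfold cv; omega
  · have hB : ¬ Book G S := fun hB => h2 (hB.piece h.1 hD hP.ne).2.2.1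
    have := (h.2.2 hB).1; omega

theorem chain_rich {a b c : V} (hc : Ch G A B c) (aB : a ∉ B) (bA : b ∉ A) (h1 : G.Adj a c)
    (h2 : G.Adj c b) (h : P2 G A a c ∧ P3 G A a c) :
    P2 G (A ∪ B) a b ∧ P3c G (A ∪ B) a b ∧ P4c G (A ∪ B) a b := by
  have bc : c ≠ b := fun e => bA (e ▸ hc.cA)
  have ac : c ≠ a := fun e => aB (e ▸ hc.cB)
  have cS : c ∈ A ∪ B := by simp [hc.cA]
  obtain ⟨⟨z, hz, z1, z2⟩, x, hx, y, hy, w1, w2, w3, w4, w5⟩ := h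
  refine ⟨⟨c, cS, h1, h2⟩, ⟨z, by simp [hz], c, cS, z1, z2, h2, fun e => bA (e ▸ hz), ac, Or.inl h1⟩,
    x, by simp [hx], y, by simp [hy], c, cS, w1, w2, w3, h2, fun e => bA (e ▸ hx), w5, fun e => bA (e ▸ hy), ac, w4,
    Or.inr (Or.inl h1)⟩

theorem Gl.rich {N : ℕ} (hg : Gl G N) (hP : Pc G S a b) (hS : S.card < N)
    (hD : D3 G S a b) (hab : ¬ G.Adj a b) (hv : -23 ≤ cv G S) :
    (S.card = 4 ∧ P2 G S a b ∧ P3c G S a b) ∨ (P2 G S a b ∧ P3c G S a b ∧ P4c G S a b) := by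
  have hc2 : S.card ≠ 2 := fun h => hab (hP.adj2 h)
  have hc3 : 3 ≤ S.card := by have := hP.card2; omega
  have hc4 := hD.card4 hP hc3
  by_cases hT : T2 G S
  · rcases hg.num hT hS with h | h | h | h
    · omega
    · obtain ⟨h1, h2, -⟩ := hD.four hP.aS hP.bS hP.ne h.1
      exact Or.inl ⟨h.1, h1, h2⟩
    · right
      obtain ⟨x, y, z, hnd, rfl⟩ := set5 hP.aS hP.bS hP.ne h.1
      have e := en5' (G := G) hnd
      have e0 := bn_zero hab
      exact seven_paths hnd (by unfold cv at hv; omega) hab hD (hT.deg hP.aS) (hT.deg hP.bS)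
    · by_cases hB : Book G S
      · exact Or.inr (hB.piece h.1 hD hP.ne).2.2
      · have := (h.2.2 hB).1; omega
  · obtain ⟨c, A, B, rfl, hc, hA, hB, aB, bA⟩ := hP.chain hT hc3
    obtain ⟨l1, l2⟩ := chain_lt hc hA hB
    have p1 := hg.pc9' hA Ω
    have p2 := hg.pc9' hB Ω
    rw [cv_chain hc] at hv
    obtain ⟨a1, q1⟩ := hg.pc14 hA Ω Ω
    obtain ⟨a2, q2⟩ := hg.pc14 hB Ω Ω
    right
    rcases q1 with q1 | q1
    · rcases q2 with q2 | q2
      · have := hc.card; omega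
      · have := chain_rich hc.symm bA aB a2.symm a1.symm (hB.symm.p23 q2)
        rw [Finset.union_comm]
        exact ⟨this.1.symm, this.2.1.symm, this.2.2.symm⟩
    · exact chain_rich hc aB bA a1 a2 (hA.p23 q1)

theorem Sp.lt (h : Sp G A B a b) (hB : ∃ x ∈ B, x ∉ A) : A.card < (A ∪ B).card := by
  obtain ⟨x, hx, hx'⟩ := hB
  apply Finset.card_lt_card
  refine ⟨Finset.subset_union_left, fun hs => hx' (hs (by simp [hx]))⟩

theorem Sp.three (h : Sp G A B a b) (hA : ∃ x ∈ A, x ∉ B) : 3 ≤ A.card := by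
  obtain ⟨x, hx, hx'⟩ := hA
  have hxa : x ≠ a := fun e => hx' (e ▸ h.aB)
  have hxb : x ≠ b := fun e => hx' (e ▸ h.bB)
  have hs : ({x, a, b} : Finset V) ⊆ A := by
    intro y hy
    simp at hy
    rcases hy with rfl | rfl | rfl
    · exact hx
    · exact h.aA
    · exact h.bA
  have := Finset.card_le_card hs
  rwa [Finset.card_eq_three.2 ⟨x, a, b, hxa, hxb, h.ne, rfl⟩] at this

/-- a leaf side -/
def Lf (G : SimpleGraph V) (A : Finset V) (a b : V) : Prop :=
  A.card = 5 ∧ 8 + (if G.Adj a b then 1 else 0) ≤ en G A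

theorem sep_aux {N : ℕ} (hg : Gl G N) (hs : Sp G A B a b) (hN : (A ∪ B).card = N)
    (h9 : 9 ≤ N) (hA : Pc G A a b) (hB : Pc G B a b) (lA : A.card < N) (lB : B.card < N) (hDA : D3 G A a b)
    (hDB : D3 G B a b) (hab : ¬ G.Adj a b) (hex : 18 * N < 7 * en G (A ∪ B) + 48) (hv : -23 ≤ cv G A) :
    Lf G A a b := by
  have hcard := hs.card
  have hen := hs.en
  rw [if_neg hab] at hen
  have hsum : -47 ≤ cv G A + cv G B := by unfold cv; omega
  have hA2 : A.card ≠ 2 := fun h => hab (hA.adj2 h)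
  have hA3 : 3 ≤ A.card := by have := hA.card2; omega
  rcases hg.rich hA lA hDA hab hv with ⟨h4, h2, h3⟩ | ⟨h2, h3, h4⟩
  · exfalso
    have h5 := (hDA.four hA.aS hA.bS hA.ne h4).2.2
    have hl := nadj_lt hA.aS hA.bS hA.ne hab
    rw [h4] at hl
    have hcv : cv G A ≤ -19 := by unfold cv; omega
    have np : ¬ P3 G B a b := fun hp => glue33 hg.fr hs.symm hp h3
    have hB7 : 7 ≤ B.card := by omega
    by_cases hT : T2 G B
    · have hBk : ¬ Book G B := fun h => by
        have := (h.piece Ω hDB hs.ne).1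
        omega
      rcases hg.num hT lB with h | h | h | h
      · omega
      · omega
      · omega
      · have := (h.2.2 hBk).2 hB7
        omega
    · obtain ⟨c, C, D, rfl, hc, hC, hD, aD, bC⟩ := hB.chain hT Ω
      obtain ⟨l1, l2⟩ := chain_lt hc hC hD
      have p1 := hg.pc9' hC Ω
      have p2 := hg.pc9' hD Ω
      have d1 := hDB.left hc bC
      have d2 := hDB.right hc aD
      rw [cv_chain hc] at hsum
      have bc : c ≠ b := fun e => bC (e ▸ hc.cA)
      have ac : c ≠ a := fun e => aD (e ▸ hc.cB)
      have k1 : G.Adj a c → ¬ P2 G D c b := by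
        rintro e1 ⟨z, hz, z1, z2⟩
        exact np ⟨c, by simp [hc.cA], z, by simp [hz], e1, z1, z2, bc, fun e => aD (e ▸ hz)⟩
      have k2 : G.Adj c b → ¬ P2 G C a c := by
        rintro e2 ⟨z, hz, z1, z2⟩
        exact np ⟨z, by simp [hz], c, by simp [hc.cA], z1, z2, e2, fun e => bC (e ▸ hz), ac⟩
      by_cases e1 : G.Adj a c
      · by_cases e2 : G.Adj c b
        · rcases hg.b3 hC Ω d1 e1 (k2 e2) with h | h
          · rcases hg.b3 hD Ω d2 e2 (k1 e1) with h' | h'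
            · have := hc.card; omega
            · omega
          · omega
        · have := hg.b1 hD Ω d2 e2 (k1 e1)
          omega
      · have := (hg.pc16 hC Ω e1).1
        by_cases e2 : G.Adj c b
        · have := hg.b1 hC Ω d1 e1 (k2 e2)
          omega
        · have := (hg.pc16 hD Ω e2).1
          omega
  · have n2 : ¬ P2 G B a b := fun hp => glue24 hg.fr hs.symm hp h4
    have n3 : ¬ P3 G B a b := fun hp => glue33 hg.fr hs.symm hp h3
    have := hg.b2 hB lB hDB hab n2 n3
    unfold Lf
    rw [if_neg hab]
    have hl := nadj_lt hA.aS hA.bS hA.ne hab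
    by_cases hT : T2 G A
    · rcases hg.num hT lA with h | h | h | h
      · rw [h.1] at hl; unfold cv at *; omega
      · rw [h.1] at hl; unfold cv at *; omega
      · unfold cv at *; omega
      · omega
    · have := hg.pc18 hA lA hA3 hT
      omega

theorem sep_leaf {N : ℕ} (hg : Gl G N) (hs : Sp G A B a b) (hN : (A ∪ B).card = N)
    (h9 : 9 ≤ N) (hT : T2 G (A ∪ B)) (hA : ∃ x ∈ A, x ∉ B) (hB : ∃ x ∈ B, x ∉ A)
    (hdeg : ∀ x ∈ A ∪ B, 3 ≤ ((A ∪ B).filter (G.Adj x)).card)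
    (hex : 18 * N < 7 * en G (A ∪ B) + 48) : Lf G A a b ∨ Lf G B a b := by
  have pA := hT.piece hs hA hB
  have pB : Pc G B a b := by
    rw [Finset.union_comm] at hT
    exact hT.piece hs.symm hB hA
  have dA := D3.side hdeg hs
  have dB : D3 G B a b := by
    rw [Finset.union_comm] at hdeg
    exact D3.side hdeg hs.symm
  have lA := hs.lt hB
  have lB := hs.symm.lt hA
  rw [Finset.union_comm B A] at lB
  have hcard := hs.card
  have hen := hs.en
  have a4 := dA.card4 pA (hs.three hA)
  have b4 := dB.card4 pB (hs.symm.three hB)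
  by_cases hab : G.Adj a b
  · rw [if_pos hab] at hen
    unfold Lf
    rw [if_pos hab]
    have tA := pA.t2 hab Ω
    have tB := pB.t2 hab Ω
    have bA : 6 ≤ A.card → ¬ Book G A := fun h h' => (h'.piece h dA hs.ne).2.1 hab
    have bB : 6 ≤ B.card → ¬ Book G B := fun h h' => (h'.piece h dB hs.ne).2.1 hab
    have nA := hg.num tA Ω
    have nB := hg.num tB Ω
    unfold cv at nA nB
    rcases nA with h | h | h | ⟨h, -, h2⟩
    · omega
    · rcases nB with h' | h' | h' | ⟨h', -, h2'⟩
      · omega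
      · omega
      · omega
      · have := h2' (bB h')
        omega
    · by_cases h8 : en G A = 9
      · exact Or.inl ⟨h.1, by omega⟩
      rcases nB with h' | h' | h' | ⟨h', -, h2'⟩
      · omega
      · omega
      · omega
      · have := h2' (bB h')
        omega
    · have := h2 (bA h)
      rcases nB with h' | h' | h' | ⟨h', -, h2'⟩
      · omega
      · omega
      · by_cases h8 : en G B = 9
        · exact Or.inr ⟨h'.1, by omega⟩
        omega
      · have := h2' (bB h')
        omega
  · by_cases hv : -23 ≤ cv G A
    · exact Or.inl (sep_aux hg hs hN h9 pA pB Ω Ω dA dB hab hex hv)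
    · right
      rw [if_neg hab] at hen
      have hv2 : -23 ≤ cv G B := by unfold cv at *; omega
      have l1 : B.card < N := by omega
      have l2 : A.card < N := by omega
      rw [Finset.union_comm] at hN hex
      exact sep_aux hg hs.symm hN h9 pB pA l1 l2 dB dA hab hex hv2

/-- ring of pieces through a vertex of degree two -/
theorem chain_th {a b c v : V} (hf : ¬ HasTheta6 G) (hc : Ch G A B c) (aB : a ∉ B) (bA : b ∉ A)
    (vA : v ∉ A) (vB : v ∉ B) (hab : a ≠ b) (va : G.Adj v a) (vb : G.Adj v b) (h1 : G.Adj a c)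
    (hP : P2 G A a c ∧ P3 G A a c) (aA : a ∈ A) (bB : b ∈ B) (h2 : G.Adj c b ∨ P2 G B c b) : False := by
  have bc : c ≠ b := fun e => bA (e ▸ hc.cA)
  have ac : c ≠ a := fun e => aB (e ▸ hc.cB)
  have vc : v ≠ c := fun e => vA (e ▸ hc.cA)
  obtain ⟨⟨z, hz, z1, z2⟩, x, hx, y, hy, w1, w2, w3, w4, w5⟩ := hP
  rcases h2 with h2 | ⟨t, ht, t1, t2⟩
  · refine th6 hf v a x y c b ⟨va, w1, w2, w3, h2, vb.symm⟩ (by tauto) ⟨?_, ?_, vc, w5.symm, ac.symm, hab, w4, ?_, ?_⟩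
    · rintro rfl; exact vA hx
    · rintro rfl; exact vA hy
    · rintro rfl; exact bA hx
    · rintro rfl; exact bA hy
  · have tA : t ∉ A := fun h => t1.ne (hc.inter t h ht).symm
    refine th6 hf v a z c t b ⟨va, z1, z2, t1, t2, vb.symm⟩ (by tauto) ⟨?_, vc, ?_, ac.symm, ?_, hab, ?_, ?_, bc⟩
    · rintro rfl; exact vA hz
    · rintro rfl; exact vB ht
    · rintro rfl; exact aB ht
    · rintro rfl; exact tA hz
    · rintro rfl; exact bA hz

/-- data for a vertex of degree two -/
structure Dg2 (G : SimpleGraph V) (S : Finset V) (v a b : V) : Prop where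
  va : G.Adj v a
  vb : G.Adj v b
  vS : v ∉ S
  pc : Pc G S a b
  en : en G (insert v S) = en G S + 2
  sp : Sp G {v, a, b} S a b
  nb : ∀ x ∈ S, G.Adj v x → x = a ∨ x = b

theorem dg2_of (hT : T2 G S) {v : V} (hv : v ∈ S) (hd : (S.filter (G.Adj v)).card < 3)
    (h4 : 4 ≤ S.card) : ∃ a b S', S = insert v S' ∧ Dg2 G S' v a b := by
  have h2 := hT.deg hv
  obtain ⟨a, b, hab, he⟩ := Finset.card_eq_two.1 (by omega : (S.filter (G.Adj v)).card = 2)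
  have ha : a ∈ S.filter (G.Adj v) := by rw [he]; simp
  have hb : b ∈ S.filter (G.Adj v) := by rw [he]; simp
  rw [Finset.mem_filter] at ha hb
  have nb : ∀ x ∈ S, G.Adj v x → x = a ∨ x = b := by
    intro x hx hvx
    have : x ∈ S.filter (G.Adj v) := by rw [Finset.mem_filter]; exact ⟨hx, hvx⟩
    rw [he] at this
    simpa using this
  have sp : Sp G {v, a, b} (S.erase v) a b := by
    refine ⟨hab, by simp, by simp, by simp [ha.1, ha.2.ne.symm], by simp [hb.1, hb.2.ne.symm], ?_, ?_⟩
    · intro x hx hx'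
      simp at hx hx'
      tauto
    · intro x hx hx' y hy hy' hxy
      simp at hx hx' hy hy'
      rcases hx with rfl | rfl | rfl
      · rcases nb y hy.2 hxy with h | h
        · exact hy'.2.1 h
        · exact hy'.2.2 h
      · exact hx' ha.2.ne.symm ha.1
      · exact hx' hb.2.ne.symm hb.1
  have hU : S.erase v ∪ {v, a, b} = S := by
    ext x
    rw [Finset.mem_union, Finset.mem_erase]
    constructor
    · rintro (⟨-, h⟩ | h)
      · exact h
      · simp only [Finset.mem_insert, Finset.mem_singleton] at h
        rcases h with rfl | rfl | rfl
        · exact hv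
        · exact ha.1
        · exact hb.1
    · intro h
      by_cases hxv : x = v
      · simp [hxv]
      · exact Or.inl ⟨hxv, h⟩
  refine ⟨a, b, S.erase v, (Finset.insert_erase hv).symm, ha.2, hb.2, by simp, ?_, ?_, sp, ?_⟩
  · refine T2.piece (B := {v, a, b}) (by rw [hU]; exact hT) sp.symm ?_ ⟨v, by simp, by simp⟩
    by_contra hn
    push Not at hn
    have : S ⊆ {v, a, b} := by
      intro x hx
      by_cases hxv : x = v
      · simp [hxv]
      · exact hn x (by simp [hxv, hx])
    have := Finset.card_le_card this
    have := Finset.card_le_three (a := v) (b := a) (c := b)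
    omega
  · rw [en_insert (Finset.notMem_erase v S)]
    congr 1
    have : (S.erase v).filter (fun u => G.Adj v u) = S.filter (G.Adj v) := by
      ext x
      simp
      intro hx h
      exact hx.ne.symm
    have e2 : ((S.erase v).filter (fun u => G.Adj v u)).card = 2 := by rw [this, he, Finset.card_pair hab]
    convert e2
  · intro x hx h
    exact nb x (Finset.mem_of_mem_erase hx) h

theorem pc_en {N : ℕ} (hg : Gl G N) (hP : Pc G S a b) (hS : S.card < N) :
    (S.card = 2 → en G S = 1) ∧ (S.card = 3 → en G S ≤ 3 ∧ (en G S = 3 → G.Adj a b)) ∧ (S.card = 4 → en G S ≤ 6) ∧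
    (S.card = 5 → en G S ≤ 9) ∧ (S.card = 6 → en G S ≤ 10) := by
  have h1 := en_le (G := G) S
  refine ⟨fun h => (hP.cv2 h).1, fun h => ?_, fun h => ?_, fun h => no_k5 hg.pl h, fun h => ?_⟩
  · rw [h] at h1
    exact ⟨by omega, fun h3 => en_full (by rw [h]; omega) hP.aS hP.bS hP.ne⟩
  · rw [h] at h1; omega
  · by_cases hT : T2 G S
    · rcases hg.num hT hS with h' | h' | h' | h'
      · omega
      · omega
      · omega
      · unfold cv at h'; omega
    · have := hg.pc18 hP hS Ω hT
      unfold cv at this; omega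

theorem dg2_big {N : ℕ} (hg : Gl G N) {v a b : V} (h : Dg2 G S v a b) (hN : (insert v S).card = N)
    (h9 : 9 ≤ N) : 7 * en G (insert v S) + 48 ≤ 18 * N := by
  have hc := Finset.card_insert_of_notMem h.vS
  rw [h.en]
  by_cases hT : T2 G S
  · obtain ⟨h1, h2⟩ := hg.ih S Ω hT
    by_cases h9 : 9 ≤ S.card
    · have := h2 h9; omega
    · have := (h1 Ω Ω).1; omega
  · obtain ⟨c, A, B, rfl, hcc, hA, hB, aB, bA⟩ := h.pc.chain hT Ω
    obtain ⟨l1, l2⟩ := chain_lt hcc hA hB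
    by_contra hex
    have hcd := hcc.card
    have hce := hcc.en
    have hsum : -25 ≤ cv G A + cv G B := by unfold cv; omega
    have vA : v ∉ A := fun hh => h.vS (by simp [hh])
    have vB : v ∉ B := fun hh => h.vS (by simp [hh])
    have a9 := hg.pc9' hA Ω
    have b9 := hg.pc9' hB Ω
    -- one side is a near-complete graph on five vertices
    have goA : (A.card = 5 ∧ en G A = 9) → False := fun h5 => by
      have hva : cv G A = -9 := by unfold cv; omega
      have ad := (hg.pc14 hA Ω Ω).1
      refine chain_th hg.fr hcc aB bA vA vB h.pc.ne h.va h.vb ad (hA.p23 (Or.inr h5)) hA.aS hB.bS ?_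
      by_contra hn
      push Not at hn
      have := (hg.pc16 hB Ω hn.1).2 hn.2
      omega
    have goB : (B.card = 5 ∧ en G B = 9) → False := fun h5 => by
      have hva : cv G B = -9 := by unfold cv; omega
      have ad := (hg.pc14 hB Ω Ω).1
      refine chain_th hg.fr hcc.symm bA aB vB vA h.pc.ne.symm h.vb h.va ad.symm (hB.symm.p23 (Or.inr h5)) hB.bS hA.aS ?_
      by_contra hn
      push Not at hn
      have := (hg.pc16 hA.symm Ω hn.1).2 hn.2
      omega
    by_cases hv : -12 ≤ cv G A
    · rcases (hg.pc14 hA Ω Ω).2 with q | q | q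
      · have := (hA.cv2 q).2
        rcases (hg.pc14 hB Ω Ω).2 with q' | q' | q'
        · omega
        · omega
        · exact goB q'
      · have : cv G A = -12 := by unfold cv; omega
        rcases (hg.pc14 hB Ω Ω).2 with q' | q' | q'
        · omega
        · omega
        · exact goB q'
      · exact goA q
    · rcases (hg.pc14 hB Ω Ω).2 with q | q | q
      · have := (hB.cv2 q).2
        rcases (hg.pc14 hA Ω Ω).2 with q' | q' | q'
        · omega
        · omega
        · exact goA q'
      · have : cv G B = -12 := by unfold cv; omega
        rcases (hg.pc14 hA Ω Ω).2 with q' | q' | q'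
        · omega
        · omega
        · exact goA q'
      · exact goB q

end Paths

set_option synthInstance.maxHeartbeats 1000000 in
set_option synthInstance.maxSize 2000 in
set_option maxRecDepth 100000 in
theorem tab_sixB : ∀ ax ay az bx yb bz xy xz yz : Bool,
    7 ≤ ax.toNat + ay.toNat + az.toNat + bx.toNat + yb.toNat + bz.toNat + xy.toNat + xz.toNat + yz.toNat →
    (((ax && xy && yz && bz) || (ax && xz && yz && yb) ||
      (ay && xy && xz && bz) || (ay && yz && xz && bx) ||
      (az && xz && xy && yb) || (az && yz && xy && bx)) ||
     (ax && ay && az && bx && yb && bz && ((xy && !xz && !yz) || (xz && !xy && !yz) || (yz && !xy && !xz)))) = true := by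
  decide +kernel

set_option synthInstance.maxHeartbeats 1000000 in
set_option synthInstance.maxSize 2000 in
set_option maxRecDepth 100000 in
theorem tab_p3cB : ∀ ax ay az bx yb bz xy xz yz : Bool,
    7 ≤ ax.toNat + ay.toNat + az.toNat + bx.toNat + yb.toNat + bz.toNat + xy.toNat + xz.toNat + yz.toNat →
    3 ≤ ax.toNat + bx.toNat + xy.toNat + xz.toNat → 3 ≤ ay.toNat + yb.toNat + xy.toNat + yz.toNat →
    3 ≤ az.toNat + bz.toNat + xz.toNat + yz.toNat → 1 ≤ ax.toNat + ay.toNat + az.toNat →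
    1 ≤ bx.toNat + yb.toNat + bz.toNat →
    ((ax && xy && yb && (ay || bx)) || (ax && xz && bz && (az || bx)) || (ay && xy && bx && (ax || yb)) ||
      (ay && yz && bz && (az || yb)) || (az && xz && bx && (ax || bz)) || (az && yz && yb && (ay || bz))) = true := by
  decide +kernel

section Small

open Classical

variable {V : Type*} [Fintype V] {G : SimpleGraph V} {S A B : Finset V} {a b : V}

def BookW (G : SimpleGraph V) (S : Finset V) (p q x y : V) : Prop :=
  p ∈ S ∧ q ∈ S ∧ x ∈ S ∧ y ∈ S ∧ G.Adj p q ∧ G.Adj x y ∧ x ≠ p ∧ x ≠ q ∧ y ≠ p ∧ y ≠ q ∧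
    (∀ z ∈ S, z ≠ p → z ≠ q → G.Adj z p ∧ G.Adj z q) ∧
    ∀ z ∈ S, z ≠ p → z ≠ q → z ≠ x → z ≠ y → ∀ w ∈ S, G.Adj z w → w = p ∨ w = q

theorem BookW.sw1 {p q x y : V} (h : BookW G S p q x y) : BookW G S q p x y := by
  obtain ⟨h1, h2, h3, h4, h5, h6, n1, n2, n3, n4, h7, h8⟩ := h
  exact ⟨h2, h1, h3, h4, h5.symm, h6, n2, n1, n4, n3, fun z hz a b => (h7 z hz b a).symm,
    fun z hz a b c d w hw e => (h8 z hz b a c d w hw e).symm⟩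

theorem BookW.sw2 {p q x y : V} (h : BookW G S p q x y) : BookW G S p q y x := by
  obtain ⟨h1, h2, h3, h4, h5, h6, n1, n2, n3, n4, h7, h8⟩ := h
  exact ⟨h1, h2, h4, h3, h5, h6.symm, n3, n4, n1, n2, h7, fun z hz a b c d => h8 z hz a b d c⟩

theorem BookW.oth {p q x y : V} (h6 : 6 ≤ S.card) :
    ∃ z ∈ S, z ≠ p ∧ z ≠ q ∧ z ≠ x ∧ z ≠ y := by
  by_contra hn
  push Not at hn
  have hs : S ⊆ {p, q, x, y} := by
    intro z hz
    by_cases m1 : z = p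
    · simp [m1]
    by_cases m2 : z = q
    · simp [m2]
    by_cases m3 : z = x
    · simp [m3]
    simp [hn z hz m1 m2 m3]
  have := Finset.card_le_card hs
  have := Finset.card_le_four (a := p) (b := q) (c := x) (d := y)
  omega

theorem BookW.px {p q x y : V} (h : BookW G S p q x y) (h6 : 6 ≤ S.card) : P4c G S p x := by
  obtain ⟨z, hz, m1, m2, m3, m4⟩ := BookW.oth (p := p) (q := q) (x := x) (y := y) h6
  obtain ⟨h1, h2, h3, h4, h5, h6, n1, n2, n3, n4, h7, h8⟩ := h
  exact ⟨z, hz, q, h2, y, h4, (h7 z hz m1 m2).1.symm, (h7 z hz m1 m2).2, (h7 y h4 n3 n4).2.symm, h6.symm,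
    m3, h5.ne.symm, n2.symm, n3, m4, Or.inl h5⟩

theorem BookW.pb {p q x y b : V} (h : BookW G S p q x y) (h6 : 6 ≤ S.card) (hb : b ∈ S)
    (b1 : b ≠ p) (b2 : b ≠ q) : P4c G S p b := by
  by_cases b3 : b = x
  · exact b3 ▸ h.px h6
  by_cases b4 : b = y
  · exact b4 ▸ h.sw2.px h6
  obtain ⟨h1, h2, h3, h4, h5, h6, n1, n2, n3, n4, h7, h8⟩ := h
  exact ⟨x, h3, y, h4, q, h2, (h7 x h3 n1 n2).1.symm, h6, (h7 y h4 n3 n4).2, (h7 b hb b1 b2).2.symm,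
    Ne.symm b3, n3, Ne.symm b4, h5.ne.symm, n2, Or.inl (h7 y h4 n3 n4).1.symm⟩

theorem BookW.xb {p q x y b : V} (h : BookW G S p q x y) (h6 : 6 ≤ S.card) (hb : b ∈ S)
    (b1 : b ≠ p) (b2 : b ≠ q) (b3 : b ≠ x) : P4c G S x b := by
  obtain ⟨z, hz, m1, m2, m3, m4⟩ := BookW.oth (p := p) (q := q) (x := x) (y := y) h6
  obtain ⟨h1, h2, h3, h4, h5, h6, n1, n2, n3, n4, h7, h8⟩ := h
  by_cases b4 : b = y
  · subst b4
    exact ⟨p, h1, z, hz, q, h2, (h7 x h3 n1 n2).1, (h7 z hz m1 m2).1.symm, (h7 z hz m1 m2).2, (h7 b h4 n3 n4).2.symm,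
      n3.symm, m3, m4, n2.symm, h5.ne, Or.inr (Or.inl (h7 x h3 n1 n2).2)⟩
  · exact ⟨y, h4, p, h1, q, h2, h6, (h7 y h4 n3 n4).1, h5, (h7 b hb b1 b2).2.symm, Ne.symm b4, n1.symm, b1.symm,
      n2.symm, n4, Or.inl (h7 x h3 n1 n2).1⟩

theorem BookW.ab {p q x y a b : V} (h : BookW G S p q x y) (h6 : 6 ≤ S.card) (ha : a ∈ S) (hb : b ∈ S)
    (hab : a ≠ b) (hP : ¬ P4c G S a b) : (a = p ∧ b = q) ∨ (a = q ∧ b = p) := by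
  by_cases a1 : a = p
  · by_cases b2 : b = q
    · exact Or.inl ⟨a1, b2⟩
    · subst a1
      exact absurd (h.pb h6 hb hab.symm b2) hP
  by_cases a2 : a = q
  · by_cases b1 : b = p
    · exact Or.inr ⟨a2, b1⟩
    · subst a2
      exact absurd (h.sw1.pb h6 hb hab.symm b1) hP
  exfalso
  apply hP
  by_cases b1 : b = p
  · subst b1; exact (h.pb h6 ha a1 a2).symm
  by_cases b2 : b = q
  · subst b2; exact (h.sw1.pb h6 ha a2 a1).symm
  by_cases a3 : a = x
  · subst a3; exact h.xb h6 hb b1 b2 hab.symm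
  by_cases a4 : a = y
  · subst a4; exact h.sw2.xb h6 hb b1 b2 hab.symm
  by_cases b3 : b = x
  · subst b3; exact (h.xb h6 ha a1 a2 hab).symm
  by_cases b4 : b = y
  · subst b4; exact (h.sw2.xb h6 ha a1 a2 hab).symm
  obtain ⟨h1, h2, h3, h4, h5, h6, n1, n2, n3, n4, h7, h8⟩ := h
  exact ⟨p, h1, x, h3, q, h2, (h7 a ha a1 a2).1, (h7 x h3 n1 n2).1.symm, (h7 x h3 n1 n2).2, (h7 b hb b1 b2).2.symm,
    Ne.symm b1, Ne.symm a3, Ne.symm b3, Ne.symm a2, h5.ne, Or.inr (Or.inl (h7 a ha a1 a2).2)⟩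

theorem BookW.ins {p q x y v : V} (h : BookW G S p q x y) (hv : v ∉ S) (vp : G.Adj v p) (vq : G.Adj v q)
    (nb : ∀ x ∈ S, G.Adj v x → x = p ∨ x = q) : Book G (insert v S) := by
  obtain ⟨h1, h2, h3, h4, h5, h6, n1, n2, n3, n4, h7, h8⟩ := h
  refine ⟨p, by simp [h1], q, by simp [h2], x, by simp [h3], y, by simp [h4], h5, h6, n1, n2, n3, n4, ?_, ?_⟩
  · intro z hz m1 m2
    rw [Finset.mem_insert] at hz
    rcases hz with rfl | hz
    · exact ⟨vp, vq⟩
    · exact h7 z hz m1 m2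
  · intro z hz m1 m2 m3 m4 w hw hzw
    rw [Finset.mem_insert] at hz hw
    rcases hz with rfl | hz
    · rcases hw with rfl | hw
      · exact absurd rfl hzw.ne
      · exact nb w hw hzw
    · rcases hw with rfl | hw
      · rcases nb z hz hzw.symm with h | h
        · exact absurd h m1
        · exact absurd h m2
      · exact h8 z hz m1 m2 m3 m4 w hw hzw

theorem bookW5 {a b x y z : V} (hn : [a, b, x, y, z].Nodup) (hab : G.Adj a b) (ax : G.Adj a x) (ay : G.Adj a y)
    (az : G.Adj a z) (bx : G.Adj b x) (yb : G.Adj b y) (bz : G.Adj b z) (xy : G.Adj x y) (xz : ¬ G.Adj x z)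
    (yz : ¬ G.Adj y z) : BookW G {a, b, x, y, z} a b x y := by
  simp only [List.nodup_cons, List.mem_cons, List.not_mem_nil, or_false, not_or] at hn
  obtain ⟨⟨n1, n2, n3, n4⟩, ⟨n5, n6, n7⟩, ⟨n8, n9⟩, n10, -⟩ := hn
  refine ⟨by simp, by simp, by simp, by simp, hab, xy, Ne.symm n2, Ne.symm n5, Ne.symm n3, Ne.symm n6, ?_, ?_⟩
  · intro u hu m1 m2
    simp only [Finset.mem_insert, Finset.mem_singleton] at hu
    rcases hu with rfl | rfl | rfl | rfl | rfl
    · exact absurd rfl m1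
    · exact absurd rfl m2
    · exact ⟨ax.symm, bx.symm⟩
    · exact ⟨ay.symm, yb.symm⟩
    · exact ⟨az.symm, bz.symm⟩
  · intro u hu m1 m2 m3 m4 w hw huw
    have hz : u = z := by
      simp only [Finset.mem_insert, Finset.mem_singleton] at hu
      tauto
    subst hz
    simp only [Finset.mem_insert, Finset.mem_singleton] at hw
    rcases hw with rfl | rfl | rfl | rfl | rfl
    · exact Or.inl rfl
    · exact Or.inr rfl
    · exact absurd huw.symm xz
    · exact absurd huw.symm yz
    · exact absurd rfl huw.ne

theorem P4c_of (hab : G.Adj a b) {x y z : V} (hx : x ∈ S) (hy : y ∈ S) (hz : z ∈ S)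
    (h1 : G.Adj a x) (h2 : G.Adj x y) (h3 : G.Adj y z) (h4 : G.Adj b z) (m1 : b ≠ x) (m2 : a ≠ y) (m3 : b ≠ y)
    (m4 : a ≠ z) (m5 : x ≠ z) : P4c G S a b :=
  ⟨x, hx, y, hy, z, hz, h1, h2, h3, h4.symm, m1.symm, m2.symm, m3.symm, m4.symm, m5, by tauto⟩

theorem nd10 {a b x y z : V} (n1 : a ≠ b) (n2 : a ≠ x) (n3 : a ≠ y) (n4 : a ≠ z) (n5 : b ≠ x) (n6 : b ≠ y) (n7 : b ≠ z)
    (n8 : x ≠ y) (n9 : x ≠ z) (n10 : y ≠ z) : [a, b, x, y, z].Nodup := by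
  simp only [List.nodup_cons, List.mem_cons, List.not_mem_nil, or_false, not_or]
  exact ⟨⟨n1, n2, n3, n4⟩, ⟨n5, n6, n7⟩, ⟨n8, n9⟩, n10, not_false, List.nodup_nil⟩

theorem book5 (ha : a ∈ S) (hb : b ∈ S) (hne : a ≠ b) (h5 : S.card = 5) (h8 : 8 ≤ en G S)
    (hP : ¬ P4c G S a b) : en G S = 8 ∧ ∃ x y, BookW G S a b x y := by
  obtain ⟨x, y, z, hn, rfl⟩ := set5 ha hb hne h5
  have h9 : i9 G a b x y z ≤ 7 := by
    by_contra hh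
    exact hP (leaf_paths hn Ω).2.2
  have e := en5' (G := G) hn
  have e1 := bn_le (G := G) a b
  have hab : G.Adj a b := bn_adj Ω
  refine ⟨by omega, ?_⟩
  have t := tab_sixB _ _ _ _ _ _ _ _ _ (show 7 ≤ i9 G a b x y z by omega)
  simp only [Bool.and_eq_true, Bool.or_eq_true, decide_eq_true_eq, Bool.not_eq_true', decide_eq_false_iff_not] at t
  have hn' := hn
  simp only [List.nodup_cons, List.mem_cons, List.not_mem_nil, or_false, not_or] at hn'
  obtain ⟨⟨n1, n2, n3, n4⟩, ⟨n5, n6, n7⟩, ⟨n8, n9⟩, n10, -⟩ := hn'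
  rcases t with t | ⟨⟨⟨⟨⟨⟨ax, ay⟩, az⟩, bx⟩, yb⟩, bz⟩, t⟩
  · exfalso
    apply hP
    rcases t with ((((t | t) | t) | t) | t) | t <;> obtain ⟨⟨⟨t1, t2⟩, t3⟩, t4⟩ := t
    · exact P4c_of hab (x := x) (y := y) (z := z) Ψ Ψ Ψ t1 t2 t3 t4 n5 n3 n6 n4 n9
    · exact P4c_of hab (x := x) (y := z) (z := y) Ψ Ψ Ψ t1 t2 t3.symm t4 n5 n4 n7 n3 n8
    · exact P4c_of hab (x := y) (y := x) (z := z) Ψ Ψ Ψ t1 t2.symm t3 t4 n6 n2 n5 n4 n10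
    · exact P4c_of hab (x := y) (y := z) (z := x) Ψ Ψ Ψ t1 t2 t3.symm t4 n6 n4 n7 n2 (Ne.symm n8)
    · exact P4c_of hab (x := z) (y := x) (z := y) Ψ Ψ Ψ t1 t2.symm t3 t4 n7 n2 n5 n3 (Ne.symm n10)
    · exact P4c_of hab (x := z) (y := y) (z := x) Ψ Ψ Ψ t1 t2.symm t3.symm t4 n7 n3 n6 n2 (Ne.symm n9)
  · rcases t with (t | t) | t <;> obtain ⟨⟨t1, t2⟩, t3⟩ := t
    · exact ⟨x, y, bookW5 hn hab ax ay az bx yb bz t1 t2 t3⟩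
    · refine ⟨x, z, ?_⟩
      rw [show ({a, b, x, y, z} : Finset V) = {a, b, x, z, y} by rw [Finset.pair_comm y z]]
      exact bookW5 (nd10 n1 n2 n4 n3 n5 n7 n6 n9 n8 (Ne.symm n10)) hab ax az ay bx bz yb t1 t2 (fun h => t3 h.symm)
    · refine ⟨y, z, ?_⟩
      rw [show ({a, b, x, y, z} : Finset V) = {a, b, y, z, x} by
        rw [Finset.insert_comm x y, Finset.pair_comm x z]]
      exact bookW5 (nd10 n1 n3 n4 n2 n6 n7 n5 n10 (Ne.symm n8) (Ne.symm n9)) hab ay az ax yb bz bx t1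
        (fun h => t2 h.symm) (fun h => t3 h.symm)

theorem dg2_small {N : ℕ} (hg : Gl G N) {v a b : V} (h : Dg2 G S v a b) (hN : (insert v S).card = N)
    (h6 : 6 ≤ N) (h8 : N ≤ 8) : en G (insert v S) + 2 ≤ 2 * N ∧ (en G (insert v S) + 2 = 2 * N → Book G (insert v S)) := by
  have hc := Finset.card_insert_of_notMem h.vS
  rw [h.en]
  by_cases hT : T2 G S
  · have np : ¬ P4c G S a b := fun hp => glue24 hg.fr h.sp ⟨v, by simp, h.va.symm, h.vb⟩ hp
    by_cases h5 : S.card = 5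
    · by_cases e8 : 8 ≤ en G S
      · obtain ⟨e, x, y, hB⟩ := book5 h.pc.aS h.pc.bS h.pc.ne h5 e8 np
        exact ⟨by omega, fun _ => hB.ins h.vS h.va h.vb h.nb⟩
      · exact ⟨by omega, fun _ => by omega⟩
    · obtain ⟨h1, h2⟩ := (hg.ih S Ω hT).1 Ω Ω
      refine ⟨by omega, fun he => ?_⟩
      obtain ⟨p, hp, q, hq, x, hx, y, hy, hB⟩ := h2 Ω
      have hB : BookW G S p q x y := ⟨hp, hq, hx, hy, hB⟩
      rcases hB.ab Ω h.pc.aS h.pc.bS h.pc.ne np with ⟨rfl, rfl⟩ | ⟨rfl, rfl⟩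
      · exact hB.ins h.vS h.va h.vb h.nb
      · exact hB.ins h.vS h.vb h.va fun x hx e => (h.nb x hx e).symm
  · obtain ⟨c, A, B, rfl, hcc, hA, hB, aB, bA⟩ := h.pc.chain hT Ω
    obtain ⟨l1, l2⟩ := chain_lt hcc hA hB
    have hcd := hcc.card
    have hce := hcc.en
    have a2 := hA.card2
    have b2 := hB.card2
    suffices ¬ (2 * N ≤ en G (A ∪ B) + 2 + 2) by exact ⟨by omega, fun _ => by omega⟩
    intro hex
    have vA : v ∉ A := fun hh => h.vS (by simp [hh])
    have vB : v ∉ B := fun hh => h.vS (by simp [hh])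
    have pA := pc_en hg hA Ω
    have pB := pc_en hg hB Ω
    have goA : G.Adj c b → ((A.card = 4 ∧ en G A = 6) ∨ (A.card = 5 ∧ en G A = 9)) → False := fun hcb h5 => by
      have ad := (hg.pc14 hA Ω (by unfold cv; omega)).1
      exact chain_th hg.fr hcc aB bA vA vB h.pc.ne h.va h.vb ad (hA.p23 h5) hA.aS hB.bS (Or.inl hcb)
    have goB : G.Adj a c → ((B.card = 4 ∧ en G B = 6) ∨ (B.card = 5 ∧ en G B = 9)) → False := fun hcb h5 => by
      have ad := (hg.pc14 hB Ω (by unfold cv; omega)).1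
      exact chain_th hg.fr hcc.symm bA aB vB vA h.pc.ne.symm h.vb h.va ad.symm (hB.symm.p23 h5) hB.bS hA.aS
        (Or.inl hcb.symm)
    obtain ⟨u2, u3, u4, u5, u6⟩ := pA
    obtain ⟨w2, w3, w4, w5, w6⟩ := pB
    have s1 : A.card ≤ 6 := by omega
    obtain hA' | hA' | hA' | hA' | hA' : A.card = 2 ∨ A.card = 3 ∨ A.card = 4 ∨ A.card = 5 ∨ A.card = 6 := by omega
    · have := u2 hA'
      obtain hB' | hB' | hB' : B.card = 4 ∨ B.card = 5 ∨ B.card = 6 := by omega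
      · have := w4 hB'; omega
      · have := w5 hB'; exact goB (hA.adj2 hA') (Or.inr ⟨hB', by omega⟩)
      · have := w6 hB'; omega
    · have := u3 hA'
      obtain hB' | hB' | hB' : B.card = 3 ∨ B.card = 4 ∨ B.card = 5 := by omega
      · have := w3 hB'; omega
      · have := w4 hB'; omega
      · have := w5 hB'; exact goB ((u3 hA').2 Ω) (Or.inr ⟨hB', by omega⟩)
    · have := u4 hA'
      obtain hB' | hB' | hB' : B.card = 2 ∨ B.card = 3 ∨ B.card = 4 := by omega
      · have := w2 hB'; omega
      · have := w3 hB'; omega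
      · have := w4 hB'
        exact goA (hg.pc14 hB Ω (by unfold cv; omega)).1 (Or.inl ⟨hA', by omega⟩)
    · have := u5 hA'
      obtain hB' | hB' : B.card = 2 ∨ B.card = 3 := by omega
      · have := w2 hB'; exact goA (hB.adj2 hB') (Or.inr ⟨hA', by omega⟩)
      · have := w3 hB'; exact goA (this.2 Ω) (Or.inr ⟨hA', by omega⟩)
    · have := u6 hA'
      have := w2 Ω
      omega

theorem p3c5 (ha : a ∈ S) (hb : b ∈ S) (hab : a ≠ b) (h5 : S.card = 5)
    (hd : D3 G S a b) (h1 : ∃ x ∈ S, x ≠ b ∧ G.Adj a x) (h2 : ∃ x ∈ S, x ≠ a ∧ G.Adj b x)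
    (h7 : G.Adj a b ∨ 7 ≤ en G S) : P3c G S a b := by
  by_cases had : G.Adj a b
  · obtain ⟨x, hx, y, hy, e1, e2, e3, e4, e5⟩ := three_path ha hb hab h5 hd h1 h2
    exact ⟨x, hx, y, hy, e1, e2, e3, e4, e5, Or.inr (Or.inr had)⟩
  replace h7 : 7 ≤ en G S := h7.resolve_left had
  obtain ⟨x, y, z, hn, rfl⟩ := set5 ha hb hab h5
  rw [en5' hn, bn_zero had, zero_add] at h7
  have hn' := hn
  simp only [List.nodup_cons, List.mem_cons, List.not_mem_nil, or_false, not_or] at hn'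
  obtain ⟨⟨n1, n2, n3, n4⟩, ⟨n5, n6, n7⟩, ⟨n8, n9⟩, n10, -⟩ := hn'
  have dx := hd x Ψ (Ne.symm n2) (Ne.symm n5)
  have dy := hd y Ψ (Ne.symm n3) (Ne.symm n6)
  have dz := hd z Ψ (Ne.symm n4) (Ne.symm n7)
  rw [deg5 hn] at dx dy dz
  rw [bn_self, bn_symm x a, bn_symm x b] at dx
  rw [bn_self, bn_symm y a, bn_symm y b, bn_symm y x] at dy
  rw [bn_self, bn_symm z a, bn_symm z b, bn_symm z x, bn_symm z y] at dz
  have ea : 1 ≤ bn G a x + bn G a y + bn G a z := by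
    obtain ⟨u, hu, h3, h4⟩ := h1
    have := bn_one h4
    simp only [Finset.mem_insert, Finset.mem_singleton] at hu
    rcases hu with rfl | rfl | rfl | rfl | rfl
    · exact absurd h4 (G.loopless.irrefl _)
    · exact absurd rfl h3
    all_goals omega
  have eb : 1 ≤ bn G b x + bn G b y + bn G b z := by
    obtain ⟨u, hu, h3, h4⟩ := h2
    have := bn_one h4
    simp only [Finset.mem_insert, Finset.mem_singleton] at hu
    rcases hu with rfl | rfl | rfl | rfl | rfl
    · exact absurd rfl h3
    · exact absurd h4 (G.loopless.irrefl _)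
    all_goals omega
  have t := tab_p3cB _ _ _ _ _ _ _ _ _ h7 (by simp only [bn] at dx; omega) (by simp only [bn] at dy; omega)
    (by simp only [bn] at dz; omega) ea eb
  simp only [Bool.and_eq_true, Bool.or_eq_true, decide_eq_true_eq] at t
  rcases t with ((((t | t) | t) | t) | t) | t <;> obtain ⟨⟨⟨e1, e2⟩, e3⟩, e4⟩ := t
  · exact ⟨x, by simp, y, by simp, e1, e2, e3.symm, Ne.symm n5, Ne.symm n3, e4.imp id fun h => Or.inl h.symm⟩
  · exact ⟨x, by simp, z, by simp, e1, e2, e3.symm, Ne.symm n5, Ne.symm n4, e4.imp id fun h => Or.inl h.symm⟩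
  · exact ⟨y, by simp, x, by simp, e1, e2.symm, e3.symm, Ne.symm n6, Ne.symm n2, e4.imp id fun h => Or.inl h.symm⟩
  · exact ⟨y, by simp, z, by simp, e1, e2, e3.symm, Ne.symm n6, Ne.symm n4, e4.imp id fun h => Or.inl h.symm⟩
  · exact ⟨z, by simp, x, by simp, e1, e2.symm, e3.symm, Ne.symm n7, Ne.symm n2, e4.imp id fun h => Or.inl h.symm⟩
  · exact ⟨z, by simp, y, by simp, e1, e2.symm, e3.symm, Ne.symm n7, Ne.symm n3, e4.imp id fun h => Or.inl h.symm⟩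

/-- a vertex of degree three whose neighbours lie in a set of three vertices -/
theorem full3 {S T : Finset V} {x : V} (hd : 3 ≤ (S.filter (G.Adj x)).card) (hT : T.card ≤ 3)
    (h : ∀ y ∈ S, G.Adj x y → y ∈ T) : ∀ y ∈ T, G.Adj x y := by
  have hs : S.filter (G.Adj x) ⊆ T := fun y hy => by
    rw [Finset.mem_filter] at hy
    exact h y hy.1 hy.2
  have := Finset.eq_of_subset_of_card_le hs Ω
  intro y hy
  rw [← this, Finset.mem_filter] at hy
  exact hy.2

theorem six_side {B : Finset V} (hT : T2 G B) (ha : a ∈ B) (hb : b ∈ B) (hab : a ≠ b) (h6 : B.card = 6)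
    (hD : D3 G B a b) (h3 : ¬ P3 G B a b) (h4 : ¬ P4c G B a b) (h9 : 9 ≤ en G B) : False := by
  have hI : ((B.erase a).erase b).card = 4 := by
    rw [Finset.card_erase_of_mem (by simp [hab.symm, hb]), Finset.card_erase_of_mem ha]
    omega
  by_cases h2 : P2 G B a b
  · obtain ⟨z, hz, az, zb⟩ := h2
    have : ∃ t ∈ B, t ≠ a ∧ t ≠ b ∧ G.Adj z t := by
      by_contra hn
      push Not at hn
      have hs : B.filter (G.Adj z) ⊆ {a, b} := fun t ht => by
        rw [Finset.mem_filter] at ht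
        by_contra hh
        simp only [Finset.mem_insert, Finset.mem_singleton, not_or] at hh
        exact hn t ht.1 hh.1 hh.2 ht.2
      have := Finset.card_le_card hs
      have := Finset.card_le_two (a := a) (b := b)
      have := hD z hz az.ne' zb.ne
      omega
    obtain ⟨t, ht, ta, tb, zt⟩ := this
    have nta : ¬ G.Adj a t := fun h => h3 ⟨t, ht, z, hz, h, zt.symm, zb, tb, az.ne'⟩
    have ntb : ¬ G.Adj t b := fun h => h3 ⟨z, hz, t, ht, az, zt, h, zb.ne, ta⟩
    have ft : ∀ u ∈ ((B.erase a).erase b).erase t, G.Adj t u := by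
      refine full3 (hD t ht ta tb) ?_ ?_
      · rw [Finset.card_erase_of_mem (by simp [ta, tb, ht])]
        omega
      · intro y hy e
        simp only [Finset.mem_erase]
        exact ⟨e.ne', fun e' => ntb (e' ▸ e), fun e' => nta (e' ▸ e.symm), hy⟩
    have : ∃ u ∈ B, u ≠ a ∧ u ≠ b ∧ u ≠ z ∧ (G.Adj a u ∨ G.Adj b u) := by
      by_contra hn
      push Not at hn
      have := hT.2 z (fun v => v = a ∨ v = b) (fun v hv hvz hvx u hu huz e => by
        by_contra hh
        push Not at hh
        have := hn u hu hh.1 hh.2 huz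
        rcases hvx with rfl | rfl
        · exact this.1 e
        · exact this.2 e) ⟨a, ha, az.ne, Or.inl rfl⟩ t ht zt.ne'
      rcases this with h | h
      · exact ta h
      · exact tb h
    obtain ⟨u, hu, ua, ub, uz, e⟩ := this
    have tu : G.Adj t u := ft u (by
      simp only [Finset.mem_erase]
      refine ⟨fun h => ?_, ub, ua, hu⟩
      subst h
      rcases e with e | e
      · exact nta e
      · exact ntb e.symm)
    rcases e with e | e
    · exact h4 ⟨u, hu, t, ht, z, hz, e, tu.symm, zt.symm, zb, ub, ta, tb, az.ne', uz, Or.inr (Or.inl az)⟩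
    · exact h4 ⟨z, hz, t, ht, u, hu, az, zt, tu, e.symm, zb.ne, ta, tb, ua, uz.symm,
        Or.inr (Or.inr (Or.inr (Or.inl zb)))⟩
  · obtain ⟨x, hx, xb, ax⟩ := hT.nbr ha b hab
    obtain ⟨y, hy, ya, yb⟩ := hT.nbr hb a hab.symm
    have nxb : ¬ G.Adj x b := fun h => h2 ⟨x, hx, ax, h⟩
    have nay : ¬ G.Adj a y := fun h => h2 ⟨y, hy, h, yb.symm⟩
    have xy : x ≠ y := fun h => nxb (h ▸ yb.symm)
    have nxy : ¬ G.Adj x y := fun h => h3 ⟨x, hx, y, hy, ax, h, yb.symm, xb, ya⟩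
    have key : ∀ {p q u w : V}, p ∈ B → q ∈ B → u ∈ B → w ∈ B → p ≠ q → u ≠ w → u ≠ p → u ≠ q → w ≠ p → w ≠ q → D3 G B p q →
        ¬ G.Adj u q → ¬ G.Adj u w → ∀ v ∈ B, v ≠ q → v ≠ u → v ≠ w → G.Adj u v := by
      intro p q u w hp hq hu hw pq uw up uq wp wq hd n1 n2 v hv v1 v2 v3
      refine full3 (T := ((B.erase q).erase u).erase w) (hd u hu up uq) ?_ ?_ v (by simp [v1, v2, v3, hv])
      · rw [Finset.card_erase_of_mem (by simp [wq, uw.symm, hw]), Finset.card_erase_of_mem (by simp [uq, hu]),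
          Finset.card_erase_of_mem hq]
        omega
      · intro v hv e
        simp only [Finset.mem_erase]
        exact ⟨fun h => n2 (h ▸ e), e.ne', fun h => n1 (h ▸ e), hv⟩
    have kx := key ha hb hx hy hab xy ax.ne' xb ya yb.ne' hD nxb nxy
    have ky := key hb ha hy hx hab.symm xy.symm yb.ne' ya xb ax.ne' hD.symm (fun h => nay h.symm) (fun h => nxy h.symm)
    have hB : B = insert a (insert b ((B.erase a).erase b)) := by
      rw [Finset.insert_erase (by simp [hab.symm, hb]), Finset.insert_erase ha]
    have e1 : _ = _ + (((B.erase a).erase b).filter (G.Adj b)).card :=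
      en_insert (G := G) (v := b) (S := (B.erase a).erase b) Ψ
    have e2 : _ = _ + ((insert b ((B.erase a).erase b)).filter (G.Adj a)).card :=
      en_insert (G := G) (v := a) (S := insert b ((B.erase a).erase b)) (by simp [hab])
    rw [← hB] at e2
    have e3 := nadj_lt (S := (B.erase a).erase b) (a := x) (b := y) (by simp [hx, xb, ax.ne'])
      (by simp [hy, ya, yb.ne']) xy nxy
    rw [hI] at e3
    have f1 : (((B.erase a).erase b).filter (G.Adj b)).card ≤ ({y} : Finset V).card := by
      apply Finset.card_le_card
      intro v hv
      simp only [Finset.mem_filter, Finset.mem_erase] at hv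
      obtain ⟨⟨v1, v2, v3⟩, v4⟩ := hv
      by_contra hh
      have vx : v ≠ x := fun h => nxb (h ▸ v4.symm)
      exact h3 ⟨x, hx, v, v3, ax, kx v v3 v1 vx (by simpa using hh), v4.symm, xb, v2⟩
    have f2 : ((insert b ((B.erase a).erase b)).filter (G.Adj a)).card ≤ ({x, b} : Finset V).card := by
      apply Finset.card_le_card
      intro v hv
      simp only [Finset.mem_filter, Finset.mem_erase, Finset.mem_insert] at hv
      obtain ⟨v1 | ⟨v1, v2, v3⟩, v4⟩ := hv
      · simp [v1]
      by_contra hh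
      simp only [Finset.mem_insert, Finset.mem_singleton, not_or] at hh
      have vx : v ≠ y := fun h => nay (h ▸ v4)
      exact h3 ⟨v, v3, y, hy, v4, (ky v v3 v2 vx hh.1).symm, yb.symm, v1, ya⟩
    have := Finset.card_le_two (a := x) (b := b)
    rw [Finset.card_singleton] at f1
    omega

theorem p2_58 (ha : a ∈ S) (hb : b ∈ S) (hab : a ≠ b) (h5 : S.card = 5) (h8 : 8 ≤ en G S) :
    P2 G S a b := by
  obtain ⟨x, y, z, hn, rfl⟩ := set5 ha hb hab h5
  by_contra h
  have := np2_i9 h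
  rw [en5' hn] at h8
  have := bn_le (G := G) a b
  omega

theorem small_aux (hf : ¬ HasTheta6 G) (hs : Sp G A B a b) (h8 : (A ∪ B).card ≤ 8)
    (hA : Pc G A a b) (hB : Pc G B a b) (dA : D3 G A a b) (dB : D3 G B a b) (a4 : 4 ≤ A.card)
    (hAB : A.card ≤ B.card) (hex : 2 * (A ∪ B).card ≤ en G (A ∪ B) + 2) : False := by
  have hc := hs.card
  have he := hs.en
  obtain h4 | h5 : A.card = 4 ∨ A.card = 5 := by omega
  · obtain ⟨p2, p3, -⟩ := dA.four hs.aA hs.bA hs.ne h4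
    obtain hb | hb | hb : B.card = 4 ∨ B.card = 5 ∨ B.card = 6 := by omega
    · exact glue33 hf hs.symm (dB.four hs.aB hs.bB hs.ne hb).2.1.p3 p3
    · exact glue33 hf hs.symm (three_path hs.aB hs.bB hs.ne hb dB (hB.nbr' Ω) (hB.symm.nbr' Ω)) p3
    · have n3 : ¬ P3 G B a b := fun h => glue33 hf hs.symm h p3
      have n4 : ¬ P4c G B a b := fun h => glue24 hf hs p2 h
      have h9 : 9 ≤ en G B := by
        by_cases hab : G.Adj a b
        · rw [if_pos hab] at he
          have := en_le (G := G) A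
          rw [h4] at this
          omega
        · rw [if_neg hab] at he
          have := nadj_lt hs.aA hs.bA hs.ne hab
          rw [h4] at this
          omega
      by_cases hT : T2 G B
      · exact six_side hT hs.aB hs.bB hs.ne hb dB n3 n4 h9
      · obtain ⟨c, C, D, rfl, hcc, hC, hD, aD, bC⟩ := hB.chain hT Ω
        have dC := dB.left hcc bC
        have dD := dB.right hcc aD
        have h1 := hcc.card
        have h2 := hcc.en
        have c2 := hC.card2
        have d2 := hD.card2
        have : C.card = 2 ∨ 4 ≤ C.card := by
          by_cases h : 3 ≤ C.card
          · exact Or.inr (dC.card4 hC h)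
          · omega
        have : D.card = 2 ∨ 4 ≤ D.card := by
          by_cases h : 3 ≤ D.card
          · exact Or.inr (dD.card4 hD h)
          · omega
        obtain ⟨hC2, hD5⟩ | ⟨hC5, hD2⟩ : (C.card = 2 ∧ D.card = 5) ∨ (C.card = 5 ∧ D.card = 2) := by omega
        · have ac := hC.adj2 hC2
          have := (hC.cv2 hC2).1
          obtain ⟨x, hx, cx, xb⟩ := p2_58 (G := G) hD.aS hD.bS hD.ne hD5 Ω
          exact n3 ⟨c, by simp [hcc.cA], x, by simp [hx], ac, cx, xb, hD.ne, fun h => aD (h ▸ hx)⟩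
        · have cb := hD.adj2 hD2
          have := (hD.cv2 hD2).1
          obtain ⟨x, hx, ax, xc⟩ := p2_58 (G := G) hC.aS hC.bS hC.ne hC5 Ω
          exact n3 ⟨x, by simp [hx], c, by simp [hcc.cA], ax, xc, cb, fun h => bC (h ▸ hx), hC.ne.symm⟩
  · have hb : B.card = 5 := by omega
    have q1 := hA.nbr' Ω
    have q2 := hA.symm.nbr' Ω
    have q3 := hB.nbr' Ω
    have q4 := hB.symm.nbr' Ω
    have pA := three_path hs.aA hs.bA hs.ne h5 dA q1 q2
    have pB := three_path hs.aB hs.bB hs.ne hb dB q3 q4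
    by_cases h7 : G.Adj a b ∨ 7 ≤ en G B
    · exact glue33 hf hs pA (p3c5 hs.aB hs.bB hs.ne hb dB q3 q4 h7)
    · push Not at h7
      exact glue33 hf hs.symm pB (p3c5 hs.aA hs.bA hs.ne h5 dA q1 q2 (Or.inr Ω))

theorem sep_small (hf : ¬ HasTheta6 G) (hs : Sp G A B a b) (h8 : (A ∪ B).card ≤ 8)
    (hT : T2 G (A ∪ B)) (hA : ∃ x ∈ A, x ∉ B) (hB : ∃ x ∈ B, x ∉ A)
    (hdeg : ∀ x ∈ A ∪ B, 3 ≤ ((A ∪ B).filter (G.Adj x)).card)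
    (hex : 2 * (A ∪ B).card ≤ en G (A ∪ B) + 2) : False := by
  have pA := hT.piece hs hA hB
  have dA := D3.side hdeg hs
  have a4 := dA.card4 pA (hs.three hA)
  have pB : Pc G B a b := by
    rw [Finset.union_comm] at hT
    exact hT.piece hs.symm hB hA
  have dB : D3 G B a b := by
    rw [Finset.union_comm] at hdeg
    exact D3.side hdeg hs.symm
  have b4 := dB.card4 pB (hs.symm.three hB)
  rcases le_total A.card B.card with h | h
  · exact small_aux hf hs h8 pA pB dA dB a4 h hex
  · rw [Finset.union_comm] at h8 hex
    exact small_aux hf hs.symm h8 pB pA dB dA b4 h hex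

/-- a piece on five vertices with at least eight edges apart from the edge of the terminals -/
structure Leaf (G : SimpleGraph V) (S L : Finset V) (a b : V) : Prop where
  sub : L ⊆ S
  aL : a ∉ L
  bL : b ∉ L
  sp : Sp G (insert a (insert b L)) (S \ L) a b
  lf : Lf G (insert a (insert b L)) a b

theorem Leaf.card {S L : Finset V} (h : Leaf G S L a b) : L.card = 3 := by
  have h5 := h.lf.1
  rw [Finset.card_insert_of_notMem (by simp [h.sp.ne, h.aL]), Finset.card_insert_of_notMem h.bL] at h5
  omega

theorem Leaf.nb {S L : Finset V} {a b x y : V} (h : Leaf G S L a b) (hx : x ∈ L) (hy : y ∈ S) (e : G.Adj x y) :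
    y ∈ L ∨ y = a ∨ y = b := by
  by_contra hn
  push Not at hn
  exact h.sp.nx x (by simp [hx]) (by simp [hx]) y (by simp [hy, hn.1]) (by simp [hn.1, hn.2.1, hn.2.2]) e

theorem Leaf.paths {S L : Finset V} (h : Leaf G S L a b) : P2 G (insert a (insert b L)) a b ∧
    P3c G (insert a (insert b L)) a b ∧ P4c G (insert a (insert b L)) a b := by
  obtain ⟨h5, h8⟩ := h.lf
  obtain ⟨x, y, z, hn, e⟩ := set5 h.sp.aA h.sp.bA h.sp.ne h5
  rw [e] at h8 ⊢
  rw [en5' hn, bn_eq] at h8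
  exact leaf_paths hn Ω

theorem Leaf.mid {S L : Finset V} (h : Leaf G S L a b) : ∃ z ∈ L, G.Adj a z ∧ G.Adj z b := by
  obtain ⟨z, hz, e1, e2⟩ := h.paths.1
  simp only [Finset.mem_insert] at hz
  rcases hz with rfl | rfl | hz
  · exact absurd rfl e1.ne
  · exact absurd rfl e2.ne
  · exact ⟨z, hz, e1, e2⟩

theorem Leaf.un {S L : Finset V} (h : Leaf G S L a b) : insert a (insert b L) ∪ (S \ L) = S := by
  have h1 := (Finset.mem_sdiff.1 h.sp.aB).1
  have h2 := (Finset.mem_sdiff.1 h.sp.bB).1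
  ext x
  simp only [Finset.mem_union, Finset.mem_insert, Finset.mem_sdiff]
  constructor
  · rintro ((rfl | rfl | hx) | hx)
    · exact h1
    · exact h2
    · exact h.sub hx
    · exact hx.1
  · intro hx
    by_cases hL : x ∈ L
    · exact Or.inl (Or.inr (Or.inr hL))
    · exact Or.inr ⟨hx, hL⟩

theorem Leaf.en_le {S L : Finset V} (h : Leaf G S L a b) (hp : Pl G) (hT : T2 G S) (h6 : 6 ≤ S.card) :
    en G (insert a (insert b L)) ≤ 8 + (if G.Adj a b then 1 else 0) := by
  by_cases hab : G.Adj a b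
  · rw [if_pos hab]
    exact no_k5 hp h.lf.1
  · rw [if_neg hab]
    have hu := h.un
    have hc := h.sp.card
    rw [hu, h.lf.1] at hc
    have h3 := h.card
    obtain ⟨x, hx⟩ := Finset.card_pos.1 (show 0 < L.card by omega)
    refine no_k5m hp (T2.piece (B := S \ L) (by rw [hu]; exact hT) h.sp ⟨x, by simp [hx], by simp [hx]⟩ ?_) hab h.lf.1
    by_contra hn
    push Not at hn
    have := Finset.card_le_card (show S \ L ⊆ {a, b} from fun y hy => by
      have := h.sp.inter y (hn y hy) hy
      simpa using this)
    have := Finset.card_le_two (a := a) (b := b)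
    omega

theorem Leaf.of {s t : V} (hs : Sp G A B s t) (hl : Lf G A s t) :
    Leaf G (A ∪ B) (A.filter fun x => x ≠ s ∧ x ≠ t) s t := by
  have e1 : insert s (insert t (A.filter fun x => x ≠ s ∧ x ≠ t)) = A := by
    ext x
    simp only [Finset.mem_insert, Finset.mem_filter]
    constructor
    · rintro (rfl | rfl | h)
      · exact hs.aA
      · exact hs.bA
      · exact h.1
    · intro hx
      by_cases h1 : x = s
      · exact Or.inl h1
      by_cases h2 : x = t
      · exact Or.inr (Or.inl h2)
      · exact Or.inr (Or.inr ⟨hx, h1, h2⟩)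
  have e2 : (A ∪ B) \ (A.filter fun x => x ≠ s ∧ x ≠ t) = B := by
    ext x
    simp only [Finset.mem_sdiff, Finset.mem_union, Finset.mem_filter, not_and]
    constructor
    · rintro ⟨h1 | h1, h2⟩
      · by_cases h3 : x = s
        · exact h3 ▸ hs.aB
        · have : x = t := by
            by_contra h
            exact h2 h1 h3 h
          exact this ▸ hs.bB
      · exact h1
    · intro hx
      refine ⟨Or.inr hx, fun h1 h2 h3 => ?_⟩
      rcases hs.inter x h1 hx with h | h
      · exact h2 h
      · exact h3 h
  refine ⟨fun x hx => ?_, by simp, by simp, by rw [e1, e2]; exact hs, by rw [e1]; exact hl⟩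
  rw [Finset.mem_filter] at hx
  simp [hx.1]

/-- a maximal family of leaves -/
structure Tor (G : SimpleGraph V) (S : Finset V) (F : Finset (Finset V × V × V)) : Prop where
  pl : Pl G
  fr : ¬ HasTheta6 G
  t2 : T2 G S
  six : 6 ≤ S.card
  lf : ∀ l ∈ F, Leaf G S l.1 l.2.1 l.2.2
  dj : ∀ l ∈ F, ∀ k ∈ F, l ≠ k → Disjoint l.1 k.1 ∧ l.2.1 ∉ k.1 ∧ l.2.2 ∉ k.1
  mx : ∀ K s t, Leaf G S K s t →
    (∀ l ∈ F, Disjoint K l.1 ∧ s ∉ l.1 ∧ t ∉ l.1 ∧ l.2.1 ∉ K ∧ l.2.2 ∉ K) → False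
  sep : ∀ A B a b, S = A ∪ B → Sp G A B a b → (∃ x ∈ A, x ∉ B) → (∃ x ∈ B, x ∉ A) → Lf G A a b ∨ Lf G B a b

theorem tor_exists (pl : Pl G) (fr : ¬ HasTheta6 G) (t2 : T2 G S) (six : 6 ≤ S.card)
    (sep : ∀ A B a b, S = A ∪ B → Sp G A B a b → (∃ x ∈ A, x ∉ B) → (∃ x ∈ B, x ∉ A) → Lf G A a b ∨ Lf G B a b) :
    ∃ F, Tor G S F := by
  obtain ⟨F, hF, hmx⟩ := Finset.exists_max_image (Finset.univ.filter fun F : Finset (Finset V × V × V) =>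
    (∀ l ∈ F, Leaf G S l.1 l.2.1 l.2.2) ∧
      ∀ l ∈ F, ∀ k ∈ F, l ≠ k → Disjoint l.1 k.1 ∧ l.2.1 ∉ k.1 ∧ l.2.2 ∉ k.1) Finset.card ⟨∅, by simp⟩
  rw [Finset.mem_filter] at hF
  obtain ⟨-, hlf, hdj⟩ := hF
  refine ⟨F, pl, fr, t2, six, hlf, hdj, fun K s t hK hn => ?_, sep⟩
  have h3 := hK.card
  obtain ⟨x, hx⟩ := Finset.card_pos.1 (show 0 < K.card by omega)
  have hnF : (K, s, t) ∉ F := fun h => Finset.disjoint_left.1 (hn _ h).1 hx hx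
  have := hmx (insert (K, s, t) F) (by
    rw [Finset.mem_filter]
    refine ⟨Finset.mem_univ _, fun l hl => ?_, fun l hl k hk hlk => ?_⟩
    · rcases Finset.mem_insert.1 hl with rfl | hl
      · exact hK
      · exact hlf l hl
    · rcases Finset.mem_insert.1 hl with rfl | hl
      · rcases Finset.mem_insert.1 hk with rfl | hk
        · exact absurd rfl hlk
        · exact ⟨(hn k hk).1, (hn k hk).2.1, (hn k hk).2.2.1⟩
      · rcases Finset.mem_insert.1 hk with rfl | hk
        · exact ⟨(hn l hl).1.symm, (hn l hl).2.2.2⟩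
        · exact hdj l hl k hk hlk)
  rw [Finset.card_insert_of_notMem hnF] at this
  omega

/-- vertices outside all leaves -/
noncomputable def S0 (S : Finset V) (F : Finset (Finset V × V × V)) : Finset V :=
  S.filter fun x => ∀ l ∈ F, x ∉ l.1

def pr (l : Finset V × V × V) (u v : V) : Prop := (u = l.2.1 ∧ v = l.2.2) ∨ (u = l.2.2 ∧ v = l.2.1)

theorem pr.symm {l : Finset V × V × V} {u v : V} (h : pr l u v) : pr l v u := by
  rcases h with ⟨h1, h2⟩ | ⟨h1, h2⟩
  · exact Or.inr ⟨h2, h1⟩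
  · exact Or.inl ⟨h2, h1⟩

/-- adjacency in the torso -/
def Jn (G : SimpleGraph V) (F : Finset (Finset V × V × V)) (u v : V) : Prop := G.Adj u v ∨ ∃ l ∈ F, pr l u v

theorem Jn.symm {F : Finset (Finset V × V × V)} {u v : V} (h : Jn G F u v) : Jn G F v u :=
  h.imp (fun e => e.symm) fun ⟨l, hl, e⟩ => ⟨l, hl, e.symm⟩

def TH (G : SimpleGraph V) (S : Finset V) (F : Finset (Finset V × V × V)) : SimpleGraph {x // x ∈ S0 S F} where
  Adj u v := u ≠ v ∧ Jn G F u v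
  symm := ⟨fun _ _ h => ⟨h.1.symm, h.2.symm⟩⟩
  loopless := ⟨fun _ h => h.1 rfl⟩

def TR (G : SimpleGraph V) (S : Finset V) (F : Finset (Finset V × V × V)) : SimpleGraph {x // x ∈ S0 S F} where
  Adj u v := G.Adj u v
  symm := ⟨fun _ _ h => h.symm⟩
  loopless := ⟨fun _ h => G.loopless.irrefl _ h⟩

def TM (G : SimpleGraph V) (S : Finset V) (F : Finset (Finset V × V × V)) : SimpleGraph {x // x ∈ S0 S F} where
  Adj u v := G.Adj u v ∧ ∃ l ∈ F, pr l u v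
  symm := ⟨fun _ _ h => ⟨h.1.symm, h.2.imp fun _ e => ⟨e.1, e.2.symm⟩⟩⟩
  loopless := ⟨fun _ h => G.loopless.irrefl _ h.1⟩

variable {F : Finset (Finset V × V × V)}

theorem mem_S0 {x : V} : x ∈ S0 S F ↔ x ∈ S ∧ ∀ l ∈ F, x ∉ l.1 := by simp [S0]

theorem S0_or {x : V} (hx : x ∈ S) : x ∈ S0 S F ∨ ∃ l ∈ F, x ∈ l.1 := by
  by_cases h : ∃ l ∈ F, x ∈ l.1
  · exact Or.inr h
  · push Not at h
    exact Or.inl (mem_S0.2 ⟨hx, h⟩)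

theorem Tor.a0 (h : Tor G S F) {l : Finset V × V × V} (hl : l ∈ F) : l.2.1 ∈ S0 S F ∧ l.2.2 ∈ S0 S F := by
  have hL := h.lf l hl
  refine ⟨mem_S0.2 ⟨(Finset.mem_sdiff.1 hL.sp.aB).1, fun k hk => ?_⟩,
    mem_S0.2 ⟨(Finset.mem_sdiff.1 hL.sp.bB).1, fun k hk => ?_⟩⟩
  · by_cases e : l = k
    · exact e ▸ hL.aL
    · exact (h.dj l hl k hk e).2.1
  · by_cases e : l = k
    · exact e ▸ hL.bL
    · exact (h.dj l hl k hk e).2.2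

theorem Tor.eq (h : Tor G S F) {l k : Finset V × V × V} (hl : l ∈ F) (hk : k ∈ F) {x : V} (hx : x ∈ l.1)
    (hx' : x ∈ k.1) : l = k := by
  by_contra e
  exact Finset.disjoint_left.1 (h.dj l hl k hk e).1 hx hx'

/-! planarity of the torso -/

theorem Tor.mids (h : Tor G S F) : ∃ z : Finset V × V × V → V,
    ∀ l ∈ F, z l ∈ l.1 ∧ G.Adj l.2.1 (z l) ∧ G.Adj (z l) l.2.2 := by
  have : ∀ l, ∃ z, l ∈ F → z ∈ l.1 ∧ G.Adj l.2.1 z ∧ G.Adj z l.2.2 := fun l => by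
    by_cases hl : l ∈ F
    · obtain ⟨z, hz⟩ := (h.lf l hl).mid
      exact ⟨z, fun _ => hz⟩
    · exact ⟨l.2.1, fun h => absurd h hl⟩
  choose z hz using this
  exact ⟨z, hz⟩

def ph (z : Finset V × V × V → V) (A : Set {x // x ∈ S0 S F}) : Set V :=
  {v | (∃ w ∈ A, w.1 = v) ∨ ∃ l ∈ F, z l = v ∧ ∃ w ∈ A, w.1 = l.2.1}

theorem ph_cn {z : Finset V × V × V → V} (hz : ∀ l ∈ F, z l ∈ l.1 ∧ G.Adj l.2.1 (z l) ∧ G.Adj (z l) l.2.2)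
    {A : Set {x // x ∈ S0 S F}} (hA : Cn (TH G S F) A) : Cn G (ph z A) := by
  refine cn_of_closed fun X hX hcl => ?_
  have key : A ⊆ {w | w.1 ∈ X} := by
    refine hA.closed ?_ ?_
    · obtain ⟨v, ⟨w, hw, rfl⟩ | ⟨l, hl, rfl, w, hw, e⟩, hv⟩ := hX
      · exact ⟨w, hw, hv⟩
      · refine ⟨w, hw, hcl _ (Or.inr ⟨l, hl, rfl, w, hw, e⟩) hv _ (Or.inl ⟨w, hw, rfl⟩) ?_⟩
        rw [e]
        exact (hz l hl).2.1.symm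
    · rintro x hx hxX y hy ⟨-, e | ⟨l, hl, ⟨e1, e2⟩ | ⟨e1, e2⟩⟩⟩
      · exact hcl _ (Or.inl ⟨x, hx, rfl⟩) hxX _ (Or.inl ⟨y, hy, rfl⟩) e
      · have hm : z l ∈ ph z A := Or.inr ⟨l, hl, rfl, x, hx, e1⟩
        exact hcl _ hm (hcl _ (Or.inl ⟨x, hx, rfl⟩) hxX _ hm (e1 ▸ (hz l hl).2.1)) _ (Or.inl ⟨y, hy, rfl⟩)
          (e2 ▸ (hz l hl).2.2)
      · have hm : z l ∈ ph z A := Or.inr ⟨l, hl, rfl, y, hy, e2⟩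
        exact hcl _ hm (hcl _ (Or.inl ⟨x, hx, rfl⟩) hxX _ hm (e1 ▸ (hz l hl).2.2.symm)) _ (Or.inl ⟨y, hy, rfl⟩)
          (e2 ▸ (hz l hl).2.1.symm)
  rintro v (⟨w, hw, rfl⟩ | ⟨l, hl, rfl, w, hw, e⟩)
  · exact key hw
  · exact hcl _ (Or.inl ⟨w, hw, rfl⟩) (key hw) _ (Or.inr ⟨l, hl, rfl, w, hw, e⟩) (e ▸ (hz l hl).2.1)

theorem ph_tch {z : Finset V × V × V → V} (hz : ∀ l ∈ F, z l ∈ l.1 ∧ G.Adj l.2.1 (z l) ∧ G.Adj (z l) l.2.2)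
    {A B : Set {x // x ∈ S0 S F}} (h : Tch (TH G S F) A B) : Tch G (ph z A) (ph z B) := by
  obtain ⟨x, hx, y, hy, -, e | ⟨l, hl, ⟨e1, e2⟩ | ⟨e1, e2⟩⟩⟩ := h
  · exact ⟨_, Or.inl ⟨x, hx, rfl⟩, _, Or.inl ⟨y, hy, rfl⟩, e⟩
  · exact ⟨_, Or.inr ⟨l, hl, rfl, x, hx, e1⟩, _, Or.inl ⟨y, hy, rfl⟩, e2 ▸ (hz l hl).2.2⟩
  · exact ⟨_, Or.inl ⟨x, hx, rfl⟩, _, Or.inr ⟨l, hl, rfl, y, hy, e2⟩, e1 ▸ (hz l hl).2.2.symm⟩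

theorem ph_dj (h : Tor G S F) {z : Finset V × V × V → V} (hz : ∀ l ∈ F, z l ∈ l.1 ∧ G.Adj l.2.1 (z l) ∧ G.Adj (z l) l.2.2)
    {A B : Set {x // x ∈ S0 S F}} (hd : Disjoint A B) : Disjoint (ph z A) (ph z B) := by
  rw [Set.disjoint_left] at hd ⊢
  rintro v (⟨w, hw, e⟩ | ⟨l, hl, e, w, hw, e1⟩) (⟨w', hw', e'⟩ | ⟨k, hk, e', w', hw', e2⟩)
  · exact hd hw (Subtype.ext (e.trans e'.symm) ▸ hw')
  · exact (mem_S0.1 w.2).2 k hk (by rw [e, ← e']; exact (hz k hk).1)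
  · exact (mem_S0.1 w'.2).2 l hl (by rw [e', ← e]; exact (hz l hl).1)
  · have := h.eq hl hk (hz l hl).1 (by rw [e, ← e']; exact (hz k hk).1)
    subst this
    exact hd hw (Subtype.ext (e1.trans e2.symm) ▸ hw')

theorem Tor.pl' (h : Tor G S F) : Pl (TH G S F) := by
  obtain ⟨z, hz⟩ := h.mids
  have ne : ∀ {A : Set {x // x ∈ S0 S F}}, A.Nonempty → (ph z A).Nonempty := fun ⟨w, hw⟩ => ⟨w.1, Or.inl ⟨w, hw, rfl⟩⟩
  constructor
  · rintro ⟨A, h1, h2, h3, h4⟩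
    exact h.pl.1 ⟨fun i => ph z (A i), fun i => ne (h1 i), fun i => ph_cn hz (h2 i), fun i j e => ph_dj h hz (h3 i j e),
      fun i j e => ph_tch hz (h4 i j e)⟩
  · rintro ⟨A, B, h1, h1', h2, h2', h3, h3', h4, h5⟩
    exact h.pl.2 ⟨fun i => ph z (A i), fun i => ph z (B i), fun i => ne (h1 i), fun i => ne (h1' i),
      fun i => ph_cn hz (h2 i), fun i => ph_cn hz (h2' i), fun i j e => ph_dj h hz (h3 i j e),
      fun i j e => ph_dj h hz (h3' i j e), fun i j => ph_dj h hz (h4 i j), fun i j => ph_tch hz (h5 i j)⟩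

/-! connectivity of the torso -/

/-- no new leaf -/
theorem Tor.new (h : Tor G S F) {s t y : V} (hS : S = A ∪ B) (hs : Sp G A B s t) (hl : Lf G A s t)
    (s0 : s ∈ S0 S F) (t0 : t ∈ S0 S F) (y0 : y ∈ S0 S F) (yA : y ∈ A) (ys : y ≠ s) (yt : y ≠ t)
    (hd : ∀ l ∈ F, l.1 ⊆ A ∨ (Disjoint A l.1 ∧ (l.2.1 ∈ A → l.2.1 = s ∨ l.2.1 = t) ∧
      (l.2.2 ∈ A → l.2.2 = s ∨ l.2.2 = t))) : False := by
  have hL := Leaf.of hs hl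
  rw [← hS] at hL
  refine h.mx _ _ _ hL fun l hlF => ?_
  have s1 := (mem_S0.1 s0).2 l hlF
  have t1 := (mem_S0.1 t0).2 l hlF
  rcases hd l hlF with hd | ⟨h1, h2, h3⟩
  · exfalso
    have hsub : l.1 ⊆ A.filter fun x => x ≠ s ∧ x ≠ t := fun x hx =>
      Finset.mem_filter.2 ⟨hd hx, fun e => s1 (e ▸ hx), fun e => t1 (e ▸ hx)⟩
    have := Finset.eq_of_subset_of_card_le hsub (by rw [hL.card, (h.lf l hlF).card])
    exact (mem_S0.1 y0).2 l hlF (by rw [this]; simp [yA, ys, yt])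
  · refine ⟨h1.mono_left (Finset.filter_subset _ _), s1, t1, fun hh => ?_, fun hh => ?_⟩
    · rw [Finset.mem_filter] at hh
      rcases h2 hh.1 with e | e
      · exact hh.2.1 e
      · exact hh.2.2 e
    · rw [Finset.mem_filter] at hh
      rcases h3 hh.1 with e | e
      · exact hh.2.1 e
      · exact hh.2.2 e

theorem Tor.cn (h : Tor G S F) (s t : {x // x ∈ S0 S F}) : Cn (TH G S F) {s, t}ᶜ := by
  refine cn_of_closed fun X ⟨x, hx, hxX⟩ hcl y hy => ?_
  by_contra hyX
  simp only [Set.mem_compl_iff, Set.mem_insert_iff, Set.mem_singleton_iff, not_or] at hx hy hcl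
  let P : V → Prop := fun v => ∃ w ∈ X, w.1 = v ∧ w ≠ s ∧ w ≠ t
  let Q : V → Prop := fun v => P v ∨ ∃ l ∈ F, v ∈ l.1 ∧ (P l.2.1 ∨ P l.2.2)
  have Q0 : ∀ w : {x // x ∈ S0 S F}, Q w.1 → w ∈ X ∧ w ≠ s ∧ w ≠ t := by
    rintro w (⟨w', h1, h2, h3⟩ | ⟨l, hl, hw, -⟩)
    · rw [← Subtype.ext h2]
      exact ⟨h1, h3⟩
    · exact absurd hw ((mem_S0.1 w.2).2 l hl)
  have P0 : ∀ w : {x // x ∈ S0 S F}, P w.1 → w ∈ X := fun w hw => (Q0 w (Or.inl hw)).1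
  have Pcl : ∀ u v : V, P u → v ∈ S0 S F → u ≠ v → Jn G F u v → v ≠ s.1 → v ≠ t.1 → P v := by
    rintro u v ⟨w, h1, rfl, h2, h3⟩ hv ne e n1 n2
    have m1 : (⟨v, hv⟩ : {x // x ∈ S0 S F}) ≠ s := fun e => n1 (congrArg Subtype.val e)
    have m2 : (⟨v, hv⟩ : {x // x ∈ S0 S F}) ≠ t := fun e => n2 (congrArg Subtype.val e)
    exact ⟨⟨v, hv⟩, hcl w ⟨h2, h3⟩ h1 ⟨v, hv⟩ ⟨m1, m2⟩ ⟨fun e => ne (congrArg Subtype.val e), e⟩, rfl, m1, m2⟩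
  have Qcl : ∀ u v : V, Q u → u ∈ S → v ∈ S → G.Adj u v → v ≠ s.1 → v ≠ t.1 → Q v := by
    intro u v hu huS hvS e n1 n2
    rcases S0_or (F := F) hvS with hv | ⟨k, hk, hv⟩
    · rcases hu with hu | ⟨l, hl, hu, hP⟩
      · exact Or.inl (Pcl u v hu hv e.ne (Or.inl e) n1 n2)
      · have ne := (h.lf l hl).sp.ne
        rcases (h.lf l hl).nb hu hvS e with hh | rfl | rfl
        · exact absurd hh ((mem_S0.1 hv).2 l hl)
        · rcases hP with hP | hP
          · exact Or.inl hP
          · exact Or.inl (Pcl _ _ hP hv ne.symm (Or.inr ⟨l, hl, Or.inr ⟨rfl, rfl⟩⟩) n1 n2)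
        · rcases hP with hP | hP
          · exact Or.inl (Pcl _ _ hP hv ne (Or.inr ⟨l, hl, Or.inl ⟨rfl, rfl⟩⟩) n1 n2)
          · exact Or.inl hP
    · have hnb := (h.lf k hk).nb hv huS e.symm
      rcases hu with hu | ⟨l, hl, hu, hP⟩
      · rcases hnb with hh | hh | hh
        · obtain ⟨w, -, rfl, -⟩ := hu
          exact absurd hh ((mem_S0.1 w.2).2 k hk)
        · exact Or.inr ⟨k, hk, hv, Or.inl (hh ▸ hu)⟩
        · exact Or.inr ⟨k, hk, hv, Or.inr (hh ▸ hu)⟩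
      · rcases hnb with hh | hh | hh
        · have := h.eq hl hk hu hh
          exact Or.inr ⟨k, hk, hv, this ▸ hP⟩
        · exact absurd hu ((mem_S0.1 (hh ▸ (h.a0 hk).1 : u ∈ S0 S F)).2 l hl)
        · exact absurd hu ((mem_S0.1 (hh ▸ (h.a0 hk).2 : u ∈ S0 S F)).2 l hl)
  have xQ : Q x.1 := Or.inl ⟨x, hxX, rfl, hx.1, hx.2⟩
  have yQ : ¬ Q y.1 := fun hh => hyX (Q0 y hh).1
  have vne : ∀ {p q : {x // x ∈ S0 S F}}, p ≠ q → p.1 ≠ q.1 := fun hpq e => hpq (Subtype.ext e)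
  have inS : ∀ p : {x // x ∈ S0 S F}, p.1 ∈ S := fun p => (mem_S0.1 p.2).1
  by_cases hst : s = t
  · subst hst
    exact yQ (h.t2.2 s.1 Q (fun u hu _ hQ v hv hvs e => Qcl u v hQ hu hv e hvs hvs) ⟨x.1, inS x, vne hx.1, xQ⟩ y.1 (inS y)
      (vne hy.1))
  have sQ : ¬ Q s.1 := fun hh => (Q0 s hh).2.1 rfl
  have tQ : ¬ Q t.1 := fun hh => (Q0 t hh).2.2 rfl
  set A := S.filter fun v => Q v ∨ v = s.1 ∨ v = t.1 with hA
  set B := S.filter fun v => ¬ Q v with hB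
  have mA : ∀ {v}, v ∈ A ↔ v ∈ S ∧ (Q v ∨ v = s.1 ∨ v = t.1) := by simp [hA]
  have mB : ∀ {v}, v ∈ B ↔ v ∈ S ∧ ¬ Q v := by simp [hB]
  have hS : S = A ∪ B := by
    ext v
    rw [Finset.mem_union, mA, mB]
    constructor
    · intro hv
      by_cases hQ : Q v
      · exact Or.inl ⟨hv, Or.inl hQ⟩
      · exact Or.inr ⟨hv, hQ⟩
    · rintro (hv | hv) <;> exact hv.1
  have hs : Sp G A B s.1 t.1 := by
    refine ⟨vne hst, mA.2 ⟨inS s, Or.inr (Or.inl rfl)⟩, mA.2 ⟨inS t, Or.inr (Or.inr rfl)⟩, mB.2 ⟨inS s, sQ⟩,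
      mB.2 ⟨inS t, tQ⟩, fun v hv hv' => (mA.1 hv).2.resolve_left (mB.1 hv').2, fun u hu hu' v hv hv' e => ?_⟩
    have uQ : Q u := by
      by_contra hh
      exact hu' (mB.2 ⟨(mA.1 hu).1, hh⟩)
    have hvS := (mB.1 hv).1
    exact (mB.1 hv).2 (Qcl u v uQ (mA.1 hu).1 hvS e (fun e => hv' (mA.2 ⟨hvS, Or.inr (Or.inl e)⟩))
      fun e => hv' (mA.2 ⟨hvS, Or.inr (Or.inr e)⟩))
  have xA : x.1 ∈ A := mA.2 ⟨inS x, Or.inl xQ⟩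
  have yB : y.1 ∈ B := mB.2 ⟨inS y, yQ⟩
  have yA : y.1 ∉ A := fun hh => by
    rcases (mA.1 hh).2 with e | e | e
    · exact yQ e
    · exact hy.1 (Subtype.ext e)
    · exact hy.2 (Subtype.ext e)
  have lQ : ∀ l ∈ F, ∀ v ∈ l.1, Q v → P l.2.1 ∨ P l.2.2 := by
    rintro l hl v hv (⟨w, -, rfl, -⟩ | ⟨k, hk, hv', hP⟩)
    · exact absurd hv ((mem_S0.1 w.2).2 l hl)
    · rw [h.eq hl hk hv hv']
      exact hP
  have aQ : ∀ {p : V}, p ∈ S0 S F → Q p → P p := by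
    rintro p hp (hP | ⟨l, hl, hv, -⟩)
    · exact hP
    · exact absurd hv ((mem_S0.1 hp).2 l hl)
  rcases h.sep A B _ _ hS hs ⟨x.1, xA, fun hh => (mB.1 hh).2 xQ⟩ ⟨y.1, yB, yA⟩ with hl | hl
  · refine h.new hS hs hl s.2 t.2 x.2 xA (vne hx.1) (vne hx.2) fun l hlF => ?_
    by_cases hP : P l.2.1 ∨ P l.2.2
    · exact Or.inl fun v hv => mA.2 ⟨(h.lf l hlF).sub hv, Or.inl (Or.inr ⟨l, hlF, hv, hP⟩)⟩
    · refine Or.inr ⟨Finset.disjoint_left.2 fun v hv hv' => ?_, fun hh => ?_, fun hh => ?_⟩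
      · rcases (mA.1 hv).2 with e | rfl | rfl
        · exact hP (lQ l hlF v hv' e)
        · exact (mem_S0.1 s.2).2 l hlF hv'
        · exact (mem_S0.1 t.2).2 l hlF hv'
      · exact (mA.1 hh).2.resolve_left fun e => hP (Or.inl (aQ (h.a0 hlF).1 e))
      · exact (mA.1 hh).2.resolve_left fun e => hP (Or.inr (aQ (h.a0 hlF).2 e))
  · rw [Finset.union_comm] at hS
    refine h.new hS hs.symm hl s.2 t.2 y.2 yB (vne hy.1) (vne hy.2) fun l hlF => ?_
    have ne := (h.lf l hlF).sp.ne
    by_cases hP : P l.2.1 ∨ P l.2.2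
    · refine Or.inr ⟨Finset.disjoint_left.2 fun v hv hv' => (mB.1 hv).2 (Or.inr ⟨l, hlF, hv', hP⟩), fun hh => ?_,
        fun hh => ?_⟩
      · by_contra hn
        push Not at hn
        refine (mB.1 hh).2 (Or.inl ?_)
        rcases hP with hP | hP
        · exact hP
        · exact Pcl _ _ hP (h.a0 hlF).1 ne.symm (Or.inr ⟨l, hlF, Or.inr ⟨rfl, rfl⟩⟩) hn.1 hn.2
      · by_contra hn
        push Not at hn
        refine (mB.1 hh).2 (Or.inl ?_)
        rcases hP with hP | hP
        · exact Pcl _ _ hP (h.a0 hlF).2 ne (Or.inr ⟨l, hlF, Or.inl ⟨rfl, rfl⟩⟩) hn.1 hn.2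
        · exact hP
    · exact Or.inl fun v hv => mB.2 ⟨(h.lf l hlF).sub hv, fun e => hP (lQ l hlF v hv e)⟩

end Small

section Final

open Classical

variable {V : Type*} [Fintype V] {G : SimpleGraph V} {S A B : Finset V} {a b : V} {F : Finset (Finset V × V × V)}

theorem Tor.mkd (h : Tor G S F) {l : Finset V × V × V} (hl : l ∈ F) {x y : V} (hp : pr l x y) :
    ¬ P2 G (S \ l.1) x y ∧ ¬ P3 G (S \ l.1) x y ∧ ¬ P4c G (S \ l.1) x y := by
  have hL := h.lf l hl
  have key : ¬ P2 G (S \ l.1) l.2.1 l.2.2 ∧ ¬ P3 G (S \ l.1) l.2.1 l.2.2 ∧ ¬ P4c G (S \ l.1) l.2.1 l.2.2 :=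
    ⟨fun e => glue24 h.fr hL.sp.symm e hL.paths.2.2, fun e => glue33 h.fr hL.sp.symm e hL.paths.2.1,
      fun e => glue24 h.fr hL.sp hL.paths.1 e⟩
  rcases hp with ⟨rfl, rfl⟩ | ⟨rfl, rfl⟩
  · exact key
  · exact ⟨fun e => key.1 e.symm, fun e => key.2.1 e.symm, fun e => key.2.2 e.symm⟩

/-- an edge of the torso other than the pair of `l` -/
theorem Tor.via (h : Tor G S F) {l : Finset V × V × V} (hl : l ∈ F) {p q : V} (hj : Jn G F p q)
    (hn : ¬ pr l p q) : G.Adj p q ∨ ∃ k ∈ F, pr k p q ∧ ∃ z ∈ k.1, z ∈ S \ l.1 ∧ z ∉ S0 S F ∧ G.Adj p z ∧ G.Adj z q := by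
  rcases hj with e | ⟨k, hk, e⟩
  · exact Or.inl e
  · refine Or.inr ⟨k, hk, e, ?_⟩
    obtain ⟨z, hz, e1, e2⟩ := (h.lf k hk).mid
    refine ⟨z, hz, Finset.mem_sdiff.2 ⟨(h.lf k hk).sub hz, fun hz' => hn (h.eq hk hl hz hz' ▸ e)⟩,
      fun hz' => (mem_S0.1 hz').2 k hk hz, ?_⟩
    rcases e with ⟨rfl, rfl⟩ | ⟨rfl, rfl⟩
    · exact ⟨e1, e2⟩
    · exact ⟨e2.symm, e1.symm⟩

theorem S0_out {l : Finset V × V × V} (hl : l ∈ F) {x : V} (hx : x ∈ S0 S F) : x ∈ S \ l.1 :=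
  Finset.mem_sdiff.2 ⟨(mem_S0.1 hx).1, (mem_S0.1 hx).2 l hl⟩

theorem pr.no {l : Finset V × V × V} {x y p q : V} (h : pr l x y) (hx : p ≠ x ∧ p ≠ y) : ¬ pr l p q ∧ ¬ pr l q p := by
  rcases h with ⟨rfl, rfl⟩ | ⟨rfl, rfl⟩
  · exact ⟨fun e => e.elim (fun e => hx.1 e.1) fun e => hx.2 e.1, fun e => e.elim (fun e => hx.2 e.2) fun e => hx.1 e.2⟩
  · exact ⟨fun e => e.elim (fun e => hx.2 e.1) fun e => hx.1 e.1, fun e => e.elim (fun e => hx.1 e.2) fun e => hx.2 e.2⟩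

theorem Tor.tri (h : Tor G S F) {l : Finset V × V × V} (hl : l ∈ F) {x y z : V} (hp : pr l x y)
    (hx : x ∈ S0 S F) (hy : y ∈ S0 S F) (hz : z ∈ S0 S F) (nzx : z ≠ x) (nzy : z ≠ y)
    (j1 : Jn G F y z) (j2 : Jn G F z x) : ¬ G.Adj x y ∧ ¬ G.Adj y z ∧ ¬ G.Adj z x := by
  obtain ⟨k2, k3, k4⟩ := h.mkd hl hp
  have sz := S0_out hl hz
  have v1 := h.via hl j1 (hp.no ⟨nzx, nzy⟩).2
  have v2 := h.via hl j2 (hp.no ⟨nzx, nzy⟩).1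
  have n1 : ∀ w, w ∉ S0 S F → x ≠ w := fun w hw e => hw (e ▸ hx)
  have n2 : ∀ w, w ∉ S0 S F → y ≠ w := fun w hw e => hw (e ▸ hy)
  have m2 : ¬ G.Adj y z := fun e => by
    rcases v2 with e' | ⟨k, hk, -, w, hw, w1, w2, e1, e2⟩
    · exact k2 ⟨z, sz, e'.symm, e.symm⟩
    · exact k3 ⟨w, w1, z, sz, e2.symm, e1.symm, e.symm, (n2 w w2).symm, nzx⟩
  have m3 : ¬ G.Adj z x := fun e => by
    rcases v1 with e' | ⟨k, hk, -, w, hw, w1, w2, e1, e2⟩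
    · exact k2 ⟨z, sz, e.symm, e'.symm⟩
    · exact k3 ⟨z, sz, w, w1, e.symm, e2.symm, e1.symm, nzy, (n1 w w2).symm⟩
  refine ⟨fun e => ?_, m2, m3⟩
  obtain ⟨k, hk, hpk, w, hw, w1, w2, e1, e2⟩ := v1.resolve_left m2
  obtain ⟨k', hk', hpk', w', hw', w1', w2', e1', e2'⟩ := v2.resolve_left m3
  refine k4 (P4c_of e w1' sz w1 e2'.symm e1'.symm e2.symm e1 (n2 w' w2') nzx.symm nzy.symm (n1 w w2) ?_)
  rintro rfl
  have := h.eq hk hk' hw hw'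
  subst this
  exact (hpk.no ⟨e.ne, nzx.symm⟩).2 hpk'

theorem Tor.quad (h : Tor G S F) {l : Finset V × V × V} (hl : l ∈ F) {x y z w : V} (hp : pr l x y)
    (hx : x ∈ S0 S F) (hy : y ∈ S0 S F) (hz : z ∈ S0 S F) (hw : w ∈ S0 S F) (nzx : z ≠ x) (nzy : z ≠ y)
    (nwx : w ≠ x) (nwy : w ≠ y) (nwz : w ≠ z)
    (j1 : Jn G F y z) (j2 : Jn G F z w) (j3 : Jn G F w x) :
    ¬ (G.Adj y z ∧ G.Adj z w ∧ G.Adj w x) ∧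
      (G.Adj x y → ¬ (G.Adj y z ∧ G.Adj z w) ∧ ¬ (G.Adj y z ∧ G.Adj w x) ∧ ¬ (G.Adj z w ∧ G.Adj w x)) := by
  obtain ⟨k2, k3, k4⟩ := h.mkd hl hp
  have sz := S0_out hl hz
  have sw := S0_out hl hw
  have ns : ∀ u ∈ S0 S F, ∀ v, v ∉ S0 S F → u ≠ v := fun u hu v hv e => hv (e ▸ hu)
  have m : ¬ (G.Adj y z ∧ G.Adj z w ∧ G.Adj w x) := fun ⟨e1, e2, e3⟩ =>
    k3 ⟨w, sw, z, sz, e3.symm, e2.symm, e1.symm, nwy, nzx⟩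
  refine ⟨m, fun e => ⟨fun ⟨a1, a2⟩ => ?_, fun ⟨a1, a2⟩ => ?_, fun ⟨a1, a2⟩ => ?_⟩⟩
  · rcases h.via hl j3 (hp.no ⟨nwx, nwy⟩).1 with a3 | ⟨k, hk, -, u, -, w1, w2, e1, e2⟩
    · exact m ⟨a1, a2, a3⟩
    · exact k4 (P4c_of e w1 sw sz e2.symm e1.symm a2.symm a1 (ns y hy u w2) nwx.symm nwy.symm nzx.symm
        (ns z hz u w2).symm)
  · rcases h.via hl j2 (hp.no ⟨nzx, nzy⟩).1 with a3 | ⟨k, hk, -, u, -, w1, w2, e1, e2⟩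
    · exact m ⟨a1, a3, a2⟩
    · exact k4 (P4c_of e sw w1 sz a2.symm e2.symm e1.symm a1 nwy.symm (ns x hx u w2) (ns y hy u w2) nzx.symm nwz)
  · rcases h.via hl j1 (hp.no ⟨nzx, nzy⟩).2 with a3 | ⟨k, hk, -, u, -, w1, w2, e1, e2⟩
    · exact m ⟨a3, a1, a2⟩
    · exact k4 (P4c_of e sw sz w1 a2.symm a1.symm e2.symm e1 nwy.symm nzx.symm nzy.symm (ns x hx u w2)
        (ns w hw u w2))

theorem Tor.pent (h : Tor G S F) {l : Finset V × V × V} (hl : l ∈ F) {x y z w u : V} (hp : pr l x y)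
    (hz : z ∈ S0 S F) (hw : w ∈ S0 S F) (hu : u ∈ S0 S F) (nzx : z ≠ x)
    (nwx : w ≠ x) (nwy : w ≠ y) (nuy : u ≠ y) (nuz : u ≠ z)
    (e : G.Adj x y) (j1 : G.Adj y z) (j2 : G.Adj z w) (j3 : G.Adj w u) (j4 : G.Adj u x) : False :=
  (h.mkd hl hp).2.2 (P4c_of e (S0_out hl hu) (S0_out hl hw) (S0_out hl hz) j4.symm j3.symm j2.symm j1 nuy.symm
    nwx.symm nwy.symm nzx.symm nuz)

theorem Tor.long (h : Tor G S F) (T : Finset {x // x ∈ S0 S F}) (hT : T ∈ Fcs (TH G S F))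
    (hm : Mk (TH G S F) (TR G S F) (TM G S F) T) : 12 ≤ 2 * T.card +
      ((T ×ˢ T).filter fun p => (TH G S F).Adj p.1 p.2 ∧ ¬ (TR G S F).Adj p.1 p.2).card := by
  obtain ⟨x, hx, y, hy, hxy, hm⟩ := hm
  obtain ⟨l, hl, hp⟩ : ∃ l ∈ F, pr l x.1 y.1 := by
    rcases hm with hm | hm
    · exact hxy.2.resolve_left hm
    · exact hm.2
  obtain ⟨c, hc, hTc, rfl, rfl⟩ := fc_list hT hx hy hxy
  set k := T.card with hk
  let t : ℕ → ℕ → ℕ := fun i j => if (TH G S F).Adj (c i) (c j) ∧ ¬ (TR G S F).Adj (c i) (c j) then 1 else 0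
  have him : T = (Finset.range k).image c := by
    apply Finset.coe_injective
    rw [hTc, Finset.coe_image, Finset.coe_range]
  have hinj : Set.InjOn c (Finset.range k : Set ℕ) := by
    intro i hi j hj e
    simp only [Finset.coe_range, Set.mem_Iio] at hi hj
    rcases lt_trichotomy i j with h1 | h1 | h1
    · exact absurd e (hc.inj i j h1 hj)
    · exact h1
    · exact absurd e.symm (hc.inj j i h1 hi)
  have hcnt : ((T ×ˢ T).filter fun p => (TH G S F).Adj p.1 p.2 ∧ ¬ (TR G S F).Adj p.1 p.2).card =
      ∑ i ∈ Finset.range k, ∑ j ∈ Finset.range k, t i j := by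
    rw [Finset.card_filter, Finset.sum_product, him, Finset.sum_image hinj]
    refine Finset.sum_congr rfl fun i _ => ?_
    rw [Finset.sum_image hinj]
  rw [hcnt]
  have hU : ∀ i j, i < j → j < k → (j = i + 1 ∨ (i = 0 ∧ j + 1 = k)) →
      Jn G F (c i).1 (c j).1 ∧ (G.Adj (c i).1 (c j).1 ∨ (t i j = 1 ∧ t j i = 1)) := by
    intro i j h1 h2 h3
    have e := (hc.adj i j h1 h2).2 h3
    refine ⟨e.2, ?_⟩
    by_cases e' : G.Adj (c i).1 (c j).1
    · exact Or.inl e'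
    · exact Or.inr ⟨if_pos ⟨e, e'⟩, if_pos ⟨e.symm, fun a => e' a.symm⟩⟩
  have hn : ∀ i j, i < j → j < k → (c j).1 ≠ (c i).1 := fun i j h1 h2 e => hc.inj i j h1 h2 (Subtype.ext e.symm)
  have h3 := hc.three
  clear_value t k
  by_contra hlt
  obtain rfl | rfl | rfl | h6 : k = 3 ∨ k = 4 ∨ k = 5 ∨ 6 ≤ k := by omega
  · simp only [Finset.sum_range_succ, Finset.sum_range_zero] at hlt
    obtain ⟨j0, u0⟩ := hU 0 1 Ω Ω Ω
    obtain ⟨j1, u1⟩ := hU 1 2 Ω Ω Ω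
    obtain ⟨j2, u2⟩ := hU 0 2 Ω Ω Ω
    obtain ⟨m1, m2, m3⟩ := h.tri hl hp (c 0).2 (c 1).2 (c 2).2 (hn 0 2 Ω Ω)
      (hn 1 2 Ω Ω) j1 j2.symm
    have := u0.resolve_left m1
    have := u1.resolve_left m2
    have := u2.resolve_left fun e => m3 e.symm
    omega
  · simp only [Finset.sum_range_succ, Finset.sum_range_zero] at hlt
    obtain ⟨j0, u0⟩ := hU 0 1 Ω Ω Ω
    obtain ⟨j1, u1⟩ := hU 1 2 Ω Ω Ω
    obtain ⟨j2, u2⟩ := hU 2 3 Ω Ω Ω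
    obtain ⟨j3, u3⟩ := hU 0 3 Ω Ω Ω
    obtain ⟨m1, m2⟩ := h.quad hl hp (c 0).2 (c 1).2 (c 2).2 (c 3).2 (hn 0 2 Ω Ω)
      (hn 1 2 Ω Ω) (hn 0 3 Ω Ω) (hn 1 3 Ω Ω)
      (hn 2 3 Ω Ω) j1 j2 j3.symm
    rcases u1 with u1 | u1 <;> rcases u2 with u2 | u2 <;> rcases u3 with u3 | u3 <;>
      first
      | exact m1 ⟨u1, u2, u3.symm⟩
      | (rcases u0 with u0 | u0 <;>
        first
        | omega
        | exact (m2 u0).1 ⟨u1, u2⟩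
        | exact (m2 u0).2.1 ⟨u1, u3.symm⟩
        | exact (m2 u0).2.2 ⟨u2, u3.symm⟩)
  · simp only [Finset.sum_range_succ, Finset.sum_range_zero] at hlt
    obtain ⟨j0, u0⟩ := hU 0 1 Ω Ω Ω
    obtain ⟨j1, u1⟩ := hU 1 2 Ω Ω Ω
    obtain ⟨j2, u2⟩ := hU 2 3 Ω Ω Ω
    obtain ⟨j3, u3⟩ := hU 3 4 Ω Ω Ω
    obtain ⟨j4, u4⟩ := hU 0 4 Ω Ω Ω
    exact h.pent hl hp (c 2).2 (c 3).2 (c 4).2 (hn 0 2 Ω Ω)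
      (hn 0 3 Ω Ω) (hn 1 3 Ω Ω) (hn 1 4 Ω Ω)
      (hn 2 4 Ω Ω) (u0.resolve_right Ω) (u1.resolve_right Ω)
      (u2.resolve_right Ω) (u3.resolve_right Ω) (u4.resolve_right Ω).symm
  · omega

theorem pq6 {a b c d e f : Prop} (B : ¬ (a ∧ d) ∧ ¬ (b ∧ e) ∧ ¬ (c ∧ f)) (C1 : (b ∨ c) ∧ (a ∨ c) ∧ (a ∨ b))
    (C2 : (e ∨ f) ∧ (d ∨ f) ∧ (d ∨ e)) : False := by
  tauto

theorem Tor.tc (h : Tor G S F) (h4 : 4 ≤ (S0 S F).card) : TC (TH G S F) :=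
  ⟨by rw [Nat.card_eq_fintype_card, Fintype.card_coe]; exact h4, h.cn⟩

theorem Tor.six' (h : Tor G S F) (h4 : 4 ≤ (S0 S F).card)
    (hs : ∃ T, Sf (TH G S F) (TR G S F) (TM G S F) 3 T) : 6 ≤ Fintype.card {x // x ∈ S0 S F} := by
  by_contra h5
  have tc := h.tc h4
  obtain ⟨T, hT, hM, hT3⟩ := hs
  -- the triangle consists of unmarked edges
  obtain ⟨x, y, z, nxy, nxz, nyz, eT⟩ := Finset.card_eq_three.1 hT3
  have hadj : ∀ u ∈ T, ∀ v ∈ T, u ≠ v → (TH G S F).Adj u v := by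
    obtain ⟨k, c, hc, hTc⟩ := (mem_Fcs.1 hT).1
    have hk := hc.card hTc
    obtain rfl : k = 3 := by omega
    have key : ∀ i j, i < j → j < 3 → (TH G S F).Adj (c i) (c j) := fun i j h1 h2 =>
      (hc.adj i j h1 h2).2 Ω
    intro u hu v hv huv
    obtain ⟨i, hi, rfl⟩ := hTc.subset hu
    obtain ⟨j, hj, rfl⟩ := hTc.subset hv
    rcases lt_trichotomy i j with h1 | rfl | h1
    · exact key i j h1 hj
    · exact absurd rfl huv
    · exact (key j i h1 hi).symm
  have hR : ∀ u ∈ T, ∀ v ∈ T, u ≠ v → G.Adj u.1 v.1 ∧ ∀ l ∈ F, ¬ pr l u.1 v.1 := by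
    intro u hu v hv huv
    have e := hadj u hu v hv huv
    have e1 : G.Adj u.1 v.1 := by
      by_contra hn
      exact hM ⟨u, hu, v, hv, e, Or.inl hn⟩
    exact ⟨e1, fun l hl hp => hM ⟨u, hu, v, hv, e, Or.inr ⟨e1, l, hl, hp⟩⟩⟩
  have hcT : Tᶜ.card ≤ 2 := by rw [Finset.card_compl]; omega
  have two : ∀ p q : {x // x ∈ S0 S F}, p ∉ T → q ∉ T → p ≠ q → ∀ w, w ∈ T ∨ w = p ∨ w = q := by
    intro p q hp hq hpq w
    by_contra hn
    push Not at hn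
    have := Finset.card_le_card (show {w, p, q} ⊆ Tᶜ from fun a ha => by
      simp only [Finset.mem_insert, Finset.mem_singleton] at ha
      rcases ha with rfl | rfl | rfl <;> simp [hp, hq, hn.1])
    rw [Finset.card_eq_three.2 ⟨w, p, q, hn.2.1, hn.2.2, hpq, rfl⟩] at this
    omega
  have one : ∀ q : {x // x ∈ S0 S F}, q ∉ T → ∃ r, r ≠ q ∧ ∀ w, w ∈ T ∨ w = q ∨ w = r := by
    intro q hq
    by_cases hr : ∃ r, r ∉ T ∧ r ≠ q
    · obtain ⟨r, hr, hrq⟩ := hr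
      exact ⟨r, hrq, two q r hq hr hrq.symm⟩
    · push Not at hr
      refine ⟨x, fun e => hq (e ▸ by rw [eT]; simp), fun w => ?_⟩
      by_cases hw : w ∈ T
      · exact Or.inl hw
      · exact Or.inr (Or.inl (hr w hw))
  -- a marked pair cannot meet the triangle
  have A : ∀ l ∈ F, ∀ u v : {x // x ∈ S0 S F}, u ≠ v → pr l u.1 v.1 → u ∈ T → False := by
    intro l hl u v huv hp hu
    by_cases hv : v ∈ T
    · exact (hR u hu v hv huv).2 l hl hp
    obtain ⟨r, hrv, hr⟩ := one v hv
    obtain ⟨w, hw, w1, w2⟩ := tc.deg3 (v := v) (s := u) (t := r) huv.symm hrv.symm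
    have hwT : w ∈ T := (hr w).resolve_right (not_or.2 ⟨hw.ne.symm, w2⟩)
    exact (h.tri hl hp u.2 v.2 w.2 (fun e => w1 (Subtype.ext e)) (fun e => hw.ne (Subtype.ext e.symm)) hw.2
      (hadj w hwT u hu w1).2).2.2 (hR w hwT u hu w1).1
  have hF : F.Nonempty := by
    rw [Finset.nonempty_iff_ne_empty]
    rintro rfl
    have e : S0 S ∅ = S := by ext a; simp [mem_S0]
    have := h.six
    rw [Fintype.card_coe, e] at h5
    omega
  obtain ⟨l, hl⟩ := hF
  obtain ⟨a1, a2⟩ := h.a0 hl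
  have hab := (h.lf l hl).sp.ne
  obtain ⟨p, hp⟩ : ∃ p : {x // x ∈ S0 S F}, p.1 = l.2.1 := ⟨⟨_, a1⟩, rfl⟩
  obtain ⟨q, hq⟩ : ∃ p : {x // x ∈ S0 S F}, p.1 = l.2.2 := ⟨⟨_, a2⟩, rfl⟩
  have hpr : pr l p.1 q.1 := Or.inl ⟨hp, hq⟩
  have hpq : p ≠ q := fun e => hab (by rw [← hp, ← hq, e])
  have pT : p ∉ T := A l hl p q hpq hpr
  have qT : q ∉ T := A l hl q p hpq.symm hpr.symm
  have B : ∀ b ∈ T, ¬ ((TH G S F).Adj p b ∧ (TH G S F).Adj q b) := by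
    rintro b hb ⟨e1, e2⟩
    have := h.tri hl hpr p.2 q.2 b.2 (fun e => e1.ne (Subtype.ext e.symm)) (fun e => e2.ne (Subtype.ext e.symm))
      e2.2 e1.2.symm
    obtain ⟨k, hk, hpk⟩ := e2.2.resolve_left this.2.1
    exact A k hk b q e2.ne.symm hpk.symm hb
  have C : ∀ u v, u ∉ T → v ∉ T → u ≠ v → ∀ t ∈ T, ∃ w ∈ T, w ≠ t ∧ (TH G S F).Adj u w := by
    intro u v hu hv huv t ht
    obtain ⟨w, hw, w1, w2⟩ := tc.deg3 (v := u) (s := v) (t := t) huv (fun e => hu (e ▸ ht))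
    exact ⟨w, (two u v hu hv huv w).resolve_right (not_or.2 ⟨hw.ne.symm, w1⟩), w2, hw⟩
  have C1 := C p q pT qT hpq
  have C2 := C q p qT pT hpq.symm
  rw [eT] at B C1 C2
  simp only [Finset.mem_insert, Finset.mem_singleton, forall_eq_or_imp, forall_eq, exists_eq_or_imp, exists_eq_left,
    ne_eq, not_true_eq_false, false_and, nxy, nxz, nyz, nxy.symm, nxz.symm, nyz.symm, not_false_eq_true, true_and,
    false_or, or_false] at B C1 C2
  exact pq6 B C1 C2

theorem Tor.ctx (h : Tor G S F) (h4 : 4 ≤ (S0 S F).card) : Ctx (TH G S F) (TR G S F) (TM G S F) where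
  tc := h.tc h4
  pl := h.pl'
  rh := fun _ _ e => ⟨fun e' => G.loopless.irrefl _ (e' ▸ e), Or.inl e⟩
  mr := fun _ _ e => e.1
  free := by
    rintro ⟨v, hi, hv, i, j, h1, h2, h3, h4⟩
    exact h.fr ⟨fun i => (v i).1, fun i j e => hi (Subtype.ext e), hv, i, j, h1, h2, h3, h4⟩
  long := h.long
  six := h.six' h4

theorem Tor.cnt (h : Tor G S F) (K : Finset (Finset V × V × V)) : K ⊆ F →
    (S0 S F ∪ K.biUnion fun l => l.1).card = (S0 S F).card + 3 * K.card ∧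
      en G (S0 S F ∪ K.biUnion fun l => l.1) ≤ en G (S0 S F) + 8 * K.card := by
  induction K using Finset.induction_on with
  | empty => intro _; simp
  | insert l K hlK ih =>
    intro hK
    obtain ⟨hl, hK⟩ := Finset.insert_subset_iff.1 hK
    obtain ⟨i1, i2⟩ := ih hK
    have hL := h.lf l hl
    obtain ⟨a1, a2⟩ := h.a0 hl
    set D := S0 S F ∪ K.biUnion fun l => l.1 with hD
    have dL : ∀ x ∈ l.1, x ∉ D := by
      intro x hx hxD
      rcases Finset.mem_union.1 hxD with h1 | h1
      · exact (mem_S0.1 h1).2 l hl hx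
      · obtain ⟨k, hk, hxk⟩ := Finset.mem_biUnion.1 h1
        exact hlK (h.eq hl (hK hk) hx hxk ▸ hk)
    have dS : D ⊆ S := by
      refine Finset.union_subset (Finset.filter_subset _ _) (Finset.biUnion_subset.2 fun k hk => (h.lf k (hK hk)).sub)
    have aD : l.2.1 ∈ D := Finset.mem_union_left _ a1
    have bD : l.2.2 ∈ D := Finset.mem_union_left _ a2
    have sp : Sp G (insert l.2.1 (insert l.2.2 l.1)) D l.2.1 l.2.2 := by
      refine ⟨hL.sp.ne, hL.sp.aA, hL.sp.bA, aD, bD, fun x hx hxD => ?_, fun x hx hxD y hy hyA e => ?_⟩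
      · simp only [Finset.mem_insert] at hx
        rcases hx with h1 | h1 | h1
        · exact Or.inl h1
        · exact Or.inr h1
        · exact absurd hxD (dL x h1)
      · simp only [Finset.mem_insert, not_or] at hx hyA
        rcases hx with rfl | rfl | h1
        · exact hxD aD
        · exact hxD bD
        · rcases hL.nb h1 (dS hy) e with h2 | h2 | h2
          · exact hyA.2.2 h2
          · exact hyA.1 h2
          · exact hyA.2.1 h2
    have eU : (S0 S F ∪ (insert l K).biUnion fun l => l.1) = insert l.2.1 (insert l.2.2 l.1) ∪ D := by
      rw [Finset.biUnion_insert]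
      ext x
      simp only [hD, Finset.mem_union, Finset.mem_insert]
      constructor
      · rintro (h1 | h1 | h1)
        · exact Or.inr (Or.inl h1)
        · exact Or.inl (Or.inr (Or.inr h1))
        · exact Or.inr (Or.inr h1)
      · rintro ((rfl | rfl | h1) | h1 | h1)
        · exact Or.inl a1
        · exact Or.inl a2
        · exact Or.inr (Or.inl h1)
        · exact Or.inl h1
        · exact Or.inr (Or.inr h1)
    have c1 := sp.card
    have c2 := sp.en
    have c3 := hL.en_le h.pl h.t2 h.six
    have c4 := hL.lf.1
    rw [eU, Finset.card_insert_of_notMem hlK]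
    omega

theorem Tor.cnt' (h : Tor G S F) : S.card = (S0 S F).card + 3 * F.card ∧ en G S ≤ en G (S0 S F) + 8 * F.card := by
  have := h.cnt F (Finset.Subset.refl _)
  have e : (S0 S F ∪ F.biUnion fun l => l.1) = S := by
    refine Finset.Subset.antisymm (Finset.union_subset (Finset.filter_subset _ _)
      (Finset.biUnion_subset.2 fun k hk => (h.lf k hk).sub)) fun x hx => ?_
    rcases S0_or (F := F) hx with h1 | ⟨l, hl, h1⟩
    · exact Finset.mem_union_left _ h1
    · exact Finset.mem_union_right _ (Finset.mem_biUnion.2 ⟨l, hl, h1⟩)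
  rwa [e] at this

theorem en_TR : en G (S0 S F) ≤ (TR G S F).edgeSet.ncard := by
  refine le_trans ?_ (Set.ncard_image_le (f := Sym2.map Subtype.val) (Set.toFinite _))
  unfold en
  rw [← Set.ncard_coe_finset]
  refine Set.ncard_le_ncard (fun e he => ?_) (Set.toFinite _)
  rw [Finset.mem_coe, Finset.mem_filter, mem_edgeFinset] at he
  induction e with
  | _ x y =>
    obtain ⟨h1, h2⟩ := he
    exact ⟨s(⟨x, h2 x Ψ⟩, ⟨y, h2 y Ψ⟩), h1, rfl⟩

theorem Tor.mle (h : Tor G S F) :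
    F.card ≤ (((TH G S F).edgeSet \ (TR G S F).edgeSet) ∪ (TM G S F).edgeSet).ncard := by
  refine le_trans ?_ (Set.ncard_image_le (f := Sym2.map Subtype.val) (Set.toFinite _))
  rw [← Set.ncard_coe_finset]
  refine Set.ncard_le_ncard_of_injOn (fun l => s(l.2.1, l.2.2)) (fun l hl => ?_) (fun l hl k hk e => ?_) (Set.toFinite _)
  · obtain ⟨a1, a2⟩ := h.a0 hl
    have hn := (h.lf l hl).sp.ne
    refine ⟨s(⟨_, a1⟩, ⟨_, a2⟩), ?_, rfl⟩
    by_cases e : G.Adj l.2.1 l.2.2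
    · exact Or.inr ⟨e, l, hl, Or.inl ⟨rfl, rfl⟩⟩
    · exact Or.inl ⟨⟨fun e' => hn (congrArg Subtype.val e'), Or.inr ⟨l, hl, Or.inl ⟨rfl, rfl⟩⟩⟩, e⟩
  · by_contra hlk
    obtain ⟨z, hz, e1, e2⟩ := (h.lf k hk).mid
    have hp : pr l k.2.1 k.2.2 := by
      rcases Sym2.eq_iff.1 e with ⟨h1, h2⟩ | ⟨h1, h2⟩
      · exact Or.inl ⟨h1.symm, h2.symm⟩
      · exact Or.inr ⟨h2.symm, h1.symm⟩
    exact (h.mkd hl hp).1 ⟨z, Finset.mem_sdiff.2 ⟨(h.lf k hk).sub hz, fun hz' => hlk (h.eq hl hk hz' hz)⟩, e1, e2⟩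

theorem Tor.bound (h : Tor G S F) : 7 * en G S + 48 ≤ 18 * S.card := by
  obtain ⟨c1, c2⟩ := h.cnt'
  have c3 := h.mle
  have h6 := h.six
  by_cases h4 : 4 ≤ (S0 S F).card
  · have hc := h.ctx h4
    have c4 := count hc
    have c5 := en_TR (G := G) (S := S) (F := F)
    have c6 := Set.ncard_union_le ((TH G S F).edgeSet \ (TR G S F).edgeSet) (TM G S F).edgeSet
    have c7 := Set.ncard_diff_add_ncard_of_subset (edgeSet_mono hc.rh) (Set.toFinite _)
    rw [Fintype.card_coe] at c4
    omega
  · have c4 : F.card ≤ (S0 S F).card.choose 2 := by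
      refine c3.trans (le_trans (Set.ncard_le_ncard (t := (TH G S F).edgeSet) ?_ (Set.toFinite _)) ?_)
      · refine Set.union_subset Set.sdiff_subset (edgeSet_mono fun u v e => ?_)
        exact ⟨fun e' => G.loopless.irrefl _ (e' ▸ e.1), Or.inl e.1⟩
      · have := (TH G S F).card_edgeFinset_le_card_choose_two
        rw [Fintype.card_coe] at this
        rwa [Set.ncard_eq_toFinset_card']
    obtain e | e | e | e : (S0 S F).card = 0 ∨ (S0 S F).card = 1 ∨ (S0 S F).card = 2 ∨ (S0 S F).card = 3 := by omega
    iterate 3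
      · have : (S0 S F).card.choose 2 ≤ 1 := by rw [e]; decide
        omega
    have h3 : F.card ≤ 3 := by rw [e] at c4; exact c4
    obtain ⟨l, hl⟩ := Finset.card_pos.1 (show 0 < F.card by omega)
    obtain ⟨a1, a2⟩ := h.a0 hl
    have hn := (h.lf l hl).sp.ne
    obtain ⟨r, hr⟩ := Finset.card_eq_one.1 (show (((S0 S F).erase l.2.1).erase l.2.2).card = 1 by
      rw [Finset.card_erase_of_mem (Finset.mem_erase.2 ⟨hn.symm, a2⟩), Finset.card_erase_of_mem a1]; omega)
    have hr' : ∀ x, (x ≠ l.2.2 ∧ x ≠ l.2.1 ∧ x ∈ S0 S F) ↔ x = r := fun x => by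
      rw [← Finset.mem_singleton, ← hr, Finset.mem_erase, Finset.mem_erase]
    obtain ⟨r2, r1, r0⟩ := (hr' r).2 rfl
    have key : ∀ p q : V, p ∈ S0 S F → q ∈ S0 S F → p ≠ q → r ≠ p → r ≠ q →
        (∀ x, x ≠ q → x ≠ p → x ∈ S0 S F → x = r) → Jn G F q r := by
      intro p q hp hq hpq hrp hrq hu
      obtain ⟨x, rfl, y, hy, exy⟩ := h.cn ⟨p, hp⟩ ⟨p, hp⟩ {⟨q, hq⟩} (by
        simp [hpq]) ⟨_, rfl⟩ ⟨⟨r, r0⟩, by simp [hrp, hrq]⟩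
      have hyr := hu y.1 (fun e => exy.1 (Subtype.ext e.symm)) (fun e => hy.1 (Or.inl (Subtype.ext e))) y.2
      rw [← hyr]
      exact exy.2
    have j1 := key _ _ a1 a2 hn r1 r2 fun x h1 h2 h3 => (hr' x).1 ⟨h1, h2, h3⟩
    have j2 := key _ _ a2 a1 hn.symm r2 r1 fun x h1 h2 h3 => (hr' x).1 ⟨h2, h1, h3⟩
    obtain ⟨t1, t2, t3⟩ := h.tri hl (Or.inl ⟨rfl, rfl⟩) a1 a2 r0 r1 r2 j1 j2.symm
    have hz : en G (S0 S F) = 0 := by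
      rw [en, Finset.card_eq_zero, Finset.filter_eq_empty_iff]
      intro e he hS
      rw [mem_edgeFinset] at he
      induction e with
      | _ x y =>
        have hx := hS x Ψ
        have hy := hS y Ψ
        rw [mem_edgeSet] at he
        have tr : ∀ x ∈ S0 S F, x = l.2.1 ∨ x = l.2.2 ∨ x = r := fun x hx => by
          by_contra hc
          push Not at hc
          exact hc.2.2 ((hr' x).1 ⟨hc.2.1, hc.1, hx⟩)
        rcases tr x hx with rfl | rfl | rfl <;> rcases tr y hy with rfl | rfl | rfl <;>
          first
          | exact he.ne rfl
          | exact t1 he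
          | exact t2 he
          | exact t3 he
          | exact t1 he.symm
          | exact t2 he.symm
          | exact t3 he.symm
    omega

theorem torso_bound (pl : Pl G) (fr : ¬ HasTheta6 G) (t2 : T2 G S) (six : 6 ≤ S.card)
    (sep : ∀ A B a b, S = A ∪ B → Sp G A B a b → (∃ x ∈ A, x ∉ B) → (∃ x ∈ B, x ∉ A) → Lf G A a b ∨ Lf G B a b) :
    7 * en G S + 48 ≤ 18 * S.card := by
  obtain ⟨F, hF⟩ := tor_exists pl fr t2 six sep
  exact hF.bound

theorem all_bd (pl : Pl G) (fr : ¬ HasTheta6 G) : ∀ N, ∀ S : Finset V, S.card = N → T2 G S → Bd G S := by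
  intro N
  induction N using Nat.strong_induction_on with
  | _ N ih =>
  intro S hN hT
  have hg : Gl G N := ⟨pl, fr, fun T hTN hT => ih _ hTN T rfl hT⟩
  by_cases h6 : 6 ≤ N
  swap
  · exact ⟨fun h => by omega, fun h => by omega⟩
  by_cases hd : ∃ v ∈ S, (S.filter (G.Adj v)).card < 3
  · obtain ⟨v, hv, hd⟩ := hd
    obtain ⟨a, b, S', rfl, h2⟩ := dg2_of hT hv hd Ω
    refine ⟨fun _ h8 => ?_, fun h9 => ?_⟩
    · rw [hN] at h8 ⊢
      exact dg2_small hg h2 hN h6 h8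
    · rw [hN] at h9 ⊢
      exact dg2_big hg h2 hN h9
  · push Not at hd
    refine ⟨fun _ h8 => ?_, fun h9 => ?_⟩
    · have : en G S + 2 < 2 * S.card := by
        by_contra hex
        have := torso_bound pl fr hT Ω fun A B a b e hs hA hB => by
          subst e
          exact (sep_small fr hs h8 hT hA hB hd Ω).elim
        omega
      exact ⟨by omega, fun h => by omega⟩
    · by_contra hex
      refine hex (torso_bound pl fr hT Ω fun A B a b e hs hA hB => ?_)
      subst e
      exact sep_leaf hg hs hN Ω hT hA hB hd Ω

theorem T2_univ (h : IsTwoConnected G) : T2 G Finset.univ := by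
  refine ⟨by rw [Finset.card_univ]; exact h.1, fun v X hX ⟨x, _, hxv, hx⟩ y _ hyv => ?_⟩
  have hc : Cn G {u | u ≠ v} := cn_iff_preconnected.2 (h.2.2 v).preconnected
  exact hc.closed (X := {u | X u}) ⟨x, hxv, hx⟩
    (fun a ha haX b hb e => hX a (Finset.mem_univ _) ha haX b (Finset.mem_univ _) hb e) hyv

end Final

/-- Edge bounds for `n`-vertex 2-connected planar graphs with no Theta graph on
6 vertices: `(18n-38)/7` for `n = 6`, `(18n-42)/7` for `n = 7`, `(18n-46)/7`
for `n = 8`, and `(18n-48)/7` for `n ≥ 9`. -/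
theorem theta6_two_connected_small_bounds {V : Type*} [Fintype V] (n : ℕ)
    (G : SimpleGraph V) (hcard : Fintype.card V = n)
    (h2conn : IsTwoConnected G) (hplanar : IsPlanar G)
    (hfree : ¬ HasTheta6 G) :
    (n = 6 → (G.edgeSet.ncard : ℚ) ≤ (18 * n - 38) / 7) ∧
    (n = 7 → (G.edgeSet.ncard : ℚ) ≤ (18 * n - 42) / 7) ∧
    (n = 8 → (G.edgeSet.ncard : ℚ) ≤ (18 * n - 46) / 7) ∧
    (9 ≤ n → (G.edgeSet.ncard : ℚ) ≤ (18 * n - 48) / 7) := by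
  obtain ⟨h1, h2⟩ := all_bd hplanar.pl hfree n Finset.univ (by rw [Finset.card_univ, hcard]) (T2_univ h2conn)
  rw [en_univ, Finset.card_univ, hcard] at h1 h2
  have key : ∀ a b : ℕ, 7 * G.edgeSet.ncard + a ≤ b → (G.edgeSet.ncard : ℚ) ≤ (b - a) / 7 := by
    intro a b h
    have : (7 : ℚ) * G.edgeSet.ncard + a ≤ b := by exact_mod_cast h
    linarith
  refine ⟨fun h => ?_, fun h => ?_, fun h => ?_, fun h => ?_⟩
  · have := (h1 Ω Ω).1
    exact_mod_cast key 38 (18 * n) Ω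
  · have := (h1 Ω Ω).1
    exact_mod_cast key 42 (18 * n) Ω
  · have := (h1 Ω Ω).1
    exact_mod_cast key 46 (18 * n) Ω
  · have := h2 h
    exact_mod_cast key 48 (18 * n) Ω
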